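/- Let (u_p)_{p>1} be a family of low energy nodal solutions of (P_p) and define w_{i,p} := p(v_{i,p} − U) for i = 1,2. Then for any fixed τ ∈ (0,1) there exists C_τ > 0 such that |w_{i,p}(z)| ≤ C_τ (1 + |z|)^τ for all z ∈ B_{ϱ₀/ε_{i,p}}(0). Consequently, w_{i,p} → w₀ in C²_loc(ℝ²) as p → ∞, where w₀ solves −Δw₀ − e^U w₀ = −(U²/2) e^U in ℝ², satisfies |w₀(z)| ≤ C_τ (1 + |z|)^τ for any τ ∈ (0,1), and ∫_{ℝ²} Δw₀ dz = 24π. -/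

import Mathlib

open Real MeasureTheory Metric Filter Topology Bornology

noncomputable section

abbrev E2 : Type := EuclideanSpace ℝ (Fin 2)

/-- Laplacian of `u : ℝ² → ℝ` via coordinate second derivatives. -/
def lap (u : E2 → ℝ) (x : E2) : ℝ :=
  ∑ i : Fin 2,
    fderiv ℝ (fun y => fderiv ℝ u y (EuclideanSpace.single i 1)) x (EuclideanSpace.single i 1)

/-- `u` is a (classical) solution of the Lane–Emden problem `(P_p)` on `Ω`. -/
def IsSolution (Ω : Set E2) (p : ℝ) (u : E2 → ℝ) : Prop :=
  ContDiffOn ℝ 2 u Ω ∧ ContinuousOn u (closure Ω) ∧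
    (∀ x ∈ Ω, -lap u x = |u x| ^ (p - 1) * u x) ∧
    (∀ x ∈ frontier Ω, u x = 0)

/-- `u` is a nodal (sign-changing) function on `Ω`. -/
def IsNodal (Ω : Set E2) (u : E2 → ℝ) : Prop :=
  (∃ x ∈ Ω, 0 < u x) ∧ (∃ x ∈ Ω, u x < 0)

/-- The Green function of `-Δ` on `Ω` with Dirichlet boundary conditions, together with
its regular part `H`, so that `G(x,y) = -(1/2π) log|x-y| + H(x,y)`. -/
structure GreenData (Ω : Set E2) where
  G : E2 → E2 → ℝ
  H : E2 → E2 → ℝ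
  decomp : ∀ x y, G x y = -(1 / (2 * π)) * Real.log ‖x - y‖ + H x y
  bdry : ∀ x ∈ Ω, ∀ y ∈ frontier Ω, G x y = 0
  symm : ∀ x y, G x y = G y x
  smoothH : ContDiffOn ℝ (⊤ : ℕ∞) (fun q : E2 × E2 => H q.1 q.2) (Ω ×ˢ Ω)
  contH : ∀ x ∈ Ω, ContinuousOn (H x) (closure Ω)
  harmH : ∀ x ∈ Ω, ∀ y ∈ Ω, lap (H x) y = 0

/-- The Kirchhoff–Routh type function `Ψ(a₁,a₂) = 2G(a₁,a₂) − R(a₁) − R(a₂)`. -/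
def KR {Ω : Set E2} (gd : GreenData Ω) (q : E2 × E2) : ℝ :=
  2 * gd.G q.1 q.2 - gd.H q.1 q.1 - gd.H q.2 q.2

/-- `q` is a non-degenerate critical point of `F`. -/
def NondegCrit (F : E2 × E2 → ℝ) (q : E2 × E2) : Prop :=
  fderiv ℝ F q = 0 ∧
    ∀ v : E2 × E2, (∀ w : E2 × E2, fderiv ℝ (fun r => fderiv ℝ F r) q v w = 0) → v = 0

/-- Convergence in `C²_loc(S)`: uniform convergence of all derivatives of order `≤ 2`
on compact subsets of `S`. -/
def TendstoC2LocOn (S : Set E2) (F : ℕ → E2 → ℝ) (g : E2 → ℝ) : Prop :=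
  ∀ K : Set E2, K ⊆ S → IsCompact K → ∀ k : ℕ, k ≤ 2 →
    TendstoUniformlyOn (fun n x => iteratedFDeriv ℝ k (F n) x)
      (fun x => iteratedFDeriv ℝ k g x) atTop K

/-- `‖u⁺‖_∞` on `closure Ω`. -/
def supPos (Ω : Set E2) (u : E2 → ℝ) : ℝ := sSup ((fun x => max (u x) 0) '' closure Ω)

/-- `‖u⁻‖_∞` on `closure Ω`. -/
def supNeg (Ω : Set E2) (u : E2 → ℝ) : ℝ := sSup ((fun x => max (-u x) 0) '' closure Ω)

/-- The energy functional `J_p`. -/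
def energy (Ω : Set E2) (p : ℝ) (u : E2 → ℝ) : ℝ :=
  (1 / 2) * (∫ x in Ω, ‖fderiv ℝ u x‖ ^ 2) - (1 / (p + 1)) * ∫ x in Ω, |u x| ^ (p + 1)

/-- The standard bubble `U(z) = −2 log(1 + |z|²/8)`. -/
def Ustd (z : E2) : ℝ := -2 * Real.log (1 + ‖z‖ ^ 2 / 8)

/-- Unit vector at angle `θ`. -/
def circDir (θ : ℝ) : E2 :=
  EuclideanSpace.single 0 (Real.cos θ) + EuclideanSpace.single 1 (Real.sin θ)

/-- Surface integral over the circle `∂B_r(c)`; the integrand may depend on the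
outer unit normal (first argument) and on the point (second argument). -/
def surfInt (c : E2) (r : ℝ) (F : E2 → E2 → ℝ) : ℝ :=
  ∫ θ in (0:ℝ)..(2 * π), r * F (circDir θ) (c + r • circDir θ)

/-- Inner product of gradients `⟨∇f, ∇g⟩`. -/
def gradInner (f g : E2 → ℝ) (x : E2) : ℝ :=
  ∑ j : Fin 2, fderiv ℝ f x (EuclideanSpace.single j 1) *
    fderiv ℝ g x (EuclideanSpace.single j 1)

/-- The quadratic form `P_i` (centred at `c`, radius `r`). -/
def Pform (c : E2) (r : ℝ) (f g : E2 → ℝ) : ℝ :=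
  -2 * r * surfInt c r (fun ν x => fderiv ℝ f x ν * fderiv ℝ g x ν) +
    r * surfInt c r (fun _ x => gradInner f g x)

/-- The quadratic form `Q_{ij}` (centred at `c`, radius `r`). -/
def Qform (c : E2) (r : ℝ) (j : Fin 2) (f g : E2 → ℝ) : ℝ :=
  surfInt c r (fun ν x =>
    -(fderiv ℝ f x (EuclideanSpace.single j 1)) * fderiv ℝ g x ν -
      fderiv ℝ f x ν * fderiv ℝ g x (EuclideanSpace.single j 1) +
      gradInner f g x * ν j)


section
set_option linter.all false

namespace LE
open ComplexConjugate

/-- Wirtinger derivatives. -/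
def dz (φ : ℂ → ℂ) (z : ℂ) : ℂ := (fderiv ℝ φ z 1 - Complex.I * fderiv ℝ φ z Complex.I) / 2
def dzb (φ : ℂ → ℂ) (z : ℂ) : ℂ := (fderiv ℝ φ z 1 + Complex.I * fderiv ℝ φ z Complex.I) / 2

def wirt (a b : ℂ) : ℂ →L[ℝ] ℂ :=
  a • (ContinuousLinearMap.id ℝ ℂ) + b • (Complex.conjCLE : ℂ →L[ℝ] ℂ)

@[simp] lemma wirt_apply (a b h : ℂ) : wirt a b h = a * h + b * conj h := by
  simp [wirt]

def HasW (φ : ℂ → ℂ) (a b : ℂ) (z : ℂ) : Prop := HasFDerivAt φ (wirt a b) z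

lemma clm_eq_wirt (T : ℂ →L[ℝ] ℂ) :
    T = wirt ((T 1 - Complex.I * T Complex.I) / 2) ((T 1 + Complex.I * T Complex.I) / 2) := by
  ext h
  have hh : h = h.re • (1:ℂ) + h.im • Complex.I := by simp [Complex.re_add_im]
  have hc : conj h = h.re • (1:ℂ) - h.im • Complex.I := by
    apply Complex.ext <;> simp
  have hT : T h = h.re * T 1 + h.im * T Complex.I := by
    conv_lhs => rw [hh]
    rw [map_add, map_smul, map_smul]; simp
  rw [wirt_apply, hc, hT]
  generalize ha : h.re = a at *
  generalize hb : h.im = b at *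
  rw [hh]
  simp only [Complex.real_smul]
  linear_combination ((b:ℂ) * T Complex.I) * Complex.I_sq

lemma wirt_norm_le (a b : ℂ) : ‖wirt a b‖ ≤ ‖a‖ + ‖b‖ := by
  apply ContinuousLinearMap.opNorm_le_bound _ (by positivity)
  intro h
  rw [wirt_apply]
  calc ‖a * h + b * conj h‖ ≤ ‖a * h‖ + ‖b * conj h‖ := norm_add_le _ _
    _ = (‖a‖ + ‖b‖) * ‖h‖ := by simp; ring

lemma DifferentiableAt.hasW {φ : ℂ → ℂ} {z : ℂ} (h : DifferentiableAt ℝ φ z) :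
    HasW φ (dz φ z) (dzb φ z) z := by
  unfold HasW dz dzb
  rw [← clm_eq_wirt]; exact h.hasFDerivAt

lemma HasW.dz {φ : ℂ → ℂ} {a b z : ℂ} (h : HasW φ a b z) : dz φ z = a := by
  unfold LE.dz; rw [HasFDerivAt.fderiv h]; simp
  linear_combination (-(a - b)/2) * Complex.I_sq

lemma HasW.dzb {φ : ℂ → ℂ} {a b z : ℂ} (h : HasW φ a b z) : dzb φ z = b := by
  unfold LE.dzb; rw [HasFDerivAt.fderiv h]; simp
  linear_combination ((a - b)/2) * Complex.I_sq

lemma HasW.fderiv {φ : ℂ → ℂ} {a b z : ℂ} (h : HasW φ a b z) : fderiv ℝ φ z = wirt a b :=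
  HasFDerivAt.fderiv h

lemma HasW.differentiableAt {φ : ℂ → ℂ} {a b z : ℂ} (h : HasW φ a b z) : DifferentiableAt ℝ φ z :=
  HasFDerivAt.differentiableAt h

lemma fderiv_eq_wirt {φ : ℂ → ℂ} {z : ℂ} : fderiv ℝ φ z = wirt (dz φ z) (dzb φ z) :=
  clm_eq_wirt _

lemma fderiv_apply_eq {φ : ℂ → ℂ} {z : ℂ} (h : ℂ) :
    fderiv ℝ φ z h = dz φ z * h + dzb φ z * conj h := by
  rw [fderiv_eq_wirt, wirt_apply]

lemma HasW.add {φ ψ : ℂ → ℂ} {a b c d z : ℂ} (h : HasW φ a b z) (k : HasW ψ c d z) :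
    HasW (fun z => φ z + ψ z) (a + c) (b + d) z := by
  have := HasFDerivAt.add h k
  unfold HasW
  convert! this using 1
  ext h; simp; ring

lemma HasW.sub {φ ψ : ℂ → ℂ} {a b c d z : ℂ} (h : HasW φ a b z) (k : HasW ψ c d z) :
    HasW (fun z => φ z - ψ z) (a - c) (b - d) z := by
  have := HasFDerivAt.sub h k
  unfold HasW
  convert! this using 1
  ext h; simp; ring

lemma HasW.mul {φ ψ : ℂ → ℂ} {a b c d z : ℂ} (h : HasW φ a b z) (k : HasW ψ c d z) :
    HasW (fun z => φ z * ψ z) (a * ψ z + φ z * c) (b * ψ z + φ z * d) z := by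
  have := HasFDerivAt.mul h k
  unfold HasW
  convert! this using 1
  ext h; simp; ring

lemma HasW.const (c z : ℂ) : HasW (fun _ => c) 0 0 z := by
  have := hasFDerivAt_const (𝕜 := ℝ) c z
  unfold HasW
  convert! this using 1
  ext h; simp

lemma HasW.id (z : ℂ) : HasW (fun z => z) 1 0 z := by
  have := hasFDerivAt_id (𝕜 := ℝ) z
  unfold HasW
  convert! this using 1
  ext h; simp

lemma HasW.cnj (z : ℂ) : HasW (fun z => conj z) 0 1 z := by
  have := (Complex.conjCLE : ℂ →L[ℝ] ℂ).hasFDerivAt (x := z)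
  unfold HasW
  convert! this using 1
  ext h; simp

lemma HasW.conj {φ : ℂ → ℂ} {a b z : ℂ} (h : HasW φ a b z) :
    HasW (fun z => conj (φ z)) (conj b) (conj a) z := by
  have := ((Complex.conjCLE : ℂ →L[ℝ] ℂ).hasFDerivAt (x := φ z)).comp z h
  unfold HasW
  convert! this using 1
  ext h; simp; ring

lemma HasW.scomp {φ : ℂ → ℂ} {F : ℂ → ℂ} {F' a b z : ℂ} (h : HasW φ a b z)
    (hF : HasDerivAt F F' (φ z)) :
    HasW (fun z => F (φ z)) (F' * a) (F' * b) z := by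
  have := (hF.hasFDerivAt.restrictScalars ℝ).comp z h
  unfold HasW
  convert! this using 1
  ext h; simp; ring

lemma HasW.congr_of_eventuallyEq {φ ψ : ℂ → ℂ} {a b z : ℂ} (h : HasW φ a b z) (e : ψ =ᶠ[𝓝 z] φ) :
    HasW ψ a b z := HasFDerivAt.congr_of_eventuallyEq h e

lemma hasFDerivAt_normsq (z : ℂ) :
    HasFDerivAt (fun z : ℂ => ‖z‖^2) (2 • (innerSL ℝ z)) z := by
  simpa using (hasStrictFDerivAt_norm_sq (F := ℂ) z).hasFDerivAt

lemma HasW.radial {g : ℝ → ℝ} {g' : ℝ} {z : ℂ} (h : HasDerivAt g g' (‖z‖^2)) :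
    HasW (fun z => ((g (‖z‖^2) : ℝ) : ℂ)) (g' * conj z) (g' * z) z := by
  have h1 := h.comp_hasFDerivAt z (hasFDerivAt_normsq z)
  have h2 := (Complex.ofRealCLM.hasFDerivAt (x := g (‖z‖^2))).comp z h1
  unfold HasW
  convert! h2 using 1
  ext h; simp
  apply Complex.ext <;> simp [Complex.inner] <;> ring

/-- a real valued function, complexified. -/
lemma hasW_ofReal {g : ℂ → ℝ} {z : ℂ} (h : DifferentiableAt ℝ g z) :
    HasW (fun z => (g z : ℂ)) (dz (fun z => (g z : ℂ)) z) (conj (dz (fun z => (g z : ℂ)) z)) z := by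
  have h2 : HasFDerivAt (fun z => (g z : ℂ)) (Complex.ofRealCLM.comp (fderiv ℝ g z)) z :=
    (Complex.ofRealCLM.hasFDerivAt (x := g z)).comp z h.hasFDerivAt
  have h3 := DifferentiableAt.hasW h2.differentiableAt
  convert! h3 using 1
  unfold dz dzb
  rw [h2.fderiv]
  have h2' : conj (2:ℂ) = 2 := Complex.conj_ofReal 2
  simp [Complex.conj_ofReal, h2']

lemma contDiff_dz {φ : ℂ → ℂ} {n m : WithTop ℕ∞} (h : ContDiff ℝ n φ) (hm : m + 1 ≤ n) :
    ContDiff ℝ m (dz φ) := by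
  have := h.fderiv_right hm
  unfold dz
  have h1 : ContDiff ℝ m (fun z => fderiv ℝ φ z 1) := this.clm_apply contDiff_const
  have h2 : ContDiff ℝ m (fun z => fderiv ℝ φ z Complex.I) := this.clm_apply contDiff_const
  exact (h1.sub (contDiff_const.mul h2)).div_const 2

lemma contDiff_dzb {φ : ℂ → ℂ} {n m : WithTop ℕ∞} (h : ContDiff ℝ n φ) (hm : m + 1 ≤ n) :
    ContDiff ℝ m (dzb φ) := by
  have := h.fderiv_right hm
  unfold dzb
  have h1 : ContDiff ℝ m (fun z => fderiv ℝ φ z 1) := this.clm_apply contDiff_const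
  have h2 : ContDiff ℝ m (fun z => fderiv ℝ φ z Complex.I) := this.clm_apply contDiff_const
  exact (h1.add (contDiff_const.mul h2)).div_const 2

lemma tsupport_dzb {φ : ℂ → ℂ} : tsupport (dzb φ) ⊆ tsupport φ := by
  have : Function.support (dzb φ) ⊆ tsupport φ := by
    intro z hz
    by_contra h
    apply hz
    have := (notMem_tsupport_iff_eventuallyEq.mp h)
    have h2 : fderiv ℝ φ z = 0 := by rw [this.fderiv_eq]; simp
    simp [dzb, h2]
  exact closure_minimal this (isClosed_tsupport _)

lemma tsupport_dz {φ : ℂ → ℂ} : tsupport (dz φ) ⊆ tsupport φ := by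
  have : Function.support (dz φ) ⊆ tsupport φ := by
    intro z hz
    by_contra h
    apply hz
    have := (notMem_tsupport_iff_eventuallyEq.mp h)
    have h2 : fderiv ℝ φ z = 0 := by rw [this.fderiv_eq]; simp
    simp [dz, h2]
  exact closure_minimal this (isClosed_tsupport _)

lemma hcs_dzb {φ : ℂ → ℂ} (h : HasCompactSupport φ) : HasCompactSupport (dzb φ) :=
  h.of_isClosed_subset (isClosed_tsupport _) tsupport_dzb

lemma hcs_dz {φ : ℂ → ℂ} (h : HasCompactSupport φ) : HasCompactSupport (dz φ) :=
  h.of_isClosed_subset (isClosed_tsupport _) tsupport_dz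

lemma ibp_dir {f φ : ℂ → ℂ} (hf : ContDiff ℝ 1 f) (hφ : ContDiff ℝ 1 φ)
    (hc : HasCompactSupport φ) (e : ℂ) :
    ∫ z, f z * fderiv ℝ φ z e = - ∫ z, fderiv ℝ f z e * φ z := by
  have c1 : Continuous (fun z => fderiv ℝ φ z e) :=
    (hφ.continuous_fderiv one_ne_zero).clm_apply continuous_const
  have c2 : Continuous (fun z => fderiv ℝ f z e) :=
    (hf.continuous_fderiv one_ne_zero).clm_apply continuous_const
  have hc' : HasCompactSupport (fun z => fderiv ℝ φ z e) := hc.fderiv_apply (𝕜 := ℝ) e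
  refine integral_mul_fderiv_eq_neg_fderiv_mul_of_integrable ?_ ?_ ?_ ?_ ?_
  · exact (c2.mul hφ.continuous).integrable_of_hasCompactSupport hc.mul_left
  · exact (hf.continuous.mul c1).integrable_of_hasCompactSupport hc'.mul_left
  · exact (hf.continuous.mul hφ.continuous).integrable_of_hasCompactSupport hc.mul_left
  · intro x _; exact hf.differentiable one_ne_zero x
  · intro x _; exact hφ.differentiable one_ne_zero x

lemma ibp_dzb {f φ : ℂ → ℂ} (hf : ContDiff ℝ 1 f) (hφ : ContDiff ℝ 1 φ)
    (hc : HasCompactSupport φ) :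
    ∫ z, f z * dzb φ z = - ∫ z, dzb f z * φ z := by
  have c1 : ∀ e, Continuous (fun z => fderiv ℝ φ z e) := fun e =>
    (hφ.continuous_fderiv one_ne_zero).clm_apply continuous_const
  have c2 : ∀ e, Continuous (fun z => fderiv ℝ f z e) := fun e =>
    (hf.continuous_fderiv one_ne_zero).clm_apply continuous_const
  have hc' : ∀ e, HasCompactSupport (fun z => fderiv ℝ φ z e) := fun e => hc.fderiv_apply (𝕜 := ℝ) e
  have i1 : ∀ e, Integrable (fun z => fderiv ℝ f z e * φ z) := fun e =>
    ((c2 e).mul hφ.continuous).integrable_of_hasCompactSupport hc.mul_left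
  have i2 : ∀ e, Integrable (fun z => f z * fderiv ℝ φ z e) := fun e =>
    (hf.continuous.mul (c1 e)).integrable_of_hasCompactSupport (hc' e).mul_left
  have e1 : (fun z => f z * dzb φ z) = fun z => (1/2) * (f z * fderiv ℝ φ z 1) +
      (Complex.I/2) * (f z * fderiv ℝ φ z Complex.I) := by
    funext z; unfold dzb; ring
  have e2 : (fun z => dzb f z * φ z) = fun z => (1/2) * (fderiv ℝ f z 1 * φ z) +
      (Complex.I/2) * (fderiv ℝ f z Complex.I * φ z) := by
    funext z; unfold dzb; ring
  rw [e1, e2, integral_add ((i2 1).const_mul _) ((i2 _).const_mul _),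
    integral_add ((i1 1).const_mul _) ((i1 _).const_mul _)]
  simp only [integral_const_mul, ibp_dir hf hφ hc]
  ring

lemma ibp_dz {f φ : ℂ → ℂ} (hf : ContDiff ℝ 1 f) (hφ : ContDiff ℝ 1 φ)
    (hc : HasCompactSupport φ) :
    ∫ z, f z * dz φ z = - ∫ z, dz f z * φ z := by
  have c1 : ∀ e, Continuous (fun z => fderiv ℝ φ z e) := fun e =>
    (hφ.continuous_fderiv one_ne_zero).clm_apply continuous_const
  have c2 : ∀ e, Continuous (fun z => fderiv ℝ f z e) := fun e =>
    (hf.continuous_fderiv one_ne_zero).clm_apply continuous_const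
  have hc' : ∀ e, HasCompactSupport (fun z => fderiv ℝ φ z e) := fun e => hc.fderiv_apply (𝕜 := ℝ) e
  have i1 : ∀ e, Integrable (fun z => fderiv ℝ f z e * φ z) := fun e =>
    ((c2 e).mul hφ.continuous).integrable_of_hasCompactSupport hc.mul_left
  have i2 : ∀ e, Integrable (fun z => f z * fderiv ℝ φ z e) := fun e =>
    (hf.continuous.mul (c1 e)).integrable_of_hasCompactSupport (hc' e).mul_left
  have e1 : (fun z => f z * dz φ z) = fun z => (1/2) * (f z * fderiv ℝ φ z 1) -
      (Complex.I/2) * (f z * fderiv ℝ φ z Complex.I) := by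
    funext z; unfold dz; ring
  have e2 : (fun z => dz f z * φ z) = fun z => (1/2) * (fderiv ℝ f z 1 * φ z) -
      (Complex.I/2) * (fderiv ℝ f z Complex.I * φ z) := by
    funext z; unfold dz; ring
  rw [e1, e2, integral_sub ((i2 1).const_mul _) ((i2 _).const_mul _),
    integral_sub ((i1 1).const_mul _) ((i1 _).const_mul _)]
  simp only [integral_const_mul, ibp_dir hf hφ hc]
  ring

end LE

namespace LE
open ComplexConjugate

lemma int_rad (f : ℝ → ℝ) : ∫ z : ℂ, f ‖z‖ = 2 * π * ∫ y in Set.Ioi (0:ℝ), y * f y := by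
  rw [integral_fun_norm_addHaar volume f]
  simp [Measure.real, Complex.volume_ball, Complex.finrank_real_complex]
  ring

lemma integrable_rad (f : ℝ → ℝ) :
    Integrable (fun z : ℂ => f ‖z‖) ↔ IntegrableOn (fun y => y * f y) (Set.Ioi (0:ℝ)) := by
  rw [integrable_fun_norm_addHaar volume (f := f)]
  simp [Complex.finrank_real_complex]

lemma indic_eq (ρ : ℝ) : ((ball (0:ℂ) ρ).indicator (fun z : ℂ => ‖z‖⁻¹)) =
    fun z : ℂ => (fun r : ℝ => (Set.Iio ρ).indicator (fun r => r⁻¹) r) ‖z‖ := by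
  funext z
  by_cases h : ‖z‖ < ρ <;> simp [Set.indicator, h]

lemma indic_eq2 (ρ : ℝ) : Set.EqOn (fun y : ℝ => y * (Set.Iio ρ).indicator (fun r => r⁻¹) y)
    ((Set.Ioo 0 ρ).indicator (fun _ => (1:ℝ))) (Set.Ioi 0) := by
  intro y hy
  simp only [Set.mem_Ioi] at hy
  by_cases h : y < ρ <;> simp [Set.indicator, h, hy, hy.ne']

lemma integrableOn_inv0 (ρ : ℝ) : IntegrableOn (fun z : ℂ => ‖z‖⁻¹) (ball 0 ρ) := by
  rw [← integrable_indicator_iff measurableSet_ball, indic_eq, integrable_rad]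
  refine IntegrableOn.congr_fun ?_ (indic_eq2 ρ).symm measurableSet_Ioi
  apply Integrable.integrableOn
  rw [integrable_indicator_iff measurableSet_Ioo]
  exact integrableOn_const (by simp)

lemma integral_inv0 {ρ : ℝ} (hρ : 0 ≤ ρ) : ∫ z in ball (0:ℂ) ρ, ‖z‖⁻¹ = 2 * π * ρ := by
  rw [← integral_indicator measurableSet_ball, indic_eq, int_rad,
    setIntegral_congr_fun measurableSet_Ioi (indic_eq2 ρ),
    setIntegral_indicator measurableSet_Ioo]
  have : Set.Ioi (0:ℝ) ∩ Set.Ioo 0 ρ = Set.Ioo 0 ρ := by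
    ext; simp; 
  rw [this]; simp [hρ]

lemma integrableOn_inv (w : ℂ) (ρ : ℝ) : IntegrableOn (fun z : ℂ => ‖z - w‖⁻¹) (ball w ρ) := by
  have := (integrableOn_inv0 ρ)
  rw [← integrable_indicator_iff measurableSet_ball] at this ⊢
  have := this.comp_sub_right w
  refine this.congr (ae_of_all _ fun z => ?_)
  simp [Set.indicator, dist_eq_norm]

lemma integral_inv (w : ℂ) {ρ : ℝ} (hρ : 0 ≤ ρ) : ∫ z in ball w ρ, ‖z - w‖⁻¹ = 2 * π * ρ := by
  rw [← integral_inv0 hρ, ← integral_indicator measurableSet_ball,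
    ← integral_indicator measurableSet_ball]
  rw [← integral_sub_right_eq_self ((ball (0:ℂ) ρ).indicator (fun z : ℂ => ‖z‖⁻¹)) w]
  congr 1; funext z
  simp [Set.indicator, dist_eq_norm]

lemma locInt_norm_inv (w : ℂ) : LocallyIntegrable (fun z : ℂ => ‖z - w‖⁻¹) := by
  intro x
  refine ⟨ball w (dist x w + 1), ?_, integrableOn_inv _ _⟩
  exact isOpen_ball.mem_nhds (by simp)

lemma locInt_inv (w : ℂ) : LocallyIntegrable (fun z : ℂ => (z - w)⁻¹) := by
  refine (locInt_norm_inv w).mono ?_ (ae_of_all _ fun z => by simp)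
  exact (measurable_id.sub_const w).inv.aestronglyMeasurable

lemma integrable_div {h : ℂ → ℂ} (hh : Continuous h) (hc : HasCompactSupport h) (w : ℂ) :
    Integrable (fun z => h z / (z - w)) := by
  have := (locInt_inv w).integrable_smul_left_of_hasCompactSupport hh hc
  simpa [div_eq_mul_inv] using this

lemma integrableOn_div_norm {h : ℂ → ℝ} (hh : Continuous h) (w : ℂ) {K : Set ℂ} (hK : IsCompact K) :
    IntegrableOn (fun z => h z / ‖z - w‖) K := by
  have h1 := ((locInt_norm_inv w).integrableOn_isCompact hK).continuousOn_mul hh.continuousOn hK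
  simpa [div_eq_mul_inv] using h1

/-- NEAR estimate. -/
lemma near_est {h : ℂ → ℝ} (hh : Continuous h) {K : Set ℂ} (hK : IsCompact K) {z : ℂ} {ρ S m : ℝ}
    (hρ : 0 < ρ) (h0 : ∀ ζ ∈ K, 0 ≤ h ζ) (hS0 : 0 ≤ S) (hS : ∀ ζ ∈ K, ‖ζ - z‖ < ρ → h ζ ≤ S)
    (hm : ∫ ζ in K, h ζ ≤ m) :
    ∫ ζ in K, h ζ / ‖ζ - z‖ ≤ 2 * π * ρ * S + m / ρ := by
  have i1 : Integrable (fun ζ => S * (ball z ρ).indicator (fun ζ => ‖ζ - z‖⁻¹) ζ) := by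
    apply Integrable.const_mul
    rw [integrable_indicator_iff measurableSet_ball]
    exact integrableOn_inv z ρ
  have i2 : IntegrableOn (fun ζ => h ζ / ρ) K :=
    (hh.div_const ρ).continuousOn.integrableOn_compact hK
  have key : ∀ ζ ∈ K, h ζ / ‖ζ - z‖ ≤
      S * (ball z ρ).indicator (fun ζ => ‖ζ - z‖⁻¹) ζ + h ζ / ρ := by
    intro ζ hζ
    by_cases hb : ‖ζ - z‖ < ρ
    · have : ζ ∈ ball z ρ := by simpa [dist_eq_norm] using hb
      rw [Set.indicator_of_mem this, div_eq_mul_inv]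
      have a1 := mul_le_mul_of_nonneg_right (hS ζ hζ hb) (inv_nonneg.mpr (norm_nonneg (ζ - z)))
      have a2 := div_nonneg (h0 ζ hζ) hρ.le
      linarith
    · have : ζ ∉ ball z ρ := by simpa [dist_eq_norm] using hb
      rw [Set.indicator_of_notMem this]
      have a2 := div_le_div_of_nonneg_left (h0 ζ hζ) hρ (not_lt.mp hb)
      linarith
  calc ∫ ζ in K, h ζ / ‖ζ - z‖ ≤ ∫ ζ in K, (S * (ball z ρ).indicator (fun ζ => ‖ζ - z‖⁻¹) ζ + h ζ / ρ) :=
        setIntegral_mono_on (integrableOn_div_norm hh z hK) (i1.integrableOn.add i2) hK.measurableSet key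
    _ = (∫ ζ in K, S * (ball z ρ).indicator (fun ζ => ‖ζ - z‖⁻¹) ζ) + ∫ ζ in K, h ζ / ρ :=
        integral_add i1.integrableOn i2
    _ ≤ (∫ ζ, S * (ball z ρ).indicator (fun ζ => ‖ζ - z‖⁻¹) ζ) + ∫ ζ in K, h ζ / ρ := by
        refine add_le_add (setIntegral_le_integral i1 ?_) le_rfl
        apply ae_of_all; intro ζ
        apply mul_nonneg hS0
        apply Set.indicator_nonneg; intro _ _; positivity
    _ ≤ 2 * π * ρ * S + m / ρ := by
        rw [integral_const_mul, integral_indicator measurableSet_ball, integral_inv z hρ.le,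
          integral_div]
        have : (∫ ζ in K, h ζ) / ρ ≤ m / ρ := by gcongr
        linarith

/-- `∫ 1/(1+|z|^2)^2 = π`. -/
lemma integral_cauchy_kernel :
    Integrable (fun z : ℂ => ((‖z‖^2 + 1)^2)⁻¹) ∧ ∫ z : ℂ, ((‖z‖^2 + 1)^2)⁻¹ = π := by
  have hd : ∀ x ∈ Set.Ioi (0:ℝ), HasDerivAt (fun y : ℝ => -(2 * (y^2+1))⁻¹)
      (x * ((x^2+1)^2)⁻¹) x := by
    intro x _
    have h1 : HasDerivAt (fun y : ℝ => 2 * (y^2+1)) (2 * (2 * x)) x := by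
      have := (((hasDerivAt_id x).pow 2).add_const 1).const_mul 2
      simpa using this
    have h2 := (h1.inv (by positivity)).neg
    convert! h2 using 1
    field_simp
  have hc : ContinuousWithinAt (fun y : ℝ => -(2 * (y^2+1))⁻¹) (Set.Ici 0) 0 := by
    apply Continuous.continuousWithinAt
    apply Continuous.neg
    apply Continuous.inv₀ (by fun_prop)
    intro x; positivity
  have hl : Tendsto (fun y : ℝ => -(2 * (y^2+1))⁻¹) atTop (𝓝 0) := by
    rw [← neg_zero]
    apply Tendsto.neg
    apply tendsto_inv_atTop_zero.comp
    apply Tendsto.const_mul_atTop (by norm_num)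
    apply tendsto_atTop_add_const_right
    exact tendsto_pow_atTop (by norm_num)
  have hpos : ∀ x ∈ Set.Ioi (0:ℝ), 0 ≤ x * ((x^2+1)^2)⁻¹ := by
    intro x hx
    have := Set.mem_Ioi.mp hx
    positivity
  constructor
  · rw [integrable_rad (fun r => ((r^2+1)^2)⁻¹)]
    exact integrableOn_Ioi_deriv_of_nonneg hc hd hpos hl
  · rw [int_rad (fun r => ((r^2+1)^2)⁻¹), integral_Ioi_of_hasDerivAt_of_nonneg hc hd hpos hl]
    norm_num
    ring

end LE

namespace LE
open ComplexConjugate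

lemma kern_hasW (δ : ℝ) (hδ : 0 < δ) (z : ℂ) :
    HasW (fun z => conj z * (((‖z‖^2 + δ^2)⁻¹ : ℝ) : ℂ))
      (-(((‖z‖^2 + δ^2)^2)⁻¹ : ℝ) * conj z ^ 2)
      ((δ^2 * ((‖z‖^2 + δ^2)^2)⁻¹ : ℝ) : ℂ) z := by
  have hp : ‖z‖^2 + δ^2 ≠ 0 := by positivity
  have h1 : HasDerivAt (fun s : ℝ => (s + δ^2)⁻¹) (-1 / (‖z‖^2 + δ^2)^2) (‖z‖^2) :=
    ((hasDerivAt_id (‖z‖^2)).add_const (δ^2)).inv hp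
  have h2 := (HasW.cnj z).mul (HasW.radial h1)
  convert! h2 using 1
  · push_cast; ring
  · have : (z * conj z : ℂ) = ((‖z‖^2:ℝ):ℂ) := by
      rw [Complex.mul_conj, Complex.normSq_eq_norm_sq]
    have e : conj z * (((-1 / (‖z‖ ^ 2 + δ ^ 2) ^ 2 : ℝ):ℂ) * z) =
      ((-1 / (‖z‖ ^ 2 + δ ^ 2) ^ 2 : ℝ):ℂ) * ((‖z‖^2:ℝ):ℂ) := by rw [← this]; ring
    rw [e]
    norm_cast
    field_simp
    push_cast
    ring

lemma contDiff_normsq {n : WithTop ℕ∞} : ContDiff ℝ n (fun z : ℂ => ‖z‖^2) := contDiff_norm_sq ℝ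

lemma contDiff_ofReal' {g : ℂ → ℝ} {n : WithTop ℕ∞} (h : ContDiff ℝ n g) :
    ContDiff ℝ n (fun z => (g z : ℂ)) := Complex.ofRealCLM.contDiff.comp h

lemma contDiff_conj' {n : WithTop ℕ∞} : ContDiff ℝ n (fun z : ℂ => conj z) :=
  Complex.conjCLE.contDiff

lemma kern_contDiff (δ : ℝ) (hδ : 0 < δ) :
    ContDiff ℝ 1 (fun z : ℂ => conj z * (((‖z‖^2 + δ^2)⁻¹ : ℝ) : ℂ)) := by
  apply contDiff_conj'.mul
  apply contDiff_ofReal'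
  apply ContDiff.inv (contDiff_normsq.add contDiff_const)
  intro x; positivity

lemma tendsto_one_div : Tendsto (fun n : ℕ => (1 / ((n:ℝ) + 1))) atTop (𝓝 0) :=
  tendsto_one_div_add_atTop_nhds_zero_nat

lemma cp_reg {φ : ℂ → ℂ} (hφ : ContDiff ℝ 1 φ) (hc : HasCompactSupport φ) :
    Tendsto (fun n : ℕ => ∫ ζ, (conj ζ * (((‖ζ‖^2 + (1 / ((n:ℝ) + 1))^2)⁻¹ : ℝ) : ℂ)) * dzb φ ζ) atTop
      (𝓝 (- (π * φ 0))) := by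
  have hcb : Continuous (dzb φ) := (contDiff_dzb hφ (m := 0) (by simp)).continuous
  have hcc := hcs_dzb hc
  let δ : ℕ → ℝ := fun n => 1 / ((n:ℝ) + 1)
  have hδ : ∀ n, 0 < δ n := fun n => by positivity
  have hδ0 : Tendsto δ atTop (𝓝 0) := tendsto_one_div
  have E : ∀ n, ∫ ζ, (conj ζ * (((‖ζ‖^2 + δ n^2)⁻¹ : ℝ) : ℂ)) * dzb φ ζ =
      - ∫ η : ℂ, ((((‖η‖^2 + 1)^2)⁻¹ : ℝ) : ℂ) * φ (δ n • η) := by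
    intro n
    rw [ibp_dzb (kern_contDiff (δ n) (hδ n)) hφ hc]
    congr 1
    have hd := hδ n
    have := Measure.integral_comp_smul volume
      (fun ζ : ℂ => ((δ n^2 * ((‖ζ‖^2 + δ n^2)^2)⁻¹ : ℝ) : ℂ) * φ ζ) (δ n)
    rw [Complex.finrank_real_complex, abs_of_nonneg (by positivity)] at this
    have e2 : ∫ ζ, dzb (fun ζ => conj ζ * (((‖ζ‖^2 + δ n^2)⁻¹ : ℝ) : ℂ)) ζ * φ ζ =
        ((δ n)^2) • ∫ x : ℂ, ((δ n^2 * ((‖δ n • x‖^2 + δ n^2)^2)⁻¹ : ℝ) : ℂ) * φ (δ n • x) := by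
      rw [this, smul_smul, mul_inv_cancel₀ (by positivity), one_smul]
      congr 1; funext ζ
      rw [(kern_hasW (δ n) hd ζ).dzb]
    rw [e2, ← integral_smul]
    congr 1; funext x
    rw [norm_smul, Real.norm_of_nonneg hd.le, Complex.real_smul, ← mul_assoc]
    congr 1
    norm_cast
    field_simp
  obtain ⟨C, hC⟩ := hc.exists_bound_of_continuous hφ.continuous
  have L2 : Tendsto (fun n => ∫ η : ℂ, ((((‖η‖^2 + 1)^2)⁻¹ : ℝ) : ℂ) * φ (δ n • η)) atTop
      (𝓝 (∫ η : ℂ, ((((‖η‖^2 + 1)^2)⁻¹ : ℝ) : ℂ) * φ 0)) := by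
    apply tendsto_integral_of_dominated_convergence (fun η : ℂ => ((‖η‖^2 + 1)^2)⁻¹ * C)
    · intro n
      apply Continuous.aestronglyMeasurable
      apply Continuous.mul
      · apply Complex.continuous_ofReal.comp
        apply Continuous.inv₀ (by fun_prop)
        intro x; positivity
      · exact hφ.continuous.comp (continuous_const_smul _)
    · exact integral_cauchy_kernel.1.mul_const C
    · intro n
      apply ae_of_all; intro η
      rw [norm_mul, Complex.norm_real, Real.norm_of_nonneg (by positivity)]
      gcongr
      exact hC _
    · apply ae_of_all; intro η
      apply Tendsto.const_mul
      apply (hφ.continuous.tendsto 0).comp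
      have := hδ0.smul_const η
      simpa using this
  have L3 := L2.neg
  simp_rw [← E] at L3
  rw [integral_mul_const, integral_complex_ofReal, integral_cauchy_kernel.2] at L3
  exact L3

/-- Cauchy-Pompeiu at 0. -/
lemma cp0 {φ : ℂ → ℂ} (hφ : ContDiff ℝ 1 φ) (hc : HasCompactSupport φ) :
    ∫ ζ, dzb φ ζ / ζ = - (π * φ 0) := by
  have hcb : Continuous (dzb φ) := (contDiff_dzb hφ (m := 0) (by simp)).continuous
  have hcc := hcs_dzb hc
  let δ : ℕ → ℝ := fun n => 1 / ((n:ℝ) + 1)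
  have hδ : ∀ n, 0 < δ n := fun n => by positivity
  have hδ0 : Tendsto δ atTop (𝓝 0) := tendsto_one_div
  have hintg : Integrable (fun ζ => dzb φ ζ / ζ) := by simpa using integrable_div hcb hcc 0
  -- left limit
  have L1 : Tendsto (fun n => ∫ ζ, (conj ζ * (((‖ζ‖^2 + δ n^2)⁻¹ : ℝ) : ℂ)) * dzb φ ζ) atTop
      (𝓝 (∫ ζ, dzb φ ζ / ζ)) := by
    apply tendsto_integral_of_dominated_convergence (fun ζ => ‖dzb φ ζ / ζ‖)
    · intro n
      exact ((kern_contDiff (δ n) (hδ n)).continuous.mul hcb).aestronglyMeasurable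
    · exact hintg.norm
    · intro n
      apply ae_of_all; intro ζ
      rcases eq_or_ne ζ 0 with rfl | hz
      · simp
      have hz' : 0 < ‖ζ‖ := norm_pos_iff.mpr hz
      rw [norm_mul, norm_mul, norm_div, RCLike.norm_conj, Complex.norm_real, Real.norm_of_nonneg (by positivity),
        div_eq_mul_inv, mul_comm]
      gcongr
      rw [← div_eq_mul_inv, div_le_iff₀ (by positivity)]
      have : ‖ζ‖⁻¹ * (‖ζ‖^2 + δ n^2) = ‖ζ‖ + ‖ζ‖⁻¹ * δ n^2 := by field_simp
      rw [this]
      have : 0 ≤ ‖ζ‖⁻¹ * δ n^2 := by positivity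
      linarith
    · have : ∀ᵐ ζ : ℂ, ζ ≠ 0 := by
        rw [ae_iff]; simp
      filter_upwards [this] with ζ hz
      have hz' : 0 < ‖ζ‖ := norm_pos_iff.mpr hz
      have e : dzb φ ζ / ζ = (conj ζ * (((‖ζ‖^2 + 0^2)⁻¹ : ℝ) : ℂ)) * dzb φ ζ := by
        have : (ζ * conj ζ : ℂ) = ((‖ζ‖^2:ℝ):ℂ) := by
          rw [Complex.mul_conj, Complex.normSq_eq_norm_sq]
        have hcz : conj ζ ≠ 0 := by simpa using hz
        simp only [ne_eq, OfNat.ofNat_ne_zero, not_false_eq_true, zero_pow, add_zero]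
        rw [Complex.ofReal_inv, ← this]
        field_simp
      rw [e]
      apply Tendsto.mul_const
      apply Tendsto.const_mul
      apply (Complex.continuous_ofReal.tendsto _).comp
      apply Tendsto.inv₀
      · exact (hδ0.pow 2).const_add _
      · positivity
  exact tendsto_nhds_unique L1 (cp_reg hφ hc)

lemma dzb_comp_add (φ : ℂ → ℂ) (w z : ℂ) : dzb (fun z => φ (z + w)) z = dzb φ (z + w) := by
  unfold dzb; rw [fderiv_comp_add_right]

lemma dz_comp_add (φ : ℂ → ℂ) (w z : ℂ) : dz (fun z => φ (z + w)) z = dz φ (z + w) := by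
  unfold dz; rw [fderiv_comp_add_right]

lemma contDiff_shift {φ : ℂ → ℂ} {n : WithTop ℕ∞} (hφ : ContDiff ℝ n φ) (w : ℂ) :
    ContDiff ℝ n (fun z => φ (z + w)) := hφ.comp (contDiff_id.add contDiff_const)

lemma hcs_shift {φ : ℂ → ℂ} (hc : HasCompactSupport φ) (w : ℂ) :
    HasCompactSupport (fun z => φ (z + w)) := hc.comp_homeomorph (Homeomorph.addRight w)

/-- Cauchy-Pompeiu. -/
lemma cp {φ : ℂ → ℂ} (hφ : ContDiff ℝ 1 φ) (hc : HasCompactSupport φ) (w : ℂ) :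
    ∫ ζ, dzb φ ζ / (ζ - w) = - (π * φ w) := by
  have h := cp0 (contDiff_shift hφ w) (hcs_shift hc w)
  simp only [zero_add] at h
  rw [← h, ← integral_add_right_eq_self (fun ζ => dzb φ ζ / (ζ - w)) w]
  congr 1; funext ζ
  rw [dzb_comp_add, add_sub_cancel_right]

end LE

namespace LE
open ComplexConjugate

/-- Laplacian on `ℂ`. -/
def lapC (v : ℂ → ℝ) (z : ℂ) : ℝ :=
  fderiv ℝ (fun y => fderiv ℝ v y 1) z 1 + fderiv ℝ (fun y => fderiv ℝ v y Complex.I) z Complex.I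

/-- complex gradient of a real function. -/
def gz (v : ℂ → ℝ) : ℂ → ℂ := dz (fun z => (v z : ℂ))

lemma fderiv_ofReal' {v : ℂ → ℝ} {z : ℂ} (h : DifferentiableAt ℝ v z) :
    fderiv ℝ (fun z => (v z : ℂ)) z = Complex.ofRealCLM.comp (fderiv ℝ v z) :=
  ((Complex.ofRealCLM.hasFDerivAt (x := v z)).comp z h.hasFDerivAt).fderiv

lemma gz_eq {v : ℂ → ℝ} {z : ℂ} (h : DifferentiableAt ℝ v z) :
    gz v z = ((fderiv ℝ v z 1 : ℝ) - Complex.I * (fderiv ℝ v z Complex.I : ℝ)) / 2 := by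
  unfold gz dz; rw [fderiv_ofReal' h]; simp

lemma hasW_gz {v : ℂ → ℝ} {z : ℂ} (h : DifferentiableAt ℝ v z) :
    HasW (fun z => (v z : ℂ)) (gz v z) (conj (gz v z)) z := hasW_ofReal h

lemma fderiv_real_eq {v : ℂ → ℝ} {z : ℂ} (h : DifferentiableAt ℝ v z) (k : ℂ) :
    fderiv ℝ v z k = 2 * (gz v z * k).re := by
  have h1 := (hasW_gz h).fderiv
  rw [fderiv_ofReal' h] at h1
  have h2 := congrArg (fun T => (T k).re) h1
  simp at h2
  rw [h2]; simp; ring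

lemma dzb_gz {v : ℂ → ℝ} {z : ℂ} (h : ContDiffAt ℝ 2 v z) :
    dzb (gz v) z = (lapC v z : ℂ) / 4 ∧ DifferentiableAt ℝ (gz v) z := by
  have hsym := h.isSymmSndFDerivAt (by simp)
  have h1 : ContDiffAt ℝ 1 (fderiv ℝ v) z := h.fderiv_right (by norm_num)
  have h2 : DifferentiableAt ℝ (fderiv ℝ v) z := h1.differentiableAt one_ne_zero
  have ev : ∀ᶠ y in 𝓝 z, DifferentiableAt ℝ v y := by
    filter_upwards [h.eventually (by simp)] with y hy
    exact hy.differentiableAt two_ne_zero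
  have e1 : gz v =ᶠ[𝓝 z] fun y => ((fderiv ℝ v y 1 : ℝ) - Complex.I * (fderiv ℝ v y Complex.I : ℝ)) / 2 := by
    filter_upwards [ev] with y hy using gz_eq hy
  have d1 : ∀ k : ℂ, HasFDerivAt (fun y => fderiv ℝ v y k) ((fderiv ℝ (fderiv ℝ v) z).flip k) z := by
    intro k
    have := h2.hasFDerivAt.clm_apply (hasFDerivAt_const k z)
    convert! this using 1
    ext; simp
  have d2 : ∀ k : ℂ, HasFDerivAt (fun y => ((fderiv ℝ v y k : ℝ) : ℂ))
      (Complex.ofRealCLM.comp ((fderiv ℝ (fderiv ℝ v) z).flip k)) z := fun k =>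
    (Complex.ofRealCLM.hasFDerivAt).comp z (d1 k)
  have d3 := ((d2 1).sub ((d2 Complex.I).const_mul Complex.I)).mul_const ((2:ℂ)⁻¹)
  have d4 : HasFDerivAt (gz v) _ z := d3.congr_of_eventuallyEq (by
    filter_upwards [e1] with y hy
    rw [hy]; simp [div_eq_mul_inv])
  refine ⟨?_, d4.differentiableAt⟩
  unfold dzb lapC
  rw [d4.fderiv, (d1 1).fderiv, (d1 Complex.I).fderiv]
  have := hsym 1 Complex.I
  simp [this]
  linear_combination (-(fderiv ℝ (fderiv ℝ v) z Complex.I Complex.I : ℂ)/4) * Complex.I_sq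

lemma contDiff_gz {v : ℂ → ℝ} {n m : WithTop ℕ∞} (h : ContDiff ℝ n v) (hm : m + 1 ≤ n) :
    ContDiff ℝ m (gz v) := contDiff_dz (contDiff_ofReal' h) hm

lemma contDiff_lapC {v : ℂ → ℝ} (h : ContDiff ℝ 2 v) : Continuous (lapC v) := by
  have h1 : ContDiff ℝ 1 (fderiv ℝ v) := h.fderiv_right (by norm_num)
  have h2 : ∀ k : ℂ, Continuous (fun z => fderiv ℝ (fun y => fderiv ℝ v y k) z k) := by
    intro k
    have : ContDiff ℝ 1 (fun y => fderiv ℝ v y k) := h1.clm_apply contDiff_const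
    exact (this.continuous_fderiv one_ne_zero).clm_apply continuous_const
  exact (h2 1).add (h2 Complex.I)

lemma hcs_gz {v : ℂ → ℝ} (h : HasCompactSupport v) : HasCompactSupport (gz v) :=
  hcs_dz (h.comp_left (g := fun x : ℝ => (x:ℂ)) (by simp))

lemma hcs_lapC {v : ℂ → ℝ} (h : HasCompactSupport v) : HasCompactSupport (lapC v) := by
  have h2 : ∀ k : ℂ, HasCompactSupport (fun z => fderiv ℝ (fun y => fderiv ℝ v y k) z k) := by
    intro k
    exact (h.fderiv_apply (𝕜 := ℝ) k).fderiv_apply (𝕜 := ℝ) k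
  exact (h2 1).add (h2 Complex.I)

lemma integral_lapC {φ : ℂ → ℝ} (hφ : ContDiff ℝ 2 φ) (hc : HasCompactSupport φ) :
    ∫ z, lapC φ z = 0 := by
  have h := ibp_dzb (contDiff_const (c := (1:ℂ))) (contDiff_gz hφ (m := 1) (by norm_num)) (hcs_gz hc)
  simp only [(HasW.const (1:ℂ) _).dzb, one_mul, zero_mul, integral_zero, neg_zero] at h
  have e : (fun z => dzb (gz φ) z) = fun z => (((lapC φ z / 4 : ℝ)) : ℂ) := by
    funext z; rw [(dzb_gz hφ.contDiffAt).1]; push_cast; ring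
  rw [e, integral_complex_ofReal, integral_div] at h
  have : (∫ z, lapC φ z) / 4 = 0 := by exact_mod_cast h
  linarith

lemma abs_log_le_inv {x : ℝ} (hx : 0 ≤ x) : |Real.log x| ≤ x + x⁻¹ := by
  rcases eq_or_lt_of_le hx with rfl | hx
  · simp
  rw [abs_le]; constructor
  · have := Real.one_sub_inv_le_log_of_pos hx; linarith
  · have := Real.log_le_sub_one_of_pos hx
    have : 0 < x⁻¹ := by positivity
    linarith

lemma locInt_log (w : ℂ) : LocallyIntegrable (fun z : ℂ => Real.log ‖z - w‖) := by
  have h1 : LocallyIntegrable (fun z : ℂ => ‖z - w‖ + ‖z - w‖⁻¹) := by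
    refine LocallyIntegrable.add ?_ (locInt_norm_inv w)
    exact (by fun_prop : Continuous (fun z : ℂ => ‖z - w‖)).locallyIntegrable
  refine h1.mono ?_ (ae_of_all _ fun z => ?_)
  · exact (Real.measurable_log.comp (by fun_prop : Continuous (fun z : ℂ => ‖z - w‖)).measurable).aestronglyMeasurable
  · rw [Real.norm_eq_abs, Real.norm_of_nonneg (by positivity)]
    exact abs_log_le_inv (norm_nonneg _)

lemma log0 {φ : ℂ → ℝ} (hφ : ContDiff ℝ 2 φ) (hc : HasCompactSupport φ) :
    ∫ ζ, Real.log ‖ζ‖ * lapC φ ζ = 2 * π * φ 0 := by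
  let δ : ℕ → ℝ := fun n => 1 / ((n:ℝ) + 1)
  have hδ : ∀ n, 0 < δ n := fun n => by positivity
  have hδ1 : ∀ n, δ n ≤ 1 := fun n => by
    simp only [δ]; rw [div_le_one (by positivity)]; linarith [n.cast_nonneg (α := ℝ)]
  have hδ0 : Tendsto δ atTop (𝓝 0) := tendsto_one_div
  have hLc := contDiff_lapC hφ
  have hLs := hcs_lapC hc
  have hcC : HasCompactSupport (fun z => (φ z : ℂ)) := hc.comp_left (g := fun x : ℝ => (x:ℂ)) (by simp)
  have cl : ∀ n, Continuous (fun ζ : ℂ => Real.log (‖ζ‖^2 + δ n^2) / 2) := by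
    intro n
    apply Continuous.div_const
    apply Continuous.log (by fun_prop)
    intro x; have := hδ n; positivity
  have L1 : Tendsto (fun n => ∫ ζ, Real.log (‖ζ‖^2 + δ n^2) / 2 * lapC φ ζ) atTop
      (𝓝 (∫ ζ, Real.log ‖ζ‖ * lapC φ ζ)) := by
    apply tendsto_integral_of_dominated_convergence
      (fun ζ => |Real.log ‖ζ‖ * lapC φ ζ| + |Real.log (‖ζ‖^2 + 1) / 2 * lapC φ ζ|)
    · intro n
      exact ((cl n).mul hLc).aestronglyMeasurable
    · apply Integrable.add
      · have := (locInt_log 0).integrable_smul_right_of_hasCompactSupport hLc hLs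
        simp only [sub_zero, smul_eq_mul] at this
        exact this.norm
      · have c0 : Continuous (fun ζ : ℂ => Real.log (‖ζ‖^2 + 1) / 2) := by simpa [δ] using cl 0
        have : Integrable (fun ζ : ℂ => Real.log (‖ζ‖^2 + 1) / 2 * lapC φ ζ) volume :=
          (c0.mul hLc).integrable_of_hasCompactSupport (hLs.mul_left)
        exact this.norm
    · intro n
      have : ∀ᵐ ζ : ℂ, ζ ≠ 0 := by
        rw [ae_iff]; simp
      filter_upwards [this] with ζ hz
      have hz' : 0 < ‖ζ‖ := norm_pos_iff.mpr hz
      rw [Real.norm_eq_abs, abs_mul, abs_mul, abs_mul, ← add_mul]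
      gcongr
      have a1 : Real.log ‖ζ‖ ≤ Real.log (‖ζ‖^2 + δ n^2) / 2 := by
        have : Real.log (‖ζ‖^2) ≤ Real.log (‖ζ‖^2 + δ n^2) :=
          Real.log_le_log (by positivity) (by nlinarith [hδ n])
        rw [Real.log_pow] at this; push_cast at this; linarith
      have a2 : Real.log (‖ζ‖^2 + δ n^2) / 2 ≤ Real.log (‖ζ‖^2 + 1) / 2 := by
        have : Real.log (‖ζ‖^2 + δ n^2) ≤ Real.log (‖ζ‖^2 + 1) :=
          Real.log_le_log (by positivity) (by nlinarith [hδ n, hδ1 n])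
        linarith
      rw [abs_le]; constructor
      · linarith [neg_abs_le (Real.log ‖ζ‖), abs_nonneg (Real.log (‖ζ‖^2 + 1) / 2)]
      · linarith [le_abs_self (Real.log (‖ζ‖^2 + 1) / 2), abs_nonneg (Real.log ‖ζ‖)]
    · have : ∀ᵐ ζ : ℂ, ζ ≠ 0 := by
        rw [ae_iff]; simp
      filter_upwards [this] with ζ hz
      have hz' : 0 < ‖ζ‖ := norm_pos_iff.mpr hz
      apply Tendsto.mul_const
      have e : Real.log ‖ζ‖ = Real.log (‖ζ‖^2 + 0^2) / 2 := by
        simp [Real.log_pow]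
      rw [e]
      apply Tendsto.div_const
      apply Tendsto.log _ (by positivity)
      exact (hδ0.pow 2).const_add _
  have E : ∀ n, ((∫ ζ, Real.log (‖ζ‖^2 + δ n^2) / 2 * lapC φ ζ : ℝ) : ℂ) =
      - 2 * conj (∫ ζ, (conj ζ * (((‖ζ‖^2 + δ n^2)⁻¹ : ℝ) : ℂ)) * dzb (fun z => (φ z : ℂ)) ζ) := by
    intro n
    have hd := hδ n
    have hW : ∀ z : ℂ, HasW (fun z => ((Real.log (‖z‖^2 + δ n^2) / 2 : ℝ) : ℂ))
        (((‖z‖^2 + δ n^2)⁻¹ / 2 : ℝ) * conj z) (((‖z‖^2 + δ n^2)⁻¹ / 2 : ℝ) * z) z := by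
      intro z
      have hp : ‖z‖^2 + δ n^2 ≠ 0 := by positivity
      apply HasW.radial (g := fun s => Real.log (s + δ n^2) / 2)
      have := (((hasDerivAt_id (‖z‖^2)).add_const (δ n^2)).log hp).div_const 2
      simpa using this
    have hC1 : ContDiff ℝ 1 (fun z : ℂ => ((Real.log (‖z‖^2 + δ n^2) / 2 : ℝ) : ℂ)) := by
      apply contDiff_ofReal'
      apply ContDiff.div_const
      apply ContDiff.log (contDiff_normsq.add contDiff_const)
      intro x; positivity
    have h := ibp_dzb hC1 (contDiff_gz hφ (m := 1) (by norm_num)) (hcs_gz hc)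
    have e : (fun z => ((Real.log (‖z‖^2 + δ n^2) / 2 : ℝ) : ℂ) * dzb (gz φ) z) =
        fun z => (((Real.log (‖z‖^2 + δ n^2) / 2 * lapC φ z / 4 : ℝ)) : ℂ) := by
      funext z; rw [(dzb_gz hφ.contDiffAt).1]; push_cast; ring
    rw [e, integral_complex_ofReal, integral_div] at h
    have e2 : ((∫ ζ, Real.log (‖ζ‖^2 + δ n^2) / 2 * lapC φ ζ : ℝ) : ℂ) =
        4 * (((∫ ζ, Real.log (‖ζ‖^2 + δ n^2) / 2 * lapC φ ζ) / 4 : ℝ) : ℂ) := by push_cast; ring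
    rw [e2, h, ← integral_conj, ← integral_const_mul, ← integral_neg, ← integral_const_mul]
    congr 1; funext z
    rw [(hW z).dzb, (hasW_gz (hφ.differentiable two_ne_zero z)).dzb]
    simp
    ring
  have L2 := (cp_reg ((contDiff_ofReal' hφ).of_le one_le_two) hcC)
  have L3 := ((Complex.continuous_conj.tendsto _).comp L2).const_mul (-2:ℂ)
  have L4 := (Complex.continuous_ofReal.tendsto _).comp L1
  have : ((fun x:ℝ => (x:ℂ)) ∘ fun n => ∫ ζ, Real.log (‖ζ‖^2 + δ n^2) / 2 * lapC φ ζ) = fun n =>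
     - 2 * conj (∫ ζ, (conj ζ * (((‖ζ‖^2 + δ n^2)⁻¹ : ℝ) : ℂ)) * dzb (fun z => (φ z : ℂ)) ζ) := by
    funext n; exact E n
  rw [this] at L4
  have := tendsto_nhds_unique L4 L3
  have h5 : ((∫ ζ, Real.log ‖ζ‖ * lapC φ ζ : ℝ) : ℂ) = ((2 * π * φ 0 : ℝ) : ℂ) := by
    rw [this]; simp; ring
  exact_mod_cast h5

lemma lapC_comp_add (φ : ℂ → ℝ) (w z : ℂ) : lapC (fun z => φ (z + w)) z = lapC φ (z + w) := by
  unfold lapC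
  have : ∀ k : ℂ, (fun y => fderiv ℝ (fun z => φ (z + w)) y k) = fun y => (fun y => fderiv ℝ φ y k) (y + w) := by
    intro k; funext y; rw [fderiv_comp_add_right]
  have h2 : ∀ k : ℂ, fderiv ℝ (fun y => (fun y => fderiv ℝ φ y k) (y + w)) z = fderiv ℝ (fun y => fderiv ℝ φ y k) (z + w) :=
    fun k => fderiv_comp_add_right (f := fun y => fderiv ℝ φ y k) w
  rw [this, this, h2, h2]

lemma log_repr {φ : ℂ → ℝ} (hφ : ContDiff ℝ 2 φ) (hc : HasCompactSupport φ) (w : ℂ) :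
    ∫ ζ, Real.log ‖ζ - w‖ * lapC φ ζ = 2 * π * φ w := by
  have h := log0 (φ := fun z => φ (z + w)) (hφ.comp (contDiff_id.add contDiff_const)) (hc.comp_homeomorph (Homeomorph.addRight w))
  simp only [zero_add] at h
  rw [← h, ← integral_add_right_eq_self (fun ζ => Real.log ‖ζ - w‖ * lapC φ ζ) w]
  congr 1; funext ζ
  rw [lapC_comp_add, add_sub_cancel_right]

end LE

namespace LE
open ComplexConjugate

def th (s : ℝ) : ℝ := Real.smoothTransition (2 - s)
def th1 : ℝ → ℝ := deriv th
def th2 : ℝ → ℝ := deriv th1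

lemma th_contDiff {n : WithTop ℕ∞} (hn : n ≤ (⊤:ℕ∞)) : ContDiff ℝ n th :=
  ((Real.smoothTransition.contDiff (n := ⊤)).of_le hn).comp (contDiff_const.sub contDiff_id)

lemma th1_contDiff {n : WithTop ℕ∞} (hn : n + 1 ≤ (⊤:ℕ∞)) : ContDiff ℝ n th1 := by
  have h := th_contDiff hn
  rw [contDiff_succ_iff_deriv] at h
  exact h.2.2

lemma two_le_top : (1:WithTop ℕ∞) + 1 ≤ ((⊤:ℕ∞) : WithTop ℕ∞) := by
  rw [one_add_one_eq_two]; exact WithTop.coe_le_coe.mpr (le_top : (2:ℕ∞) ≤ ⊤)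

lemma th_one {s : ℝ} (h : s ≤ 1) : th s = 1 := Real.smoothTransition.one_of_one_le (by linarith)
lemma th_zero {s : ℝ} (h : 2 ≤ s) : th s = 0 := Real.smoothTransition.zero_of_nonpos (by linarith)
lemma th_nonneg (s : ℝ) : 0 ≤ th s := Real.smoothTransition.nonneg _
lemma th_le_one (s : ℝ) : th s ≤ 1 := Real.smoothTransition.le_one _

lemma th1_zero {s : ℝ} (h : s < 1 ∨ 2 < s) : th1 s = 0 := by
  unfold th1
  rcases h with h | h
  · have : th =ᶠ[𝓝 s] fun _ => 1 := by
      filter_upwards [Iio_mem_nhds h] with y hy using th_one (le_of_lt hy)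
    rw [this.deriv_eq]; simp
  · have : th =ᶠ[𝓝 s] fun _ => 0 := by
      filter_upwards [Ioi_mem_nhds h] with y hy using th_zero (le_of_lt hy)
    rw [this.deriv_eq]; simp

lemma th2_zero {s : ℝ} (h : s < 1 ∨ 2 < s) : th2 s = 0 := by
  unfold th2
  rcases h with h | h
  · have : th1 =ᶠ[𝓝 s] fun _ => 0 := by
      filter_upwards [Iio_mem_nhds h] with y hy using th1_zero (Or.inl hy)
    rw [this.deriv_eq]; simp
  · have : th1 =ᶠ[𝓝 s] fun _ => 0 := by
      filter_upwards [Ioi_mem_nhds h] with y hy using th1_zero (Or.inr hy)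
    rw [this.deriv_eq]; simp

lemma th_bound : ∃ C > 0, ∀ s, |th1 s| ≤ C ∧ |th2 s| ≤ C := by
  have c1 : Continuous th1 := (th1_contDiff (n := 0) (by simp)).continuous
  have c2 : Continuous th2 := (th1_contDiff (n := 1) two_le_top).continuous_deriv le_rfl
  obtain ⟨C1, h1⟩ := (isCompact_Icc (a := (1:ℝ)) (b := 2)).exists_bound_of_continuousOn c1.continuousOn
  obtain ⟨C2, h2⟩ := (isCompact_Icc (a := (1:ℝ)) (b := 2)).exists_bound_of_continuousOn c2.continuousOn
  refine ⟨|C1| + |C2| + 1, by positivity, fun s => ?_⟩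
  by_cases hs : s ∈ Set.Icc (1:ℝ) 2
  · have a := h1 s hs
    have b := h2 s hs
    rw [Real.norm_eq_abs] at a b
    constructor <;> linarith [le_abs_self C1, le_abs_self C2, abs_nonneg C1, abs_nonneg C2]
  · have : s < 1 ∨ 2 < s := by
      by_contra h; push Not at h; exact hs ⟨h.1, h.2⟩
    rw [th1_zero this, th2_zero this]
    simp; positivity

lemma th_hasDeriv (s : ℝ) : HasDerivAt th (th1 s) s :=
  ((th_contDiff (n := 1) (by exact_mod_cast le_top)).differentiable one_ne_zero s).hasDerivAt

lemma th1_hasDeriv (s : ℝ) : HasDerivAt th1 (th2 s) s :=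
  ((th1_contDiff (n := 1) two_le_top).differentiable one_ne_zero s).hasDerivAt

def chi (L : ℝ) (z : ℂ) : ℝ := th (‖z‖^2 / L^2)

lemma chi_contDiff (L : ℝ) {n : WithTop ℕ∞} (hn : n ≤ (⊤:ℕ∞)) : ContDiff ℝ n (chi L) :=
  (th_contDiff hn).comp (contDiff_normsq.div_const _)

lemma chi_one {L : ℝ} (hL : 0 < L) {z : ℂ} (h : ‖z‖ ≤ L) : chi L z = 1 := by
  apply th_one
  rw [div_le_one (by positivity)]
  gcongr

lemma chi_zero {L : ℝ} (hL : 0 < L) {z : ℂ} (h : 3 * L / 2 ≤ ‖z‖) : chi L z = 0 := by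
  apply th_zero
  rw [le_div_iff₀ (by positivity)]
  nlinarith

lemma chi_nonneg (L : ℝ) (z : ℂ) : 0 ≤ chi L z := th_nonneg _
lemma chi_le_one (L : ℝ) (z : ℂ) : chi L z ≤ 1 := th_le_one _

lemma chi_tsupport {L : ℝ} (hL : 0 < L) : tsupport (chi L) ⊆ closedBall 0 (3 * L / 2) := by
  apply closure_minimal _ isClosed_closedBall
  intro z hz
  by_contra h
  apply hz
  apply chi_zero hL
  simp at h; exact h.le

lemma chi_hcs {L : ℝ} (hL : 0 < L) : HasCompactSupport (chi L) :=
  (isCompact_closedBall 0 (3 * L / 2)).of_isClosed_subset (isClosed_tsupport _) (chi_tsupport hL)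

lemma chi_hasW (L : ℝ) (z : ℂ) : HasW (fun z => (chi L z : ℂ))
    ((th1 (‖z‖^2 / L^2) / L^2 : ℝ) * conj z) ((th1 (‖z‖^2 / L^2) / L^2 : ℝ) * z) z := by
  apply HasW.radial (g := fun s => th (s / L^2))
  have := (th_hasDeriv (‖z‖^2 / L^2)).comp (‖z‖^2) ((hasDerivAt_id (‖z‖^2)).div_const (L^2))
  convert! this using 1
  ring

lemma hcsC {g : ℂ → ℝ} (h : HasCompactSupport g) : HasCompactSupport (fun z => (g z : ℂ)) :=
  h.comp_left (g := fun x : ℝ => (x:ℂ)) (by simp)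

lemma vol_cb {r : ℝ} (hr : 0 ≤ r) (z : ℂ) : volume.real (closedBall z r) = π * r^2 := by
  rw [Measure.real, Complex.volume_closedBall]
  simp [ENNReal.toReal_ofReal hr]; ring

lemma cp_est : ∃ C > 0, ∀ (ψ : ℂ → ℂ), ContDiff ℝ 1 ψ → ∀ (L B : ℝ) (w : ℂ), 0 < L → ‖w‖ ≤ L / 2 →
    (∀ ζ, L ≤ ‖ζ‖ → ‖ζ‖ ≤ 3 * L / 2 → ‖ψ ζ‖ ≤ B) →
    ‖ψ w‖ ≤ (∫ ζ in closedBall 0 (3 * L / 2), ‖dzb ψ ζ‖ / ‖ζ - w‖) + C * B := by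
  obtain ⟨C0, hC0, hC⟩ := th_bound
  refine ⟨7 * C0, by positivity, ?_⟩
  intro ψ hψ L B w hL hw hB
  have hB0 : 0 ≤ B := by
    refine (norm_nonneg _).trans (hB (L:ℂ) ?_ ?_) <;> simp [abs_of_pos hL] <;> linarith
  have hW : ∀ z, HasW (fun z => (chi L z : ℂ) * ψ z) _ _ z := fun z =>
    (chi_hasW L z).mul (DifferentiableAt.hasW (hψ.differentiable one_ne_zero z))
  have hcd : ContDiff ℝ 1 (fun z => (chi L z : ℂ) * ψ z) :=
    (contDiff_ofReal' (chi_contDiff L (by exact_mod_cast le_top))).mul hψ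
  have hcs : HasCompactSupport (fun z => (chi L z : ℂ) * ψ z) := (hcsC (chi_hcs hL)).mul_right
  have h := cp hcd hcs w
  have e1 : (chi L w : ℂ) * ψ w = ψ w := by
    rw [chi_one hL (by linarith)]; simp
  rw [e1] at h
  set K := closedBall (0:ℂ) (3 * L / 2) with hK
  have hz : ∀ ζ, ζ ∉ K → dzb (fun z => (chi L z : ℂ) * ψ z) ζ / (ζ - w) = 0 := by
    intro ζ hζ
    simp [hK] at hζ
    rw [(hW ζ).dzb, chi_zero hL hζ.le, th1_zero]
    · simp
    · right
      rw [lt_div_iff₀ (by positivity)]; nlinarith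
  rw [← setIntegral_eq_integral_of_forall_compl_eq_zero hz] at h
  have hcont : Continuous (fun ζ => ‖dzb ψ ζ‖) := (contDiff_dzb hψ (m := 0) (by simp)).continuous.norm
  have hKc : IsCompact K := isCompact_closedBall _ _
  have i1 := integrableOn_div_norm hcont w hKc
  have h2 : π * ‖ψ w‖ ≤ ∫ ζ in K, (‖dzb ψ ζ‖ / ‖ζ - w‖ + 3 * C0 * B / L^2) := by
    have : π * ‖ψ w‖ = ‖- (π * ψ w)‖ := by simp [abs_of_pos pi_pos]
    rw [this, ← h]
    apply norm_integral_le_of_norm_le (i1.add (integrableOn_const (by simpa using hKc.measure_lt_top.ne)))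
    rw [ae_restrict_iff' hKc.measurableSet]
    apply ae_of_all
    intro ζ hζ
    simp [hK] at hζ
    show _ ≤ ‖dzb ψ ζ‖ / ‖ζ - w‖ + 3 * C0 * B / L^2
    rw [(hW ζ).dzb, norm_div]
    have b1 : ‖(chi L ζ : ℂ) * dzb ψ ζ‖ ≤ ‖dzb ψ ζ‖ := by
      rw [norm_mul, Complex.norm_real, Real.norm_of_nonneg (chi_nonneg _ _)]
      exact mul_le_of_le_one_left (norm_nonneg _) (chi_le_one _ _)
    by_cases hζL : ‖ζ‖ < L
    · rw [th1_zero]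
      · simp only [zero_div, Complex.ofReal_zero, zero_mul, zero_add]
        have : 0 ≤ 3 * C0 * B / L^2 := by positivity
        have : ‖(chi L ζ : ℂ) * dzb ψ ζ‖ / ‖ζ - w‖ ≤ ‖dzb ψ ζ‖ / ‖ζ - w‖ := by gcongr
        linarith
      · left
        rw [div_lt_one (by positivity)]; gcongr
    · push Not at hζL
      have hd : L / 2 ≤ ‖ζ - w‖ := by
        have := norm_sub_norm_le ζ w; linarith
      have hd0 : 0 < ‖ζ - w‖ := by linarith
      have b2 : ‖((th1 (‖ζ‖^2 / L^2) / L^2 : ℝ) : ℂ) * ζ * ψ ζ‖ ≤ C0 / L^2 * (3 * L / 2) * B := by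
        rw [norm_mul, norm_mul, Complex.norm_real, Real.norm_eq_abs, abs_div, abs_of_pos (by positivity : 0 < L^2)]
        gcongr
        · exact (hC _).1
        · exact hB ζ hζL hζ
      calc _ ≤ (C0 / L^2 * (3 * L / 2) * B + ‖dzb ψ ζ‖) / ‖ζ - w‖ := by
            gcongr
            exact (norm_add_le _ _).trans (add_le_add b2 b1)
        _ = ‖dzb ψ ζ‖ / ‖ζ - w‖ + C0 / L^2 * (3 * L / 2) * B / ‖ζ - w‖ := by ring
        _ ≤ ‖dzb ψ ζ‖ / ‖ζ - w‖ + C0 / L^2 * (3 * L / 2) * B / (L / 2) := by gcongr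
        _ = _ := by field_simp
  rw [integral_add i1 (integrableOn_const (by simpa using hKc.measure_lt_top.ne)), setIntegral_const, vol_cb (by positivity), smul_eq_mul] at h2
  have hI : 0 ≤ ∫ ζ in K, ‖dzb ψ ζ‖ / ‖ζ - w‖ := integral_nonneg fun ζ => by positivity
  have hpi := pi_gt_three
  have e3 : π * (3 * L / 2)^2 * (3 * C0 * B / L^2) = π * (27 / 4 * C0 * B) := by field_simp; ring
  rw [e3] at h2
  have h3 : π * ‖ψ w‖ ≤ π * ((∫ ζ in K, ‖dzb ψ ζ‖ / ‖ζ - w‖) + 7 * C0 * B) := by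
    have : 0 ≤ C0 * B := by positivity
    nlinarith
  exact le_of_mul_le_mul_left h3 pi_pos

lemma grad_est0 : ∃ C > 0, ∀ (Φ : ℂ → ℂ), ContDiff ℝ 2 Φ → ∀ (r A B : ℝ), 0 < r →
    (∀ ζ, ‖ζ‖ ≤ 3 * r / 2 → ‖dzb (dz Φ) ζ‖ ≤ A) → (∀ ζ, ‖ζ‖ ≤ 3 * r / 2 → ‖Φ ζ‖ ≤ B) →
    ‖dz Φ 0‖ ≤ C * (r * A + B / r) := by
  obtain ⟨C0, hC0, hC⟩ := th_bound
  refine ⟨4 + 4 * C0, by positivity, ?_⟩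
  intro Φ hΦ r A B hr hA hB
  have hA0 : 0 ≤ A := (norm_nonneg _).trans (hA 0 (by simp; positivity))
  have hB0 : 0 ≤ B := (norm_nonneg _).trans (hB 0 (by simp; positivity))
  have hΨ : ContDiff ℝ 1 (dz Φ) := contDiff_dz hΦ (by norm_num)
  have hW : ∀ z, HasW (fun z => (chi r z : ℂ) * dz Φ z) _ _ z := fun z =>
    (chi_hasW r z).mul (DifferentiableAt.hasW (hΨ.differentiable one_ne_zero z))
  have hcd : ContDiff ℝ 1 (fun z => (chi r z : ℂ) * dz Φ z) :=
    (contDiff_ofReal' (chi_contDiff r (by exact_mod_cast le_top))).mul hΨ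
  have hcs : HasCompactSupport (fun z => (chi r z : ℂ) * dz Φ z) := (hcsC (chi_hcs hr)).mul_right
  have h := cp hcd hcs 0
  have e1 : (chi r 0 : ℂ) * dz Φ 0 = dz Φ 0 := by
    rw [chi_one hr (by simp; positivity)]; simp
  rw [e1] at h
  let κ : ℂ → ℝ := fun ζ => th1 (‖ζ‖^2 / r^2) / r^2
  have hκ : ContDiff ℝ 1 κ :=
    ((th1_contDiff two_le_top).comp (contDiff_normsq.div_const _)).div_const _
  have hκz : ∀ ζ, 3 * r / 2 ≤ ‖ζ‖ → κ ζ = 0 := by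
    intro ζ hζ
    simp only [κ]
    rw [th1_zero]; simp
    right; rw [lt_div_iff₀ (by positivity)]; nlinarith
  have hκc : HasCompactSupport κ := by
    apply HasCompactSupport.intro (isCompact_closedBall 0 (3 * r / 2))
    intro z hz
    simp at hz
    exact hκz z hz.le
  have hκW : ∀ z, HasW (fun z => (κ z : ℂ)) ((th2 (‖z‖^2 / r^2) / r^4 : ℝ) * conj z)
      ((th2 (‖z‖^2 / r^2) / r^4 : ℝ) * z) z := by
    intro z
    apply HasW.radial (g := fun s => th1 (s / r^2) / r^2)
    have := ((th1_hasDeriv (‖z‖^2 / r^2)).comp (‖z‖^2) ((hasDerivAt_id (‖z‖^2)).div_const (r^2))).div_const (r^2)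
    convert! this using 1
    field_simp
  have ib := ibp_dz (hΦ.of_le one_le_two) (contDiff_ofReal' hκ) (hcsC hκc)
  have cΨ : Continuous (dzb (dz Φ)) := (contDiff_dzb hΨ (m := 0) (by simp)).continuous
  have hcs2 : HasCompactSupport (fun z => (chi r z : ℂ) * dzb (dz Φ) z) := (hcsC (chi_hcs hr)).mul_right
  have cont2 : Continuous (fun z => (chi r z : ℂ) * dzb (dz Φ) z) :=
    (Complex.continuous_ofReal.comp (chi_contDiff r (n := 0) (by simp)).continuous).mul cΨ
  have i1 : Integrable (fun z => (chi r z : ℂ) * dzb (dz Φ) z / z) := by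
    simpa using integrable_div cont2 hcs2 0
  have i2 : Integrable (fun z => dz Φ z * (κ z : ℂ)) :=
    (hΨ.continuous.mul (Complex.continuous_ofReal.comp hκ.continuous)).integrable_of_hasCompactSupport
      ((hcsC hκc).mul_left)
  have e2 : (fun ζ => dzb (fun z => (chi r z : ℂ) * dz Φ z) ζ / (ζ - 0)) =
      fun z => (chi r z : ℂ) * dzb (dz Φ) z / z + dz Φ z * (κ z : ℂ) := by
    funext ζ
    rw [(hW ζ).dzb, sub_zero]
    rcases eq_or_ne ζ 0 with rfl | hζ
    · have : κ 0 = 0 := by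
        simp only [κ]; rw [th1_zero]; simp; left; simp
      simp [this]
    · simp only [κ]; field_simp; ring
  rw [e2, integral_add i1 i2] at h
  have ib2 : ∫ z, dz Φ z * (κ z : ℂ) = - ∫ z, Φ z * dz (fun z => (κ z : ℂ)) z := by rw [ib]; simp
  rw [ib2] at h
  have n1 : ‖∫ z, (chi r z : ℂ) * dzb (dz Φ) z / z‖ ≤ A * (2 * π * (2 * r)) := by
    rw [← integral_inv0 (by positivity), ← integral_const_mul, ← integral_indicator measurableSet_ball]
    apply norm_integral_le_of_norm_le
    · rw [integrable_indicator_iff measurableSet_ball]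
      exact (integrableOn_inv0 _).const_mul A
    · apply ae_of_all; intro ζ
      by_cases hζ : ζ ∈ ball (0:ℂ) (2 * r)
      · rw [Set.indicator_of_mem hζ]
        rw [norm_div, norm_mul, Complex.norm_real, Real.norm_of_nonneg (chi_nonneg _ _), div_eq_mul_inv]
        gcongr
        by_cases h3 : ‖ζ‖ ≤ 3 * r / 2
        · exact (mul_le_of_le_one_left (norm_nonneg _) (chi_le_one _ _)).trans (hA ζ h3)
        · rw [chi_zero hr (not_le.mp h3).le]; simpa using hA0
      · rw [Set.indicator_of_notMem hζ]
        simp at hζ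
        rw [chi_zero hr (by linarith)]; simp
  have n2 : ‖∫ z, Φ z * dz (fun z => (κ z : ℂ)) z‖ ≤ π * (3 * r / 2)^2 * (B * (C0 / r^4 * (3 * r / 2))) := by
    rw [← vol_cb (by positivity) 0, ← smul_eq_mul, ← setIntegral_const, ← integral_indicator measurableSet_closedBall]
    apply norm_integral_le_of_norm_le
    · rw [integrable_indicator_iff measurableSet_closedBall]
      exact integrableOn_const measure_closedBall_lt_top.ne
    · apply ae_of_all; intro ζ
      rw [(hκW ζ).dz]
      by_cases hζ : ζ ∈ closedBall (0:ℂ) (3 * r / 2)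
      · rw [Set.indicator_of_mem hζ]
        simp at hζ
        rw [norm_mul, norm_mul, Complex.norm_real, Real.norm_eq_abs, abs_div, abs_of_pos (by positivity : 0 < r^4), RCLike.norm_conj]
        gcongr
        · exact hB ζ hζ
        · exact (hC _).2
      · rw [Set.indicator_of_notMem hζ]
        simp at hζ
        rw [th2_zero]; simp
        right; rw [lt_div_iff₀ (by positivity)]; nlinarith
  have h4 : π * ‖dz Φ 0‖ ≤ A * (2 * π * (2 * r)) + π * (3 * r / 2)^2 * (B * (C0 / r^4 * (3 * r / 2))) := by
    have : π * ‖dz Φ 0‖ = ‖- (π * dz Φ 0)‖ := by simp [abs_of_pos pi_pos]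
    rw [this, ← h]
    refine (norm_add_le _ _).trans ?_
    rw [norm_neg]
    exact add_le_add n1 n2
  have e5 : A * (2 * π * (2 * r)) + π * (3 * r / 2)^2 * (B * (C0 / r^4 * (3 * r / 2))) =
     π * (4 * (r * A) + 27 / 8 * C0 * (B / r)) := by field_simp; ring
  rw [e5] at h4
  have h6 := le_of_mul_le_mul_left h4 pi_pos
  have p1 : 0 ≤ r * A := by positivity
  have p2 : 0 ≤ B / r := by positivity
  have p3 : 0 ≤ C0 * (r * A) := by positivity
  have p4 : 0 ≤ C0 * (B / r) := by positivity
  nlinarith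

lemma grad_est : ∃ C > 0, ∀ (Φ : ℂ → ℂ), ContDiff ℝ 2 Φ → ∀ (z : ℂ) (r A B : ℝ), 0 < r →
    (∀ ζ, ‖ζ - z‖ ≤ 3 * r / 2 → ‖dzb (dz Φ) ζ‖ ≤ A) → (∀ ζ, ‖ζ - z‖ ≤ 3 * r / 2 → ‖Φ ζ‖ ≤ B) →
    ‖dz Φ z‖ ≤ C * (r * A + B / r) := by
  obtain ⟨C, hC, h⟩ := grad_est0
  refine ⟨C, hC, ?_⟩
  intro Φ hΦ z r A B hr hA hB
  have := h (fun y => Φ (y + z)) (contDiff_shift hΦ z) r A B hr ?_ ?_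
  · rw [dz_comp_add, zero_add] at this; exact this
  · intro ζ hζ
    have e : dz (fun y => Φ (y + z)) = fun y => dz Φ (y + z) := by
      funext y; rw [dz_comp_add]
    rw [e, dzb_comp_add]
    apply hA; simpa using hζ
  · intro ζ hζ
    apply hB; simpa using hζ

end LE

namespace LE
open ComplexConjugate

lemma cut_contDiff {F : Type*} [NormedAddCommGroup F] [NormedSpace ℝ F] {χ : ℂ → ℝ} {f : ℂ → F} {O : Set ℂ} {n : WithTop ℕ∞}
    (hO : IsOpen O) (hχ : ContDiff ℝ n χ) (hf : ContDiffOn ℝ n f O) (hs : tsupport χ ⊆ O) :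
    ContDiff ℝ n (fun z => χ z • f z) := by
  rw [contDiff_iff_contDiffAt]
  intro z
  by_cases hz : z ∈ tsupport χ
  · exact hχ.contDiffAt.smul (hf.contDiffAt (hO.mem_nhds (hs hz)))
  · have : (fun z => χ z • f z) =ᶠ[𝓝 z] fun _ => 0 := by
      have := (isClosed_tsupport χ).isOpen_compl.mem_nhds hz
      filter_upwards [this] with y hy
      rw [image_eq_zero_of_notMem_tsupport hy, zero_smul]
    exact contDiffAt_const.congr_of_eventuallyEq this

lemma newton {h : ℂ → ℂ} (hh : ContDiff ℝ 2 h) (hc : HasCompactSupport h) :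
    ∃ N : ℂ → ℂ, ContDiff ℝ 2 N ∧ ∀ w, dzb N w = π * h w := by
  have li : LocallyIntegrable (fun t : ℂ => t⁻¹) := by
    simpa using locInt_inv 0
  have h1 : ContDiff ℝ 1 h := hh.of_le (by norm_num)
  refine ⟨convolution (fun t : ℂ => t⁻¹) h (ContinuousLinearMap.mul ℝ ℂ) volume,
    hc.contDiff_convolution_right _ li hh, ?_⟩
  intro w
  have e : ∀ k : ℂ, fderiv ℝ (convolution (fun t : ℂ => t⁻¹) h (ContinuousLinearMap.mul ℝ ℂ) volume) w k
      = ∫ t : ℂ, t⁻¹ * fderiv ℝ h (w - t) k := by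
    intro k
    rw [(hc.hasFDerivAt_convolution_right (ContinuousLinearMap.mul ℝ ℂ) li h1 w).fderiv]
    rw [convolution_precompR_apply _ li (hc.fderiv ℝ) (h1.continuous_fderiv one_ne_zero)]
    rfl
  have ii : ∀ k : ℂ, Integrable (fun t : ℂ => t⁻¹ * fderiv ℝ h (w - t) k) := by
    intro k
    have hcont : Continuous (fun a => fderiv ℝ h a k) := (h1.continuous_fderiv one_ne_zero).clm_apply continuous_const
    have hcc : HasCompactSupport (fun a => fderiv ℝ h a k) := by
      have := (hc.fderiv ℝ)
      exact this.comp_left (g := fun T : ℂ →L[ℝ] ℂ => T k) (by simp)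
    exact hcc.convolutionExists_right (ContinuousLinearMap.mul ℝ ℂ) li hcont w
  unfold dzb
  rw [e, e, ← integral_const_mul, ← integral_add (ii 1) ((ii Complex.I).const_mul _), ← integral_div]
  have e2 := integral_sub_left_eq_self (fun t : ℂ => (t⁻¹ * fderiv ℝ h (w - t) 1 + Complex.I * (t⁻¹ * fderiv ℝ h (w - t) Complex.I))/2) volume w
  rw [← e2]
  have e3 := cp h1 hc w
  have : ∀ t : ℂ, ((w-t)⁻¹ * fderiv ℝ h (w - (w-t)) 1 + Complex.I * ((w-t)⁻¹ * fderiv ℝ h (w - (w-t)) Complex.I))/2 = - (dzb h t / (t - w)) := by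
    intro t
    rw [sub_sub_cancel]; unfold dzb
    rw [← neg_sub t w, inv_neg]; ring
  rw [integral_congr_ae (Filter.Eventually.of_forall this), integral_neg, e3]; ring

lemma dzb_eq_zero_hasDerivAt {M : ℂ → ℂ} {z : ℂ} (h : DifferentiableAt ℝ M z) (h0 : dzb M z = 0) :
    DifferentiableAt ℂ M z := by
  have h1 := DifferentiableAt.hasW h
  rw [h0] at h1
  have : HasFDerivAt M (ContinuousLinearMap.toSpanSingleton ℂ (dz M z)) z := by
    unfold HasW at h1
    rw [hasFDerivAt_iff_isLittleO] at h1 ⊢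
    refine h1.congr_left ?_
    intro y; simp [wirt_apply]; ring
  exact this.differentiableAt

lemma reg {O : Set ℂ} (hO : IsOpen O) {v f : ℂ → ℝ} (hv : ContDiffOn ℝ 2 v O) (hf : ContDiffOn ℝ 2 f O)
    (he : ∀ z ∈ O, lapC v z = - f z) : ContDiffOn ℝ 3 v O := by
  have hvd : ∀ z ∈ O, DifferentiableAt ℝ v z := fun z hz =>
    (hv.contDiffAt (hO.mem_nhds hz)).differentiableAt two_ne_zero
  have key : ContDiffOn ℝ 2 (gz v) O := by
    intro z0 hz0
    apply ContDiffAt.contDiffWithinAt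
    obtain ⟨r, hr, hrO⟩ : ∃ r > 0, closedBall z0 (2*r) ⊆ O := by
      obtain ⟨r, hr, h⟩ := Metric.nhds_basis_closedBall.mem_iff.1 (hO.mem_nhds hz0)
      exact ⟨r/2, by linarith, by rwa [mul_div_cancel₀ _ two_ne_zero]⟩
    set χ : ℂ → ℝ := fun z => chi r (z - z0) with hχ
    have hχ2 : ContDiff ℝ 2 χ := (chi_contDiff r (n := 2) (by simpa [one_add_one_eq_two] using two_le_top)).comp (contDiff_id.sub contDiff_const)
    have hs : tsupport χ ⊆ closedBall z0 (2*r) := by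
      apply closure_minimal _ isClosed_closedBall
      intro z hz
      by_contra hn
      apply hz
      apply chi_zero hr
      rw [mem_closedBall, dist_eq_norm] at hn
      push Not at hn
      linarith
    have hχc : HasCompactSupport χ := (isCompact_closedBall z0 (2*r)).of_isClosed_subset (isClosed_tsupport _) hs
    have hh : ContDiff ℝ 2 (fun z => χ z • f z) := cut_contDiff hO hχ2 hf (hs.trans hrO)
    have hhc : HasCompactSupport (fun z => χ z • f z) := hχc.smul_right
    obtain ⟨N, hN, hN2⟩ := newton (h := fun z => ((χ z • f z : ℝ):ℂ)) (contDiff_ofReal' hh) (hcsC hhc)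
    set M : ℂ → ℂ := fun z => gz v z + N z * (1/(4*π)) with hM
    have hMd : DifferentiableOn ℂ M (ball z0 r) := by
      intro z hz
      apply DifferentiableAt.differentiableWithinAt
      have hzO : z ∈ O := hrO (by rw [mem_closedBall]; rw [mem_ball] at hz; linarith)
      obtain ⟨q1, q2⟩ := dzb_gz (hv.contDiffAt (hO.mem_nhds hzO))
      have w1 := (DifferentiableAt.hasW q2).add ((DifferentiableAt.hasW (hN.differentiable two_ne_zero z)).mul (HasW.const (1/(4*π)) z))
      apply dzb_eq_zero_hasDerivAt w1.differentiableAt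
      rw [w1.dzb, q1, hN2, he z hzO]
      have : χ z = 1 := chi_one hr (by rw [mem_ball, dist_eq_norm] at hz; exact hz.le)
      simp only [this]
      have : (π:ℂ) ≠ 0 := by exact_mod_cast Real.pi_ne_zero
      push_cast
      field_simp
      simp
    have hMc : ContDiffAt ℝ 2 M z0 :=
      ((hMd.contDiffOn isOpen_ball).contDiffAt (isOpen_ball.mem_nhds (mem_ball_self hr)) : ContDiffAt ℂ 2 M z0).restrict_scalars ℝ
    have : gz v = fun z => M z - N z * (1/(4*π)) := by
      ext z; simp [hM]
    rw [this]
    exact hMc.sub (hN.contDiffAt.mul contDiffAt_const)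
  have e3 : (3 : WithTop ℕ∞) = 2 + 1 := by norm_num
  rw [e3, contDiffOn_succ_iff_fderiv_of_isOpen hO]
  refine ⟨fun z hz => (hvd z hz).differentiableWithinAt, by simp, ?_⟩
  have : ∀ z ∈ O, fderiv ℝ v z = (2:ℝ) • Complex.reCLM.comp (ContinuousLinearMap.mul ℝ ℂ (gz v z)) := by
    intro z hz
    ext k
    rw [fderiv_real_eq (hvd z hz)]; simp
  refine ContDiffOn.congr ?_ this
  apply ContDiffOn.const_smul
  apply ContDiffOn.clm_comp contDiffOn_const
  exact (ContinuousLinearMap.mul ℝ ℂ).contDiff.comp_contDiffOn key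

lemma dzb_dz_comm {Φ : ℂ → ℂ} {z : ℂ} (h : ContDiffAt ℝ 2 Φ z) : dzb (dz Φ) z = dz (dzb Φ) z ∧
    DifferentiableAt ℝ (dz Φ) z ∧ DifferentiableAt ℝ (dzb Φ) z := by
  have hsym := h.isSymmSndFDerivAt (by simp)
  have h1 : ContDiffAt ℝ 1 (fderiv ℝ Φ) z := h.fderiv_right (by norm_num)
  have h2 : DifferentiableAt ℝ (fderiv ℝ Φ) z := h1.differentiableAt one_ne_zero
  have d1 : ∀ k : ℂ, HasFDerivAt (fun y => fderiv ℝ Φ y k) ((fderiv ℝ (fderiv ℝ Φ) z).flip k) z := by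
    intro k
    have := h2.hasFDerivAt.clm_apply (hasFDerivAt_const k z)
    convert! this using 1
    ext; simp
  have d3 := ((d1 1).sub ((d1 Complex.I).const_mul Complex.I)).mul_const ((2:ℂ)⁻¹)
  have d4 : HasFDerivAt (dz Φ) _ z := d3.congr_of_eventuallyEq (by
    filter_upwards with y; simp [dz, div_eq_mul_inv])
  have d3' := ((d1 1).add ((d1 Complex.I).const_mul Complex.I)).mul_const ((2:ℂ)⁻¹)
  have d4' : HasFDerivAt (dzb Φ) _ z := d3'.congr_of_eventuallyEq (by
    filter_upwards with y; simp [dzb, div_eq_mul_inv])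
  refine ⟨?_, d4.differentiableAt, d4'.differentiableAt⟩
  have hs := hsym 1 Complex.I
  rw [dzb, dz, d4.fderiv, d4'.fderiv]
  simp [hs]
  ring
end LE

namespace LE
open ComplexConjugate

/-- nonlinearity -/
def FF (p : ℝ) (v : ℂ → ℝ) (z : ℂ) : ℝ := (1 + v z / p) ^ p
def FF1 (p : ℝ) (v : ℂ → ℝ) (z : ℂ) : ℝ := (1 + v z / p) ^ (p - 1)
def SS (v : ℂ → ℝ) : ℂ → ℂ := dz (gz v)
def QQ (v : ℂ → ℝ) (z : ℂ) : ℂ := SS v z - gz v z ^ 2 / 2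

/-- rescaled local solution -/
structure Loc (C0 p R : ℝ) (v : ℂ → ℝ) : Prop where
  cd : ContDiff ℝ 3 v
  hp : 14 ≤ p
  hR : 64 ≤ R
  hC : 0 < C0
  neg : ∀ z, ‖z‖ ≤ R → -p < v z ∧ v z ≤ 0
  eq : ∀ z, ‖z‖ < R → lapC v z = -FF p v z
  v0 : v 0 = 0
  g0 : gz v 0 = 0
  mass : ∫ z in closedBall 0 R, FF p v z ≤ C0
  ann1 : ∀ z, R / 3 ≤ ‖z‖ → ‖z‖ ≤ R → v z + p ≤ C0
  ann2 : ∀ z, R / 3 ≤ ‖z‖ → ‖z‖ ≤ R → R ^ 2 * FF p v z ≤ C0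

lemma FF_cont {p : ℝ} (hp : 0 < p) {v : ℂ → ℝ} (hv : Continuous v) : Continuous (FF p v) :=
  (continuous_const.add (hv.div_const p)).rpow_const fun _ => Or.inr hp.le

variable {C0 p R : ℝ} {v : ℂ → ℝ}

namespace Loc

lemma ppos (h : Loc C0 p R v) : 0 < p := by linarith [h.hp]
lemma Rpos (h : Loc C0 p R v) : 0 < R := by linarith [h.hR]
lemma contF (h : Loc C0 p R v) : Continuous (FF p v) := FF_cont h.ppos h.cd.continuous
lemma base (h : Loc C0 p R v) {z : ℂ} (hz : ‖z‖ ≤ R) : 0 < 1 + v z / p := by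
  have := (h.neg z hz).1
  have hp := h.ppos
  have : -1 < v z / p := by rw [lt_div_iff₀ hp]; linarith
  linarith
lemma base1 (h : Loc C0 p R v) {z : ℂ} (hz : ‖z‖ ≤ R) : 1 + v z / p ≤ 1 := by
  have := div_nonpos_of_nonpos_of_nonneg (h.neg z hz).2 h.ppos.le
  linarith
lemma Fpos (h : Loc C0 p R v) {z : ℂ} (hz : ‖z‖ ≤ R) : 0 < FF p v z := Real.rpow_pos_of_pos (h.base hz) _
lemma F1pos (h : Loc C0 p R v) {z : ℂ} (hz : ‖z‖ ≤ R) : 0 < FF1 p v z := Real.rpow_pos_of_pos (h.base hz) _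
lemma F_le_exp (h : Loc C0 p R v) {z : ℂ} (hz : ‖z‖ ≤ R) : FF p v z ≤ Real.exp (v z) := by
  have h1 : 1 + v z / p ≤ Real.exp (v z / p) := by linarith [Real.add_one_le_exp (v z / p)]
  calc FF p v z ≤ (Real.exp (v z / p)) ^ p := Real.rpow_le_rpow (h.base hz).le h1 h.ppos.le
    _ = _ := by rw [← Real.exp_mul, div_mul_cancel₀ _ h.ppos.ne']
lemma F1_le_exp (h : Loc C0 p R v) {z : ℂ} (hz : ‖z‖ ≤ R) : FF1 p v z ≤ Real.exp (13/14 * v z) := by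
  have h1 : 1 + v z / p ≤ Real.exp (v z / p) := by linarith [Real.add_one_le_exp (v z / p)]
  have hp := h.ppos
  have := h.hp
  calc FF1 p v z ≤ (Real.exp (v z / p)) ^ (p-1) := Real.rpow_le_rpow (h.base hz).le h1 (by linarith)
    _ = Real.exp (v z / p * (p-1)) := by rw [← Real.exp_mul]
    _ ≤ _ := by
      apply Real.exp_le_exp.2
      have h2 := (h.neg z hz).2
      have : v z / p * (p-1) = v z * ((p-1)/p) := by field_simp
      rw [this]
      have : 13/14 ≤ (p-1)/p := by rw [div_le_div_iff₀ (by norm_num) hp]; linarith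
      nlinarith
lemma F_le_one (h : Loc C0 p R v) {z : ℂ} (hz : ‖z‖ ≤ R) : FF p v z ≤ 1 :=
  (h.F_le_exp hz).trans (by simpa using (h.neg z hz).2)
lemma F1_le_one (h : Loc C0 p R v) {z : ℂ} (hz : ‖z‖ ≤ R) : FF1 p v z ≤ 1 :=
  (h.F1_le_exp hz).trans (by have := (h.neg z hz).2; simp; linarith)
/-- `t F1 ≤ 14 e^{-6t/7}` -/
lemma tF1 (h : Loc C0 p R v) {z : ℂ} (hz : ‖z‖ ≤ R) : (-v z) * FF1 p v z ≤ 14 * Real.exp (6/7 * v z) := by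
  have h1 := h.F1_le_exp hz
  have h2 := (h.neg z hz).2
  have h3 : -v z / 14 ≤ Real.exp (-v z / 14) := by linarith [Real.add_one_le_exp (-v z / 14)]
  calc (-v z) * FF1 p v z ≤ (-v z) * Real.exp (13/14 * v z) := by gcongr; linarith
    _ ≤ (14 * Real.exp (-v z / 14)) * Real.exp (13/14 * v z) := by gcongr; linarith
    _ = _ := by rw [mul_assoc, ← Real.exp_add]; ring_nf
lemma F1_sub (h : Loc C0 p R v) {z : ℂ} (hz : ‖z‖ ≤ R) : FF1 p v z - FF p v z = (-v z) * FF1 p v z / p := by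
  have : FF p v z = FF1 p v z * (1 + v z / p) := by
    unfold FF FF1
    rw [← Real.rpow_add_one (h.base hz).ne']; ring_nf
  rw [this]; ring

lemma cG (h : Loc C0 p R v) : ContDiff ℝ 2 (gz v) := contDiff_gz h.cd (by norm_num)
lemma cS (h : Loc C0 p R v) : ContDiff ℝ 1 (SS v) := contDiff_dz h.cG (by norm_num)
lemma cQ (h : Loc C0 p R v) : ContDiff ℝ 1 (QQ v) :=
  h.cS.sub (((h.cG.of_le (by norm_num)).pow 2).div_const 2)

lemma dzbG (h : Loc C0 p R v) {z : ℂ} (hz : ‖z‖ < R) : dzb (gz v) z = -((FF p v z : ℝ):ℂ) / 4 := by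
  rw [(dzb_gz (h.cd.contDiffAt.of_le (by norm_num))).1, h.eq z hz]; simp

lemma hasWG (h : Loc C0 p R v) {z : ℂ} (hz : ‖z‖ < R) : HasW (gz v) (SS v z) (-((FF p v z : ℝ):ℂ) / 4) z := by
  rw [← h.dzbG hz]
  exact DifferentiableAt.hasW (h.cG.differentiable two_ne_zero z)

lemma hasWv (h : Loc C0 p R v) (z : ℂ) : HasW (fun z => (v z : ℂ)) (gz v z) (conj (gz v z)) z :=
  hasW_gz (h.cd.differentiable (by norm_num) z)

lemma hasWF (h : Loc C0 p R v) {z : ℂ} (hz : ‖z‖ < R) :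
    HasW (fun z => ((FF p v z : ℝ):ℂ)) (FF1 p v z * gz v z) (FF1 p v z * conj (gz v z)) z := by
  have d : HasFDerivAt v (fderiv ℝ v z) z := (h.cd.differentiable (by norm_num) z).hasFDerivAt
  have hb := h.base hz.le
  have d1 : HasFDerivAt (FF p v) (FF1 p v z • fderiv ℝ v z) z := by
    have d0 : HasDerivAt (fun t : ℝ => (1 + t / p)^p) (FF1 p v z) (v z) := by
      have d2 : HasDerivAt (fun t : ℝ => 1 + t / p) (1/p) (v z) :=
        ((hasDerivAt_id (v z)).div_const p).const_add 1
      have := d2.rpow_const (p := p) (Or.inl hb.ne')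
      convert! this using 1
      have := h.ppos.ne'
      unfold FF1; field_simp
    exact d0.comp_hasFDerivAt z d
  have d2 := hasW_ofReal d1.differentiableAt
  have e : dz (fun z => ((FF p v z : ℝ):ℂ)) z = FF1 p v z * gz v z := by
    have := fderiv_ofReal' d1.differentiableAt
    unfold dz; rw [this, d1.fderiv, gz_eq d.differentiableAt]; simp; ring
  rw [e] at d2
  convert! d2 using 1
  simp

lemma dzbS (h : Loc C0 p R v) {z : ℂ} (hz : ‖z‖ < R) : dzb (SS v) z = -(FF1 p v z * gz v z) / 4 := by
  unfold SS
  rw [(dzb_dz_comm h.cG.contDiffAt).1]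
  have e : dzb (gz v) =ᶠ[𝓝 z] fun z => -(1/4) * ((FF p v z : ℝ):ℂ) := by
    have : ∀ᶠ y in 𝓝 z, ‖y‖ < R := (continuous_norm.tendsto z).eventually (eventually_lt_nhds hz)
    filter_upwards [this] with y hy
    rw [h.dzbG hy]; ring
  have := ((HasW.const (-(1/4)) z).mul (h.hasWF hz)).congr_of_eventuallyEq e
  rw [this.dz]; ring

lemma hasWS (h : Loc C0 p R v) {z : ℂ} (hz : ‖z‖ < R) : HasW (SS v) (dz (SS v) z) (-(FF1 p v z * gz v z) / 4) z := by
  rw [← h.dzbS hz]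
  exact DifferentiableAt.hasW (h.cS.differentiable one_ne_zero z)

lemma dzbQ (h : Loc C0 p R v) {z : ℂ} (hz : ‖z‖ < R) :
    dzb (QQ v) z = -(gz v z / 4) * (((-v z) * FF1 p v z / p : ℝ) : ℂ) := by
  have w := (h.hasWS hz).sub (((h.hasWG hz).mul (h.hasWG hz)).mul (HasW.const (1/2) z))
  have e : QQ v = fun z => SS v z - gz v z * gz v z * (1/2) := by
    funext y; unfold QQ; ring
  rw [e, w.dzb, ← h.F1_sub hz.le]; push_cast; ring

lemma norm_dzbQ (h : Loc C0 p R v) {z : ℂ} (hz : ‖z‖ < R) :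
    ‖dzb (QQ v) z‖ ≤ 4 * ‖gz v z‖ * Real.exp (6/7 * v z) / p := by
  rw [h.dzbQ hz, norm_mul, norm_neg, norm_div, Complex.norm_real]
  have h1 := h.tF1 hz.le
  have h0 : 0 ≤ (-v z) * FF1 p v z := mul_nonneg (by linarith [(h.neg z hz.le).2]) (h.F1pos hz.le).le
  have hp := h.ppos
  rw [Real.norm_of_nonneg (by positivity)]
  simp only [Complex.norm_ofNat]
  calc ‖gz v z‖ / 4 * ((-v z) * FF1 p v z / p) ≤ ‖gz v z‖ / 4 * (14 * Real.exp (6/7 * v z) / p) := by gcongr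
    _ = 14 / 4 * ‖gz v z‖ * Real.exp (6/7 * v z) / p := by ring
    _ ≤ _ := by gcongr; norm_num

lemma norm_dzbS (h : Loc C0 p R v) {z : ℂ} (hz : ‖z‖ < R) : ‖dzb (SS v) z‖ ≤ FF1 p v z * ‖gz v z‖ := by
  rw [h.dzbS hz, norm_div, norm_neg, norm_mul, Complex.norm_real, Real.norm_of_nonneg (h.F1pos hz.le).le]
  simp only [Complex.norm_ofNat]
  have := mul_nonneg (h.F1pos hz.le).le (norm_nonneg (gz v z))
  linarith

/-- `|F - e^v| ≤ C/p`-/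
lemma F_sub_exp (h : Loc C0 p R v) {z : ℂ} (hz : ‖z‖ ≤ R) : |FF p v z - Real.exp (v z)| ≤ 200 / p := by
  have h1 := h.F_le_exp hz
  have hp := h.ppos
  have h2 := (h.neg z hz).2
  rw [abs_sub_comm, abs_of_nonneg (by linarith)]
  -- F ≥ e^v (1 - v²/p) 
  have h3 : Real.exp (v z) * (1 - (2*(v z)^2) / p) ≤ FF p v z := by
    rcases le_or_gt (p/2) (-v z) with h4 | h4
    · have : 1 - (2*(v z)^2)/p ≤ 0 := by
        rw [sub_nonpos, le_div_iff₀ hp]; nlinarith [h.hp]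
      have := mul_nonpos_of_nonneg_of_nonpos (Real.exp_pos (v z)).le this
      linarith [h.Fpos hz]
    · have hb := h.base hz
      have e : FF p v z = Real.exp (p * Real.log (1 + v z / p)) := by
        unfold FF; rw [Real.rpow_def_of_pos hb]; ring_nf
      -- log(1+x) ≥ x - x² for x ≥ -1/2
      have hx : -(1/2) < v z / p := by rw [lt_div_iff₀ hp]; linarith
      have l : v z / p - 2*(v z / p)^2 ≤ Real.log (1 + v z / p) := by
        have hl := Real.one_sub_inv_le_log_of_pos hb
        set x := v z / p
        refine le_trans ?_ hl
        have hx0 : x ≤ 0 := div_nonpos_of_nonpos_of_nonneg h2 hp.le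
        rw [le_sub_iff_add_le]
        rw [← le_sub_iff_add_le', inv_le_iff_one_le_mul₀ hb]
        nlinarith [mul_nonneg (sq_nonneg x) (by linarith : 0 ≤ 1 + 2*x), sq_nonneg x]
      have e2 : v z - (2*(v z)^2)/p ≤ p * Real.log (1 + v z / p) := by
        calc v z - (2*(v z)^2)/p = p * (v z / p - 2*(v z / p)^2) := by field_simp
          _ ≤ _ := by gcongr
      rw [e]
      calc Real.exp (v z) * (1 - (2*(v z)^2) / p) ≤ Real.exp (v z) * Real.exp (-((2*(v z)^2)/p)) := by
            gcongr; linarith [Real.add_one_le_exp (-((2*(v z)^2)/p))]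
        _ = Real.exp (v z - (2*(v z)^2)/p) := by rw [← Real.exp_add]; ring_nf
        _ ≤ _ := Real.exp_le_exp.2 e2
  have h5 : Real.exp (v z) * (2*(v z)^2) ≤ 200 := by
    have := Real.quadratic_le_exp_of_nonneg (x := -v z) (by linarith)
    have e : Real.exp (v z) * Real.exp (-v z) = 1 := by rw [← Real.exp_add]; simp
    have := mul_le_mul_of_nonneg_left this (Real.exp_pos (v z)).le
    rw [e] at this
    nlinarith [Real.exp_pos (v z), mul_nonneg (Real.exp_pos (v z)).le (by linarith : 0 ≤ -v z)]
  have : Real.exp (v z) * (2*(v z)^2) / p ≤ 200 / p := by gcongr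
  have e : Real.exp (v z) * (1 - (2*(v z)^2) / p) = Real.exp (v z) - Real.exp (v z) * (2*(v z)^2) / p := by ring
  linarith
end Loc
end LE

namespace LE
open ComplexConjugate

lemma dz_add_const (v : ℂ → ℝ) (hv : Differentiable ℝ v) (c : ℝ) : dz (fun z => ((v z + c : ℝ):ℂ)) = gz v := by
  funext z
  have := (hasW_gz (hv z)).add (HasW.const (c:ℂ) z)
  have e : (fun z => ((v z + c : ℝ):ℂ)) = fun z => (v z : ℂ) + (c:ℂ) := by funext; push_cast; rfl
  rw [e, this.dz]; simp

lemma G_ann (C0 : ℝ) : ∃ C > 0, ∀ p R v, Loc C0 p R v → ∀ z, R/2 ≤ ‖z‖ → ‖z‖ ≤ 3*R/4 → ‖gz v z‖ ≤ C / R := by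
  by_cases hC0 : 0 < C0
  swap
  · exact ⟨1, one_pos, fun p R v h => absurd h.hC hC0⟩
  obtain ⟨C, hC, hg⟩ := grad_est
  refine ⟨C * (C0 + 9 * C0), by positivity, ?_⟩
  intro p R v h z h1 h2
  have hR := h.Rpos
  have hd : Differentiable ℝ v := h.cd.differentiable (by norm_num)
  have := hg (fun z => ((v z + p : ℝ):ℂ)) (contDiff_ofReal' ((h.cd.of_le (by norm_num)).add contDiff_const)) z (R/9) (C0/R^2) C0 (by positivity) ?_ ?_
  · rw [dz_add_const v hd p] at this
    refine this.trans ?_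
    rw [mul_div_assoc]
    gcongr
    have : R / 9 * (C0/R^2) + C0/(R/9) = (C0/9 + 9 * C0)/R := by field_simp
    rw [this]
    gcongr
    linarith
  · intro ζ hζ
    rw [dz_add_const v hd p]
    have a1 : R/3 ≤ ‖ζ‖ := by
      have : ‖z‖ ≤ ‖ζ‖ + ‖ζ - z‖ := by
        calc ‖z‖ = ‖ζ - (ζ - z)‖ := by simp
          _ ≤ _ := norm_sub_le _ _
      linarith
    have a2 : ‖ζ‖ < R := by
      have : ‖ζ‖ ≤ ‖ζ - z‖ + ‖z‖ := by
        calc ‖ζ‖ = ‖(ζ - z) + z‖ := by simp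
          _ ≤ _ := norm_add_le _ _
      linarith
    rw [h.dzbG a2, norm_div, norm_neg, Complex.norm_real, Real.norm_of_nonneg (h.Fpos a2.le).le]
    simp only [Complex.norm_ofNat]
    have := h.ann2 ζ a1 a2.le
    have : FF p v ζ ≤ C0 / R^2 := by rw [le_div_iff₀ (by positivity)]; linarith
    linarith [h.Fpos a2.le]
  · intro ζ hζ
    have a1 : R/3 ≤ ‖ζ‖ := by
      have : ‖z‖ ≤ ‖ζ‖ + ‖ζ - z‖ := by
        calc ‖z‖ = ‖ζ - (ζ - z)‖ := by simp
          _ ≤ _ := norm_sub_le _ _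
      linarith
    have a2 : ‖ζ‖ < R := by
      have : ‖ζ‖ ≤ ‖ζ - z‖ + ‖z‖ := by
        calc ‖ζ‖ = ‖(ζ - z) + z‖ := by simp
          _ ≤ _ := norm_add_le _ _
      linarith
    rw [Complex.norm_real, Real.norm_of_nonneg (by linarith [(h.neg ζ a2.le).1])]
    exact h.ann1 ζ a1 a2.le

lemma Loc.mass_sub {C0 p R : ℝ} {v : ℂ → ℝ} (h : Loc C0 p R v) {A : Set ℂ} (hA : A ⊆ closedBall 0 R) :
    ∫ z in A, FF p v z ≤ ∫ z in closedBall 0 R, FF p v z := by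
  apply setIntegral_mono_set
  · exact h.contF.continuousOn.integrableOn_compact (isCompact_closedBall 0 R)
  · filter_upwards [ae_restrict_mem isClosed_closedBall.measurableSet] with z hz
    exact (h.Fpos (by simpa using hz)).le
  · exact hA.eventuallyLE

lemma G_rep (C0 : ℝ) : ∃ C > 0, ∀ p R v, Loc C0 p R v → ∀ z, ‖z‖ ≤ R/4 →
    ‖gz v z‖ ≤ (∫ ζ in closedBall 0 (3*R/4), FF p v ζ / ‖ζ - z‖) + C / R := by
  obtain ⟨C1, hC1, h1⟩ := G_ann C0
  obtain ⟨C2, hC2, h2⟩ := cp_est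
  refine ⟨C2 * C1, by positivity, ?_⟩
  intro p R v h z hz
  have hR := h.Rpos
  have := h2 (gz v) (h.cG.of_le (by norm_num)) (R/2) (C1/R) z (by positivity) (by linarith)
    (fun ζ a b => h1 p R v h ζ a (by linarith))
  have e : 3 * (R/2)/2 = 3*R/4 := by ring
  rw [e] at this
  refine this.trans ?_
  rw [mul_div_assoc C2]
  gcongr ?_ + _
  apply setIntegral_mono_on
  · exact integrableOn_div_norm ((contDiff_dzb (m := 0) h.cG (by norm_num)).continuous.norm) z (isCompact_closedBall _ _)
  · exact integrableOn_div_norm h.contF z (isCompact_closedBall _ _)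
  · exact isClosed_closedBall.measurableSet
  · intro ζ hζ
    have hζ' : ‖ζ‖ < R := by simp at hζ; linarith
    rw [h.dzbG hζ', norm_div, norm_neg, Complex.norm_real, Real.norm_of_nonneg (h.Fpos hζ'.le).le]
    gcongr
    simp only [Complex.norm_ofNat]
    linarith [h.Fpos hζ'.le]

lemma G_bdd (C0 : ℝ) : ∃ C > 0, ∀ p R v, Loc C0 p R v → ∀ z, ‖z‖ ≤ R/4 → ‖gz v z‖ ≤ C := by
  by_cases hC0 : 0 < C0
  swap
  · exact ⟨1, one_pos, fun p R v h => absurd h.hC hC0⟩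
  obtain ⟨C1, hC1, h1⟩ := G_rep C0
  refine ⟨2 * π + C0 + C1, by positivity, ?_⟩
  intro p R v h z hz
  have hR := h.Rpos
  have hsub : closedBall (0:ℂ) (3*R/4) ⊆ closedBall 0 R := closedBall_subset_closedBall (by linarith)
  have := near_est h.contF (isCompact_closedBall 0 (3*R/4)) (z := z) (ρ := 1) (S := 1) (m := C0) one_pos
    (fun ζ hζ => (h.Fpos (by simpa using hsub hζ)).le) zero_le_one
    (fun ζ hζ _ => (h.F_le_one (by simpa using hsub hζ))) ((h.mass_sub hsub).trans h.mass)
  have h3 := h1 p R v h z hz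
  have : C1 / R ≤ C1 := div_le_self hC1.le (by linarith [h.hR])
  linarith

/-- Laplacian of a cut-off function -/
lemma lap_cut : ∃ C > 0, ∀ (V : ℂ → ℝ), ContDiff ℝ 2 V → ∀ L > 0, ∀ z : ℂ, ‖z‖ ≤ 3 * L / 2 →
    |lapC (fun z => chi L z * V z) z| ≤ |lapC V z| + C * (|V z| / L^2 + ‖gz V z‖ / L) := by
  obtain ⟨C0, hC0, hC⟩ := th_bound
  refine ⟨100 * C0, by positivity, ?_⟩
  intro V hV L hL z hz
  set κ : ℂ → ℝ := fun ζ => th1 (‖ζ‖^2 / L^2) / L^2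
  have hκW : ∀ z, HasW (fun z => (κ z : ℂ)) ((th2 (‖z‖^2 / L^2) / L^4 : ℝ) * conj z)
      ((th2 (‖z‖^2 / L^2) / L^4 : ℝ) * z) z := by
    intro z
    apply HasW.radial (g := fun s => th1 (s / L^2) / L^2)
    have := ((th1_hasDeriv (‖z‖^2 / L^2)).comp (‖z‖^2) ((hasDerivAt_id (‖z‖^2)).div_const (L^2))).div_const (L^2)
    convert! this using 1
    field_simp
  have hVd := hV.differentiable two_ne_zero
  have e1 : gz (fun z => chi L z * V z) = fun z => (κ z : ℂ) * conj z * (V z : ℂ) + (chi L z : ℂ) * gz V z := by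
    funext y
    have := ((chi_hasW L y).mul (hasW_gz (hVd y))).dz
    unfold gz at *
    simp only [Complex.ofReal_mul]
    rw [this]
  have hφ : ContDiff ℝ 2 (fun z => chi L z * V z) :=
    (chi_contDiff L (by simpa [one_add_one_eq_two] using two_le_top)).mul hV
  have e2 := (dzb_gz (hφ.contDiffAt (x := z))).1
  have hGV := dzb_gz (hV.contDiffAt (x := z))
  have wG := DifferentiableAt.hasW hGV.2
  rw [hGV.1] at wG
  have w := ((((hκW z).mul (HasW.cnj z)).mul (hasW_gz (hVd z))).add ((chi_hasW L z).mul wG)).dzb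
  rw [e1, w] at e2
  have e3 : ((lapC (fun z => chi L z * V z) z : ℝ) : ℂ) = chi L z * lapC V z +
      4 * (((th2 (‖z‖^2/L^2)/L^4 : ℝ) * z * conj z + (κ z : ℂ)) * V z + (κ z:ℂ) * conj z * conj (gz V z)
        + (κ z : ℂ) * z * gz V z) := by
    have : ((lapC (fun z => chi L z * V z) z : ℝ) : ℂ) = 4 * (((lapC (fun z => chi L z * V z) z : ℝ) : ℂ)/4) := by ring
    rw [this, ← e2]; simp only [κ]; ring
  have hκ : |κ z| ≤ C0 / L^2 := by
    simp only [κ]; rw [abs_div, abs_of_pos (by positivity : 0 < L^2)]; gcongr; exact (hC _).1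
  have hκ2 : |th2 (‖z‖^2/L^2)/L^4| ≤ C0 / L^4 := by
    rw [abs_div, abs_of_pos (by positivity : 0 < L^4)]; gcongr; exact (hC _).2
  have : |lapC (fun z => chi L z * V z) z| = ‖((lapC (fun z => chi L z * V z) z : ℝ) : ℂ)‖ := by
    rw [Complex.norm_real]; rfl
  rw [this, e3]
  have n1 : ‖(chi L z : ℂ) * lapC V z‖ ≤ |lapC V z| := by
    rw [norm_mul, Complex.norm_real, Complex.norm_real, Real.norm_of_nonneg (chi_nonneg _ _)]
    exact mul_le_of_le_one_left (norm_nonneg _) (chi_le_one _ _)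
  have n2 : ‖((th2 (‖z‖^2/L^2)/L^4 : ℝ) * z * conj z + (κ z : ℂ)) * V z‖ ≤ 4 * C0 * (|V z| / L^2) := by
    rw [norm_mul, Complex.norm_real]
    have : ‖((th2 (‖z‖^2/L^2)/L^4 : ℝ):ℂ) * z * conj z + (κ z : ℂ)‖ ≤ 4 * C0 / L^2 := by
      refine (norm_add_le _ _).trans ?_
      rw [norm_mul, norm_mul, Complex.norm_real, Complex.norm_real, RCLike.norm_conj]
      calc _ ≤ C0/L^4 * (3*L/2) * (3*L/2) + C0/L^2 := by
            gcongr
            · exact hκ2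
            · exact hκ
        _ = (13/4) * C0 / L^2 := by field_simp; ring
        _ ≤ _ := by gcongr; norm_num
    calc _ ≤ 4 * C0 / L^2 * ‖V z‖ := by gcongr
      _ = _ := by rw [Real.norm_eq_abs]; ring
  have n3 : ‖(κ z:ℂ) * conj z * conj (gz V z)‖ ≤ 2 * C0 * (‖gz V z‖ / L) := by
    rw [norm_mul, norm_mul, Complex.norm_real, RCLike.norm_conj, RCLike.norm_conj]
    calc _ ≤ C0/L^2 * (3*L/2) * ‖gz V z‖ := by gcongr; exact hκ
      _ = 3/2 * C0 * (‖gz V z‖ / L) := by field_simp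
      _ ≤ _ := by gcongr; norm_num
  have n4 : ‖(κ z:ℂ) * z * (gz V z)‖ ≤ 2 * C0 * (‖gz V z‖ / L) := by
    rw [norm_mul, norm_mul, Complex.norm_real]
    calc _ ≤ C0/L^2 * (3*L/2) * ‖gz V z‖ := by gcongr; exact hκ
      _ = 3/2 * C0 * (‖gz V z‖ / L) := by field_simp
      _ ≤ _ := by gcongr; norm_num
  have p1 : 0 ≤ C0 * (|V z| / L^2) := by positivity
  have p2 : 0 ≤ C0 * (‖gz V z‖ / L) := by positivity
  refine (norm_add_le _ _).trans ?_
  rw [norm_mul (4:ℂ)]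
  simp only [Complex.norm_ofNat]
  have n5 := norm_add_le (((th2 (‖z‖^2/L^2)/L^4 : ℝ) * z * conj z + (κ z : ℂ)) * V z + (κ z:ℂ) * conj z * conj (gz V z)) ((κ z : ℂ) * z * gz V z)
  have n6 := norm_add_le (((th2 (‖z‖^2/L^2)/L^4 : ℝ) * z * conj z + (κ z : ℂ)) * V z) ((κ z:ℂ) * conj z * conj (gz V z))
  nlinarith
end LE

namespace LE
open ComplexConjugate

lemma int_log_cont {h : ℂ → ℝ} (hh : Continuous h) (w : ℂ) {K : Set ℂ} (hK : IsCompact K) :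
    IntegrableOn (fun ζ => Real.log ‖ζ - w‖ * h ζ) K :=
  ((locInt_log w).integrableOn_isCompact hK).mul_continuousOn hh.continuousOn hK

lemma int_log_hcs {h : ℂ → ℝ} (hh : Continuous h) (hc : HasCompactSupport h) (w : ℂ) :
    Integrable (fun ζ => Real.log ‖ζ - w‖ * h ζ) := by
  have := int_log_cont hh w hc.isCompact
  rwa [integrableOn_iff_integrable_of_support_subset] at this
  intro x hx
  apply subset_tsupport
  intro h0; apply hx; simp [h0]

lemma lapC_congr {φ ψ : ℂ → ℝ} {z : ℂ} (h : φ =ᶠ[𝓝 z] ψ) : lapC φ z = lapC ψ z := by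
  have : ∀ k : ℂ, (fun y => fderiv ℝ φ y k) =ᶠ[𝓝 z] fun y => fderiv ℝ ψ y k := by
    intro k
    filter_upwards [h.fderiv (𝕜 := ℝ)] with y hy
    rw [hy]
  unfold lapC
  rw [(this 1).fderiv_eq, (this Complex.I).fderiv_eq]

lemma logrep (C0 : ℝ) : ∃ C > 0, ∀ p R v, Loc C0 p R v → ∀ z, ‖z‖ ≤ R/4 →
    |2 * π * v z + ∫ ζ in ball 0 (R/2), (Real.log ‖ζ - z‖ * FF p v ζ - Real.log ‖ζ - 0‖ * FF p v ζ)| ≤ C := by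
  by_cases hC0 : 0 < C0
  swap
  · exact ⟨1, one_pos, fun p R v h => absurd h.hC hC0⟩
  obtain ⟨C1, hC1, h1⟩ := G_ann C0
  obtain ⟨C2, hC2, h2⟩ := lap_cut
  refine ⟨(C0 + C2 * (4*C0 + 2*C1)) * π, by positivity, ?_⟩
  intro p R v h z hz
  have hR := h.Rpos
  have hL : 0 < R/2 := by positivity
  have hd : Differentiable ℝ v := h.cd.differentiable (by norm_num)
  have hV : ContDiff ℝ 2 (fun z => v z + p) := (h.cd.of_le (by norm_num)).add contDiff_const
  set φ : ℂ → ℝ := fun z => chi (R/2) z * (v z + p) with hφd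
  have hφ : ContDiff ℝ 2 φ := (chi_contDiff (R/2) (by simpa [one_add_one_eq_two] using two_le_top)).mul hV
  have hc : HasCompactSupport φ := (chi_hcs hL).mul_right
  have hl := contDiff_lapC hφ
  have hlc := hcs_lapC hc
  have r1 := log_repr hφ hc z
  have r2 := log_repr hφ hc 0
  have e1 : φ z = v z + p := by simp only [hφd]; rw [chi_one hL (by linarith)]; ring
  have e2 : φ 0 = p := by simp only [hφd]; rw [chi_one hL (by simp; linarith), h.v0]; ring
  have i1 := int_log_hcs hl hlc z
  have i2 := int_log_hcs hl hlc 0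
  have r3 : ∫ ζ, (Real.log ‖ζ - z‖ * lapC φ ζ - Real.log ‖ζ - 0‖ * lapC φ ζ) = 2 * π * v z := by
    rw [integral_sub i1 i2, r1, r2, e1, e2]; ring
  have i3 : Integrable (fun ζ => Real.log ‖ζ - z‖ * lapC φ ζ - Real.log ‖ζ - 0‖ * lapC φ ζ) := i1.sub i2
  rw [← integral_add_compl (measurableSet_ball (x := (0:ℂ)) (ε := R/2)) i3] at r3
  have elap : ∀ ζ : ℂ, lapC (fun z => v z + p) ζ = lapC v ζ := by
    intro ζ; unfold lapC; simp [fderiv_add_const]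
  have r4 : ∫ ζ in ball (0:ℂ) (R/2), (Real.log ‖ζ - z‖ * lapC φ ζ - Real.log ‖ζ - 0‖ * lapC φ ζ)
      = - ∫ ζ in ball 0 (R/2), (Real.log ‖ζ - z‖ * FF p v ζ - Real.log ‖ζ - 0‖ * FF p v ζ) := by
    rw [← integral_neg]
    apply setIntegral_congr_fun measurableSet_ball
    intro ζ hζ
    have hev : φ =ᶠ[𝓝 ζ] fun z => v z + p := by
      filter_upwards [isOpen_ball.mem_nhds hζ] with y hy
      simp only [hφd]; rw [chi_one hL (by simpa using (mem_ball_zero_iff.1 hy).le)]; ring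
    have : lapC φ ζ = - FF p v ζ := by
      rw [← h.eq ζ (by have := mem_ball_zero_iff.1 hζ; linarith), ← elap]
      exact lapC_congr hev
    simp only [this]; ring
  rw [← sub_neg_eq_add, ← r4]
  rw [← r3]

  rw [add_sub_cancel_left, ← integral_indicator measurableSet_ball.compl]
  set M := (C0 + C2 * (4*C0 + 2*C1)) / R^2 with hM
  have hM0 : 0 ≤ M := by positivity
  have hintg : Integrable ((closedBall (0:ℂ) (3*(R/2)/2)).indicator (fun _ => M)) := by
    rw [integrable_indicator_iff isClosed_closedBall.measurableSet]
    exact integrableOn_const measure_closedBall_lt_top.ne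
  rw [← Real.norm_eq_abs]
  refine (norm_integral_le_of_norm_le hintg (ae_of_all _ ?_)).trans ?_
  · intro ζ
    by_cases hζ : ζ ∈ (ball (0:ℂ) (R/2))ᶜ
    swap
    · rw [Set.indicator_of_notMem hζ, norm_zero]
      exact Set.indicator_nonneg (fun _ _ => hM0) _
    rw [Set.indicator_of_mem hζ]
    have hζ1 : R/2 ≤ ‖ζ‖ := by simpa using hζ
    by_cases hζ2 : ζ ∈ closedBall (0:ℂ) (3*(R/2)/2)
    · rw [Set.indicator_of_mem hζ2]
      have hζ3 : ‖ζ‖ ≤ 3*(R/2)/2 := by simpa using hζ2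
      have b := h2 _ hV (R/2) hL ζ hζ3
      rw [← sub_mul, norm_mul, sub_zero]
      have b2 : ‖Real.log ‖ζ - z‖ - Real.log ‖ζ‖‖ ≤ 1 := by
        have t1 : ‖ζ‖ ≤ ‖ζ - z‖ + ‖z‖ := by
          calc ‖ζ‖ = ‖(ζ - z) + z‖ := by simp
            _ ≤ _ := norm_add_le _ _
        have t2 := norm_sub_le ζ z
        have q1 : 0 < ‖ζ‖ := by linarith
        have q2 : 0 < ‖ζ - z‖ := by linarith
        have l2 := Real.log_two_lt_d9
        rw [Real.norm_eq_abs, abs_le]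
        constructor
        · have : Real.log ‖ζ‖ ≤ Real.log (2 * ‖ζ - z‖) := Real.log_le_log q1 (by linarith)
          rw [Real.log_mul two_ne_zero q2.ne'] at this; linarith
        · have : Real.log ‖ζ - z‖ ≤ Real.log (2 * ‖ζ‖) := Real.log_le_log q2 (by linarith)
          rw [Real.log_mul two_ne_zero q1.ne'] at this; linarith
      have b3 : |lapC φ ζ| ≤ M := by
        refine b.trans ?_
        have hR' : ‖ζ‖ ≤ R := by linarith
        have eg : gz (fun z => v z + p) ζ = gz v ζ := by
          have := congrFun (dz_add_const v hd p) ζ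
          exact this
        have c1 : |lapC (fun z => v z + p) ζ| ≤ C0 / R^2 := by
          rw [elap, h.eq ζ (by linarith), abs_neg, abs_of_pos (h.Fpos hR'), le_div_iff₀ (by positivity)]
          linarith [h.ann2 ζ (by linarith) hR']
        have c2 : |v ζ + p| ≤ C0 := by
          rw [abs_of_pos (by linarith [(h.neg ζ hR').1])]; exact h.ann1 ζ (by linarith) hR'
        have c3 := h1 p R v h ζ hζ1 (by linarith)
        rw [eg]
        calc _ ≤ C0/R^2 + C2 * (C0 / (R/2)^2 + (C1/R) / (R/2)) := by gcongr
          _ = M := by rw [hM]; field_simp; ring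
      calc _ ≤ 1 * M := by gcongr; exact b3
        _ = M := one_mul M
    · have : lapC φ ζ = 0 := by
        by_contra hne
        have h3 : ζ ∈ tsupport (lapC φ) := subset_tsupport _ hne
        have h4 : tsupport φ ⊆ closedBall 0 (3*(R/2)/2) := (tsupport_mul_subset_left).trans (chi_tsupport hL)
        have h5 : φ =ᶠ[𝓝 ζ] fun _ => 0 := by
          have : (tsupport φ)ᶜ ∈ 𝓝 ζ := (isClosed_tsupport φ).isOpen_compl.mem_nhds (fun hh => hζ2 (h4 hh))
          filter_upwards [this] with y hy using image_eq_zero_of_notMem_tsupport hy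
        apply hne
        rw [lapC_congr h5]; simp [lapC]
      rw [Set.indicator_of_notMem hζ2, this]; simp
  · rw [integral_indicator isClosed_closedBall.measurableSet, setIntegral_const, vol_cb (by positivity), hM]
    simp only [smul_eq_mul]
    have : π * (3 * (R/2)/2)^2 * ((C0 + C2 * (4*C0 + 2*C1)) / R^2) = 9/16 * ((C0 + C2 * (4*C0 + 2*C1)) * π) := by
      field_simp; ring
    rw [this]
    have : 0 ≤ (C0 + C2 * (4*C0 + 2*C1)) * π := by positivity
    linarith
end LE

namespace LE
open ComplexConjugate

lemma log_le_log' {x y : ℝ} (hx : 0 ≤ x) (h : x ≤ y) (hy : 1 ≤ y) : Real.log x ≤ Real.log y := by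
  rcases hx.eq_or_lt with h0 | h0
  · rw [← h0]; simpa using Real.log_nonneg hy
  · exact Real.log_le_log h0 h

lemma logD (ζ a b : ℂ) : Real.log ‖ζ - a‖ - Real.log ‖ζ - b‖ ≤ Real.log (1 + ‖a - b‖) +
    (ball b 1).indicator (fun ζ => ‖ζ - b‖⁻¹) ζ := by
  have t : ‖ζ - a‖ ≤ ‖ζ - b‖ + ‖a - b‖ := by
    calc ‖ζ - a‖ = ‖(ζ - b) - (a - b)‖ := by ring_nf
      _ ≤ _ := norm_sub_le _ _
  have n0 := norm_nonneg (a - b)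
  by_cases h : ζ ∈ ball b 1
  · rw [Set.indicator_of_mem h]
    have h' : ‖ζ - b‖ < 1 := by rwa [mem_ball, dist_eq_norm] at h
    have l1 : Real.log ‖ζ - a‖ ≤ Real.log (1 + ‖a - b‖) :=
      log_le_log' (norm_nonneg _) (by linarith) (by linarith)
    have l2 : - Real.log ‖ζ - b‖ ≤ ‖ζ - b‖⁻¹ := by
      rw [← Real.log_inv]
      exact Real.log_le_self (by positivity)
    linarith
  · rw [Set.indicator_of_notMem h]
    have h' : 1 ≤ ‖ζ - b‖ := by rw [mem_ball, dist_eq_norm] at h; linarith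
    have : Real.log ‖ζ - a‖ ≤ Real.log (‖ζ - b‖ * (1 + ‖a - b‖)) :=
      log_le_log' (norm_nonneg _) (by nlinarith) (by nlinarith)
    rw [Real.log_mul (by positivity) (by positivity)] at this
    linarith

lemma ind_int (b : ℂ) : Integrable ((ball b 1).indicator (fun ζ => ‖ζ - b‖⁻¹)) := by
  rw [integrable_indicator_iff measurableSet_ball]; exact integrableOn_inv b 1

lemma ind_int_val (b : ℂ) (X : Set ℂ) : ∫ ζ in X, (ball b 1).indicator (fun ζ => ‖ζ - b‖⁻¹) ζ ≤ 2 * π := by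
  have h0 : 0 ≤ (ball b 1).indicator (fun ζ => ‖ζ - b‖⁻¹) := by
    intro ζ
    exact Set.indicator_nonneg (fun _ _ => by positivity) _
  refine (setIntegral_le_integral (ind_int b) (ae_of_all _ h0)).trans ?_
  rw [integral_indicator measurableSet_ball, integral_inv b zero_le_one]; simp

lemma log_lower (C0 : ℝ) : ∃ C > 0, ∀ p R v, Loc C0 p R v → ∀ m, ∫ z in closedBall 0 R, FF p v z ≤ m →
    ∀ z, ‖z‖ ≤ R/4 → -(m / (2*π)) * Real.log (1 + ‖z‖) - C ≤ v z := by
  obtain ⟨C1, hC1, h1⟩ := logrep C0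
  refine ⟨C1/(2*π) + 1, by positivity, ?_⟩
  intro p R v h m hm z hz
  have hR := h.Rpos
  have h2 := h1 p R v h z hz
  have hX : ball (0:ℂ) (R/2) ⊆ closedBall 0 R := ball_subset_closedBall.trans (closedBall_subset_closedBall (by linarith))
  have i1 := (int_log_cont h.contF z (isCompact_closedBall 0 R)).mono_set hX
  have i2 := (int_log_cont h.contF 0 (isCompact_closedBall 0 R)).mono_set hX
  have i3 : IntegrableOn (FF p v) (ball 0 (R/2)) := (h.contF.continuousOn.integrableOn_compact (isCompact_closedBall 0 R)).mono_set hX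
  have key : ∫ ζ in ball 0 (R/2), (Real.log ‖ζ - z‖ * FF p v ζ - Real.log ‖ζ - 0‖ * FF p v ζ)
      ≤ Real.log (1 + ‖z‖) * m + 2 * π := by
    calc _ ≤ ∫ ζ in ball 0 (R/2), (Real.log (1 + ‖z‖) * FF p v ζ + (ball 0 1).indicator (fun ζ => ‖ζ - 0‖⁻¹) ζ) := by
          apply setIntegral_mono_on (i1.sub i2) ((i3.const_mul _).add (ind_int 0).integrableOn) measurableSet_ball
          intro ζ hζ
          have hζ' : ‖ζ‖ ≤ R := by simpa using hX hζ
          have l := logD ζ z 0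
          rw [sub_zero z] at l
          have f0 := (h.Fpos hζ').le
          have f1 := h.F_le_one hζ'
          have f2 : 0 ≤ (ball 0 1).indicator (fun ζ => ‖ζ - 0‖⁻¹) ζ := Set.indicator_nonneg (fun _ _ => by positivity) _
          simp only [Pi.sub_apply, Pi.add_apply]
          nlinarith
      _ = Real.log (1 + ‖z‖) * (∫ ζ in ball 0 (R/2), FF p v ζ) + ∫ ζ in ball (0:ℂ) (R/2), (ball (0:ℂ) 1).indicator (fun ζ => ‖ζ - 0‖⁻¹) ζ := by
          rw [integral_add (i3.const_mul _) (ind_int 0).integrableOn, integral_const_mul]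
      _ ≤ _ := by
          gcongr
          · exact Real.log_nonneg (by linarith [norm_nonneg z])
          · exact (h.mass_sub hX).trans hm
          · exact ind_int_val 0 _
  rw [abs_le] at h2
  have : -(Real.log (1 + ‖z‖) * m + 2 * π) - C1 ≤ 2 * π * v z := by linarith [h2.1]
  have e : -(m / (2*π)) * Real.log (1 + ‖z‖) - (C1/(2*π) + 1) = (-(Real.log (1 + ‖z‖) * m + 2 * π) - C1) / (2*π) := by
    field_simp; ring
  rw [e, div_le_iff₀ (by positivity)]; linarith

lemma log_upper (C0 : ℝ) : ∃ C > 0, ∀ p R v, Loc C0 p R v → ∀ K a b, 1 ≤ K → K ≤ R/2 →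
    ∫ z in closedBall 0 R, FF p v z ≤ b → a ≤ ∫ z in ball 0 K, FF p v z →
    ∀ z, 2 * K ≤ ‖z‖ → ‖z‖ ≤ R/4 →
    2 * π * v z ≤ -(a * Real.log (‖z‖/(2*K))) + (b - a) * Real.log (1 + ‖z‖) + C := by
  obtain ⟨C1, hC1, h1⟩ := logrep C0
  refine ⟨C1 + 2 * π, by positivity, ?_⟩
  intro p R v h K a b hK hKR hb ha z hz1 hz
  have hR := h.Rpos
  have h2 := h1 p R v h z hz
  have hX : ball (0:ℂ) (R/2) ⊆ closedBall 0 R := ball_subset_closedBall.trans (closedBall_subset_closedBall (by linarith))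
  have hKX : ball (0:ℂ) K ⊆ ball 0 (R/2) := ball_subset_ball hKR
  have i1 := (int_log_cont h.contF z (isCompact_closedBall 0 R)).mono_set hX
  have i2 := (int_log_cont h.contF 0 (isCompact_closedBall 0 R)).mono_set hX
  have i3 : IntegrableOn (FF p v) (ball 0 (R/2)) := (h.contF.continuousOn.integrableOn_compact (isCompact_closedBall 0 R)).mono_set hX
  have i4 : Integrable ((ball 0 K).indicator (FF p v)) (volume.restrict (ball 0 (R/2))) := i3.indicator measurableSet_ball
  set l1 := Real.log (‖z‖/(2*K))
  set l2 := Real.log (1 + ‖z‖)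
  have hl1 : 0 ≤ l1 := Real.log_nonneg (by rw [le_div_iff₀ (by linarith)]; linarith)
  have hl2 : 0 ≤ l2 := Real.log_nonneg (by linarith [norm_nonneg z])
  set mK := ∫ z in ball 0 K, FF p v z
  have key : -∫ ζ in ball 0 (R/2), (Real.log ‖ζ - z‖ * FF p v ζ - Real.log ‖ζ - 0‖ * FF p v ζ)
      ≤ -(a * l1) + (b - a) * l2 + 2 * π := by
    rw [← integral_neg]
    calc _ ≤ ∫ ζ in ball 0 (R/2), (l2 * FF p v ζ + (-l1 - l2) * (ball 0 K).indicator (FF p v) ζ + (ball z 1).indicator (fun ζ => ‖ζ - z‖⁻¹) ζ) := by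
          apply setIntegral_mono_on (i1.sub i2).neg (((i3.const_mul _).add (i4.const_mul _)).add (ind_int z).integrableOn) measurableSet_ball
          intro ζ hζ
          have hζ' : ‖ζ‖ ≤ R := by simpa using hX hζ
          have f0 := (h.Fpos hζ').le
          have f1 := h.F_le_one hζ'
          have f2 : 0 ≤ (ball z 1).indicator (fun ζ => ‖ζ - z‖⁻¹) ζ := Set.indicator_nonneg (fun _ _ => by positivity) _
          simp only [Pi.neg_apply, Pi.sub_apply, Pi.add_apply]
          by_cases hk : ζ ∈ ball (0:ℂ) K
          · rw [Set.indicator_of_mem hk]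
            have hk' : ‖ζ‖ < K := by simpa using hk
            have t1 : ‖z‖ ≤ ‖ζ‖ + ‖ζ - z‖ := by
              calc ‖z‖ = ‖ζ - (ζ - z)‖ := by simp
                _ ≤ _ := norm_sub_le _ _
            have g1 : Real.log (‖z‖/2) ≤ Real.log ‖ζ - z‖ := Real.log_le_log (by linarith) (by linarith)
            have g2 : Real.log ‖ζ - 0‖ ≤ Real.log K := by
              rw [sub_zero]; exact log_le_log' (norm_nonneg _) hk'.le hK
            have g3 : l1 = Real.log (‖z‖/2) - Real.log K := by
              simp only [l1]; rw [← Real.log_div (by linarith) (by linarith), div_div]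
            nlinarith
          · rw [Set.indicator_of_notMem hk]
            have l := logD ζ 0 z
            rw [zero_sub, norm_neg] at l
            change _ ≤ l2 + _ at l
            nlinarith
      _ = l2 * (∫ ζ in ball 0 (R/2), FF p v ζ) + (-l1-l2) * mK + ∫ ζ in ball 0 (R/2), (ball z 1).indicator (fun ζ => ‖ζ - z‖⁻¹) ζ := by
          have i5 : Integrable (fun ζ => l2 * FF p v ζ + (-l1 - l2) * (ball 0 K).indicator (FF p v) ζ) (volume.restrict (ball 0 (R/2))) := (i3.const_mul _).add (i4.const_mul _)
          rw [integral_add i5 (ind_int z).integrableOn, integral_add (i3.const_mul _) (i4.const_mul _), integral_const_mul, integral_const_mul,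
            setIntegral_indicator measurableSet_ball, Set.inter_eq_right.2 hKX]
      _ ≤ l2 * b + (-l1-l2) * a + 2 * π := by
          gcongr ?_ + ?_ + ?_
          · gcongr
            exact (h.mass_sub hX).trans hb
          · nlinarith
          · exact ind_int_val z _
      _ = _ := by ring
  rw [abs_le] at h2
  linarith [h2.2]
end LE

namespace LE
open ComplexConjugate

lemma int_unif {h : ℂ → ℝ} (hh : Continuous h) {L S : ℝ} (hL : 0 ≤ L) (h0 : ∀ ζ, ‖ζ‖ ≤ L → 0 ≤ h ζ) (hS0 : 0 ≤ S)
    (hS : ∀ ζ, ‖ζ‖ ≤ L → h ζ ≤ S) (w : ℂ) :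
    ∫ ζ in closedBall (0:ℂ) L, h ζ / ‖ζ - w‖ ≤ S * (2 * π + π * L ^ 2) := by
  have hm : ∫ ζ in closedBall (0:ℂ) L, h ζ ≤ S * (π * L^2) := by
    have : ∫ ζ in closedBall (0:ℂ) L, h ζ ≤ ∫ ζ in closedBall (0:ℂ) L, S := by
      apply setIntegral_mono_on
      · exact hh.continuousOn.integrableOn_compact (isCompact_closedBall _ _)
      · exact continuousOn_const.integrableOn_compact (isCompact_closedBall _ _)
      · exact isClosed_closedBall.measurableSet
      · intro ζ hζ; exact hS ζ (by simpa using hζ)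
    refine this.trans ?_
    rw [setIntegral_const, vol_cb hL, smul_eq_mul]; linarith
  have := near_est hh (isCompact_closedBall 0 L) (z := w) (ρ := 1) (S := S) one_pos
    (fun ζ hζ => h0 ζ (by simpa using hζ)) hS0 (fun ζ hζ _ => hS ζ (by simpa using hζ)) hm
  linarith

def annul (M : ℝ) : Set ℂ := {ζ | M/2 ≤ ‖ζ‖ ∧ ‖ζ‖ ≤ 5*M}

lemma annul_closed (M : ℝ) : IsClosed (annul M) :=
  (isClosed_le continuous_const continuous_norm).inter (isClosed_le continuous_norm continuous_const)
lemma annul_sub {M : ℝ} : annul M ⊆ closedBall 0 (5*M) := fun ζ hζ => by simpa using hζ.2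
lemma annul_compact (M : ℝ) : IsCompact (annul M) :=
  (isCompact_closedBall (0:ℂ) (5*M)).of_isClosed_subset (annul_closed M) annul_sub

lemma ann_G (C0 : ℝ) : ∃ C > 0, ∀ p R v, Loc C0 p R v → ∀ M ρ m, 1 ≤ M → 16 * M ≤ R → 0 < ρ →
    ∫ ζ in annul M, FF p v ζ ≤ m → ∀ z, M ≤ ‖z‖ → ‖z‖ ≤ 4 * M →
    ‖gz v z‖ ≤ 2 * π * ρ + m / ρ + 2 * C0 / M + C / R := by
  obtain ⟨C, hC, h1⟩ := G_rep C0
  refine ⟨C, hC, ?_⟩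
  intro p R v h M ρ m hM hMR hρ hm z hz1 hz2
  have hR := h.Rpos
  have hsub : closedBall (0:ℂ) (3*R/4) ⊆ closedBall 0 R := closedBall_subset_closedBall (by linarith)
  have hsub2 : annul M ⊆ closedBall (0:ℂ) (3*R/4) := annul_sub.trans (closedBall_subset_closedBall (by linarith))
  have h2 := h1 p R v h z (by linarith)
  have h3 := near_est h.contF (annul_compact M) (z := z) (ρ := ρ) (S := 1) (m := m) hρ
    (fun ζ hζ => (h.Fpos (by simpa using hsub (hsub2 hζ))).le) zero_le_one
    (fun ζ hζ _ => (h.F_le_one (by simpa using hsub (hsub2 hζ)))) hm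
  have hintg := integrableOn_div_norm h.contF z (isCompact_closedBall (0:ℂ) (3*R/4))
  have hFi : IntegrableOn (FF p v) (closedBall 0 R) := h.contF.continuousOn.integrableOn_compact (isCompact_closedBall 0 R)
  have e := setIntegral_union (μ := volume) (f := fun ζ => FF p v ζ / ‖ζ - z‖) (s := annul M) (t := closedBall (0:ℂ) (3*R/4) \ annul M)
    Set.disjoint_sdiff_right (isClosed_closedBall.measurableSet.diff (annul_closed M).measurableSet)
    (hintg.mono_set hsub2) (hintg.mono_set Set.diff_subset)
  rw [Set.union_diff_cancel hsub2] at e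
  have h4 : ∫ ζ in closedBall (0:ℂ) (3*R/4) \ annul M, FF p v ζ / ‖ζ - z‖ ≤ 2 * C0 / M := by
    calc _ ≤ ∫ ζ in closedBall (0:ℂ) (3*R/4) \ annul M, FF p v ζ * (2/M) := by
          apply setIntegral_mono_on (hintg.mono_set Set.diff_subset) ((hFi.mono_set (Set.diff_subset.trans hsub)).mul_const _)
            (isClosed_closedBall.measurableSet.diff (annul_closed M).measurableSet)
          intro ζ hζ
          have hd : M / 2 ≤ ‖ζ - z‖ := by
            have hn : ¬ (M/2 ≤ ‖ζ‖ ∧ ‖ζ‖ ≤ 5*M) := hζ.2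
            by_cases hc : M/2 ≤ ‖ζ‖
            · have : 5*M < ‖ζ‖ := by by_contra hh; exact hn ⟨hc, not_lt.1 hh⟩
              linarith [norm_sub_norm_le ζ z]
            · push Not at hc
              have := norm_sub_norm_le z ζ
              rw [norm_sub_rev] at this
              linarith
          have hF := (h.Fpos (by simpa using hsub hζ.1)).le
          have e1 : FF p v ζ * (2/M) = FF p v ζ / (M/2) := by field_simp
          rw [e1]
          gcongr
      _ = (∫ ζ in closedBall (0:ℂ) (3*R/4) \ annul M, FF p v ζ) * (2/M) := integral_mul_const _ _
      _ ≤ C0 * (2/M) := by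
          gcongr
          exact (h.mass_sub (Set.diff_subset.trans hsub)).trans h.mass
      _ = _ := by ring
  rw [e] at h2
  linarith

lemma pigeon {C0 p R : ℝ} {v : ℂ → ℝ} (h : Loc C0 p R v) (J : ℕ) (hJ : 0 < J) (M0 : ℝ) (hM0 : 1 ≤ M0) (hR : 16 * (16^J * M0) ≤ R) :
    ∃ M, M0 ≤ M ∧ M ≤ 16^J * M0 ∧ ∫ ζ in annul M, FF p v ζ ≤ C0 / J := by
  have hsubs : ∀ j ∈ Finset.range J, annul (16^j * M0) ⊆ closedBall 0 R := by
    intro j hj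
    apply annul_sub.trans (closedBall_subset_closedBall _)
    have : (16:ℝ)^j ≤ 16^J := pow_le_pow_right₀ (by norm_num) (Finset.mem_range.1 hj).le
    have h0 : (0:ℝ) < 16^J := by positivity
    nlinarith [mul_le_mul_of_nonneg_right this (by linarith : (0:ℝ) ≤ M0), mul_pos h0 (by linarith : 0 < M0)]
  have hFi : IntegrableOn (FF p v) (closedBall 0 R) := h.contF.continuousOn.integrableOn_compact (isCompact_closedBall 0 R)
  have key : ∀ i j : ℕ, i < j → Disjoint (annul (16^i * M0)) (annul (16^j * M0)) := by
    intro i j hij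
    rw [Set.disjoint_left]
    intro ζ h1 h2
    have a := h1.2
    have b := h2.1
    have : (16:ℝ)^(i+1) ≤ 16^j := pow_le_pow_right₀ (by norm_num) hij
    rw [pow_succ] at this
    have : (0:ℝ) < 16^i := by positivity
    nlinarith
  have hsum : ∑ j ∈ Finset.range J, ∫ ζ in annul (16^j * M0), FF p v ζ ≤ ∑ j ∈ Finset.range J, C0 / J := by
    rw [← integral_biUnion_finset]
    · rw [Finset.sum_const, Finset.card_range, nsmul_eq_mul, mul_div_cancel₀ _ (by positivity)]
      exact (h.mass_sub (Set.iUnion₂_subset hsubs)).trans h.mass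
    · intro i _; exact (annul_closed _).measurableSet
    · intro i _ j _ hij
      rcases lt_or_gt_of_ne hij with hl | hl
      · exact key i j hl
      · exact (key j i hl).symm
    · intro i hi; exact hFi.mono_set (hsubs i hi)
  obtain ⟨j, hj, hle⟩ := Finset.exists_le_of_sum_le ⟨0, Finset.mem_range.2 hJ⟩ hsum
  refine ⟨16^j * M0, ?_, ?_, hle⟩
  · have : (1:ℝ) ≤ 16^j := one_le_pow₀ (by norm_num)
    nlinarith
  · have : (16:ℝ)^j ≤ 16^J := pow_le_pow_right₀ (by norm_num) (Finset.mem_range.1 hj).le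
    gcongr

lemma Q_small (C0 : ℝ) (κ : ℝ) (hκ : 0 < κ) (K : ℝ) : ∃ p0 R0 : ℝ, ∀ p R v, Loc C0 p R v → p0 ≤ p → R0 ≤ R →
    ∀ z, ‖z‖ ≤ K → ‖QQ v z‖ ≤ κ := by
  by_cases hC0 : 0 < C0
  swap
  · exact ⟨0, 0, fun p R v h => absurd h.hC hC0⟩
  obtain ⟨Ca, hCa, ha⟩ := ann_G C0
  obtain ⟨Cg, hCg, hg⟩ := grad_est
  obtain ⟨Cc, hCc, hc⟩ := cp_est
  obtain ⟨CG, hCG, hG⟩ := G_bdd C0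
  set D := 1 + Cc * (26 * Cg + 72) with hD
  have hDpos : 0 < D := by positivity
  obtain ⟨σ, hσ0, hσ1, hσκ⟩ : ∃ σ > 0, σ ≤ 1 ∧ D * σ ≤ κ := by
    refine ⟨min 1 (κ / D), by positivity, min_le_left _ _, ?_⟩
    calc D * min 1 (κ/D) ≤ D * (κ / D) := by gcongr; exact min_le_right _ _
      _ = κ := by field_simp
  obtain ⟨J, hJ⟩ := exists_nat_gt (C0 / σ^2)
  have hJ0 : (0:ℝ) < J := lt_of_le_of_lt (by positivity) hJ
  set M0 := max (max 1 K) (C0/σ) with hM0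
  set MJ := (16:ℝ)^J * M0 with hMJ
  have hM01 : 1 ≤ M0 := (le_max_left _ _).trans (le_max_left _ _)
  have hM0K : K ≤ M0 := (le_max_right _ _).trans (le_max_left _ _)
  have hM0C : C0/σ ≤ M0 := le_max_right _ _
  refine ⟨4 * CG * (2 * π + π * (3*MJ)^2) / σ, max (16 * MJ) (Ca/σ), ?_⟩
  intro p R v h hp hR z hz
  have hppos := h.ppos
  have hRpos := h.Rpos
  obtain ⟨M, hM1, hM2, hM3⟩ := pigeon h J (by exact_mod_cast hJ0) M0 hM01 ((le_max_left _ _).trans hR)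
  have hMR : 16 * M ≤ R := by have := (le_max_left (16*MJ) (Ca/σ)).trans hR; linarith
  have hM : 1 ≤ M := hM01.trans hM1
  have G12 : ∀ z, M ≤ ‖z‖ → ‖z‖ ≤ 4 * M → ‖gz v z‖ ≤ 12 * σ := by
    intro z h1 h2
    have := ha p R v h M σ (C0/J) hM hMR hσ0 hM3 z h1 h2
    have e1 : C0 / J / σ ≤ σ := by
      rw [div_le_iff₀ hσ0, div_le_iff₀ hJ0]
      rw [div_lt_iff₀ (by positivity)] at hJ
      nlinarith
    have e2 : C0 / M ≤ σ := by
      rw [div_le_iff₀ (by linarith)]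
      rw [div_le_iff₀ hσ0] at hM0C
      nlinarith
    have e3 : Ca / R ≤ σ := by
      have := (le_max_right (16*MJ) (Ca/σ)).trans hR
      rw [div_le_iff₀ hRpos]
      rw [div_le_iff₀ hσ0] at this
      linarith
    have := Real.pi_lt_d2
    rw [mul_div_assoc] at *
    nlinarith
  have S12 : ∀ z, 2*M ≤ ‖z‖ → ‖z‖ ≤ 3 * M → ‖QQ v z‖ ≤ (26 * Cg + 72) * σ := by
    intro z h1 h2
    have hb : ∀ ζ : ℂ, ‖ζ - z‖ ≤ 3 * (2/3) / 2 → M ≤ ‖ζ‖ ∧ ‖ζ‖ ≤ 4 * M := by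
      intro ζ hζ
      have a := norm_sub_norm_le ζ z
      have b := norm_sub_norm_le z ζ
      rw [norm_sub_rev] at b
      constructor <;> linarith
    have := hg (gz v) h.cG z (2/3) (12*σ) (12*σ) (by norm_num) ?_ ?_
    · have g1 := G12 z (by linarith) (by linarith)
      calc ‖QQ v z‖ ≤ ‖SS v z‖ + ‖gz v z ^ 2 / 2‖ := norm_sub_le _ _
        _ = ‖dz (gz v) z‖ + ‖gz v z‖^2/2 := by rw [norm_div, norm_pow]; simp [SS]
        _ ≤ Cg * (2/3 * (12*σ) + 12*σ/(2/3)) + (12*σ)^2/2 := by gcongr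
        _ = 26 * Cg * σ + 72 * σ * σ := by ring
        _ ≤ 26 * Cg * σ + 72 * σ * 1 := by gcongr
        _ = _ := by ring
    · intro ζ hζ
      have ⟨q1, q2⟩ := hb ζ hζ
      refine (h.norm_dzbS (by linarith)).trans ?_
      have f1 := h.F1_le_one (z := ζ) (by linarith)
      have f2 := (h.F1pos (z := ζ) (by linarith)).le
      have g1 := G12 ζ q1 q2
      nlinarith [norm_nonneg (gz v ζ)]
    · intro ζ hζ
      exact G12 ζ (hb ζ hζ).1 (hb ζ hζ).2
  have h5 := hc (QQ v) h.cQ (2*M) ((26 * Cg + 72) * σ) z (by linarith) (by linarith)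
    (fun ζ a b => S12 ζ a (by linarith))
  have e5 : 3 * (2*M)/2 = 3*M := by ring
  rw [e5] at h5
  have h6 := int_unif ((contDiff_dzb (m := 0) h.cQ (by norm_num)).continuous.norm) (L := 3*M) (S := 4*CG/p) (by linarith)
    (fun ζ _ => norm_nonneg _) (by positivity) ?_ z
  · have h7 : 4*CG/p * (2*π + π*(3*M)^2) ≤ σ := by
      calc _ ≤ 4*CG/p * (2*π + π*(3*MJ)^2) := by gcongr
        _ ≤ σ := by
          rw [div_le_iff₀ hσ0] at hp
          rw [div_mul_eq_mul_div, div_le_iff₀ hppos]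
          linarith
    calc _ ≤ _ := h5
      _ ≤ σ + Cc * ((26 * Cg + 72) * σ) := by gcongr; linarith
      _ = D * σ := by rw [hD]; ring
      _ ≤ κ := hσκ
  · intro ζ hζ
    refine (h.norm_dzbQ (by linarith)).trans ?_
    have g1 := hG p R v h ζ (by linarith)
    have e1 : Real.exp (6/7 * v ζ) ≤ 1 := by
      rw [Real.exp_le_one_iff]; have := (h.neg ζ (by linarith)).2; linarith
    apply div_le_div_of_nonneg_right _ hppos.le
    calc 4 * ‖gz v ζ‖ * Real.exp (6/7 * v ζ) ≤ 4 * CG * 1 := by gcongr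
      _ = 4 * CG := by ring

end LE

namespace LE
open ComplexConjugate

lemma HasW.ray {φ : ℂ → ℂ} {a b z : ℂ} {s : ℝ} (h : HasW φ a b ((s:ℂ) * z)) :
    HasDerivAt (fun s : ℝ => φ ((s:ℂ) * z)) (a * z + b * conj z) s := by
  have h1 : HasDerivAt (fun s : ℝ => (s:ℂ) * z) z s := by
    have := (Complex.ofRealCLM.hasDerivAt (x := s)).mul_const z
    simpa using this
  have h2 : HasFDerivAt φ (wirt a b) ((fun s : ℝ => (s:ℂ) * z) s) := h
  have := HasFDerivAt.comp_hasDerivAt s h2 h1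
  rw [wirt_apply] at this
  exact this

lemma ray_norm {s K : ℝ} {z : ℂ} (h0 : 0 ≤ s) (h1 : s ≤ 1) (hz : ‖z‖ ≤ K) : ‖(s:ℂ) * z‖ ≤ K := by
  rw [norm_mul, Complex.norm_real, Real.norm_of_nonneg h0]
  nlinarith [norm_nonneg z]

lemma gron {a : ℂ → ℝ} {G S B : ℂ → ℂ} {K A η : ℝ} (hK : 0 < K) (hA : 0 ≤ A) (hη : 0 ≤ η)
    (ha : ∀ z, ‖z‖ ≤ K → HasW (fun z => (a z : ℂ)) (G z) (conj (G z)) z)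
    (hG : ∀ z, ‖z‖ ≤ K → HasW G (S z) (B z) z) (a0 : a 0 = 0) (G0 : G 0 = 0)
    (hb : ∀ z, ‖z‖ ≤ K → ‖S z‖ + ‖B z‖ ≤ A * (|a z| + ‖G z‖) + η) {z : ℂ} (hz : ‖z‖ ≤ K) :
    |a z| ≤ η * Real.exp (K * (2 + 2*A)) ∧ ‖G z‖ ≤ η * Real.exp (K * (2+2*A)) := by
  set k := K * (2 + 2 * A) with hk
  have hkpos : 0 < k := by positivity
  let f : ℝ → ℂ × ℂ := fun s => ((a ((s:ℂ)*z) : ℂ), G ((s:ℂ)*z))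
  have hd : ∀ s ∈ Set.Icc (0:ℝ) 1, HasDerivAt f (G ((s:ℂ)*z) * z + conj (G ((s:ℂ)*z)) * conj z,
      S ((s:ℂ)*z) * z + B ((s:ℂ)*z) * conj z) s := by
    intro s hs
    have hn := ray_norm hs.1 hs.2 hz
    exact (ha _ hn).ray.prodMk (hG _ hn).ray
  have := norm_le_gronwallBound_of_norm_deriv_right_le (f := f) (δ := 0) (K := k) (ε := K * η) (a := 0) (b := 1)
    (fun s hs => (hd s hs).continuousAt.continuousWithinAt)
    (fun s hs => (hd s ⟨hs.1, hs.2.le⟩).hasDerivWithinAt) (by simp [f, a0, G0]) ?_ 1 (by simp)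
  · have hf : ‖f 1‖ ≤ η * Real.exp k := by
      refine this.trans ?_
      rw [gronwallBound_of_K_ne_0 hkpos.ne']
      simp only [zero_mul, zero_add, sub_zero, mul_one]
      have h1 : K * η / k ≤ η := by
        rw [div_le_iff₀ hkpos, hk]
        nlinarith [mul_nonneg hη hK.le, mul_nonneg (mul_nonneg hη hK.le) hA]
      have h2 : (0:ℝ) ≤ Real.exp k - 1 := by linarith [Real.one_le_exp hkpos.le]
      calc _ ≤ η * (Real.exp k - 1) := by gcongr
        _ ≤ _ := by nlinarith
    have e : f 1 = ((a z : ℂ), G z) := by simp [f]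
    rw [e] at hf
    have h1 := (norm_fst_le _).trans hf
    have h2 := (norm_snd_le _).trans hf
    simp only [Complex.norm_real, Real.norm_eq_abs] at h1
    exact ⟨h1, h2⟩
  · intro s hs
    have hn := ray_norm hs.1 hs.2.le hz
    set y := (s:ℂ) * z
    have h1 := norm_fst_le (f s)
    have h2 := norm_snd_le (f s)
    simp only [f, Complex.norm_real, Real.norm_eq_abs] at h1 h2
    change |a y| ≤ ‖f s‖ at h1
    change ‖G y‖ ≤ ‖f s‖ at h2
    have hb' := hb y hn
    have n0 := norm_nonneg (f s)
    rw [Prod.norm_def, max_le_iff]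
    constructor
    · calc ‖G y * z + conj (G y) * conj z‖ ≤ ‖G y‖ * ‖z‖ + ‖G y‖ * ‖z‖ := by
            refine (norm_add_le _ _).trans ?_
            simp
        _ ≤ ‖f s‖ * K + ‖f s‖ * K := by gcongr
        _ ≤ k * ‖f s‖ + K * η := by
            rw [hk]; nlinarith [mul_nonneg hK.le hη, mul_nonneg (mul_nonneg hK.le hA) n0]
    · calc ‖S y * z + B y * conj z‖ ≤ ‖S y‖ * ‖z‖ + ‖B y‖ * ‖z‖ := by
            refine (norm_add_le _ _).trans ?_
            simp
        _ = (‖S y‖ + ‖B y‖) * ‖z‖ := by ring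
        _ ≤ (A * (|a y| + ‖G y‖) + η) * K := by gcongr
        _ ≤ (A * (‖f s‖ + ‖f s‖) + η) * K := by gcongr
        _ ≤ k * ‖f s‖ + K * η := by rw [hk]; nlinarith [mul_nonneg hK.le n0]

/-- the bubble on `ℂ` -/
def Uc (z : ℂ) : ℝ := -2 * Real.log (1 + ‖z‖^2/8)
def gU (z : ℂ) : ℂ := conj z * ((-2 / (8 + ‖z‖^2) : ℝ) : ℂ)

lemma Uc_nonpos (z : ℂ) : Uc z ≤ 0 := by
  have := Real.log_nonneg (by nlinarith [sq_nonneg ‖z‖] : 1 ≤ 1 + ‖z‖^2/8)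
  unfold Uc; linarith
lemma exp_Uc (z : ℂ) : Real.exp (Uc z) = 64 / (8 + ‖z‖^2)^2 := by
  have h : 0 < 1 + ‖z‖^2/8 := by positivity
  have : Uc z = Real.log ((1 + ‖z‖^2/8)^2)⁻¹ := by rw [Real.log_inv, Real.log_pow]; unfold Uc; push_cast; ring
  rw [this, Real.exp_log (by positivity)]
  field_simp
  norm_num
lemma hasW_Uc (z : ℂ) : HasW (fun z => (Uc z : ℂ)) (gU z) (conj (gU z)) z := by
  have h1 : HasDerivAt (fun s : ℝ => -2 * Real.log (1 + s/8)) (-2 / (8 + ‖z‖^2)) (‖z‖^2) := by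
    have h : 0 < 1 + ‖z‖^2/8 := by positivity
    have := ((((hasDerivAt_id (‖z‖^2)).div_const 8).const_add 1).log h.ne').const_mul (-2)
    convert! this using 1
    simp only [id]
    field_simp
  have := HasW.radial h1
  convert! this using 1
  · unfold gU; ring
  · unfold gU; rw [map_mul, Complex.conj_conj, Complex.conj_ofReal]; ring
lemma hasW_gU (z : ℂ) : HasW gU (gU z ^ 2 / 2) (-((Real.exp (Uc z) : ℝ) : ℂ) / 4) z := by
  have h1 : HasDerivAt (fun s : ℝ => -2 / (8 + s)) (2 / (8 + ‖z‖^2)^2) (‖z‖^2) := by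
    have h : 0 < 8 + ‖z‖^2 := by positivity
    have := ((hasDerivAt_const (‖z‖^2) (-2:ℝ))).div ((hasDerivAt_id (‖z‖^2)).const_add 8) h.ne'
    convert! this using 1
    simp only [id]
    ring
  have := (HasW.cnj z).mul (HasW.radial h1)
  have h8 : ((8 + ‖z‖^2 : ℝ) : ℂ) ≠ 0 := by exact_mod_cast (by positivity : 8 + ‖z‖^2 ≠ 0)
  push_cast at h8
  convert! this using 1
  · unfold gU; push_cast; field_simp; ring
  · rw [exp_Uc]; push_cast
    have : conj z * (2 / (8 + (‖z‖:ℂ)^2)^2 * z) = 2 * (‖z‖:ℂ)^2 / (8 + (‖z‖:ℂ)^2)^2 := by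
      have e : conj z * z = (‖z‖:ℂ)^2 := by rw [mul_comm, Complex.mul_conj, Complex.normSq_eq_norm_sq]; push_cast; rfl
      rw [← e]; ring
    rw [this]
    field_simp
    ring
lemma norm_gU (z : ℂ) : ‖gU z‖ = 2 * ‖z‖ / (8 + ‖z‖^2) := by
  unfold gU
  rw [norm_mul, Complex.norm_real, Complex.norm_conj, Real.norm_eq_abs, abs_div, abs_of_pos (by positivity : 0 < 8 + ‖z‖^2)]
  norm_num; ring
lemma norm_gU_le (z : ℂ) : ‖gU z‖ ≤ 1 := by
  rw [norm_gU, div_le_one (by positivity)]; nlinarith [sq_nonneg (‖z‖-1)]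
lemma gU_eq (z : ℂ) : gz Uc z = gU z := (hasW_Uc z).dz
lemma exp_lip {a b : ℝ} (ha : a ≤ 0) (hb : b ≤ 0) : |Real.exp a - Real.exp b| ≤ |a - b| := by
  wlog h : b ≤ a generalizing a b
  · rw [abs_sub_comm, abs_sub_comm a]; exact this hb ha (by linarith)
  rw [abs_of_nonneg (by linarith [Real.exp_le_exp.2 h]), abs_of_nonneg (by linarith)]
  have h1 := Real.add_one_le_exp (b - a)
  have h2 : Real.exp b = Real.exp a * Real.exp (b-a) := by rw [← Real.exp_add]; ring_nf
  have h3 := Real.exp_pos a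
  have h4 : Real.exp a ≤ 1 := by simpa using ha
  nlinarith

lemma vU_close (C0 : ℝ) (η : ℝ) (hη : 0 < η) (K : ℝ) : ∃ p0 R0 : ℝ, ∀ p R v, Loc C0 p R v → p0 ≤ p → R0 ≤ R →
    ∀ z, ‖z‖ ≤ K → |v z - Uc z| ≤ η ∧ ‖gz v z - gU z‖ ≤ η := by
  obtain ⟨CG, hCG, hG⟩ := G_bdd C0
  set K' := max K 1 with hK'
  have hK'1 : 0 < K' := lt_of_lt_of_le one_pos (le_max_right _ _)
  set E := Real.exp (K' * (2 + 2 * (CG+1))) with hE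
  have hEp : 0 < E := Real.exp_pos _
  obtain ⟨p0, R0, hQ⟩ := Q_small C0 (η / E / 2) (by positivity) K'
  refine ⟨max p0 (100 * E / η), max R0 (4 * K'+1), ?_⟩
  intro p R v h hp hR z hz
  have hp1 := (le_max_left _ _).trans hp
  have hp2 := (le_max_right _ _).trans hp
  have hR1 := (le_max_left _ _).trans hR
  have hR2 := (le_max_right _ _).trans hR
  have hppos := h.ppos
  have key := gron (a := fun z => v z - Uc z) (G := fun z => gz v z - gU z)
    (S := fun z => SS v z - gU z ^ 2 / 2) (B := fun z => -((FF p v z : ℝ):ℂ)/4 - -((Real.exp (Uc z) : ℝ) : ℂ) / 4)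
    (K := K') (A := CG + 1) (η := η / E) hK'1 (by positivity) (by positivity) ?_ ?_ ?_ ?_ ?_ (z := z) (hz.trans (le_max_left _ _))
  · have e : η / E * Real.exp (K' * (2 + 2 * (CG+1))) = η := by rw [← hE]; field_simp
    rw [e] at key
    exact key
  · intro y hy
    have := (h.hasWv y).sub (hasW_Uc y)
    simpa using this
  · intro y hy
    exact (h.hasWG (by linarith)).sub (hasW_gU y)
  · simp [h.v0, Uc]
  · simp [h.g0, gU]
  · intro y hy
    have q := hQ p R v h hp1 hR1 y hy
    have g := hG p R v h y (by linarith)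
    have u := norm_gU_le y
    have e1 : SS v y - gU y^2/2 = QQ v y + (gz v y + gU y) * (gz v y - gU y) / 2 := by unfold QQ; ring
    have e2 : -((FF p v y : ℝ):ℂ)/4 - -((Real.exp (Uc y) : ℝ) : ℂ) / 4 = ((-(FF p v y - Real.exp (Uc y))/4 : ℝ) : ℂ) := by
      push_cast; ring
    have b1 : ‖SS v y - gU y^2/2‖ ≤ η / E / 2 + (CG + 1) * ‖gz v y - gU y‖ / 2 := by
      rw [e1]
      refine (norm_add_le _ _).trans ?_
      gcongr
      rw [norm_div, norm_mul]
      simp only [Complex.norm_ofNat]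
      gcongr
      exact (norm_add_le _ _).trans (by linarith)
    have b2 : |FF p v y - Real.exp (Uc y)| ≤ 200 / p + |v y - Uc y| := by
      have := h.F_sub_exp (z := y) (by linarith)
      have := exp_lip (h.neg y (by linarith)).2 (Uc_nonpos y)
      have := abs_sub_le (FF p v y) (Real.exp (v y)) (Real.exp (Uc y))
      linarith
    have b3 : 50 / p ≤ η / E / 2 := by
      rw [div_le_iff₀ hη] at hp2
      rw [div_div, div_le_div_iff₀ hppos (by positivity)]
      linarith
    rw [e2, Complex.norm_real, Real.norm_eq_abs, abs_div, abs_neg, abs_of_pos (by norm_num : (0:ℝ) < 4)]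
    have b4 : 200 / p = 4 * (50 / p) := by ring
    nlinarith [mul_nonneg hCG.le (abs_nonneg (v y - Uc y)), abs_nonneg (v y - Uc y), mul_nonneg hCG.le (norm_nonneg (gz v y - gU y)), norm_nonneg (gz v y - gU y)]

end LE

namespace LE
open ComplexConjugate

structure Adm (C0 N p R : ℝ) (v : ℂ → ℝ) : Prop where
  loc : Loc C0 p R v
  hN : 1 ≤ N
  hpN : N ≤ p
  hRN : N ≤ R
  massN : ∫ z in closedBall 0 R, FF p v z ≤ 8 * π + 1 / N
  hpow : p ^ N ≤ R
  hlog : Real.log R ≤ C0 * p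

lemma Adm.mono {C0 N N' p R : ℝ} {v : ℂ → ℝ} (h : Adm C0 N' p R v) (h1 : 1 ≤ N) (h2 : N ≤ N') : Adm C0 N p R v where
  loc := h.loc
  hN := h1
  hpN := h2.trans h.hpN
  hRN := h2.trans h.hRN
  massN := h.massN.trans (by gcongr)
  hpow := (Real.rpow_le_rpow_of_exponent_le (by linarith [h.loc.hp]) h2).trans h.hpow
  hlog := h.hlog

lemma int_eU (K : ℝ) (hK : 0 ≤ K) : ∫ z in ball (0:ℂ) K, Real.exp (Uc z) = 8 * π - 64 * π / (8 + K^2) := by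
  have e1 : ∫ z in ball (0:ℂ) K, Real.exp (Uc z) = ∫ z : ℂ, (Set.Iio K).indicator (fun y => 64 / (8 + y^2)^2) ‖z‖ := by
    rw [← integral_indicator measurableSet_ball]
    congr 1; ext z
    by_cases hz : ‖z‖ < K
    · rw [Set.indicator_of_mem (by simpa using hz), Set.indicator_of_mem (by simpa using hz), exp_Uc]
    · rw [Set.indicator_of_notMem (by simpa using hz), Set.indicator_of_notMem (by simpa using hz)]
  rw [e1, int_rad (fun y => (Set.Iio K).indicator (fun y => 64 / (8 + y^2)^2) y)]
  have e2 : ∫ y in Set.Ioi (0:ℝ), y * (Set.Iio K).indicator (fun y => 64 / (8 + y^2)^2) y = ∫ y in (0:ℝ)..K, y * (64 / (8 + y^2)^2) := by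
    rw [intervalIntegral.integral_of_le hK, integral_Ioc_eq_integral_Ioo, ← Set.Ioi_inter_Iio, ← setIntegral_indicator measurableSet_Iio]
    congr 1; ext y
    by_cases hy : y ∈ Set.Iio K
    · simp only [Set.indicator_of_mem hy]
    · simp only [Set.indicator_of_notMem hy, mul_zero]
  have e3 : ∫ y in (0:ℝ)..K, y * (64 / (8 + y^2)^2) = -32/(8+K^2) - -32/(8+0^2) := by
    apply intervalIntegral.integral_eq_sub_of_hasDerivAt (f := fun y => -32/(8+y^2))
    · intro y _
      have h : 0 < 8 + y^2 := by positivity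
      have := ((hasDerivAt_const y (-32:ℝ))).div (((hasDerivAt_id y).pow 2).const_add 8) h.ne'
      convert! this using 1
      simp
      ring
    · apply Continuous.intervalIntegrable
      apply continuous_id.mul
      apply continuous_const.div (by fun_prop)
      intro y; positivity
  rw [e2, e3]
  field_simp
  ring

lemma mass_ball (C0 : ℝ) : ∃ N ≥ 1, ∀ p R v, Adm C0 N p R v → 8 * π - 1 ≤ ∫ z in ball 0 21, FF p v z := by
  obtain ⟨p0, R0, h0⟩ := vU_close C0 (1/10000) (by norm_num) 21
  refine ⟨max (max p0 R0) 4000000, (by norm_num : (1:ℝ) ≤ 4000000).trans (le_max_right _ _), ?_⟩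
  intro p R v ha
  have h := ha.loc
  have n1 := (le_max_left p0 R0).trans (le_max_left _ 4000000)
  have n2 := (le_max_right p0 R0).trans (le_max_left _ 4000000)
  have n3 := le_max_right (max p0 R0) 4000000
  have hpN := ha.hpN
  have hRN := ha.hRN
  have hp := h.ppos
  have key : ∀ z ∈ ball (0:ℂ) 21, Real.exp (Uc z) - 1/5000 ≤ FF p v z := by
    intro z hz
    have hz' : ‖z‖ < 21 := by simpa using hz
    have a := (h0 p R v h (by linarith) (by linarith) z hz'.le).1
    have b := h.F_sub_exp (z := z) (by linarith)
    have c := exp_lip (h.neg z (by linarith)).2 (Uc_nonpos z)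
    have d : 200 / p ≤ 1/10000 := by rw [div_le_div_iff₀ hp (by norm_num)]; linarith
    have b' := abs_le.1 b
    have c' := abs_le.1 c
    linarith
  have hi : IntegrableOn (fun z => Real.exp (Uc z)) (ball (0:ℂ) 21) := by
    have hc : Continuous (fun z => Real.exp (Uc z)) := by
      simp only [exp_Uc]
      apply continuous_const.div (by fun_prop)
      intro z; positivity
    exact (hc.continuousOn.integrableOn_compact (isCompact_closedBall 0 21)).mono_set ball_subset_closedBall
  have hi2 : IntegrableOn (fun z : ℂ => (1/5000:ℝ)) (ball (0:ℂ) 21) :=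
    (continuousOn_const.integrableOn_compact (isCompact_closedBall 0 21)).mono_set ball_subset_closedBall
  have h1 := setIntegral_mono_on (hi.sub hi2)
    ((h.contF.continuousOn.integrableOn_compact (isCompact_closedBall 0 21)).mono_set ball_subset_closedBall) measurableSet_ball
    key
  simp only [Pi.sub_apply] at h1
  rw [integral_sub hi hi2, int_eU 21 (by norm_num), setIntegral_const] at h1
  have hv : volume.real (ball (0:ℂ) 21) = π * 441 := by
    rw [Measure.real, Complex.volume_ball]
    simp [ENNReal.toReal_ofReal]; norm_num; ring
  rw [hv, smul_eq_mul] at h1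
  have := Real.pi_lt_d2
  norm_num at h1
  linarith

lemma decay (C0 : ℝ) : ∃ N ≥ 1, ∃ C > 0, ∀ p R v, Adm C0 N p R v → ∀ z, ‖z‖ ≤ R/4 →
    Real.exp (6/7 * v z) ≤ C / (1 + ‖z‖)^3 := by
  obtain ⟨N, hN, hm⟩ := mass_ball C0
  obtain ⟨C1, hC1, h1⟩ := log_upper C0
  refine ⟨max N 42, hN.trans (le_max_left _ _), Real.exp (C1 + 8 * π * Real.log 84), Real.exp_pos _, ?_⟩
  intro p R v ha z hz
  have h := ha.loc
  have hz0 := norm_nonneg z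
  have hl84 : 0 ≤ Real.log 84 := Real.log_nonneg (by norm_num)
  have hpi := Real.pi_gt_d2
  suffices hs : 6/7 * v z ≤ C1 + 8 * π * Real.log 84 - 3 * Real.log (1 + ‖z‖) by
    calc Real.exp (6/7 * v z) ≤ Real.exp (C1 + 8 * π * Real.log 84 - 3 * Real.log (1 + ‖z‖)) := Real.exp_le_exp.2 hs
      _ = _ := by
        rw [Real.exp_sub]
        congr 1
        rw [show (3:ℝ) * Real.log (1 + ‖z‖) = Real.log ((1+‖z‖)^3) by rw [Real.log_pow]; norm_num, Real.exp_log (by positivity)]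
  by_cases hz42 : 42 ≤ ‖z‖
  · have hR42 : 42 ≤ R := (le_max_right _ _).trans ha.hRN
    have hN' := hm p R v (ha.mono hN (le_max_left _ _))
    have hmass : ∫ z in closedBall 0 R, FF p v z ≤ 8 * π + 1 := by
      refine ha.massN.trans ?_
      have : 1 / max N 42 ≤ 1 := by rw [div_le_one (by positivity)]; exact ha.hN
      linarith
    have := h1 p R v h 21 (8*π-1) (8*π+1) (by norm_num) (by linarith) hmass hN' z (by linarith) hz
    have e : Real.log (1 + ‖z‖) ≤ Real.log (‖z‖/(2*21)) + Real.log 84 := by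
      rw [← Real.log_mul (by positivity) (by norm_num)]
      apply Real.log_le_log (by positivity)
      linarith
    have l0 : 0 ≤ Real.log (1 + ‖z‖) := Real.log_nonneg (by linarith)
    have q : 2 * π * v z ≤ -((8*π-1) * (Real.log (1+‖z‖) - Real.log 84)) + 2 * Real.log (1+‖z‖) + C1 := by
      have : (8*π-1) * (Real.log (1+‖z‖) - Real.log 84) ≤ (8*π-1) * Real.log (‖z‖/(2*21)) := by
        gcongr
        · linarith
        · linarith
      linarith
    have hv := (h.neg z (by linarith [h.Rpos])).2
    have q2 : 2 * π * v z + (8 * π - 3) * Real.log (1+‖z‖) ≤ C1 + 8 * π * Real.log 84 := by nlinarith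
    have q3 : 2 * π * (v z + 7/2 * Real.log (1+‖z‖)) ≤ C1 + 8 * π * Real.log 84 := by nlinarith
    have q4 : 0 ≤ C1 + 8 * π * Real.log 84 := by positivity
    by_cases hs : 0 ≤ v z + 7/2 * Real.log (1+‖z‖)
    · nlinarith
    · linarith
  · have : Real.log (1+‖z‖) ≤ Real.log 84 := Real.log_le_log (by positivity) (by linarith)
    have hv := (h.neg z (by linarith [h.Rpos])).2
    nlinarith

lemma Gdecay (C0 : ℝ) : ∃ N ≥ 1, ∃ C > 0, ∀ p R v, Adm C0 N p R v → ∀ z, ‖z‖ ≤ R/8 →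
    ‖gz v z‖ ≤ C / (1 + ‖z‖) := by
  by_cases hC0 : 0 < C0
  swap
  · exact ⟨1, le_rfl, 1, one_pos, fun p R v h => absurd h.loc.hC hC0⟩
  obtain ⟨N, hN, C1, hC1, h1⟩ := decay C0
  obtain ⟨C2, hC2, h2⟩ := G_rep C0
  refine ⟨N, hN, 8 * π * C1 + 2 * C0 + C2, by positivity, ?_⟩
  intro p R v ha z hz
  have h := ha.loc
  have hR := h.hR
  have hz0 := norm_nonneg z
  have hsub : closedBall (0:ℂ) (3*R/4) ⊆ closedBall 0 R := closedBall_subset_closedBall (by linarith)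
  have h3 := near_est h.contF (isCompact_closedBall 0 (3*R/4)) (z := z) (ρ := (1+‖z‖)/2) (S := 8 * C1 / (1+‖z‖)^3) (m := C0) (by positivity)
    (fun ζ hζ => (h.Fpos (by simpa using hsub hζ)).le) (by positivity) ?_ ((h.mass_sub hsub).trans h.mass)
  · have h4 := h2 p R v h z (by linarith)
    have e1 : C2 / R ≤ C2 / (1 + ‖z‖) := by gcongr; linarith
    have e2 : 2 * π * ((1+‖z‖)/2) * (8 * C1 / (1+‖z‖)^3) ≤ 8 * π * C1 / (1+‖z‖) := by
      have : 2 * π * ((1+‖z‖)/2) * (8 * C1 / (1+‖z‖)^3) = 8 * π * C1 / (1+‖z‖)^2 := by field_simp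
      rw [this]
      gcongr
      nlinarith
    have e3 : C0 / ((1+‖z‖)/2) = 2 * C0 / (1+‖z‖) := by field_simp
    rw [add_div, add_div]
    linarith
  · intro ζ hζ hd
    have a := norm_sub_norm_le ζ z
    have b := norm_sub_norm_le z ζ
    rw [norm_sub_rev] at b
    have hζ4 : ‖ζ‖ ≤ R/4 := by linarith
    have hv := (h.neg ζ (by linarith)).2
    calc FF p v ζ ≤ Real.exp (v ζ) := h.F_le_exp (by linarith)
      _ ≤ Real.exp (6/7 * v ζ) := Real.exp_le_exp.2 (by linarith)
      _ ≤ C1 / (1+‖ζ‖)^3 := h1 p R v ha ζ hζ4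
      _ ≤ C1 / ((1+‖z‖)/2)^3 := by gcongr; linarith
      _ = _ := by field_simp; ring

end LE

namespace LE
open ComplexConjugate

lemma int_cube : Integrable (fun ζ : ℂ => 1 / (1 + ‖ζ‖)^3) := by
  have := integrable_one_add_norm (E := ℂ) (μ := volume) (r := 3) (by simp [Complex.finrank_real_complex]; norm_num)
  convert! this using 2 with ζ
  rw [Real.rpow_neg (by positivity), one_div]
  norm_cast

lemma cont_cube : Continuous (fun ζ : ℂ => 1 / (1 + ‖ζ‖)^3) :=
  continuous_const.div (by fun_prop) (fun ζ => by positivity)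

lemma kern : ∃ C > 0, ∀ (L : ℝ) (w : ℂ), ∫ ζ in closedBall (0:ℂ) L, (1 / (1 + ‖ζ‖)^3) / ‖ζ - w‖ ≤ C / (1 + ‖w‖) := by
  set m := ∫ ζ : ℂ, 1 / (1 + ‖ζ‖)^3 with hm
  have hm0 : 0 ≤ m := integral_nonneg fun ζ => by positivity
  refine ⟨8 * π + 2 * m, by positivity, ?_⟩
  intro L w
  have hw := norm_nonneg w
  have h3 := near_est cont_cube (isCompact_closedBall (0:ℂ) L) (z := w) (ρ := (1+‖w‖)/2) (S := 8 / (1+‖w‖)^3) (m := m) (by positivity)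
    (fun ζ hζ => by positivity) (by positivity) ?_ (setIntegral_le_integral int_cube (Eventually.of_forall fun ζ => by positivity))
  · refine h3.trans ?_
    have e2 : 2 * π * ((1+‖w‖)/2) * (8 / (1+‖w‖)^3) ≤ 8 * π / (1+‖w‖) := by
      have : 2 * π * ((1+‖w‖)/2) * (8 / (1+‖w‖)^3) = 8 * π / (1+‖w‖)^2 := by field_simp
      rw [this]
      gcongr
      nlinarith
    have e3 : m / ((1+‖w‖)/2) = 2 * m / (1+‖w‖) := by field_simp
    rw [add_div (8*π)]
    linarith
  · intro ζ hζ hd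
    have b := norm_sub_norm_le w ζ
    rw [norm_sub_rev] at b
    calc 1 / (1+‖ζ‖)^3 ≤ 1 / ((1+‖w‖)/2)^3 := by gcongr; linarith
      _ = _ := by field_simp; ring

/-- cp_est with a cubic decay -/
lemma cp_cube : ∃ C > 0, ∀ (ψ : ℂ → ℂ), ContDiff ℝ 1 ψ → ∀ (L B D : ℝ) (w : ℂ), 0 < L → 0 ≤ D → ‖w‖ ≤ L / 2 →
    (∀ ζ, L ≤ ‖ζ‖ → ‖ζ‖ ≤ 3 * L / 2 → ‖ψ ζ‖ ≤ B) → (∀ ζ, ‖ζ‖ ≤ 3 * L / 2 → ‖dzb ψ ζ‖ ≤ D / (1 + ‖ζ‖)^3) →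
    ‖ψ w‖ ≤ C * (D / (1 + ‖w‖) + B) := by
  obtain ⟨C1, hC1, h1⟩ := kern
  obtain ⟨C2, hC2, h2⟩ := cp_est
  refine ⟨C1 + C2, by positivity, ?_⟩
  intro ψ hψ L B D w hL hD hw hB hd
  have hB0 : 0 ≤ B := (norm_nonneg _).trans (hB (L:ℂ) (by simp [abs_of_pos hL]) (by simp [abs_of_pos hL]; linarith))
  have h3 := h2 ψ hψ L B w hL hw hB
  have h4 : ∫ ζ in closedBall (0:ℂ) (3*L/2), ‖dzb ψ ζ‖ / ‖ζ - w‖ ≤ D * (C1 / (1 + ‖w‖)) := by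
    calc _ ≤ ∫ ζ in closedBall (0:ℂ) (3*L/2), D * ((1 / (1 + ‖ζ‖)^3) / ‖ζ - w‖) := by
          apply setIntegral_mono_on
          · exact integrableOn_div_norm ((contDiff_dzb (m := 0) hψ (by norm_num)).continuous.norm) w (isCompact_closedBall _ _)
          · exact (integrableOn_div_norm cont_cube w (isCompact_closedBall _ _)).const_mul D
          · exact isClosed_closedBall.measurableSet
          · intro ζ hζ
            have := hd ζ (by simpa using hζ)
            rw [← mul_div_assoc, mul_one_div]
            gcongr
      _ = D * ∫ ζ in closedBall (0:ℂ) (3*L/2), (1 / (1 + ‖ζ‖)^3) / ‖ζ - w‖ := integral_const_mul _ _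
      _ ≤ _ := by gcongr; exact h1 _ w
  have : 0 ≤ D / (1 + ‖w‖) := by positivity
  have e : D * (C1 / (1+‖w‖)) = C1 * (D / (1+‖w‖)) := by ring
  nlinarith [mul_nonneg hC2.le this, mul_nonneg hC1.le hB0]

lemma Qann (C0 : ℝ) : ∃ N ≥ 1, ∃ C > 0, ∀ p R v, Adm C0 N p R v → ∀ z, R/16 ≤ ‖z‖ → ‖z‖ ≤ 3*R/32 →
    ‖QQ v z‖ ≤ C / R^2 := by
  obtain ⟨N1, hN1, C1, hC1, h1⟩ := decay C0
  obtain ⟨N2, hN2, C2, hC2, h2⟩ := Gdecay C0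
  obtain ⟨Cg, hCg, hg⟩ := grad_est
  refine ⟨max N1 N2, hN1.trans (le_max_left _ _), Cg * (C1 * C2 * 32^4 / 64 + 2048 * C2) + 512 * C2^2, by positivity, ?_⟩
  intro p R v ha z hz1 hz2
  have h := ha.loc
  have hR := h.hR
  have d1 := h1 p R v (ha.mono hN1 (le_max_left _ _))
  have d2 := h2 p R v (ha.mono hN2 (le_max_right _ _))
  have hb : ∀ ζ : ℂ, ‖ζ - z‖ ≤ 3 * (R/64) / 2 → R/32 ≤ ‖ζ‖ ∧ ‖ζ‖ ≤ R/8 := by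
    intro ζ hζ
    have a := norm_sub_norm_le ζ z
    have b := norm_sub_norm_le z ζ
    rw [norm_sub_rev] at b
    constructor <;> linarith
  have hGb : ∀ ζ : ℂ, R/32 ≤ ‖ζ‖ → ‖ζ‖ ≤ R/8 → ‖gz v ζ‖ ≤ 32 * C2 / R := by
    intro ζ q1 q2
    calc ‖gz v ζ‖ ≤ C2 / (1 + ‖ζ‖) := d2 ζ q2
      _ ≤ C2 / (R/32) := by gcongr; linarith
      _ = _ := by field_simp
  have := hg (gz v) h.cG z (R/64) (C1 * C2 * 32^4 / R^4) (32 * C2 / R) (by linarith) ?_ ?_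
  · have g1 := hGb z (by linarith) (by linarith)
    have e : R/64 * (C1 * C2 * 32^4 / R^4) ≤ C1 * C2 * 32^4 / 64 / R^2 := by
      have : R/64 * (C1 * C2 * 32^4 / R^4) = C1 * C2 * 32^4 / 64 / R^3 := by field_simp
      rw [this]
      gcongr
      · linarith
      · norm_num
    calc ‖QQ v z‖ ≤ ‖SS v z‖ + ‖gz v z ^ 2 / 2‖ := norm_sub_le _ _
      _ = ‖dz (gz v) z‖ + ‖gz v z‖^2/2 := by rw [norm_div, norm_pow]; simp [SS]
      _ ≤ Cg * (R/64 * (C1 * C2 * 32^4 / R^4) + 32 * C2 / R/(R/64)) + (32 * C2 / R)^2/2 := by gcongr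
      _ ≤ Cg * (C1 * C2 * 32^4 / 64 / R^2 + 32 * C2 / R/(R/64)) + (32 * C2 / R)^2/2 := by gcongr
      _ = _ := by field_simp; ring
  · intro ζ hζ
    have ⟨q1, q2⟩ := hb ζ hζ
    refine (h.norm_dzbS (by linarith)).trans ?_
    have f1 := h.F1_le_exp (z := ζ) (by linarith)
    have hv := (h.neg ζ (by linarith)).2
    have f2 : FF1 p v ζ ≤ C1 / (R/32)^3 := by
      calc FF1 p v ζ ≤ Real.exp (6/7 * v ζ) := f1.trans (Real.exp_le_exp.2 (by linarith))
        _ ≤ C1 / (1 + ‖ζ‖)^3 := d1 ζ (by linarith)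
        _ ≤ _ := by gcongr; linarith
    calc FF1 p v ζ * ‖gz v ζ‖ ≤ (C1 / (R/32)^3) * (32 * C2 / R) := by gcongr; exact hGb ζ q1 q2
      _ = _ := by field_simp
  · intro ζ hζ
    exact hGb ζ (hb ζ hζ).1 (hb ζ hζ).2

lemma dzbQ_decay (C0 : ℝ) : ∃ N ≥ 1, ∃ C > 0, ∀ p R v, Adm C0 N p R v → ∀ z, ‖z‖ ≤ R/8 →
    ‖dzb (QQ v) z‖ ≤ C / p / (1 + ‖z‖)^4 := by
  obtain ⟨N1, hN1, C1, hC1, h1⟩ := decay C0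
  obtain ⟨N2, hN2, C2, hC2, h2⟩ := Gdecay C0
  refine ⟨max N1 N2, hN1.trans (le_max_left _ _), 4 * C2 * C1, by positivity, ?_⟩
  intro p R v ha z hz
  have h := ha.loc
  have hR := h.hR
  have hp := h.ppos
  have d1 := h1 p R v (ha.mono hN1 (le_max_left _ _)) z (by linarith)
  have d2 := h2 p R v (ha.mono hN2 (le_max_right _ _)) z hz
  calc _ ≤ 4 * ‖gz v z‖ * Real.exp (6/7 * v z) / p := h.norm_dzbQ (by linarith)
    _ ≤ 4 * (C2 / (1 + ‖z‖)) * (C1 / (1 + ‖z‖)^3) / p := by gcongr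
    _ = _ := by field_simp

lemma Qdecay (C0 : ℝ) : ∃ N ≥ 1, ∃ C > 0, ∀ p R v, Adm C0 N p R v → ∀ z, ‖z‖ ≤ R/32 → p * (1 + ‖z‖) ≤ R →
    ‖QQ v z‖ ≤ C / p / (1 + ‖z‖)^2 := by
  obtain ⟨N1, hN1, C1, hC1, h1⟩ := Qann C0
  obtain ⟨N2, hN2, C2, hC2, h2⟩ := dzbQ_decay C0
  obtain ⟨C3, hC3, h3⟩ := cp_cube
  refine ⟨max N1 N2, hN1.trans (le_max_left _ _), C3 * (2 * C2 + 2 * C1), by positivity, ?_⟩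
  intro p R v ha z hz hpz
  have h := ha.loc
  have hR := h.hR
  have hp := h.ppos
  have hp14 := h.hp
  have hz0 := norm_nonneg z
  have d1 := h1 p R v (ha.mono hN1 (le_max_left _ _))
  have d2 := h2 p R v (ha.mono hN2 (le_max_right _ _))
  have hRi : C1 / R ≤ C1 / p / (1 + ‖z‖) := by rw [div_div]; gcongr
  have q1 := h3 (QQ v) h.cQ (R/16) (C1/R^2) (C2/p) z (by linarith) (by positivity) (by linarith)
    (fun ζ a b => d1 ζ a (by linarith)) ?_
  have q2 := h3 (fun ζ => ζ * QQ v ζ) (contDiff_id.mul h.cQ) (R/16) (C1/R) (C2/p) z (by linarith) (by positivity) (by linarith)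
    ?_ ?_
  · have hR2 : C1 / R^2 ≤ C1 / R := by gcongr; nlinarith
    have e1 : ‖QQ v z‖ ≤ C3 * ((C2 + C1) / p / (1 + ‖z‖)) := by
      refine q1.trans ?_
      gcongr
      rw [add_div, add_div]
      linarith
    have e2 : ‖z‖ * ‖QQ v z‖ ≤ C3 * ((C2 + C1) / p / (1 + ‖z‖)) := by
      rw [norm_mul] at q2
      refine q2.trans ?_
      gcongr
      rw [add_div, add_div]
      linarith
    have e3 : (1 + ‖z‖) * ‖QQ v z‖ ≤ C3 * (2 * C2 + 2 * C1) / p / (1 + ‖z‖) := by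
      have : C3 * (2 * C2 + 2 * C1) / p / (1 + ‖z‖) = 2 * (C3 * ((C2 + C1) / p / (1 + ‖z‖))) := by field_simp
      rw [this]; linarith
    have e4 : C3 * (2 * C2 + 2 * C1) / p / (1 + ‖z‖)^2 = (C3 * (2 * C2 + 2 * C1) / p / (1 + ‖z‖)) / (1+‖z‖) := by field_simp
    rw [e4, le_div_iff₀ (by positivity)]
    linarith
  · intro ζ a b
    rw [norm_mul]
    have := d1 ζ a (by linarith)
    calc ‖ζ‖ * ‖QQ v ζ‖ ≤ R * (C1 / R^2) := by gcongr; linarith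
      _ = _ := by field_simp
  · intro ζ hζ
    have hd : DifferentiableAt ℝ (QQ v) ζ := h.cQ.contDiffAt.differentiableAt one_ne_zero
    have e := ((HasW.id ζ).mul (LE.DifferentiableAt.hasW hd)).dzb
    rw [e, zero_mul, zero_add, norm_mul]
    calc ‖ζ‖ * ‖dzb (QQ v) ζ‖ ≤ (1 + ‖ζ‖) * (C2 / p / (1 + ‖ζ‖)^4) := by gcongr; linarith; exact d2 ζ (by linarith)
      _ = _ := by field_simp
  · intro ζ hζ
    refine (d2 ζ (by linarith)).trans ?_
    gcongr
    · linarith [norm_nonneg ζ]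
    · norm_num

end LE

namespace LE
open ComplexConjugate

lemma g_up (C0 δ : ℝ) (hδ : 0 < δ) : ∃ N ≥ 1, ∃ C > 0, ∀ p R v, Adm C0 N p R v → ∀ z, ‖z‖ ≤ R/4 →
    Real.exp (-v z / 2) ≤ C * (1 + ‖z‖)^2 * (1 + ‖z‖)^δ := by
  obtain ⟨C1, hC1, h1⟩ := log_lower C0
  refine ⟨max 1 (1/δ), le_max_left _ _, Real.exp (C1/2), Real.exp_pos _, ?_⟩
  intro p R v ha z hz
  have h := ha.loc
  have hl : 0 ≤ Real.log (1 + ‖z‖) := Real.log_nonneg (by linarith [norm_nonneg z])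
  have := h1 p R v h _ ha.massN z hz
  have e1 : 1 / max 1 (1/δ) ≤ δ := by
    rw [div_le_iff₀ (by positivity)]
    calc 1 = δ * (1/δ) := by field_simp
      _ ≤ _ := by gcongr; exact le_max_right _ _
  have e2 : (8 * π + 1 / max 1 (1/δ)) / (2*π) ≤ 4 + 2 * δ := by
    rw [div_le_iff₀ (by positivity)]
    have := Real.pi_gt_d2
    nlinarith
  have e3 : -v z / 2 ≤ C1/2 + Real.log (1+‖z‖) * (2 + δ) := by nlinarith
  calc _ ≤ Real.exp (C1/2 + Real.log (1+‖z‖) * (2 + δ)) := Real.exp_le_exp.2 e3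
    _ = Real.exp (C1/2) * ((1+‖z‖)^((2:ℝ)+δ)) := by
      rw [Real.exp_add, Real.rpow_def_of_pos (by positivity : (0:ℝ) < 1 + ‖z‖)]
    _ = _ := by
      rw [Real.rpow_add (by positivity), mul_assoc]
      norm_cast

namespace Loc
variable {C0 p R : ℝ} {v : ℂ → ℝ}

def kk (p : ℝ) (v : ℂ → ℝ) (z : ℂ) : ℂ := (Real.exp (-v z/2) : ℂ) * (FF p v z / 8 + gz v z * conj (gz v z) / 4)
def PP (v : ℂ → ℝ) (z : ℂ) : ℂ := -(1/2) * ((Real.exp (-v z/2) : ℂ) * gz v z)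

lemma hasWg (h : Loc C0 p R v) (z : ℂ) : HasW (fun z => (Real.exp (-v z/2) : ℂ)) (PP v z) (conj (PP v z)) z := by
  have h1 : HasDerivAt (fun x : ℂ => Complex.exp (-x/2)) (Complex.exp (-(v z : ℂ)/2) * (-1/2)) (v z : ℂ) := by
    have := (((hasDerivAt_id (v z : ℂ)).neg).div_const 2).cexp
    simpa using this
  have := (h.hasWv z).scomp h1
  have e : ∀ z, Complex.exp (-(v z:ℂ)/2) = (Real.exp (-v z/2) : ℂ) := by intro z; push_cast; rfl
  simp only [e] at this
  convert! this using 1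
  · unfold PP; ring
  · unfold PP; simp only [map_mul, map_neg, map_div₀, map_one, Complex.conj_ofReal, map_ofNat]; ring

lemma hasWP (h : Loc C0 p R v) {z : ℂ} (hz : ‖z‖ < R) : HasW (PP v) (-(1/2) * ((Real.exp (-v z/2) : ℂ) * QQ v z)) (kk p v z) z := by
  have := (HasW.const (-(1/2)) z).mul ((h.hasWg z).mul (h.hasWG hz))
  convert! this using 1
  · unfold PP QQ; ring
  · unfold PP kk; simp only [map_mul, map_neg, map_div₀, map_one, Complex.conj_ofReal, map_ofNat]; ring

def kz (p : ℝ) (v : ℂ → ℝ) (z : ℂ) : ℂ :=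
  (Real.exp (-v z/2) : ℂ) * (((FF1 p v z - FF p v z : ℝ) : ℂ) * gz v z / 8 + conj (gz v z) * QQ v z / 4)

lemma hasWk (h : Loc C0 p R v) {z : ℂ} (hz : ‖z‖ < R) : HasW (kk p v) (kz p v z) (conj (kz p v z)) z := by
  have h1 := (HasW.const (1/8) z).mul (h.hasWF hz)
  have h2 := (HasW.const (1/4) z).mul ((h.hasWG hz).mul (h.hasWG hz).conj)
  have h3 := (h.hasWg z).mul (h1.add h2)
  convert! h3 using 1
  · ext y; unfold kk; ring
  · unfold kz PP QQ
    simp only [map_mul, map_neg, map_div₀, map_one, Complex.conj_ofReal, map_ofNat, Complex.ofReal_sub]; ring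
  · unfold kz PP QQ
    simp only [map_mul, map_neg, map_div₀, map_one, Complex.conj_ofReal, map_ofNat, Complex.ofReal_sub, map_add, map_sub, map_pow, Complex.conj_conj]; ring

end Loc
end LE

namespace LE
open ComplexConjugate
open Loc

lemma ray_norm_eq {s : ℝ} {z : ℂ} (h0 : 0 ≤ s) : ‖(s:ℂ) * z‖ = s * ‖z‖ := by
  rw [norm_mul, Complex.norm_real, Real.norm_of_nonneg h0]

lemma kz_bound (C0 δ : ℝ) (hδ : 0 < δ) : ∃ N ≥ 1, ∃ C > 0, ∀ p R v, Adm C0 N p R v → ∀ z, ‖z‖ ≤ R/32 → p * (1 + ‖z‖) ≤ R →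
    ‖kz p v z‖ ≤ C / p * (1 + ‖z‖)^(δ - 1) ∧ ‖(Real.exp (-v z/2) : ℂ) * QQ v z‖ ≤ C / p * (1 + ‖z‖)^δ := by
  obtain ⟨N1, hN1, C1, hC1, h1⟩ := g_up C0 δ hδ
  obtain ⟨N2, hN2, C2, hC2, h2⟩ := decay C0
  obtain ⟨N3, hN3, C3, hC3, h3⟩ := Gdecay C0
  obtain ⟨N4, hN4, C4, hC4, h4⟩ := Qdecay C0
  refine ⟨max (max N1 N2) (max N3 N4), hN1.trans ((le_max_left _ _).trans (le_max_left _ _)), C1 * (2 * C2 * C3 + C3 * C4) + C1 * C4, by positivity, ?_⟩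
  intro p R v ha z hz hpz
  have h := ha.loc
  have hp := h.ppos
  have hR := h.hR
  have d1 := h1 p R v (ha.mono hN1 ((le_max_left _ _).trans (le_max_left _ _))) z (by linarith)
  have d2 := h2 p R v (ha.mono hN2 ((le_max_right _ _).trans (le_max_left _ _))) z (by linarith)
  have d3 := h3 p R v (ha.mono hN3 ((le_max_left _ _).trans (le_max_right _ _))) z (by linarith)
  have d4 := h4 p R v (ha.mono hN4 ((le_max_right _ _).trans (le_max_right _ _))) z hz hpz
  set A := 1 + ‖z‖ with hA
  have hA1 : 1 ≤ A := by linarith [norm_nonneg z]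
  have hA0 : 0 < A := by linarith
  have hng : ‖(Real.exp (-v z/2) : ℂ)‖ = Real.exp (-v z/2) := by
    rw [Complex.norm_real, Real.norm_of_nonneg (Real.exp_pos _).le]
  have hAd : 0 < A^δ := by positivity
  have eA : A^(δ-1) = A^δ / A := by rw [Real.rpow_sub_one hA0.ne']
  constructor
  · have e1 : ‖((FF1 p v z - FF p v z : ℝ) : ℂ)‖ ≤ 14 * (C2 / A^3) / p := by
      rw [Complex.norm_real, h.F1_sub (z := z) (by linarith), Real.norm_of_nonneg]
      · apply div_le_div_of_nonneg_right _ hp.le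
        have := h.tF1 (z := z) (by linarith)
        refine this.trans ?_
        linarith
      · have := (h.neg z (by linarith)).2
        have := (h.F1pos (z := z) (by linarith)).le
        apply div_nonneg (mul_nonneg (by linarith) this) hp.le
    have e2 : ‖((FF1 p v z - FF p v z : ℝ) : ℂ) * gz v z / 8 + conj (gz v z) * QQ v z / 4‖ ≤
        (2 * C2 * C3 + C3 * C4) / p / A^3 := by
      calc _ ≤ ‖((FF1 p v z - FF p v z : ℝ) : ℂ) * gz v z / 8‖ + ‖conj (gz v z) * QQ v z / 4‖ := norm_add_le _ _
        _ = ‖((FF1 p v z - FF p v z : ℝ) : ℂ)‖ * ‖gz v z‖ / 8 + ‖gz v z‖ * ‖QQ v z‖ / 4 := by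
            rw [norm_div, norm_div, norm_mul, norm_mul, Complex.norm_conj]; simp only [Complex.norm_ofNat]
        _ ≤ (14 * (C2 / A^3) / p) * (C3 / A) / 8 + (C3 / A) * (C4 / p / A^2) / 4 := by gcongr
        _ = (14 / 8 * C2 * C3 / A + C3 * C4 / 4) / p / A^3 := by field_simp
        _ ≤ _ := by
            gcongr
            · calc 14 / 8 * C2 * C3 / A ≤ 14 / 8 * C2 * C3 := div_le_self (by positivity) hA1
                _ ≤ 2 * C2 * C3 := by gcongr; norm_num
            · linarith [mul_pos hC3 hC4]
    calc ‖kz p v z‖ ≤ (C1 * A^2 * A^δ) * ((2 * C2 * C3 + C3 * C4) / p / A^3) := by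
          unfold kz; rw [norm_mul, hng]; gcongr
      _ = (C1 * (2 * C2 * C3 + C3 * C4)) / p * A^(δ-1) := by rw [eA]; field_simp
      _ ≤ _ := by gcongr; linarith [mul_pos hC1 hC4]
  · calc _ ≤ (C1 * A^2 * A^δ) * (C4 / p / A^2) := by
          rw [norm_mul, hng]; gcongr
      _ = (C1 * C4) / p * A^δ := by field_simp
      _ ≤ _ := by gcongr; have : 0 < C1 * (2 * C2 * C3 + C3 * C4) := by positivity
                  linarith

lemma k_bound (C0 δ : ℝ) (hδ : 0 < δ) : ∃ N ≥ 1, ∃ C > 0, ∀ p R v, Adm C0 N p R v → ∀ z, ‖z‖ ≤ R/32 → p * (1 + ‖z‖) ≤ R →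
    ‖kk p v z - 1/8‖ ≤ C / p * (1 + ‖z‖)^δ ∧ ‖(Real.exp (-v z/2) : ℂ) * QQ v z‖ ≤ C / p * (1 + ‖z‖)^δ := by
  obtain ⟨N, hN, C, hC, h1⟩ := kz_bound C0 δ hδ
  refine ⟨N, hN, C + 2 * C / δ, by positivity, ?_⟩
  intro p R v ha z hz hpz
  have h := ha.loc
  have hp := h.ppos
  have hR := h.hR
  have hz0 := norm_nonneg z
  refine ⟨?_, ((h1 p R v ha z hz hpz).2).trans ?_⟩
  swap
  · gcongr
    have : 0 < 2 * C / δ := by positivity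
    linarith
  let f : ℝ → ℂ := fun s => kk p v ((s:ℂ)*z) - 1/8
  have hd : ∀ s ∈ Set.Icc (0:ℝ) 1, HasDerivAt f (kz p v ((s:ℂ)*z) * z + conj (kz p v ((s:ℂ)*z)) * conj z) s := by
    intro s hs
    have hn := ray_norm hs.1 hs.2 hz
    exact ((h.hasWk (by linarith)).ray).sub_const _
  have key := image_norm_le_of_norm_deriv_right_le_deriv_boundary' (f := f) (a := 0) (b := 1)
    (fun s hs => (hd s hs).continuousAt.continuousWithinAt)
    (fun s hs => (hd s ⟨hs.1, hs.2.le⟩).hasDerivWithinAt) (B := fun s => 2 * C / δ / p * (1 + s * ‖z‖)^δ)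
    (B' := fun s => 2 * C / δ / p * (‖z‖ * δ * (1 + s * ‖z‖)^(δ-1))) ?_ ?_ ?_ ?_ (x := 1) (by simp)
  · simp only [f, Complex.ofReal_one, one_mul] at key
    refine key.trans ?_
    gcongr
    linarith
  · have : f 0 = 0 := by simp [f, kk, h.v0, h.g0, FF]
    rw [this, norm_zero]; positivity
  · intro s hs
    have hs0 := hs.1
    have : 0 < 1 + s * ‖z‖ := by positivity
    apply ContinuousAt.continuousWithinAt
    apply ContinuousAt.mul continuousAt_const
    exact ContinuousAt.rpow_const (by fun_prop) (Or.inl this.ne')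
  · intro s hs
    have hs0 := hs.1
    have : 0 < 1 + s * ‖z‖ := by positivity
    have h5 : HasDerivAt (fun s : ℝ => 1 + s * ‖z‖) ‖z‖ s := by
      simpa using ((hasDerivAt_id s).mul_const ‖z‖).const_add 1
    exact ((h5.rpow_const (Or.inl this.ne')).const_mul _).hasDerivWithinAt
  · intro s hs
    have hs0 := hs.1
    have hn := ray_norm hs.1 hs.2.le hz
    have hn' := ray_norm_eq (z := z) hs.1
    have hle : s * ‖z‖ ≤ ‖z‖ := mul_le_of_le_one_left hz0 hs.2.le
    have := (h1 p R v ha ((s:ℂ)*z) hn (by rw [hn']; nlinarith)).1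
    rw [hn'] at this
    calc _ ≤ ‖kz p v ((s:ℂ)*z)‖ * ‖z‖ + ‖kz p v ((s:ℂ)*z)‖ * ‖z‖ := by
          refine (norm_add_le _ _).trans ?_
          simp
      _ ≤ (C / p * (1 + s * ‖z‖)^(δ-1)) * ‖z‖ + (C / p * (1 + s * ‖z‖)^(δ-1)) * ‖z‖ := by gcongr
      _ = _ := by field_simp; ring

lemma g_bound (C0 δ : ℝ) (hδ : 0 < δ) : ∃ N ≥ 1, ∃ C > 0, ∀ p R v, Adm C0 N p R v → ∀ z, ‖z‖ ≤ R/32 → p * (1 + ‖z‖) ≤ R →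
    |Real.exp (-v z/2) - (1 + ‖z‖^2/8)| ≤ C / p * (1 + ‖z‖)^2 * (1 + ‖z‖)^δ := by
  obtain ⟨N, hN, C, hC, h1⟩ := k_bound C0 δ hδ
  refine ⟨N, hN, 4 * C, by positivity, ?_⟩
  have hP : ∀ p R v, Adm C0 N p R v → ∀ z, ‖z‖ ≤ R/32 → p * (1 + ‖z‖) ≤ R →
      ‖PP v z - conj z / 8‖ ≤ ‖z‖ * (2 * C / p * (1+‖z‖)^δ) := by
    intro p R v ha z hz hpz
    have h := ha.loc
    have hp := h.ppos
    have hR := h.hR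
    have hz0 := norm_nonneg z
    let f : ℝ → ℂ := fun s => PP v ((s:ℂ)*z) - conj ((s:ℂ)*z) * (1/8)
    have hd : ∀ s ∈ Set.Icc (0:ℝ) 1, HasDerivAt f
        ((-(1/2) * ((Real.exp (-v ((s:ℂ)*z)/2) : ℂ) * QQ v ((s:ℂ)*z)) - 0) * z + (kk p v ((s:ℂ)*z) - 1/8) * conj z) s := by
      intro s hs
      have hn := ray_norm hs.1 hs.2 hz
      have := ((h.hasWP (z := (s:ℂ)*z) (by linarith)).sub ((HasW.cnj _).mul (HasW.const (1/8) _))).ray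
      convert! this using 1
      ring
    have key := norm_image_sub_le_of_norm_deriv_le_segment_01' (f := f) (C := ‖z‖ * (2 * C / p * (1+‖z‖)^δ))
      (fun s hs => (hd s hs).hasDerivWithinAt) ?_
    · have e0 : f 0 = 0 := by simp [f, PP, h.g0]
      rw [e0, sub_zero] at key
      simp only [f, Complex.ofReal_one, one_mul, mul_one_div] at key
      exact key
    · intro s hs
      have hn := ray_norm hs.1 hs.2.le hz
      have hn' := ray_norm_eq (z := z) hs.1
      have hle : s * ‖z‖ ≤ ‖z‖ := mul_le_of_le_one_left hz0 hs.2.le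
      have hs0 := hs.1
      obtain ⟨a, b⟩ := h1 p R v ha ((s:ℂ)*z) hn (by rw [hn']; nlinarith)
      rw [hn'] at a b
      have hmono : (1 + s * ‖z‖)^δ ≤ (1 + ‖z‖)^δ := by gcongr
      have hCp : 0 < C / p := by positivity
      calc _ ≤ ‖(-(1/2) * ((Real.exp (-v ((s:ℂ)*z)/2) : ℂ) * QQ v ((s:ℂ)*z)) - 0) * z‖ + ‖(kk p v ((s:ℂ)*z) - 1/8) * conj z‖ := norm_add_le _ _
        _ = (1/2) * ‖(Real.exp (-v ((s:ℂ)*z)/2) : ℂ) * QQ v ((s:ℂ)*z)‖ * ‖z‖ + ‖kk p v ((s:ℂ)*z) - 1/8‖ * ‖z‖ := by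
            rw [sub_zero, norm_mul, norm_mul (-(1/2) : ℂ), norm_mul (kk p v ((s:ℂ)*z) - 1/8), Complex.norm_conj]
            norm_num
        _ ≤ (1/2) * (C / p * (1 + ‖z‖)^δ) * ‖z‖ + (C / p * (1 + ‖z‖)^δ) * ‖z‖ := by
            gcongr
            · exact b.trans (by gcongr)
            · exact a.trans (by gcongr)
        _ ≤ ‖z‖ * (2 * C / p * (1+‖z‖)^δ) := by
            have : 0 ≤ C / p * (1 + ‖z‖)^δ * ‖z‖ := by positivity
            have e : ‖z‖ * (2 * C / p * (1+‖z‖)^δ) = 2 * (C / p * (1 + ‖z‖)^δ * ‖z‖) := by ring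
            rw [e]; linarith
  intro p R v ha z hz hpz
  have h := ha.loc
  have hp := h.ppos
  have hR := h.hR
  have hz0 := norm_nonneg z
  let f : ℝ → ℂ := fun s => (Real.exp (-v ((s:ℂ)*z)/2) : ℂ) - ((1 + ‖(s:ℂ)*z‖^2/8 : ℝ) : ℂ)
  have hd : ∀ s ∈ Set.Icc (0:ℝ) 1, HasDerivAt f
      ((PP v ((s:ℂ)*z) - conj ((s:ℂ)*z) / 8) * z + conj (PP v ((s:ℂ)*z) - conj ((s:ℂ)*z) / 8) * conj z) s := by
    intro s hs
    have hn := ray_norm hs.1 hs.2 hz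
    have hr : HasDerivAt (fun s : ℝ => 1 + s/8) (1/8) (‖(s:ℂ)*z‖^2) := by
      simpa using ((hasDerivAt_id (‖(s:ℂ)*z‖^2)).div_const 8).const_add 1
    have := ((h.hasWg ((s:ℂ)*z)).sub (HasW.radial hr)).ray
    convert! this using 1
    simp only [map_sub, map_div₀, Complex.conj_conj, map_ofNat]
    push_cast
    ring
  have key := norm_image_sub_le_of_norm_deriv_le_segment_01' (f := f) (C := ‖z‖ * (‖z‖ * (2 * C / p * (1+‖z‖)^δ)) * 2)
    (fun s hs => (hd s hs).hasDerivWithinAt) ?_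
  · have e0 : f 0 = 0 := by simp [f, h.v0]
    rw [e0, sub_zero] at key
    have e1 : f 1 = ((Real.exp (-v z/2) - (1 + ‖z‖^2/8) : ℝ) : ℂ) := by simp [f]
    rw [e1, Complex.norm_real, Real.norm_eq_abs] at key
    refine key.trans ?_
    calc ‖z‖ * (‖z‖ * (2 * C / p * (1+‖z‖)^δ)) * 2 = 4 * C / p * ‖z‖^2 * (1+‖z‖)^δ := by ring
      _ ≤ _ := by gcongr; linarith
  · intro s hs
    have hn := ray_norm hs.1 hs.2.le hz
    have hn' := ray_norm_eq (z := z) hs.1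
    have hle : s * ‖z‖ ≤ ‖z‖ := mul_le_of_le_one_left hz0 hs.2.le
    have hs0 := hs.1
    have a := hP p R v ha ((s:ℂ)*z) hn (by rw [hn']; nlinarith)
    rw [hn'] at a
    have hmono : (1 + s * ‖z‖)^δ ≤ (1 + ‖z‖)^δ := by gcongr
    have a' : ‖PP v ((s:ℂ)*z) - conj ((s:ℂ)*z) / 8‖ ≤ ‖z‖ * (2 * C / p * (1+‖z‖)^δ) :=
      a.trans (by gcongr)
    calc _ ≤ ‖PP v ((s:ℂ)*z) - conj ((s:ℂ)*z) / 8‖ * ‖z‖ + ‖PP v ((s:ℂ)*z) - conj ((s:ℂ)*z) / 8‖ * ‖z‖ := by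
          refine (norm_add_le _ _).trans ?_
          rw [norm_mul, norm_mul, Complex.norm_conj, Complex.norm_conj]
      _ ≤ _ := by nlinarith

end LE

namespace LE
open ComplexConjugate
open Loc

set_option maxHeartbeats 1600000 in
lemma w_bound (C0 τ : ℝ) (hτ : 0 < τ) : ∃ N ≥ 1, ∃ C > 0, ∀ p R v, Adm C0 N p R v → ∀ z, ‖z‖ ≤ R →
    |p * (v z - Uc z)| ≤ C * (1 + ‖z‖)^τ := by
  obtain ⟨N, hN, C1, hC1, h1⟩ := g_bound C0 (τ/2) (by positivity)
  obtain ⟨D, hD⟩ : ∃ D, D = 16 * C1 := ⟨_, rfl⟩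
  have hD0 : 0 < D := by rw [hD]; positivity
  refine ⟨max N (max 32 (1 + 2/τ)), hN.trans (le_max_left _ _), 4 * D + 16 * D / τ + (5 + 8 * |C0|), by positivity, ?_⟩
  intro p R v ha z hzR
  have ha' := ha.mono hN (le_max_left _ (max 32 (1 + 2/τ)))
  have h := ha.loc
  have hp := h.ppos
  have hR := h.hR
  have hz0 := norm_nonneg z
  set A := 1 + ‖z‖ with hA
  have hA1 : 1 ≤ A := by linarith
  have hA0 : 0 < A := by linarith
  have hAt : 1 ≤ A^τ := Real.one_le_rpow hA1 hτ.le
  have hv := h.neg z hzR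
  have hU : Uc z = -2 * Real.log (1 + ‖z‖^2/8) := rfl
  have hg0 : 1 ≤ 1 + ‖z‖^2/8 := by nlinarith
  have hg0' : 1 + ‖z‖^2/8 ≤ A^2 := by rw [hA]; nlinarith
  have hg0l : A^2 / 16 ≤ 1 + ‖z‖^2/8 := by rw [hA]; nlinarith [sq_nonneg (‖z‖ - 1)]
  set g0 := 1 + ‖z‖^2/8 with hg0d
  have hlg0 : Real.log g0 ≤ 2 * Real.log A := by
    rw [← Real.log_rpow hA0]
    apply Real.log_le_log (by linarith)
    exact_mod_cast hg0'
  have hlg0n : 0 ≤ Real.log g0 := Real.log_nonneg hg0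
  set B := A^(τ/2) with hB
  have hB1 : 1 ≤ B := Real.one_le_rpow hA1 (by positivity)
  have hBB : A^τ = B^2 := by rw [hB, ← Real.rpow_natCast, ← Real.rpow_mul hA0.le]; congr 1; push_cast; ring
  have hlA : Real.log A ≤ B / (τ/2) := Real.log_le_rpow_div hA0.le (by positivity)
  have hrest : 0 ≤ 5 + 8 * |C0| := by positivity
  have hDτ : 0 ≤ 16 * D / τ := by positivity
  by_cases hc : ‖z‖ ≤ R/32 ∧ p * A ≤ R
  · have hb := h1 p R v ha' z hc.1 hc.2
    rw [← hA, ← hg0d, ← hB] at hb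
    set g := Real.exp (-v z/2) with hg
    have hg1 : 1 ≤ g := Real.one_le_exp (by linarith [hv.2])
    have hvg : v z = -2 * Real.log g := by rw [hg, Real.log_exp]; ring
    have hq : |g - g0| ≤ (D / p * B) * g0 := by
      calc _ ≤ C1 / p * A^2 * B := hb
        _ = (D / p * B) * (A^2/16) := by rw [hD]; ring
        _ ≤ _ := by gcongr
    have hq1 := (abs_le.1 hq).1
    have hq2 := (abs_le.1 hq).2
    set q := D / p * B with hqd
    have hqp : p * q = D * B := by rw [hqd]; field_simp
    have hg00 : 0 < g0 := by linarith
    have hgp : 0 < g := by linarith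
    have hup : Real.log g - Real.log g0 ≤ q := by
      rw [← Real.log_div hgp.ne' hg00.ne']
      refine (Real.log_le_sub_one_of_pos (by positivity)).trans ?_
      rw [sub_le_iff_le_add, div_le_iff₀ hg00]; linarith
    have hlo : p * (Real.log g0 - Real.log g) ≤ (2 * D + 8 * D / τ) * A^τ := by
      by_cases hq3 : q ≤ 1/2
      · have : Real.log g0 - Real.log g ≤ 2 * q := by
          rw [← Real.log_div hg00.ne' hgp.ne']
          refine (Real.log_le_sub_one_of_pos (by positivity)).trans ?_
          rw [sub_le_iff_le_add, div_le_iff₀ hgp]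
          have : 0 < q := by positivity
          have a1 : (2*q+1) * ((1-q)*g0) ≤ (2*q+1)*g := mul_le_mul_of_nonneg_left (by linarith) (by linarith)
          have a2 : 0 ≤ (q * (1-2*q)) * g0 := mul_nonneg (mul_nonneg this.le (by linarith)) hg00.le
          linarith
        calc _ ≤ p * (2 * q) := by gcongr
          _ = 2 * D * B := by rw [mul_left_comm, hqp]; ring
          _ ≤ 2 * D * A^τ := by rw [hBB]; gcongr; exact le_self_pow₀ hB1 (by norm_num)
          _ ≤ _ := by gcongr; have : 0 < 8 * D / τ := by positivity
                      linarith
      · push Not at hq3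
        have hp2 : p ≤ 2 * D * B := by
          have := mul_le_mul_of_nonneg_left hq3.le hp.le
          linarith
        calc _ ≤ p * Real.log g0 := by gcongr; linarith [Real.log_nonneg hg1]
          _ ≤ (2 * D * B) * (2 * (B / (τ/2))) := by gcongr; linarith
          _ = 8 * D / τ * A^τ := by rw [hBB]; field_simp; ring
          _ ≤ _ := by gcongr; linarith
    rw [hvg, hU, abs_le]
    have : p * (Real.log g - Real.log g0) ≤ p * q := by gcongr
    rw [hqp] at this
    have h8 : 0 ≤ 16 * D / τ * A^τ := by positivity
    have h81 : D * B ≤ D * A^τ := by rw [hBB]; gcongr; exact le_self_pow₀ hB1 (by norm_num)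
    have h9 : 0 ≤ (5 + 8 * |C0|) * A^τ := by positivity
    have h10 : 0 ≤ D * A^τ := by positivity
    have h11 : 8 * D / τ * A^τ * 2 = 16 * D / τ * A^τ := by ring
    have e1 : (4 * D + 16 * D / τ + (5 + 8 * |C0|)) * A^τ = 4 * (D * A^τ) + 16 * D / τ * A^τ + (5 + 8 * |C0|) * A^τ := by ring
    have e2 : (2 * D + 8 * D / τ) * A^τ = 2 * (D * A^τ) + 8 * D / τ * A^τ := by ring
    have e3 : p * (-2 * Real.log g - -2 * Real.log g0) = -2 * (p * (Real.log g - Real.log g0)) := by ring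
    have e4 : p * (Real.log g0 - Real.log g) = -(p * (Real.log g - Real.log g0)) := by ring
    rw [e2, e4] at hlo
    rw [e1, e3]
    constructor <;> linarith
  · have hpn : 32 ≤ p := ((le_max_left _ _).trans (le_max_right _ _)).trans ha.hpN
    have hRA : R ≤ p * A := by
      by_contra hcc
      push Not at hcc
      apply hc
      refine ⟨?_, hcc.le⟩
      have := mul_le_mul_of_nonneg_right hpn hA0.le
      linarith
    have hpow := ha.hpow
    have h5 : p^(1 + 2/τ) ≤ R := by
      refine le_trans ?_ hpow
      apply Real.rpow_le_rpow_of_exponent_le (by linarith)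
      exact (le_max_right _ _).trans (le_max_right _ _)
    have h6 : p^(2/τ) ≤ A := by
      rw [Real.rpow_add hp, Real.rpow_one] at h5
      exact le_of_mul_le_mul_left (h5.trans hRA) hp
    have h7 : p^2 ≤ A^τ := by
      calc p^2 = (p^(2/τ))^τ := by rw [← Real.rpow_mul hp.le, div_mul_cancel₀ _ hτ.ne']; norm_cast
        _ ≤ _ := by gcongr
    have hlA' : Real.log A ≤ |C0| * p + 1 := by
      have : A ≤ R * 2 := by linarith
      have h8 := Real.log_le_log hA0 this
      rw [Real.log_mul (by linarith) (by norm_num)] at h8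
      have := ha.hlog
      have h9 : C0 * p ≤ |C0| * p := by gcongr; exact le_abs_self _
      have := Real.log_two_lt_d9
      linarith
    have h10 : |v z - Uc z| ≤ (5 + 8*|C0|) * p := by
      rw [hU, abs_le]
      have : 0 ≤ |C0| * p := by positivity
      have e : (5 + 8*|C0|) * p = 5 * p + 8 * (|C0| * p) := by ring
      rw [e]
      constructor <;> linarith
    calc _ = p * |v z - Uc z| := by rw [abs_mul, abs_of_pos hp]
      _ ≤ p * ((5 + 8*|C0|) * p) := by gcongr
      _ = (5 + 8*|C0|) * p^2 := by ring
      _ ≤ (5 + 8*|C0|) * A^τ := by gcongr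
      _ ≤ _ := mul_le_mul_of_nonneg_right (by linarith) (by linarith)

end LE

namespace LE
open ComplexConjugate
open Loc

structure Lim (C1 : ℝ) (w : ℂ → ℝ) (W S : ℂ → ℂ) : Prop where
  hC : 0 < C1
  hw : ∀ z, HasW (fun z => (w z : ℂ)) (W z) (conj (W z)) z
  hW : ∀ z, HasW W (S z) (((Real.exp (Uc z) * (Uc z^2/2 - w z) : ℝ) : ℂ)/4) z
  w0 : w 0 = 0
  W0 : W 0 = 0
  cQ : ContDiff ℝ 1 (fun z => S z - gU z * W z)
  dQ : ∀ z, dzb (fun z => S z - gU z * W z) z = gU z / 4 * ((Uc z * Real.exp (Uc z) : ℝ) : ℂ)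
  Qb : ∀ z, 1 ≤ ‖z‖ → ‖S z - gU z * W z‖ ≤ C1 / ‖z‖^2

lemma abs_Uc_le {z : ℂ} {K : ℝ} (hz : ‖z‖ ≤ K) : |Uc z| ≤ K^2 := by
  have h0 := norm_nonneg z
  rw [abs_of_nonpos (Uc_nonpos z)]
  unfold Uc
  have := Real.log_le_sub_one_of_pos (x := 1 + ‖z‖^2/8) (by positivity)
  have : ‖z‖^2 ≤ K^2 := by gcongr
  have := sq_nonneg K
  linarith

lemma dd_close (C0 S : ℝ) (hS : 0 < S) (K : ℝ) (hK : 0 < K) : ∃ N ≥ 1, ∀ p R v, Adm C0 N p R v → ∀ z, ‖z‖ ≤ K →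
    ‖gz v z * ((v z * FF1 p v z : ℝ) : ℂ) - gU z * ((Uc z * Real.exp (Uc z) : ℝ) : ℂ)‖ ≤ S := by
  obtain ⟨D, hD⟩ : ∃ D, D = 15 + 215 * (K^2 + 1) := ⟨_, rfl⟩
  have hD0 : 0 < D := by rw [hD]; positivity
  obtain ⟨η, hη0, hη1, hηS⟩ : ∃ η : ℝ, 0 < η ∧ η ≤ 1 ∧ η * D ≤ S :=
    ⟨min 1 (S / D), by positivity, min_le_left _ _, by
      calc _ ≤ S / D * D := by gcongr; exact min_le_right _ _
        _ = S := by field_simp⟩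
  obtain ⟨p0, R0, h1⟩ := vU_close C0 η hη0 K
  refine ⟨max 1 (max (max p0 R0) (max K (1/η))), le_max_left _ _, ?_⟩
  intro p R v ha z hz
  have h := ha.loc
  have hp := h.ppos
  have m1 : max (max p0 R0) (max K (1/η)) ≤ max 1 (max (max p0 R0) (max K (1/η))) := le_max_right _ _
  have m2 := (le_max_left p0 R0).trans ((le_max_left _ (max K (1/η))).trans m1)
  have m3 := (le_max_right p0 R0).trans ((le_max_left _ (max K (1/η))).trans m1)
  have m4 := (le_max_left K (1/η)).trans ((le_max_right (max p0 R0) _).trans m1)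
  have m5 := (le_max_right K (1/η)).trans ((le_max_right (max p0 R0) _).trans m1)
  have hzR : ‖z‖ ≤ R := hz.trans (m4.trans ha.hRN)
  obtain ⟨a1, a2⟩ := h1 p R v h (m2.trans ha.hpN) (m3.trans ha.hRN) z hz
  have hpη : 1 / p ≤ η := by
    rw [div_le_iff₀ hp]
    have := m5.trans ha.hpN
    rw [div_le_iff₀ hη0] at this
    linarith
  have hv := h.neg z hzR
  have hU := Uc_nonpos z
  have b1 := h.F_sub_exp hzR
  have b2 := h.tF1 hzR
  have b3 := h.F1_sub hzR
  have b4 := h.F1pos hzR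
  have b5 : 14 * Real.exp (6/7 * v z) ≤ 14 := by
    have : Real.exp (6/7 * v z) ≤ 1 := by rw [Real.exp_le_one_iff]; linarith
    linarith
  have b6 := exp_lip hv.2 hU
  have b7 : 0 ≤ -v z * FF1 p v z := mul_nonneg (by linarith) b4.le
  have b8 : -v z * FF1 p v z ≤ 14 := b2.trans b5
  have c1 : |FF1 p v z - Real.exp (Uc z)| ≤ 215 * η := by
    have e1 : |FF1 p v z - FF p v z| ≤ 14 * η := by
      rw [b3, abs_of_nonneg (by positivity), div_eq_mul_one_div]
      gcongr
    have e2 : |FF p v z - Real.exp (v z)| ≤ 200 * η := by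
      refine b1.trans ?_
      rw [div_eq_mul_one_div]; gcongr
    calc _ = |(FF1 p v z - FF p v z) + (FF p v z - Real.exp (v z)) + (Real.exp (v z) - Real.exp (Uc z))| := by congr 1; ring
      _ ≤ |FF1 p v z - FF p v z| + |FF p v z - Real.exp (v z)| + |Real.exp (v z) - Real.exp (Uc z)| := abs_add_three _ _ _
      _ ≤ _ := by linarith
  have hVU := abs_Uc_le hz
  have hv2 : |v z| ≤ K^2 + 1 := by
    have := abs_sub_abs_le_abs_sub (v z) (Uc z)
    linarith
  have hF1 : |v z * FF1 p v z| ≤ 14 := by rw [abs_le]; constructor <;> linarith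
  have c2 : |v z * FF1 p v z - Uc z * Real.exp (Uc z)| ≤ (K^2+1) * (215 * η) + η := by
    calc _ = |v z * (FF1 p v z - Real.exp (Uc z)) + (v z - Uc z) * Real.exp (Uc z)| := by congr 1; ring
      _ ≤ |v z| * |FF1 p v z - Real.exp (Uc z)| + |v z - Uc z| * |Real.exp (Uc z)| := by
          rw [← abs_mul, ← abs_mul]; exact abs_add_le _ _
      _ ≤ (K^2+1) * (215 * η) + η * 1 := by
          gcongr
          rw [abs_of_pos (Real.exp_pos _), Real.exp_le_one_iff]; exact hU
      _ = _ := by ring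
  calc _ = ‖(gz v z - gU z) * ((v z * FF1 p v z : ℝ) : ℂ) + gU z * ((v z * FF1 p v z - Uc z * Real.exp (Uc z) : ℝ) : ℂ)‖ := by
        congr 1; push_cast; ring
    _ ≤ ‖gz v z - gU z‖ * |v z * FF1 p v z| + ‖gU z‖ * |v z * FF1 p v z - Uc z * Real.exp (Uc z)| := by
        refine (norm_add_le _ _).trans ?_
        rw [norm_mul, norm_mul, Complex.norm_real, Complex.norm_real, Real.norm_eq_abs, Real.norm_eq_abs]
    _ ≤ η * 14 + 1 * ((K^2+1) * (215 * η) + η) := by gcongr; exact norm_gU_le z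
    _ = η * D := by rw [hD]; ring
    _ ≤ S := hηS

lemma Q_conv (C0 : ℝ) {C1 : ℝ} {w : ℂ → ℝ} {W S : ℂ → ℂ} (hl : Lim C1 w W S) (κ : ℝ) (hκ : 0 < κ) (K : ℝ) :
    ∃ N ≥ 1, ∀ p R v, Adm C0 N p R v → ∀ z, ‖z‖ ≤ K → ‖(p:ℂ) * QQ v z - (S z - gU z * W z)‖ ≤ κ := by
  obtain ⟨C, hC, hcp⟩ := cp_est
  obtain ⟨N1, hN1, C2, hC2, h2⟩ := Qdecay C0
  have hC1 := hl.hC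
  obtain ⟨L, hL⟩ : ∃ L, L = max (2*K) (1 + 2 * (C * (C2 + C1)) / κ) := ⟨_, rfl⟩
  have hLK : 2 * K ≤ L := by rw [hL]; exact le_max_left _ _
  have hL2 : 1 + 2 * (C * (C2 + C1)) / κ ≤ L := by rw [hL]; exact le_max_right _ _
  have hpos : 0 < 2 * (C * (C2 + C1)) / κ := by positivity
  have hL1 : 1 ≤ L := by linarith
  have hLb : C * ((C2 + C1) / L^2) ≤ κ / 2 := by
    have : 2 * (C * (C2 + C1)) / κ ≤ L := by linarith
    rw [div_le_iff₀ hκ] at this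
    rw [← mul_div_assoc, div_le_iff₀ (by positivity)]
    have h3 : L * κ ≤ L^2 * κ := by gcongr; exact le_self_pow₀ hL1 (by norm_num)
    linarith
  obtain ⟨T, hT⟩ : ∃ T, T = 2 * π + π * (3 * L / 2)^2 := ⟨_, rfl⟩
  have hT0 : 0 < T := by rw [hT]; positivity
  obtain ⟨N2, hN2, h3⟩ := dd_close C0 (κ / 2 / T) (by positivity) (3 * L / 2) (by positivity)
  refine ⟨max (max N1 N2) (max 2 (48 * L)), hN1.trans ((le_max_left _ _).trans (le_max_left _ _)), ?_⟩
  intro p R v ha z hz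
  have h := ha.loc
  have hp := h.ppos
  have ha1 := ha.mono hN1 ((le_max_left N1 N2).trans (le_max_left _ (max 2 (48 * L))))
  have ha2 := ha.mono hN2 ((le_max_right N1 N2).trans (le_max_left _ (max 2 (48 * L))))
  have m1 : 2 ≤ max (max N1 N2) (max 2 (48 * L)) := (le_max_left _ _).trans (le_max_right _ _)
  have m2 : 48 * L ≤ max (max N1 N2) (max 2 (48 * L)) := (le_max_right _ _).trans (le_max_right _ _)
  have hp14 := h.hp
  have hR2 : p^2 ≤ R := by
    have := (Real.rpow_le_rpow_of_exponent_le (by linarith) m1).trans ha.hpow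
    exact_mod_cast this
  have hpL : 48 * L ≤ p := m2.trans ha.hpN
  have hRL : 48 * L ≤ R := m2.trans ha.hRN
  have hq : ContDiff ℝ 1 (fun z => (p:ℂ) * QQ v z) := contDiff_const.mul h.cQ
  have key := hcp (fun z => (p:ℂ) * QQ v z - (S z - gU z * W z)) (hq.sub hl.cQ) L ((C2 + C1) / L^2) z (by linarith) (by linarith) ?_
  · refine key.trans ?_
    have hd : ∀ ζ, ‖ζ‖ ≤ 3 * L / 2 → ‖dzb (fun z => (p:ℂ) * QQ v z - (S z - gU z * W z)) ζ‖ ≤ κ / 2 / T := by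
      intro ζ hζ
      have d1 := LE.DifferentiableAt.hasW (h.cQ.differentiable (by norm_num) ζ)
      have d2 := LE.DifferentiableAt.hasW (hl.cQ.differentiable (by norm_num) ζ)
      have d3 := (((HasW.const (p:ℂ) ζ).mul d1).sub d2).dzb
      rw [d3, hl.dQ, h.dzbQ (by linarith)]
      have e : (0 * QQ v ζ + (p:ℂ) * (-(gz v ζ / 4) * ((-v ζ * FF1 p v ζ / p : ℝ) : ℂ)) - gU ζ / 4 * ((Uc ζ * Real.exp (Uc ζ) : ℝ) : ℂ)) =
          (gz v ζ * ((v ζ * FF1 p v ζ : ℝ) : ℂ) - gU ζ * ((Uc ζ * Real.exp (Uc ζ) : ℝ) : ℂ)) / 4 := by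
        have : (p:ℂ) ≠ 0 := by exact_mod_cast hp.ne'
        push_cast
        field_simp
        ring
      rw [e, norm_div]
      simp only [Complex.norm_ofNat]
      have := h3 p R v ha2 ζ hζ
      linarith [norm_nonneg (gz v ζ * ((v ζ * FF1 p v ζ : ℝ) : ℂ) - gU ζ * ((Uc ζ * Real.exp (Uc ζ) : ℝ) : ℂ))]
    have := int_unif (contDiff_dzb (m := 0) (hq.sub hl.cQ) (by norm_num)).continuous.norm (L := 3 * L / 2) (by linarith)
      (fun ζ _ => norm_nonneg _) (by positivity : 0 ≤ κ / 2 / T) hd z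
    rw [← hT, div_mul_cancel₀ _ hT0.ne'] at this
    linarith
  · intro ζ h4 h5
    have hζ : 1 ≤ ‖ζ‖ := hL1.trans h4
    have q1 := h2 p R v ha1 ζ (by linarith) (by nlinarith)
    have q2 := hl.Qb ζ hζ
    calc _ ≤ ‖(p:ℂ) * QQ v ζ‖ + ‖S ζ - gU ζ * W ζ‖ := norm_sub_le _ _
      _ ≤ p * (C2 / p / (1 + ‖ζ‖)^2) + C1 / ‖ζ‖^2 := by
          rw [norm_mul, Complex.norm_real, Real.norm_of_nonneg hp.le]; gcongr
      _ = C2 / (1 + ‖ζ‖)^2 + C1 / ‖ζ‖^2 := by field_simp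
      _ ≤ C2 / L^2 + C1 / L^2 := by gcongr; linarith
      _ = _ := by ring

lemma pF_exp (V : ℝ) (hV : 1 ≤ V) {p v : ℝ} (hp : 8 * V^3 ≤ p) (h1 : -V ≤ v) (h2 : v ≤ 0) :
    |p * ((1 + v/p)^p - Real.exp v) + v^2/2 * Real.exp v| ≤ 20 * V^6 / p := by
  have hV2 : 1 ≤ V^2 := one_le_pow₀ hV
  have hV3 : V ≤ V^3 := le_self_pow₀ hV (by norm_num)
  have hp0 : 0 < p := by linarith
  set x := -v/p with hx
  have hx0 : 0 ≤ x := div_nonneg (by linarith) hp0.le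
  have hxV : x ≤ V / p := by rw [hx]; gcongr; linarith
  have hV8 : V / p ≤ 1/8 := by rw [div_le_iff₀ hp0]; linarith
  have hx1 : |x| < 1 := by rw [abs_of_nonneg hx0]; linarith
  have hl := Real.abs_log_sub_add_sum_range_le hx1 2
  rw [abs_of_nonneg hx0] at hl
  simp only [Finset.sum_range_succ, Finset.range_zero, Finset.sum_empty, zero_add] at hl
  norm_num at hl
  have hl2 : x^3 / (1 - x) ≤ 2 * (V/p)^3 := by
    rw [div_le_iff₀ (by linarith)]
    have : x^3 ≤ (V/p)^3 := by gcongr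
    have h3 : 0 ≤ (V/p)^3 := by positivity
    nlinarith
  set r := p * (x + x^2/2 + Real.log (1-x)) with hr
  have hr1 : |r| ≤ 2 * V^3 / p^2 := by
    rw [hr, abs_mul, abs_of_pos hp0]
    calc _ ≤ p * (2 * (V/p)^3) := by gcongr; exact hl.trans hl2
      _ = _ := by field_simp
  have hv : v = -(p * x) := by rw [hx]; field_simp
  have e1 : (1 + v/p)^p = Real.exp v * Real.exp (-(v^2/(2*p)) + r) := by
    have : 1 + v/p = 1 - x := by rw [hx]; ring
    rw [this, Real.rpow_def_of_pos (by linarith), ← Real.exp_add]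
    congr 1
    rw [hr, hv]; field_simp; ring
  set h := -(v^2/(2*p)) + r with hh
  have hv2 : v^2 ≤ V^2 := by rw [sq_le_sq]; rw [abs_of_nonpos h2, abs_of_pos (by linarith)]; linarith
  have hV23 : V^2 ≤ V^3 := pow_le_pow_right₀ hV (by norm_num)
  have hp1 : 1 ≤ p := by linarith
  have hh1 : |h| ≤ 3 * V^3 / p := by
    calc |h| ≤ |-(v^2/(2*p))| + |r| := abs_add_le _ _
      _ ≤ V^3/p + 2 * V^3 / p := by
          gcongr
          · rw [abs_neg, abs_of_nonneg (by positivity), div_le_div_iff₀ (by positivity) (by positivity)]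
            nlinarith
          · refine hr1.trans ?_
            gcongr
            exact le_self_pow₀ hp1 (by norm_num)
      _ = _ := by ring
  have hh2 : |h| ≤ 1 := by
    refine hh1.trans ?_
    rw [div_le_one hp0]; linarith [pow_pos (by linarith : 0 < V) 3]
  have he := Real.abs_exp_sub_one_sub_id_le hh2
  have e2 : p * ((1 + v/p)^p - Real.exp v) + v^2/2 * Real.exp v = Real.exp v * (p * (Real.exp h - 1 - h) + p * r) := by
    rw [e1, hh]; field_simp; ring
  rw [e2, abs_mul, abs_of_pos (Real.exp_pos _)]
  have hev : Real.exp v ≤ 1 := Real.exp_le_one_iff.2 h2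
  calc _ ≤ 1 * (|p * (Real.exp h - 1 - h)| + |p * r|) := by gcongr; exact abs_add_le _ _
    _ = p * |Real.exp h - 1 - h| + p * |r| := by rw [one_mul, abs_mul, abs_mul, abs_of_pos hp0]
    _ ≤ p * (3 * V^3 / p)^2 + p * (2 * V^3 / p^2) := by
        gcongr
        refine he.trans ?_
        rw [← sq_abs]; gcongr
    _ = (9 * V^6 + 2 * V^3) / p := by field_simp; ring
    _ ≤ _ := by
        gcongr
        have : V^3 ≤ V^6 := pow_le_pow_right₀ hV (by norm_num)
        linarith [pow_pos (by linarith : 0 < V) 6]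

end LE

namespace LE
open ComplexConjugate
open Loc

lemma exp_taylor2 {a b : ℝ} (ha : a ≤ 0) (hb : b ≤ 0) : |Real.exp a - Real.exp b - Real.exp b * (a - b)| ≤ (a-b)^2 := by
  have h1 : Real.exp b * (a - b) ≤ Real.exp a - Real.exp b := by
    have := Real.add_one_le_exp (a - b)
    have h2 : Real.exp a = Real.exp b * Real.exp (a-b) := by rw [← Real.exp_add]; congr 1; ring
    rw [h2]
    nlinarith [Real.exp_pos b]
  have h1' : Real.exp a * (b - a) ≤ Real.exp b - Real.exp a := by
    have := Real.add_one_le_exp (b - a)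
    have h2 : Real.exp b = Real.exp a * Real.exp (b-a) := by rw [← Real.exp_add]; congr 1; ring
    rw [h2]
    nlinarith [Real.exp_pos a]
  rw [abs_of_nonneg (by linarith)]
  have h3 := exp_lip ha hb
  have h4 : (Real.exp a - Real.exp b) * (a - b) ≤ |a - b| * |a - b| := by
    refine (le_abs_self _).trans ?_
    rw [abs_mul]; gcongr
  rw [abs_mul_abs_self] at h4
  nlinarith

lemma Lim.bdd {C1 : ℝ} {w : ℂ → ℝ} {W S : ℂ → ℂ} (hl : Lim C1 w W S) (K : ℝ) : ∃ M > 0, ∀ z, ‖z‖ ≤ K → |w z| ≤ M ∧ ‖W z‖ ≤ M := by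
  have c1 : Continuous (fun z => (w z : ℂ)) := continuous_iff_continuousAt.2 fun z => (hl.hw z).differentiableAt.continuousAt
  have c2 : Continuous W := continuous_iff_continuousAt.2 fun z => (hl.hW z).differentiableAt.continuousAt
  obtain ⟨M1, h1⟩ := (isCompact_closedBall (0:ℂ) K).exists_bound_of_continuousOn c1.continuousOn
  obtain ⟨M2, h2⟩ := (isCompact_closedBall (0:ℂ) K).exists_bound_of_continuousOn c2.continuousOn
  refine ⟨max (max M1 M2) 1, by positivity, fun z hz => ⟨?_, ?_⟩⟩
  · have := h1 z (by simpa using hz)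
    rw [Complex.norm_real, Real.norm_eq_abs] at this
    exact this.trans ((le_max_left _ _).trans (le_max_left _ _))
  · exact (h2 z (by simpa using hz)).trans ((le_max_right _ _).trans (le_max_left _ _))

set_option maxHeartbeats 1600000 in
lemma w_conv (C0 : ℝ) {C1 : ℝ} {w : ℂ → ℝ} {W S : ℂ → ℂ} (hl : Lim C1 w W S) (κ : ℝ) (hκ : 0 < κ) (K : ℝ) (hK : 0 < K) :
    ∃ N ≥ 1, ∀ p R v, Adm C0 N p R v → ∀ z, ‖z‖ ≤ K →
      |p * (v z - Uc z) - w z| ≤ κ ∧ ‖(p:ℂ) * (gz v z - gU z) - W z‖ ≤ κ ∧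
      ‖(p:ℂ) * (SS v z - gU z^2/2) - S z‖ + ‖(p:ℂ) * (-(FF p v z : ℂ)/4 - -(Real.exp (Uc z) : ℂ)/4) - ((Real.exp (Uc z) * (Uc z^2/2 - w z) : ℝ) : ℂ)/4‖ ≤ κ := by
  obtain ⟨M, hM, hMb⟩ := hl.bdd K
  obtain ⟨E, hE⟩ : ∃ E, E = Real.exp (K * (2 + 2 * 2)) := ⟨_, rfl⟩
  have hE1 : 1 ≤ E := by rw [hE]; apply Real.one_le_exp; positivity
  obtain ⟨θ, hθ⟩ : ∃ θ, θ = κ / (5 * E) := ⟨_, rfl⟩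
  have hθ0 : 0 < θ := by rw [hθ]; positivity
  have hθE : 5 * (θ * E) = κ := by rw [hθ]; field_simp
  obtain ⟨V, hV⟩ : ∃ V, V = K^2 + 1 := ⟨_, rfl⟩
  have hV1 : 1 ≤ V := by rw [hV]; nlinarith
  have hV0 : 0 < V := by linarith
  obtain ⟨D, hD⟩ : ∃ D, D = 2 * M + 20 * V^6 + V^2 + 2 * V + 2 := ⟨_, rfl⟩
  have hD0 : 0 < D := by rw [hD]; positivity
  obtain ⟨η, hη0, hη1, hηS⟩ : ∃ η : ℝ, 0 < η ∧ η ≤ 1 ∧ η * D ≤ θ/2 :=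
    ⟨min 1 (θ/2 / D), by positivity, min_le_left _ _, by
      calc _ ≤ θ/2 / D * D := by gcongr; exact min_le_right _ _
        _ = θ/2 := by field_simp⟩
  obtain ⟨N1, hN1, h1⟩ := Q_conv C0 hl (θ/2) (by positivity) K
  obtain ⟨p0, R0, h2⟩ := vU_close C0 η hη0 K
  have hex : ∃ N, N1 ≤ N ∧ p0 ≤ N ∧ R0 ≤ N ∧ 1/η ≤ N ∧ 2*K ≤ N ∧ 8 * V^3 ≤ N :=
    ⟨max (max (max N1 p0) (max R0 (1/η))) (max (2*K) (8*V^3)), by simp, by simp, by simp, by simp, by simp, by simp⟩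
  obtain ⟨N, n1, n2, n3, n4, n5, n6⟩ := hex
  refine ⟨N, hN1.trans n1, ?_⟩
  intro p R v ha
  have h := ha.loc
  have hp := h.ppos
  have hpN := ha.hpN
  have hRN := ha.hRN
  have hpη : 1 / p ≤ η := by
    rw [div_le_iff₀ hp]
    have := n4.trans hpN
    rw [div_le_iff₀ hη0] at this
    linarith
  have hKR : K < R := by linarith
  -- the estimate
  have est : ∀ z, ‖z‖ ≤ K → ‖(p:ℂ) * (SS v z - gU z^2/2) - S z‖ + ‖(p:ℂ) * (-(FF p v z : ℂ)/4 - -(Real.exp (Uc z) : ℂ)/4) - ((Real.exp (Uc z) * (Uc z^2/2 - w z) : ℝ) : ℂ)/4‖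
      ≤ 2 * (|p * (v z - Uc z) - w z| + ‖(p:ℂ) * (gz v z - gU z) - W z‖) + θ := by
    intro z hz
    obtain ⟨m1, m2⟩ := hMb z hz
    have q := h1 p R v (ha.mono hN1 n1) z hz
    obtain ⟨a1, a2⟩ := h2 p R v h (n2.trans hpN) (n3.trans hRN) z hz
    have hv := h.neg z (by linarith)
    have hU := Uc_nonpos z
    have hVU := abs_Uc_le hz
    have hgU := norm_gU_le z
    have hv2 : |v z| ≤ V := by
      have := abs_sub_abs_le_abs_sub (v z) (Uc z)
      linarith
    have hUV : |Uc z| ≤ V := by linarith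
    set a := p * (v z - Uc z) - w z with ha'
    set b := (p:ℂ) * (gz v z - gU z) - W z with hb'
    have s1 : ‖(p:ℂ) * (SS v z - gU z^2/2) - S z‖ ≤ θ/2 + (3/2) * ‖b‖ + η * M := by
      have e : (p:ℂ) * (SS v z - gU z^2/2) - S z = ((p:ℂ) * QQ v z - (S z - gU z * W z)) + ((gz v z - gU z)/2 + gU z) * b + (gz v z - gU z)/2 * W z := by
        rw [hb']; unfold QQ; ring
      have n2 : ‖(gz v z - gU z)/2‖ ≤ η / 2 := by
        rw [norm_div]; simp only [Complex.norm_ofNat]; linarith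
      rw [e]
      calc _ ≤ ‖(p:ℂ) * QQ v z - (S z - gU z * W z)‖ + ‖((gz v z - gU z)/2 + gU z) * b‖ + ‖(gz v z - gU z)/2 * W z‖ := norm_add₃_le
        _ ≤ θ/2 + (3/2) * ‖b‖ + (η/2) * M := by
            rw [norm_mul, norm_mul]
            gcongr
            refine (norm_add_le _ _).trans ?_
            linarith
        _ ≤ _ := by have := mul_pos hη0 hM; linarith
    have s2 : ‖(p:ℂ) * (-(FF p v z : ℂ)/4 - -(Real.exp (Uc z) : ℂ)/4) - ((Real.exp (Uc z) * (Uc z^2/2 - w z) : ℝ) : ℂ)/4‖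
        ≤ (2 * |a| + η * (M + 20 * V^6 + V^2 + 2 * V)) / 4 := by
      have e : (p:ℂ) * (-(FF p v z : ℂ)/4 - -(Real.exp (Uc z) : ℂ)/4) - ((Real.exp (Uc z) * (Uc z^2/2 - w z) : ℝ) : ℂ)/4
        = ((-(Real.exp (Uc z) * a + p * (Real.exp (v z) - Real.exp (Uc z) - Real.exp (Uc z) * (v z - Uc z)) +
          (p * ((1 + v z/p)^p - Real.exp (v z)) + v z^2/2 * Real.exp (v z)) + (Uc z^2/2 * (Real.exp (Uc z) - Real.exp (v z)) + (Uc z - v z) * (Uc z + v z)/2 * Real.exp (v z))) / 4 : ℝ) : ℂ) := by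
        rw [ha']; unfold FF; push_cast; ring
      rw [e, Complex.norm_real, Real.norm_eq_abs, abs_div, abs_neg, abs_of_pos (by norm_num : (0:ℝ) < 4)]
      apply div_le_div_of_nonneg_right _ (by norm_num)
      have t1 : |Real.exp (Uc z) * a| ≤ |a| := by
        rw [abs_mul, abs_of_pos (Real.exp_pos _)]
        exact mul_le_of_le_one_left (abs_nonneg _) (Real.exp_le_one_iff.2 hU)
      have t2 : |p * (Real.exp (v z) - Real.exp (Uc z) - Real.exp (Uc z) * (v z - Uc z))| ≤ |a| + η * M := by
        rw [abs_mul, abs_of_pos hp]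
        have e1 : |p * (v z - Uc z)| ≤ |a| + M := by
          have : p * (v z - Uc z) = a + w z := by rw [ha']; ring
          rw [this]; exact (abs_add_le _ _).trans (by gcongr)
        rw [abs_mul, abs_of_pos hp] at e1
        calc _ ≤ p * (v z - Uc z)^2 := by gcongr; exact exp_taylor2 hv.2 hU
          _ = (p * |v z - Uc z|) * |v z - Uc z| := by rw [← sq_abs]; ring
          _ ≤ (|a| + M) * η := by gcongr
          _ = η * |a| + η * M := by ring
          _ ≤ _ := by gcongr; exact mul_le_of_le_one_left (abs_nonneg _) hη1
      have t3 : |p * ((1 + v z/p)^p - Real.exp (v z)) + v z^2/2 * Real.exp (v z)| ≤ η * (20 * V^6) := by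
        refine (pF_exp V hV1 (n6.trans hpN) (abs_le.1 hv2).1 hv.2).trans ?_
        rw [div_eq_mul_one_div, mul_comm]; gcongr
      have t4 : |Uc z^2/2 * (Real.exp (Uc z) - Real.exp (v z)) + (Uc z - v z) * (Uc z + v z)/2 * Real.exp (v z)| ≤ η * (V^2 + 2 * V) := by
        have e1 : |Uc z - v z| ≤ η := by rw [abs_sub_comm]; exact a1
        have e2 : |Real.exp (Uc z) - Real.exp (v z)| ≤ η := (exp_lip hU hv.2).trans e1
        have e3 : |Uc z^2/2| ≤ V^2 := by
          rw [abs_of_nonneg (by positivity), ← sq_abs]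
          have : |Uc z|^2 ≤ V^2 := by gcongr
          nlinarith
        have e4 : |(Uc z + v z)/2| ≤ 2 * V := by
          rw [abs_div, abs_of_pos (by norm_num : (0:ℝ) < 2)]
          have := abs_add_le (Uc z) (v z)
          linarith
        calc _ ≤ |Uc z^2/2| * |Real.exp (Uc z) - Real.exp (v z)| + |Uc z - v z| * |(Uc z + v z)/2| * |Real.exp (v z)| := by
              rw [← abs_mul, ← abs_mul, ← abs_mul]
              refine (abs_add_le _ _).trans (le_of_eq ?_)
              congr 2; ring
          _ ≤ V^2 * η + η * (2 * V) * 1 := by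
              gcongr
              rw [abs_of_pos (Real.exp_pos _)]; exact Real.exp_le_one_iff.2 hv.2
          _ = _ := by ring
      refine (abs_add_le _ _).trans ?_
      have := abs_add_three (Real.exp (Uc z) * a) (p * (Real.exp (v z) - Real.exp (Uc z) - Real.exp (Uc z) * (v z - Uc z)))
          (p * ((1 + v z/p)^p - Real.exp (v z)) + v z^2/2 * Real.exp (v z))
      linarith
    have hDe : η * D = 2 * (η * M) + η * (20 * V^6 + V^2 + 2 * V) + 2 * η := by rw [hD]; ring
    have hp2 : 0 ≤ η * (20 * V^6 + V^2 + 2 * V) := by positivity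
    have hp3 : 0 < η * M := by positivity
    have := norm_nonneg b
    have := abs_nonneg a
    have e5 : η * (M + 20 * V^6 + V^2 + 2 * V) = η * M + η * (20 * V^6 + V^2 + 2 * V) := by ring
    rw [e5] at s2
    linarith
  intro z hz
  have g := gron (z := z) (a := fun z => p * (v z - Uc z) - w z) (G := fun z => (p:ℂ) * (gz v z - gU z) - W z)
    (S := fun z => (p:ℂ) * (SS v z - gU z^2/2) - S z)
    (B := fun z => (p:ℂ) * (-(FF p v z : ℂ)/4 - -(Real.exp (Uc z) : ℂ)/4) - ((Real.exp (Uc z) * (Uc z^2/2 - w z) : ℝ) : ℂ)/4)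
    (K := K) (A := 2) (η := θ) hK (by norm_num) hθ0.le ?_ ?_ ?_ ?_ est hz
  · obtain ⟨g1, g2⟩ := g
    rw [← hE] at g1 g2
    have : 0 < θ * E := by positivity
    have hθ1 : θ ≤ θ * E := le_mul_of_one_le_right hθ0.le hE1
    refine ⟨by linarith, by linarith, (est z hz).trans ?_⟩
    linarith
  · intro z hz
    have := ((HasW.const (p:ℂ) z).mul ((h.hasWv z).sub (hasW_Uc z))).sub (hl.hw z)
    convert! this using 1
    · funext y; push_cast; rfl
    · ring
    · simp only [map_sub, map_mul, Complex.conj_ofReal]; ring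
  · intro z hz
    have := ((HasW.const (p:ℂ) z).mul ((h.hasWG (z := z) (by linarith)).sub (hasW_gU z))).sub (hl.hW z)
    convert! this using 1 <;> ring
  · simp [h.v0, Uc, hl.w0]
  · simp [h.g0, gU, hl.W0]

end LE

namespace LE
open ComplexConjugate

/-- `log (1+t) / t`, extended analytically. -/
def la : ℝ → ℝ := dslope (fun t => Real.log (1 + t)) 0

lemma la_mul (t : ℝ) : t * la t = Real.log (1 + t) := by
  have := sub_smul_dslope (fun t : ℝ => Real.log (1 + t)) 0 t
  simpa [la] using this

lemma la_an {t : ℝ} (ht : -1 < t) : AnalyticAt ℝ la t := by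
  have hlog : ∀ {t : ℝ}, -1 < t → AnalyticAt ℝ (fun t : ℝ => Real.log (1 + t)) t := by
    intro t ht
    apply AnalyticAt.log
    · fun_prop
    · linarith
  by_cases h0 : t = 0
  · subst h0
    obtain ⟨q, hq⟩ := hlog ht
    exact ⟨_, hq.has_fpower_series_dslope_fslope⟩
  · have h1 : AnalyticAt ℝ (fun t : ℝ => Real.log (1 + t) / t) t := (hlog ht).div analyticAt_id h0
    apply h1.congr
    filter_upwards [isOpen_ne.mem_nhds h0] with s hs
    rw [← la_mul s]
    field_simp

def la1 : ℝ → ℝ := deriv la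

lemma la_d {t : ℝ} (ht : -1 < t) : HasDerivAt la (la1 t) t := (la_an ht).differentiableAt.hasDerivAt

lemma la1_an {t : ℝ} (ht : -1 < t) : AnalyticAt ℝ la1 t := (la_an ht).deriv

lemma logp_d {t : ℝ} (ht : -1 < t) : HasDerivAt (fun t : ℝ => Real.log (1 + t)) (1 / (1 + t)) t := by
  have h5 : HasDerivAt (fun t : ℝ => 1 + t) 1 t := by simpa using (hasDerivAt_id t).const_add 1
  exact h5.log (by linarith)

lemma la_rel {t : ℝ} (ht : -1 < t) : la t + t * la1 t = 1 / (1 + t) := by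
  have h1 : HasDerivAt (fun t => t * la t) (1 * la t + t * la1 t) t := (hasDerivAt_id t).mul (la_d ht)
  have h2 := logp_d ht
  have : (fun t => t * la t) = (fun t : ℝ => Real.log (1 + t)) := funext la_mul
  rw [this] at h1
  have := h1.unique h2
  linarith

def Lam (t : ℝ) : ℝ := ∫ x in (0:ℝ)..t, la x

lemma la_cont : ContinuousOn la (Set.Ioi (-1)) := fun t ht => (la_d ht).continuousAt.continuousWithinAt

lemma Lam_d {t : ℝ} (ht : -1 < t) : HasDerivAt Lam (la t) t := by
  apply intervalIntegral.integral_hasDerivAt_right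
  · apply ContinuousOn.intervalIntegrable
    apply la_cont.mono
    intro x hx
    rw [Set.mem_uIcc] at hx
    simp only [Set.mem_Ioi]
    rcases hx with h | h <;> linarith [h.1]
  · exact la_cont.stronglyMeasurableAtFilter isOpen_Ioi t ht
  · exact (la_d ht).continuousAt

/-- profile of `w₀` as a function of `t = |z|²/8`. -/
def Wf (t : ℝ) : ℝ := 2 * Real.log (1+t)^2 + 6 * Real.log (1+t) + 4 * (2/(1+t) - 1) * Lam t + 5 * (2/(1+t) - 2)
def Wf1 (t : ℝ) : ℝ := 4 * Real.log (1+t)/(1+t) + 6/(1+t) - 8 * Lam t/(1+t)^2 + 4 * (2/(1+t) - 1) * la t - 10/(1+t)^2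
def Wf2 (t : ℝ) : ℝ := -2/(1+t)^2 - 4 * Real.log (1+t)/(1+t)^2 - 16 * la t/(1+t)^2 + 16 * Lam t/(1+t)^3 + 4 * (2/(1+t) - 1) * la1 t + 20/(1+t)^3

lemma inv_d {t : ℝ} (ht : -1 < t) (n : ℕ) (c : ℝ) : HasDerivAt (fun t : ℝ => c / (1+t)^(n+1)) (-(n+1)*c/(1+t)^(n+2)) t := by
  have h0 : (1 + t) ≠ 0 := by linarith
  have h5 : HasDerivAt (fun t : ℝ => 1 + t) 1 t := by simpa using (hasDerivAt_id t).const_add 1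
  have := (hasDerivAt_const t c).div (h5.pow (n+1)) (pow_ne_zero _ h0)
  convert! this using 1
  simp only [Nat.add_sub_cancel, Pi.pow_apply]
  push_cast
  field_simp
  ring

lemma inv1_d {t : ℝ} (ht : -1 < t) (c : ℝ) : HasDerivAt (fun t : ℝ => c / (1+t)) (-c/(1+t)^2) t := by
  have := inv_d ht 0 c
  simpa using this

lemma Wf_d {t : ℝ} (ht : -1 < t) : HasDerivAt Wf (Wf1 t) t := by
  have h0 : (1 + t) ≠ 0 := by linarith
  have hl := logp_d ht
  have hi := inv1_d ht 2
  have := ((((hl.pow 2).const_mul 2).add (hl.const_mul 6)).add (((hi.sub_const 1).const_mul 4).mul (Lam_d ht))).add ((hi.sub_const 2).const_mul 5)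
  convert! this using 1
  simp only [Wf1]
  field_simp
  ring

lemma Wf1_d {t : ℝ} (ht : -1 < t) : HasDerivAt Wf1 (Wf2 t) t := by
  have h0 : (1 + t) ≠ 0 := by linarith
  have hl := logp_d ht
  have hi := inv1_d ht 2
  have := (((((hl.const_mul 4).mul (inv1_d ht 1)).add (inv1_d ht 6)).sub (((Lam_d ht).const_mul 8).mul (inv_d ht 1 1))).add
    (((hi.sub_const 1).const_mul 4).mul (la_d ht))).sub (inv_d ht 1 10)
  convert! this using 1
  · funext s; simp only [Wf1, Pi.add_apply, Pi.sub_apply, Pi.mul_apply]; ring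
  · simp only [Wf2]
    push_cast
    field_simp
    ring

/-- the ODE -/
lemma Wf_ode {t : ℝ} (ht : -1 < t) : t * Wf2 t + Wf1 t = 2 / (1+t)^2 * (2 * Real.log (1+t)^2 - Wf t) := by
  have h0 : (1 + t) ≠ 0 := by linarith
  have h1 := la_rel ht
  have h2 := la_mul t
  have h3 : t * la1 t = 1/(1+t) - la t := by linarith
  have e : t * Wf2 t + Wf1 t = -2*t/(1+t)^2 - 4 * t* Real.log (1+t)/(1+t)^2 - 16 * (t * la t)/(1+t)^2 + 16 * t * Lam t/(1+t)^3 + 4 * (2/(1+t) - 1) * (t * la1 t) + 20 * t/(1+t)^3 + Wf1 t := by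
    simp only [Wf2]; ring
  rw [e, h3, h2]
  simp only [Wf1, Wf]
  field_simp
  ring

def qf (t : ℝ) : ℝ := Wf2 t + 2 * Wf1 t / (1+t)

lemma t2q {t : ℝ} (ht : -1 < t) : t^2 * qf t = 6 - 8 * (Real.log (1+t) + 1)/(1+t) + (4 * Real.log (1+t) + 2)/(1+t)^2 := by
  have h0 : (1 + t) ≠ 0 := by linarith
  have h1 := la_rel ht
  have h2 := la_mul t
  have h3 : t^2 * la1 t = t/(1+t) - t * la t := by
    have : t^2 * la1 t = t * (t * la1 t) := by ring
    rw [this, show t * la1 t = 1/(1+t) - la t by linarith]; ring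
  have e : t^2 * qf t = -2*t^2/(1+t)^2 - 4 * t^2 * Real.log (1+t)/(1+t)^2 - 16 * t * (t * la t)/(1+t)^2 + 4 * (2/(1+t) - 1) * (t^2 * la1 t) + 20 * t^2/(1+t)^3
     + 2 * t^2 * (4 * Real.log (1+t)/(1+t) + 6/(1+t) - 10/(1+t)^2)/(1+t) + 8 * t * (2/(1+t) - 1) * (t * la t)/(1+t) := by
    simp only [qf, Wf2, Wf1]; field_simp; ring
  rw [e, h3, h2]
  field_simp
  ring

lemma qf_an {t : ℝ} (ht : -1 < t) : AnalyticAt ℝ qf t := by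
  have h0 : (1 + t) ≠ 0 := by linarith
  have hs : AnalyticAt ℝ (fun t : ℝ => 1 + t) t := by fun_prop
  have hl : AnalyticAt ℝ (fun t : ℝ => Real.log (1 + t)) t := hs.log (by linarith)
  have h1 := la_an ht
  have h2 := la1_an ht
  have h : AnalyticAt ℝ (fun t => -2/(1+t)^2 - 4 * Real.log (1+t)/(1+t)^2 - 16 * la t/(1+t)^2 + 4 * (2/(1+t) - 1) * la1 t + 20/(1+t)^3
     + 2 * (4 * Real.log (1+t)/(1+t) + 6/(1+t) - 10/(1+t)^2)/(1+t) + 8 * (2/(1+t) - 1) * la t/(1+t)) t := by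
    have c : ∀ c : ℝ, AnalyticAt ℝ (fun t : ℝ => c) t := fun c => analyticAt_const
    have d1 : ∀ c : ℝ, AnalyticAt ℝ (fun t : ℝ => c/(1+t)) t := fun c => analyticAt_const.div hs h0
    have hs2 := hs.pow 2
    have hs3 := hs.pow 3
    have n2 : (1+t)^2 ≠ 0 := pow_ne_zero _ h0
    have n3 : (1+t)^3 ≠ 0 := pow_ne_zero _ h0
    exact (((((((c (-2)).div hs2 n2).sub (((c 4).mul hl).div hs2 n2)).sub (((c 16).mul h1).div hs2 n2)).add
      (((c 4).mul ((d1 2).sub (c 1))).mul h2)).add ((c 20).div hs3 n3)).add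
      (((c 2).mul (((((c 4).mul hl).div hs h0).add (d1 6)).sub ((c 10).div hs2 n2))).div hs h0)).add
      ((((c 8).mul ((d1 2).sub (c 1))).mul h1).div hs h0)
  apply h.congr
  filter_upwards [isOpen_Ioi.mem_nhds ht] with s hs
  have h0 : (1 + s) ≠ 0 := by simp only [Set.mem_Ioi] at hs; linarith
  simp only [qf, Wf2, Wf1]; field_simp; ring

lemma qf_ode {t : ℝ} (ht : -1 < t) (h : t ≠ 0) : 2 * qf t + t * deriv qf t = 8 * Real.log (1+t)/(1+t)^3 := by
  have h0 : (1 + t) ≠ 0 := by linarith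
  have hq := (qf_an ht).differentiableAt.hasDerivAt
  have h1 := ((hasDerivAt_id t).pow 2).mul hq
  have hl := logp_d ht
  have h2 := (((hasDerivAt_const t (6:ℝ)).sub (((hl.add_const 1).const_mul 8).mul (inv1_d ht 1))).add
    (((hl.const_mul 4).add_const 2).mul (inv_d ht 1 1)))
  have h3 := h1.congr_of_eventuallyEq (f₁ := fun t : ℝ => 6 - 8 * (Real.log (1+t) + 1) * (1/(1+t)) + (4 * Real.log (1+t) + 2)*(1/(1+t)^2)) (by
    filter_upwards [isOpen_Ioi.mem_nhds ht] with s hs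
    have := t2q hs
    simp only [Pi.mul_apply, Pi.pow_apply, id]
    rw [this]; ring)
  have h4 := h3.unique h2
  simp only [Pi.pow_apply, id] at h4
  have h5 : t * (2 * qf t + t * deriv qf t) = t * (8 * Real.log (1+t)/(1+t)^3) := by
    push_cast at h4
    have : t * (2 * qf t + t * deriv qf t) = 2 * t^(2-1) * 1 * qf t + t^2 * deriv qf t := by norm_num; ring
    rw [this, h4]
    field_simp
    ring
  exact mul_left_cancel₀ h h5

end LE

namespace LE
open ComplexConjugate

lemma tpos (z : ℂ) : -1 < ‖z‖^2/8 := by have := sq_nonneg ‖z‖; linarith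

def wc (z : ℂ) : ℝ := Wf (‖z‖^2/8)
def Wc (z : ℂ) : ℂ := ((Wf1 (‖z‖^2/8)/8 : ℝ) : ℂ) * conj z
def Sc (z : ℂ) : ℂ := ((Wf2 (‖z‖^2/8)/64 : ℝ) : ℂ) * conj z^2

lemma scale_d {f : ℝ → ℝ} {f' s : ℝ} (h : HasDerivAt f f' (s/8)) : HasDerivAt (fun s => f (s/8)) (f'/8) s := by
  have := h.comp s ((hasDerivAt_id s).div_const 8)
  simpa [Function.comp_def, div_eq_mul_inv] using this

lemma hasW_wc (z : ℂ) : HasW (fun z => (wc z : ℂ)) (Wc z) (conj (Wc z)) z := by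
  have := HasW.radial (scale_d (Wf_d (tpos z)))
  convert! this using 1
  unfold Wc
  simp only [map_mul, Complex.conj_ofReal, Complex.conj_conj]

lemma conj_mul_self' (z : ℂ) : z * conj z = ((‖z‖^2 : ℝ) : ℂ) := by
  rw [Complex.mul_conj, Complex.normSq_eq_norm_sq]

lemma exp_Uc' (z : ℂ) : Real.exp (Uc z) = 1 / (1 + ‖z‖^2/8)^2 := by
  rw [exp_Uc]
  have : (8 + ‖z‖^2) ≠ 0 := by positivity
  have h2 : 1 + ‖z‖^2/8 = (8 + ‖z‖^2)/8 := by ring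
  rw [h2]; field_simp; norm_num

lemma hasW_Wc (z : ℂ) : HasW Wc (Sc z) (((Real.exp (Uc z) * (Uc z^2/2 - wc z) : ℝ) : ℂ)/4) z := by
  have h1 := HasW.radial (scale_d (f := fun t => Wf1 t / 8) ((Wf1_d (tpos z)).div_const 8))
  have := h1.mul (HasW.cnj z)
  convert! this using 1
  · unfold Sc; push_cast; ring
  · have e := Wf_ode (tpos z)
    have e2 : Real.exp (Uc z) * (Uc z^2/2 - wc z) = (‖z‖^2/8 * Wf2 (‖z‖^2/8) + Wf1 (‖z‖^2/8)) / 2 := by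
      rw [e, exp_Uc']; unfold wc Uc; ring
    rw [e2]
    have e3 : (Wf2 (‖z‖^2/8) / 8 / 8 : ℝ) * z * conj z = ((Wf2 (‖z‖^2/8) / 8 / 8 * ‖z‖^2 : ℝ) : ℂ) := by
      rw [mul_assoc, conj_mul_self']; push_cast; ring
    rw [e3]; push_cast; ring

lemma Qc_eq (z : ℂ) : Sc z - gU z * Wc z = ((qf (‖z‖^2/8)/64 : ℝ) : ℂ) * conj z^2 := by
  unfold Sc Wc gU qf
  have : ((-2/(8+‖z‖^2):ℝ)) = -(1/(1+‖z‖^2/8))/4 := by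
    have : (8 + ‖z‖^2) ≠ 0 := by positivity
    have h2 : 1 + ‖z‖^2/8 = (8 + ‖z‖^2)/8 := by ring
    rw [h2]; field_simp; norm_num
  rw [this]
  push_cast
  ring

lemma lim_wc : Lim 18 wc Wc Sc where
  hC := by norm_num
  hw := hasW_wc
  hW := hasW_Wc
  w0 := by simp [wc, Wf, Lam]
  W0 := by simp [Wc]
  cQ := by
    have : (fun z => Sc z - gU z * Wc z) = fun z => ((qf (‖z‖^2/8)/64 : ℝ) : ℂ) * conj z^2 := funext Qc_eq
    rw [this]
    have h1 : ContDiffOn ℝ 1 qf (Set.Ioi (-1)) := fun t ht => (qf_an ht).contDiffAt.contDiffWithinAt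
    have h2 : ContDiff ℝ 1 (fun z : ℂ => qf (‖z‖^2/8)) := h1.comp_contDiff (contDiff_normsq.of_le le_top |>.div_const 8) (fun z => tpos z)
    exact (Complex.ofRealCLM.contDiff.comp (h2.div_const 64)).mul ((Complex.conjCLE.contDiff).pow 2)
  dQ := by
    intro z
    have : (fun z => Sc z - gU z * Wc z) = fun z => ((qf (‖z‖^2/8)/64 : ℝ) : ℂ) * (conj z * conj z) := by
      funext z; rw [Qc_eq]; ring
    rw [this]
    have h1 := HasW.radial (scale_d (f := fun t => qf t / 64) ((qf_an (tpos z)).differentiableAt.hasDerivAt.div_const 64))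
    rw [(h1.mul ((HasW.cnj z).mul (HasW.cnj z))).dzb]
    by_cases hz : z = 0
    · subst hz; simp [gU]
    · have ht : ‖z‖^2/8 ≠ 0 := by have := norm_pos_iff.2 hz; positivity
      have e := qf_ode (tpos z) ht
      have e3 : (deriv qf (‖z‖^2/8) / 64 / 8 : ℝ) * z * (conj z * conj z) = ((deriv qf (‖z‖^2/8) / 64 / 8 * ‖z‖^2 : ℝ) : ℂ) * conj z := by
        push_cast
        have := conj_mul_self' z
        push_cast at this
        rw [← this]; ring
      rw [e3]
      have e4 : gU z / 4 * ((Uc z * Real.exp (Uc z) : ℝ) : ℂ) = ((8 * Real.log (1 + ‖z‖^2/8)/(1+‖z‖^2/8)^3 / 64 : ℝ) : ℂ) * conj z := by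
        rw [exp_Uc']
        have e5 : gU z = ((-(1/(1+‖z‖^2/8))/4 : ℝ) : ℂ) * conj z := by
          unfold gU
          have : ((-2/(8+‖z‖^2):ℝ)) = -(1/(1+‖z‖^2/8))/4 := by
            have : (8 + ‖z‖^2) ≠ 0 := by positivity
            have h2 : 1 + ‖z‖^2/8 = (8 + ‖z‖^2)/8 := by ring
            rw [h2]; field_simp; norm_num
          rw [this]; ring
        rw [e5]
        have h0 : (1 + ‖z‖^2/8) ≠ 0 := by positivity
        have : (-(1/(1+‖z‖^2/8))/4)/4 * (Uc z * (1/(1+‖z‖^2/8)^2)) = 8 * Real.log (1 + ‖z‖^2/8)/(1+‖z‖^2/8)^3 / 64 := by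
          unfold Uc; field_simp; ring
        rw [← this]; push_cast; ring
      rw [e4, ← e]
      push_cast
      ring
  Qb := by
    intro z hz
    rw [Qc_eq, norm_mul, Complex.norm_real, norm_pow, Complex.norm_conj, Real.norm_eq_abs]
    have e := t2q (tpos z)
    have hs : 1 ≤ 1 + ‖z‖^2/8 := by have := sq_nonneg ‖z‖; linarith
    have hl1 : Real.log (1 + ‖z‖^2/8) ≤ ‖z‖^2/8 := by
      have := Real.log_le_sub_one_of_pos (x := 1 + ‖z‖^2/8) (by positivity); linarith
    have hl0 : 0 ≤ Real.log (1 + ‖z‖^2/8) := Real.log_nonneg hs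
    have hb : |(‖z‖^2/8)^2 * qf (‖z‖^2/8)| ≤ 18 := by
      rw [e]
      set t := ‖z‖^2/8
      set l := Real.log (1 + t)
      have a1 : 8 * (l + 1)/(1+t) ≤ 8 := by rw [div_le_iff₀ (by linarith)]; linarith
      have a2 : 0 ≤ 8 * (l + 1)/(1+t) := by positivity
      have a3 : (4 * l + 2)/(1+t)^2 ≤ 4 := by rw [div_le_iff₀ (by positivity)]; nlinarith
      have a4 : 0 ≤ (4 * l + 2)/(1+t)^2 := by positivity
      rw [abs_le]; constructor <;> linarith
    rw [abs_mul, abs_of_nonneg (by positivity)] at hb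
    rw [abs_div, abs_of_pos (by norm_num : (0:ℝ) < 64), le_div_iff₀ (by positivity)]
    calc _ = (‖z‖^2/8)^2 * |qf (‖z‖^2/8)| := by ring
      _ ≤ 18 := hb

lemma contDiff_wc : ContDiff ℝ 3 wc := by
  have h1 : ContDiffOn ℝ 3 Lam (Set.Ioi (-1)) := by
    have : (3 : WithTop ℕ∞) = 2 + 1 := by norm_num
    rw [this, contDiffOn_succ_iff_deriv_of_isOpen isOpen_Ioi]
    refine ⟨fun t ht => (Lam_d ht).differentiableAt.differentiableWithinAt, by intro h; exact absurd h (by decide), ?_⟩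
    have h2 : ContDiffOn ℝ 2 la (Set.Ioi (-1)) := fun t ht => (la_an ht).contDiffAt.contDiffWithinAt
    exact h2.congr fun t ht => (Lam_d ht).deriv
  have hs : ContDiffOn ℝ 3 (fun t : ℝ => 1 + t) (Set.Ioi (-1)) := (contDiff_const.add contDiff_id).contDiffOn
  have hn : ∀ t ∈ Set.Ioi (-1:ℝ), 1 + t ≠ 0 := by intro t ht; simp only [Set.mem_Ioi] at ht; linarith
  have hl : ContDiffOn ℝ 3 (fun t : ℝ => Real.log (1 + t)) (Set.Ioi (-1)) := hs.log hn
  have hi : ContDiffOn ℝ 3 (fun t : ℝ => 2 / (1 + t)) (Set.Ioi (-1)) := contDiffOn_const.div hs hn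
  have h : ContDiffOn ℝ 3 Wf (Set.Ioi (-1)) :=
    (((contDiffOn_const.mul (hl.pow 2)).add (contDiffOn_const.mul hl)).add ((contDiffOn_const.mul (hi.sub contDiffOn_const)).mul h1)).add
      (contDiffOn_const.mul (hi.sub contDiffOn_const))
  exact h.comp_contDiff (contDiff_normsq.of_le le_top |>.div_const 8) (fun z => tpos z)

lemma gz_wc : gz wc = Wc := funext fun z => (hasW_wc z).dz

lemma lapC_wc (z : ℂ) : lapC wc z = Real.exp (Uc z) * (Uc z^2/2 - wc z) := by
  have h1 := (dzb_gz (contDiff_wc.contDiffAt (x := z) |>.of_le (by norm_num))).1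
  rw [gz_wc, (hasW_Wc z).dzb] at h1
  have : ((Real.exp (Uc z) * (Uc z^2/2 - wc z) : ℝ) : ℂ) = (lapC wc z : ℂ) := by
    have h4 : (4:ℂ) ≠ 0 := by norm_num
    exact (div_left_inj' h4).1 h1
  exact_mod_cast this.symm

end LE

namespace LE
open ComplexConjugate

lemma la_nonneg {t : ℝ} (ht : 0 ≤ t) : 0 ≤ la t ∧ la t ≤ 1 := by
  rcases ht.eq_or_lt with h | h
  · subst h
    have := la_rel (t := 0) (by norm_num)
    simp at this
    rw [this]; norm_num
  · have h1 := la_mul t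
    have h2 : la t = Real.log (1 + t) / t := by rw [← h1]; field_simp
    rw [h2]
    have h3 : 0 ≤ Real.log (1 + t) := Real.log_nonneg (by linarith)
    have h4 : Real.log (1 + t) ≤ t := by
      have := Real.log_le_sub_one_of_pos (x := 1 + t) (by positivity); linarith
    exact ⟨by positivity, by rw [div_le_one h]; exact h4⟩

lemma Lam_bd {t : ℝ} (ht : 0 ≤ t) : 0 ≤ Lam t ∧ Lam t ≤ Real.log (1+t) + Real.log (1+t)^2/2 := by
  have key : ∀ (f f' : ℝ → ℝ), (∀ s, 0 ≤ s → HasDerivAt f (f' s) s) → (∀ s, 0 ≤ s → 0 ≤ f' s) → f 0 ≤ f t := by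
    intro f f' h1 h2
    have : MonotoneOn f (Set.Ici 0) := by
      apply monotoneOn_of_deriv_nonneg (convex_Ici 0)
      · exact fun s hs => (h1 s hs).continuousAt.continuousWithinAt
      · intro s hs; rw [interior_Ici] at hs; exact (h1 s (le_of_lt hs)).differentiableAt.differentiableWithinAt
      · intro s hs; rw [interior_Ici] at hs; rw [(h1 s (le_of_lt hs)).deriv]; exact h2 s (le_of_lt hs)
    exact this Set.self_mem_Ici ht ht
  have L0 : Lam 0 = 0 := by simp [Lam]
  constructor
  · have := key Lam la (fun s hs => Lam_d (by linarith)) (fun s hs => (la_nonneg hs).1)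
    linarith
  · have := key (fun s => Real.log (1+s) + Real.log (1+s)^2/2 - Lam s) (fun s => (1 + Real.log (1+s))/(1+s) - la s)
      (fun s hs => by
        have hl := logp_d (t := s) (by linarith)
        have := (hl.add ((hl.pow 2).div_const 2)).sub (Lam_d (t := s) (by linarith))
        convert! this using 1
        have : 1 + s ≠ 0 := by linarith
        push_cast
        field_simp)
      (fun s hs => by
        have h1 := la_mul s
        have h2 := (la_nonneg hs).2
        rw [sub_nonneg, le_div_iff₀ (by linarith)]
        linarith)
    simp [L0] at this
    linarith

lemma Wf_bd {t : ℝ} (ht : 0 ≤ t) : |Wf t| ≤ 4 * Real.log (1+t)^2 + 10 * Real.log (1+t) + 10 := by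
  have h1 := Lam_bd ht
  have hl : 0 ≤ Real.log (1 + t) := Real.log_nonneg (by linarith)
  have h2 : 0 ≤ 2/(1+t) := by positivity
  have h3 : 2/(1+t) ≤ 2 := by rw [div_le_iff₀ (by linarith)]; linarith
  have h4 : |4 * (2/(1+t) - 1) * Lam t| ≤ 4 * Lam t := by
    rw [abs_mul, abs_mul, abs_of_nonneg h1.1, abs_of_pos (by norm_num : (0:ℝ) < 4)]
    have : |2/(1+t) - 1| ≤ 1 := by rw [abs_le]; constructor <;> linarith
    have := mul_le_mul_of_nonneg_right this h1.1
    linarith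
  rw [abs_le] at h4
  have := sq_nonneg (Real.log (1+t))
  unfold Wf
  rw [abs_le]; constructor <;> linarith

lemma logt_bd (z : ℂ) {a : ℝ} (ha : 0 < a) : Real.log (1 + ‖z‖^2/8) ≤ 2 / a * (1 + ‖z‖)^a := by
  have h0 := norm_nonneg z
  have h1 : Real.log (1 + ‖z‖^2/8) ≤ Real.log ((1 + ‖z‖)^2) := by
    apply Real.log_le_log (by positivity)
    nlinarith
  rw [Real.log_pow] at h1
  have h2 := Real.log_le_rpow_div (x := 1 + ‖z‖) (by positivity) ha
  push_cast at h1
  calc _ ≤ _ := h1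
    _ ≤ 2 * ((1 + ‖z‖)^a/a) := by linarith
    _ = _ := by ring

lemma wc_bound {τ : ℝ} (hτ : 0 < τ) : ∃ C > 0, ∀ z, |wc z| ≤ C * (1 + ‖z‖)^τ := by
  refine ⟨4 * (4/τ)^2 + 10 * (4/τ) + 10, by positivity, fun z => ?_⟩
  have h0 := norm_nonneg z
  have h1 := Wf_bd (t := ‖z‖^2/8) (by positivity)
  have h2 := logt_bd z (half_pos hτ)
  have e : 2/(τ/2) = 4/τ := by field_simp; norm_num
  rw [e] at h2
  have hl : 0 ≤ Real.log (1 + ‖z‖^2/8) := Real.log_nonneg (by have := sq_nonneg ‖z‖; linarith)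
  have hX : 1 ≤ (1 + ‖z‖)^(τ/2) := Real.one_le_rpow (by linarith) (by positivity)
  have hX2 : (1 + ‖z‖)^τ = ((1 + ‖z‖)^(τ/2))^2 := by
    rw [← Real.rpow_natCast, ← Real.rpow_mul (by positivity)]; congr 1; push_cast; ring
  rw [hX2]
  unfold wc
  set X := (1 + ‖z‖)^(τ/2)
  set l := Real.log (1 + ‖z‖^2/8)
  have h3 : l^2 ≤ (4/τ*X)^2 := by gcongr
  have h4 : X ≤ X^2 := by nlinarith
  have h5 : 4/τ * X ≤ 4/τ * X^2 := mul_le_mul_of_nonneg_left h4 (by positivity)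
  have e2 : (4 * (4/τ)^2 + 10 * (4/τ) + 10) * X^2 = 4 * (4/τ*X)^2 + 10 * (4/τ * X^2) + 10 * X^2 := by ring
  rw [e2]
  nlinarith

lemma integrable_lapwc : Integrable (fun z => lapC wc z) := by
  obtain ⟨C, hC, hw⟩ := wc_bound (τ := 1) one_pos
  have hc : Continuous (fun z => lapC wc z) := contDiff_lapC (contDiff_wc.of_le (by norm_num))
  apply (int_cube.const_mul (81 * (32 + C))).mono' hc.aestronglyMeasurable
  refine Filter.Eventually.of_forall fun z => ?_
  have h0 := norm_nonneg z
  rw [lapC_wc, Real.norm_eq_abs, abs_mul, abs_of_pos (Real.exp_pos _)]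
  have h1 : Real.exp (Uc z) ≤ 81 / (1 + ‖z‖)^4 := by
    rw [exp_Uc, div_le_div_iff₀ (by positivity) (by positivity)]
    have : 8 * (1 + ‖z‖)^2 ≤ 9 * (8 + ‖z‖^2) := by nlinarith [sq_nonneg (‖z‖ - 8)]
    have := mul_self_le_mul_self (by positivity) this
    nlinarith
  have h2 := logt_bd z (a := 1/2) (by norm_num)
  have hl : 0 ≤ Real.log (1 + ‖z‖^2/8) := Real.log_nonneg (by have := sq_nonneg ‖z‖; linarith)
  have h3 : Real.log (1 + ‖z‖^2/8)^2 ≤ 16 * (1 + ‖z‖) := by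
    calc _ ≤ (2/(1/2) * (1 + ‖z‖)^(1/2:ℝ))^2 := by gcongr
      _ = 16 * ((1 + ‖z‖)^(1/2:ℝ))^2 := by ring
      _ = _ := by
        rw [← Real.rpow_natCast, ← Real.rpow_mul (by positivity)]; norm_num
  have h4 : |Uc z^2/2 - wc z| ≤ (32 + C) * (1 + ‖z‖) := by
    have h5 := hw z
    rw [Real.rpow_one] at h5
    have e : Uc z^2/2 = 2 * Real.log (1 + ‖z‖^2/8)^2 := by unfold Uc; ring
    have := abs_sub (Uc z^2/2) (wc z)
    rw [e] at this ⊢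
    rw [abs_of_nonneg (a := 2 * Real.log (1 + ‖z‖^2/8)^2) (by positivity)] at this
    linarith
  calc _ ≤ 81 / (1 + ‖z‖)^4 * ((32 + C) * (1 + ‖z‖)) := by gcongr
    _ = _ := by field_simp

lemma T_lim : Tendsto (fun t => t * Wf1 t) atTop (𝓝 6) := by
  rw [tendsto_iff_norm_sub_tendsto_zero]
  have h0 : Tendsto (fun t : ℝ => 144 * (1+t)^(-(1/2:ℝ))) atTop (𝓝 0) := by
    have := ((tendsto_rpow_neg_atTop (y := 1/2) (by norm_num)).comp (tendsto_atTop_add_const_left atTop (1:ℝ) tendsto_id)).const_mul 144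
    simpa [Function.comp_def] using this
  apply squeeze_zero' (Filter.Eventually.of_forall fun t => norm_nonneg _) _ h0
  filter_upwards [Filter.eventually_ge_atTop 0] with t ht
  have hs : (1 + t) ≠ 0 := by linarith
  have e : t * Wf1 t - 6 = 4 * Real.log (1+t)/(1+t) - 6/(1+t) - 8 * (t/(1+t)) * Lam t/(1+t) - 10 * (t/(1+t))/(1+t) := by
    have h1 := la_mul t
    have : t * Wf1 t = 4 * t * Real.log (1+t)/(1+t) + 6*t/(1+t) - 8 * t * Lam t/(1+t)^2 + 4 * (2/(1+t) - 1) * (t * la t) - 10*t/(1+t)^2 := by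
      unfold Wf1; ring
    rw [this, h1]
    field_simp
    ring
  rw [e, Real.norm_eq_abs]
  have hL := Lam_bd ht
  have hl : 0 ≤ Real.log (1 + t) := Real.log_nonneg (by linarith)
  have hl2 := Real.log_le_rpow_div (x := 1 + t) (ε := 1/4) (by positivity) (by norm_num)
  have hX : 1 ≤ (1 + t)^(1/4:ℝ) := Real.one_le_rpow (by linarith) (by positivity)
  have hq : t/(1+t) ≤ 1 := by rw [div_le_one (by linarith)]; linarith
  have hq0 : 0 ≤ t/(1+t) := by positivity
  have hX2 : (1 + t)^(-(1/2:ℝ)) = ((1 + t)^(1/4:ℝ))^2/(1+t) := by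
    rw [← Real.rpow_natCast, ← Real.rpow_mul (by positivity)]
    nth_rw 3 [← Real.rpow_one (1 + t)]
    rw [← Real.rpow_sub (by linarith)]; norm_num
  rw [hX2]
  set X := (1 + t)^(1/4:ℝ)
  set l := Real.log (1+t)
  have hl3 : l ≤ 4 * X := by linarith
  have hl4 : l^2 ≤ 16 * X^2 := by nlinarith
  have hX4 : X ≤ X^2 := by nlinarith
  have e2 : 4 * l/(1+t) - 6/(1+t) - 8 * (t/(1+t)) * Lam t/(1+t) - 10 * (t/(1+t))/(1+t) = (4 * l - 6 - 8 * ((t/(1+t)) * Lam t) - 10 * (t/(1+t)))/(1+t) := by ring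
  rw [e2, abs_div, abs_of_pos (by linarith : 0 < 1 + t), ← mul_div_assoc 144 (X^2) (1+t)]
  apply div_le_div_of_nonneg_right _ (by linarith)
  have a1 : (t/(1+t)) * Lam t ≤ Lam t := mul_le_of_le_one_left hL.1 hq
  have a2 : 0 ≤ (t/(1+t)) * Lam t := mul_nonneg hq0 hL.1
  rw [abs_le]; constructor <;> linarith

lemma integral_lapwc : ∫ z, lapC wc z = 24 * π := by
  have e : (fun z => lapC wc z) = fun z : ℂ => (fun r : ℝ => (r^2/8 * Wf2 (r^2/8) + Wf1 (r^2/8)) / 2) ‖z‖ := by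
    funext z
    simp only
    rw [lapC_wc, Wf_ode (tpos z), exp_Uc']; unfold wc Uc; ring
  have hi := integrable_lapwc
  rw [e] at hi ⊢
  have hi := (integrable_rad (fun r : ℝ => (r^2/8 * Wf2 (r^2/8) + Wf1 (r^2/8)) / 2)).1 hi
  rw [int_rad (fun r : ℝ => (r^2/8 * Wf2 (r^2/8) + Wf1 (r^2/8)) / 2)]
  have h1 : ∀ y : ℝ, HasDerivAt (fun y => 2 * ((y^2/8) * Wf1 (y^2/8))) (y * ((y^2/8 * Wf2 (y^2/8) + Wf1 (y^2/8)) / 2)) y := by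
    intro y
    have ht : -1 < y^2/8 := by have := sq_nonneg y; linarith
    have h2 : HasDerivAt (fun y : ℝ => y^2/8) (y/4) y := by
      have := ((hasDerivAt_id y).pow 2).div_const 8
      convert! this using 1
      simp; ring
    have h3 := (h2.mul ((Wf1_d ht).comp y h2)).const_mul 2
    convert! h3 using 1
    simp only [Function.comp]; ring
  have h2 := integral_Ioi_of_hasDerivAt_of_tendsto (a := 0) (m := 2 * 6) (f := fun y => 2 * ((y^2/8) * Wf1 (y^2/8)))
    (h1 0).continuousAt.continuousWithinAt (fun y _ => h1 y) hi (by
      apply Tendsto.const_mul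
      apply T_lim.comp (g := fun t => t * Wf1 t) (f := fun y : ℝ => y^2/8)
      exact (tendsto_pow_atTop (by norm_num)).atTop_div_const (by norm_num))
  rw [h2]
  simp
  ring

end LE

namespace LE
open ComplexConjugate

/-- Convex smooth truncation. -/
def Hs (δ t : ℝ) : ℝ := ∫ s in (0:ℝ)..t, Real.smoothTransition ((s - δ)/δ)

lemma Hs_cont (δ : ℝ) : Continuous (fun s => Real.smoothTransition ((s - δ)/δ)) :=
  Real.smoothTransition.continuous.comp ((continuous_id.sub continuous_const).div_const δ)

lemma Hs_d (δ t : ℝ) : HasDerivAt (Hs δ) (Real.smoothTransition ((t - δ)/δ)) t :=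
  intervalIntegral.integral_hasDerivAt_right ((Hs_cont δ).intervalIntegrable _ _)
    ((Hs_cont δ).stronglyMeasurableAtFilter _ _) (Hs_cont δ).continuousAt

lemma Hs1_cd (δ : ℝ) : ContDiff ℝ 2 (fun s => Real.smoothTransition ((s - δ)/δ)) :=
  (Real.smoothTransition.contDiff (n := 2)).comp ((contDiff_id.sub contDiff_const).div_const δ)

lemma Hs_cd (δ : ℝ) : ContDiff ℝ 2 (Hs δ) := by
  have : (2 : WithTop ℕ∞) = 1 + 1 := by norm_num
  rw [this, contDiff_succ_iff_deriv]
  refine ⟨fun t => (Hs_d δ t).differentiableAt, by intro h; exact absurd h (by decide), ?_⟩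
  have : deriv (Hs δ) = fun s => Real.smoothTransition ((s - δ)/δ) := funext fun t => (Hs_d δ t).deriv
  rw [this]
  exact (Hs1_cd δ).of_le (by norm_num)

lemma Hs1_mono {δ : ℝ} (hδ : 0 < δ) : Monotone (fun s => Real.smoothTransition ((s - δ)/δ)) := by
  intro a b hab
  apply Real.smoothTransition.monotone
  gcongr

lemma Hs_zero {δ t : ℝ} (hδ : 0 < δ) (ht : t ≤ δ) : Hs δ t = 0 := by
  unfold Hs
  rw [intervalIntegral.integral_congr (g := fun _ => (0:ℝ))]
  · simp
  intro s hs
  simp only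
  apply Real.smoothTransition.zero_of_nonpos
  have : s ≤ δ := by
    rw [Set.mem_uIcc] at hs
    rcases hs with h | h <;> linarith [h.2]
  apply div_nonpos_of_nonpos_of_nonneg <;> linarith

lemma Hs_ge {δ t : ℝ} (hδ : 0 < δ) : t - 2 * δ ≤ Hs δ t := by
  rcases le_total t δ with h | h
  · rw [Hs_zero hδ h]; linarith
  have hm : AntitoneOn (fun t => t - Hs δ t) (Set.Ici (2*δ)) ∨ True := Or.inr trivial
  have mono : Monotone (fun t => Hs δ t) := by
    apply monotone_of_deriv_nonneg
    · exact fun t => (Hs_d δ t).differentiableAt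
    · intro t; rw [(Hs_d δ t).deriv]; exact Real.smoothTransition.nonneg _
  rcases le_total t (2 * δ) with h2 | h2
  · have := mono h
    simp only [Hs_zero hδ le_rfl] at this
    linarith
  · have : MonotoneOn (fun t => Hs δ t - t) (Set.Ici (2*δ)) := by
      have hd : ∀ s, HasDerivAt (fun t => Hs δ t - t) (Real.smoothTransition ((s - δ)/δ) - 1) s := fun s => (Hs_d δ s).sub (hasDerivAt_id s)
      apply monotoneOn_of_deriv_nonneg (convex_Ici _)
      · exact fun s _ => (hd s).continuousAt.continuousWithinAt
      · exact fun s _ => (hd s).differentiableAt.differentiableWithinAt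
      · intro s hs
        rw [interior_Ici] at hs
        simp only [Set.mem_Ioi] at hs
        rw [(hd s).deriv, Real.smoothTransition.one_of_one_le]
        · simp
        · rw [le_div_iff₀ hδ]; linarith
    have h3 := this (Set.self_mem_Ici) h2 h2
    simp only at h3
    have h4 := mono (show δ ≤ 2 * δ by linarith)
    simp only [Hs_zero hδ le_rfl] at h4
    linarith

lemma lapC_comp_ge {h u : ℂ → ℝ} {H H1 : ℝ → ℝ} {O : Set ℂ} (hO : IsOpen O) (hu : ContDiffOn ℝ 2 u O)
    (hH : ∀ t, HasDerivAt H (H1 t) t) (hH1 : ContDiff ℝ 2 H1) (hm : Monotone H1) {z : ℂ} (hz : z ∈ O) :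
    H1 (u z) * lapC u z ≤ lapC (fun y => H (u y)) z := by
  have hd : ∀ y ∈ O, DifferentiableAt ℝ u y := fun y hy => (hu.contDiffAt (hO.mem_nhds hy)).differentiableAt (by norm_num)
  have key : ∀ k : ℂ, fderiv ℝ (fun y => fderiv ℝ (fun y => H (u y)) y k) z k =
      H1 (u z) * fderiv ℝ (fun y => fderiv ℝ u y k) z k + deriv H1 (u z) * (fderiv ℝ u z k)^2 := by
    intro k
    have e : (fun y => fderiv ℝ (fun y => H (u y)) y k) =ᶠ[𝓝 z] fun y => H1 (u y) * fderiv ℝ u y k := by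
      filter_upwards [hO.mem_nhds hz] with y hy
      have := ((hH (u y)).comp_hasFDerivAt y (hd y hy).hasFDerivAt).fderiv
      simp only [Function.comp_def] at this
      rw [this]; simp
    rw [e.fderiv_eq]
    have h2 : DifferentiableAt ℝ (fun y => fderiv ℝ u y k) z := by
      have h3 : ContDiffAt ℝ 1 (fderiv ℝ u) z := (hu.contDiffAt (hO.mem_nhds hz)).fderiv_right (by norm_num)
      exact (h3.clm_apply contDiffAt_const).differentiableAt (by norm_num)
    have h1 : HasFDerivAt (fun y => H1 (u y)) (deriv H1 (u z) • fderiv ℝ u z) z :=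
      ((hH1.differentiable (by norm_num)) (u z)).hasDerivAt.comp_hasFDerivAt z (hd z hz).hasFDerivAt
    have h4 : HasFDerivAt (fun y => H1 (u y) * fderiv ℝ u y k) _ z := h1.mul h2.hasFDerivAt
    rw [h4.fderiv]
    simp
    ring
  unfold lapC
  rw [key, key]
  have : 0 ≤ deriv H1 (u z) := hm.deriv_nonneg
  have a := mul_nonneg this (sq_nonneg (fderiv ℝ u z 1))
  have b := mul_nonneg this (sq_nonneg (fderiv ℝ u z Complex.I))
  linarith

/-- The transferred problem: positive side with maximum point `x0`. -/
structure Sol (D p : ℝ) (Ω : Set ℂ) (u : ℂ → ℝ) (x0 : ℂ) : Prop where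
  hp : 1 < p
  hD : 1 ≤ D
  hO : IsOpen Ω
  hb : Ω ⊆ ball 0 D
  cd : ContDiffOn ℝ 2 u Ω
  cc : ContinuousOn u (closure Ω)
  eq : ∀ x ∈ Ω, lapC u x = -(|u x|^(p-1) * u x)
  bd : ∀ x ∈ frontier Ω, u x = 0
  mem : x0 ∈ Ω
  mx : ∀ y ∈ closure Ω, u y ≤ u x0
  pos : 0 < u x0

def gp (p : ℝ) (u : ℂ → ℝ) (y : ℂ) : ℝ := (max (u y) 0)^p

lemma gp_nonneg (p : ℝ) (u : ℂ → ℝ) (y : ℂ) : 0 ≤ gp p u y := Real.rpow_nonneg (le_max_right _ _) _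

/-- log kernel -/
def LK (D : ℝ) (x y : ℂ) : ℝ := Real.log (2*D) - Real.log ‖y - x‖

lemma LK_nonneg {D : ℝ} (hD : 1 ≤ D) {x y : ℂ} (hx : x ∈ ball (0:ℂ) D) (hy : y ∈ ball (0:ℂ) D) : 0 ≤ LK D x y := by
  unfold LK
  rw [mem_ball_zero_iff] at hx hy
  by_cases h : y = x
  · subst h; simp; exact Real.log_nonneg (by linarith)
  have h1 : 0 < ‖y - x‖ := norm_pos_iff.2 (sub_ne_zero.2 h)
  have := Real.log_le_log h1 (show ‖y - x‖ ≤ 2 * D by have := norm_sub_le y x; linarith)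
  linarith

lemma LK_locInt (D : ℝ) (x : ℂ) : LocallyIntegrable (LK D x) :=
  (continuous_const.locallyIntegrable).sub (locInt_log x)

lemma LK_int (D : ℝ) (x : ℂ) {S : Set ℂ} (hS : S ⊆ ball 0 D) : IntegrableOn (LK D x) S :=
  ((LK_locInt D x).integrableOn_isCompact (isCompact_closedBall (0:ℂ) D)).mono_set (hS.trans ball_subset_closedBall)

section
variable {D p : ℝ} {Ω : Set ℂ} {u : ℂ → ℝ} {x0 : ℂ}

lemma Sol.gp_cont (h : Sol D p Ω u x0) {q : ℝ} (hq : 0 ≤ q) : ContinuousOn (gp q u) (closure Ω) :=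
  (h.cc.sup continuousOn_const).rpow_const (fun x _ => Or.inr hq)

lemma Sol.gp_le (h : Sol D p Ω u x0) {q : ℝ} (hq : 0 ≤ q) {y : ℂ} (hy : y ∈ Ω) : gp q u y ≤ u x0 ^ q :=
  Real.rpow_le_rpow (le_max_right _ _) (max_le (h.mx y (subset_closure hy)) h.pos.le) hq

lemma Sol.gp_aesm (h : Sol D p Ω u x0) {q : ℝ} (hq : 0 ≤ q) : AEStronglyMeasurable (gp q u) (volume.restrict Ω) :=
  ((h.gp_cont hq).mono subset_closure).aestronglyMeasurable h.hO.measurableSet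

lemma Sol.vol (h : Sol D p Ω u x0) : volume Ω < ⊤ := (measure_mono h.hb).trans_lt measure_ball_lt_top

lemma Sol.int_mul (h : Sol D p Ω u x0) {q : ℝ} (hq : 0 ≤ q) {k : ℂ → ℝ} (hk : IntegrableOn k Ω) :
    IntegrableOn (fun y => k y * gp q u y) Ω := by
  apply Integrable.mul_bdd (c := u x0 ^ q) hk (h.gp_aesm hq)
  filter_upwards [ae_restrict_mem h.hO.measurableSet] with y hy
  rw [Real.norm_of_nonneg (gp_nonneg _ _ _)]
  exact h.gp_le hq hy

lemma Sol.gp_int (h : Sol D p Ω u x0) {q : ℝ} (hq : 0 ≤ q) : IntegrableOn (gp q u) Ω := by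
  have := h.int_mul hq (k := fun _ => 1) (integrableOn_const h.vol.ne)
  simpa using this

lemma Sol.green (h : Sol D p Ω u x0) {x : ℂ} (hx : x ∈ Ω) :
    2 * π * u x ≤ ∫ y in Ω, LK D x y * gp p u y := by
  have main : ∀ δ > 0, 2 * π * (u x - 2 * δ) ≤ ∫ y in Ω, LK D x y * gp p u y := by
    intro δ hδ
    classical
    let φ : ℂ → ℝ := Ω.indicator (fun y => Hs δ (u y))
    let K : Set ℂ := closure Ω ∩ u ⁻¹' (Set.Ici δ)
    have hKc : IsClosed K := h.cc.preimage_isClosed_of_isClosed isClosed_closure isClosed_Ici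
    have hbd : IsBounded (closure Ω) := (isBounded_ball.subset h.hb).closure
    have hK : IsCompact K := Metric.isCompact_of_isClosed_isBounded hKc (hbd.subset Set.inter_subset_left)
    have hKO : K ⊆ Ω := by
      intro y hy
      by_contra hn
      have := h.bd y ⟨hy.1, by rwa [h.hO.interior_eq]⟩
      have h2 := hy.2
      simp only [Set.mem_preimage, Set.mem_Ici] at h2
      linarith
    have hφ0 : ∀ y ∉ K, φ y = 0 := by
      intro y hy
      by_cases hyO : y ∈ Ω
      · simp only [φ, Set.indicator_of_mem hyO]
        apply Hs_zero hδ
        by_contra hn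
        push Not at hn
        exact hy ⟨subset_closure hyO, hn.le⟩
      · simp [φ, hyO]
    have hev1 : ∀ y ∈ Ω, φ =ᶠ[𝓝 y] fun y => Hs δ (u y) := by
      intro y hy
      filter_upwards [h.hO.mem_nhds hy] with s hs
      simp [φ, hs]
    have hev2 : ∀ y ∉ K, φ =ᶠ[𝓝 y] fun y => 0 := by
      intro y hy
      filter_upwards [hKc.isOpen_compl.mem_nhds hy] with s hs
      exact hφ0 s hs
    have hcd : ContDiff ℝ 2 φ := by
      rw [contDiff_iff_contDiffAt]
      intro y
      by_cases hy : y ∈ K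
      · refine ContDiffAt.congr_of_eventuallyEq ?_ (hev1 y (hKO hy))
        exact (Hs_cd δ).contDiffAt.comp y (h.cd.contDiffAt (h.hO.mem_nhds (hKO hy)))
      · exact contDiffAt_const.congr_of_eventuallyEq (hev2 y hy)
    have hcs : HasCompactSupport φ := HasCompactSupport.intro hK hφ0
    have hl0 : ∀ y ∉ Ω, lapC φ y = 0 := by
      intro y hy
      rw [lapC_congr (hev2 y (fun hk => hy (hKO hk)))]
      simp [lapC]
    have hl1 : ∀ y ∈ Ω, -gp p u y ≤ lapC φ y := by
      intro y hy
      rw [lapC_congr (hev1 y hy)]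
      refine le_trans ?_ (lapC_comp_ge (h := u) h.hO h.cd (Hs_d δ) (Hs1_cd δ) (Hs1_mono hδ) hy)
      rw [h.eq y hy]
      by_cases hu : u y ≤ 0
      · rw [Real.smoothTransition.zero_of_nonpos]
        · have := gp_nonneg p u y; linarith
        · apply div_nonpos_of_nonpos_of_nonneg <;> linarith
      · push Not at hu
        have e : |u y|^(p-1) * u y = gp p u y := by
          unfold gp
          rw [abs_of_pos hu, max_eq_left hu.le]
          nth_rw 2 [← Real.rpow_one (u y)]
          rw [← Real.rpow_add hu]; ring_nf
        rw [e]
        have := mul_le_mul_of_nonneg_right (Real.smoothTransition.le_one ((u y - δ)/δ)) (gp_nonneg p u y)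
        linarith
    have r1 := log_repr hcd hcs x
    have r2 := integral_lapC hcd hcs
    have hlc : Continuous (lapC φ) := contDiff_lapC hcd
    have hls : HasCompactSupport (lapC φ) := hcs_lapC hcs
    have i1 : Integrable (fun y => Real.log ‖y - x‖ * lapC φ y) := by
      have := (locInt_log x).integrable_smul_left_of_hasCompactSupport hlc hls
      refine this.congr (ae_of_all _ fun y => ?_)
      simp [mul_comm]
    have i2 : Integrable (fun y => Real.log (2*D) * lapC φ y) := (hlc.integrable_of_hasCompactSupport hls).const_mul _
    have e1 : 2 * π * φ x = ∫ y, -(LK D x y * lapC φ y) := by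
      have : (fun y => -(LK D x y * lapC φ y)) = fun y => Real.log ‖y - x‖ * lapC φ y - Real.log (2*D) * lapC φ y := by
        funext y; unfold LK; ring
      rw [this, integral_sub i1 i2, r1, integral_const_mul, r2]; ring
    have e2 : ∫ y, -(LK D x y * lapC φ y) = ∫ y in Ω, -(LK D x y * lapC φ y) := by
      rw [setIntegral_eq_integral_of_forall_compl_eq_zero]
      intro y hy; rw [hl0 y hy]; simp
    have i3 : IntegrableOn (fun y => -(LK D x y * lapC φ y)) Ω := by
      have : Integrable (fun y => -(LK D x y * lapC φ y)) := by
        refine (i1.sub i2).congr (ae_of_all _ fun y => ?_)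
        simp only [Pi.sub_apply, LK]; ring
      exact this.integrableOn
    calc 2 * π * (u x - 2 * δ) ≤ 2 * π * φ x := by
          have := Hs_ge (t := u x) hδ
          have e : φ x = Hs δ (u x) := by simp [φ, hx]
          rw [e]
          have := Real.pi_pos
          gcongr
      _ = ∫ y in Ω, -(LK D x y * lapC φ y) := by rw [e1, e2]
      _ ≤ _ := by
        apply setIntegral_mono_on i3 (h.int_mul (by linarith [h.hp]) (LK_int D x h.hb)) h.hO.measurableSet
        intro y hy
        have a := LK_nonneg h.hD (h.hb hx) (h.hb hy)
        have := mul_le_mul_of_nonneg_left (hl1 y hy) a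
        linarith
  by_contra hn
  push Not at hn
  set J := ∫ y in Ω, LK D x y * gp p u y
  have hpi := Real.pi_pos
  have := main ((2 * π * u x - J)/(8*π)) (by apply div_pos <;> linarith)
  have e : 2 * π * (u x - 2 * ((2 * π * u x - J)/(8*π))) = 2 * π * u x - (2 * π * u x - J)/2 := by field_simp; ring
  rw [e] at this
  linarith

end
end LE

namespace LE
open ComplexConjugate

def FK (γ D r : ℝ) : ℝ := Real.exp (γ * (Real.log (2*D) - Real.log r))

lemma FK_int0 {γ D : ℝ} (hγ : γ < 2) (hD : 1 ≤ D) : IntegrableOn (fun z : ℂ => FK γ D ‖z‖) (ball 0 (2*D)) := by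
  rw [← integrable_indicator_iff measurableSet_ball]
  have e : ((ball (0:ℂ) (2*D)).indicator (fun z : ℂ => FK γ D ‖z‖)) =
    fun z : ℂ => (fun r : ℝ => (Set.Iio (2*D)).indicator (FK γ D) r) ‖z‖ := by
    funext z
    by_cases h : ‖z‖ < 2*D <;> simp [Set.indicator, h]
  rw [e, integrable_rad]
  have h1 : IntegrableOn (fun x : ℝ => Real.exp (γ * Real.log (2*D)) * x^(1-γ)) (Set.Ioo 0 (2*D)) := by
    apply Integrable.const_mul
    exact (intervalIntegral.integrableOn_Ioo_rpow_iff (by linarith)).2 (by linarith)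
  rw [← integrable_indicator_iff measurableSet_Ioo] at h1
  refine h1.integrableOn.congr_fun ?_ measurableSet_Ioi
  intro y hy
  simp only [Set.mem_Ioi] at hy
  by_cases h : y < 2*D
  · simp only [Set.indicator, Set.mem_Ioo, hy, h, and_self, if_true, Set.mem_Iio, FK]
    rw [Real.rpow_def_of_pos hy, ← Real.exp_add]
    nth_rw 2 [← Real.exp_log hy]
    rw [← Real.exp_add]
    congr 1; ring
  · simp [Set.indicator, h]

lemma FK_int {γ D : ℝ} (hγ : γ < 2) (hD : 1 ≤ D) (x : ℂ) : IntegrableOn (fun y : ℂ => FK γ D ‖y - x‖) (ball x (2*D)) ∧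
    ∫ y in ball x (2*D), FK γ D ‖y - x‖ = ∫ y in ball (0:ℂ) (2*D), FK γ D ‖y‖ := by
  have h0 := FK_int0 hγ hD
  have e : (ball x (2*D)).indicator (fun y : ℂ => FK γ D ‖y - x‖) = fun y => (ball (0:ℂ) (2*D)).indicator (fun y => FK γ D ‖y‖) (y - x) := by
    funext z; simp [Set.indicator, dist_eq_norm]
  constructor
  · rw [← integrable_indicator_iff measurableSet_ball] at h0 ⊢
    rw [e]; exact h0.comp_sub_right x
  · rw [← integral_indicator measurableSet_ball, ← integral_indicator measurableSet_ball, e,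
      integral_sub_right_eq_self ((ball (0:ℂ) (2*D)).indicator (fun y => FK γ D ‖y‖)) x]

lemma ball_sub {D : ℝ} {S : Set ℂ} (hS : S ⊆ ball 0 D) {x : ℂ} (hx : x ∈ ball (0:ℂ) D) : S ⊆ ball x (2*D) := by
  intro y hy
  have := hS hy
  rw [mem_ball_zero_iff] at this hx
  rw [mem_ball, dist_eq_norm]
  have := norm_sub_le y x
  linarith

lemma FK_bd {γ : ℝ} (hγ : γ < 2) (D : ℝ) (hD : 1 ≤ D) : ∃ C > 0, ∀ x ∈ ball (0:ℂ) D, ∀ S ⊆ ball (0:ℂ) D, MeasurableSet S →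
    IntegrableOn (fun y => Real.exp (γ * LK D x y)) S ∧ ∫ y in S, Real.exp (γ * LK D x y) ≤ C := by
  refine ⟨(∫ y in ball (0:ℂ) (2*D), FK γ D ‖y‖) + 1, ?_, fun x hx S hS hm => ⟨(FK_int hγ hD x).1.mono_set (ball_sub hS hx), ?_⟩⟩
  · have : 0 ≤ ∫ y in ball (0:ℂ) (2*D), FK γ D ‖y‖ := integral_nonneg fun y => (Real.exp_pos _).le
    linarith
  · rw [← (FK_int hγ hD x).2]
    have : ∫ y in S, Real.exp (γ * LK D x y) ≤ ∫ y in ball x (2*D), FK γ D ‖y - x‖ :=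
      setIntegral_mono_set (FK_int hγ hD x).1 (ae_of_all _ fun y => (Real.exp_pos _).le) (ball_sub hS hx).eventuallyLE
    linarith

def AA (p : ℝ) (Ω : Set ℂ) (u : ℂ → ℝ) : ℝ := p * ∫ y in Ω, gp p u y
def EE (p : ℝ) (Ω : Set ℂ) (u : ℂ → ℝ) : ℝ := p * ∫ y in Ω, gp (p+1) u y

lemma young_pt {p b w : ℝ} (hp : 1 < p) :
    b * (max w 0)^p ≤ Real.log p * (max w 0)^p + p * Real.exp (-(1/2)) * (max w 0)^(p+1) - p/2 * (max w 0)^p + Real.exp b / p := by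
  by_cases hw : w ≤ 0
  · rw [max_eq_right hw, Real.zero_rpow (by linarith), Real.zero_rpow (by linarith)]
    simp; positivity
  push Not at hw
  rw [max_eq_left hw.le]
  have hg : 0 < w^p := Real.rpow_pos_of_pos hw p
  set a := p * w^p with ha
  have ha0 : 0 < a := by positivity
  have h1 : a * b - a * Real.log a + a ≤ Real.exp b := by
    have := Real.add_one_le_exp (b - Real.log a)
    rw [Real.exp_sub, Real.exp_log ha0, le_div_iff₀ ha0] at this
    linarith
  have hla : Real.log a = Real.log p + p * Real.log w := by
    rw [ha, Real.log_mul (by linarith) hg.ne', Real.log_rpow hw]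
  have h2 : Real.log w ≤ w * Real.exp (-(1/2)) - 1/2 := by
    have := Real.log_le_sub_one_of_pos (x := w * Real.exp (-(1/2))) (by positivity)
    rw [Real.log_mul hw.ne' (Real.exp_pos _).ne', Real.log_exp] at this
    linarith
  have h3 : w^(p+1) = w^p * w := Real.rpow_add_one hw.ne' p
  rw [h3]
  have h4 : a * Real.log a ≤ a * (Real.log p + p * (w * Real.exp (-(1/2)) - 1/2)) := by
    rw [hla]; gcongr
  have hpe : Real.exp b / p * p = Real.exp b := div_mul_cancel₀ _ (by linarith)
  have hp0 : 0 < p := by linarith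
  refine le_of_mul_le_mul_right ?_ hp0
  have e1 : b * w^p * p = a * b := by rw [ha]; ring
  have e2 : (Real.log p * w^p + p * Real.exp (-(1/2)) * (w^p * w) - p/2 * w^p + Real.exp b / p) * p
     = a * (Real.log p + p * (w * Real.exp (-(1/2)) - 1/2)) + Real.exp b := by
    rw [add_mul _ (Real.exp b / p), hpe, ha]; ring
  rw [e1, e2]
  linarith

section
variable {D p : ℝ} {Ω : Set ℂ} {u : ℂ → ℝ} {x0 : ℂ}

lemma Sol.EE_nonneg (h : Sol D p Ω u x0) : 0 ≤ EE p Ω u :=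
  mul_nonneg (by linarith [h.hp]) (integral_nonneg fun y => gp_nonneg _ _ _)

lemma Sol.AA_nonneg (h : Sol D p Ω u x0) : 0 ≤ AA p Ω u :=
  mul_nonneg (by linarith [h.hp]) (integral_nonneg fun y => gp_nonneg _ _ _)

lemma Sol.EE_le (h : Sol D p Ω u x0) : EE p Ω u ≤ AA p Ω u * u x0 := by
  unfold EE AA
  have hp := h.hp
  rw [mul_assoc, ← integral_mul_const]
  apply mul_le_mul_of_nonneg_left _ (by linarith)
  apply setIntegral_mono_on (h.gp_int (by linarith)) ((h.gp_int (by linarith)).mul_const _) h.hO.measurableSet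
  intro y hy
  unfold gp
  rw [Real.rpow_add_one' (le_max_right _ _) (by linarith)]
  apply mul_le_mul_of_nonneg_left (max_le (h.mx y (subset_closure hy)) h.pos.le) (gp_nonneg p u y)
end

lemma Sol.young {γ : ℝ} (hγ : γ < 2) (hγ0 : 0 < γ) (D : ℝ) (hD : 1 ≤ D) : ∃ C > 0, ∀ (p : ℝ) (Ω : Set ℂ) (u : ℂ → ℝ) (x0 : ℂ), Sol D p Ω u x0 →
    2 * π * γ * u x0 ≤ Real.log p / p * AA p Ω u + Real.exp (-(1/2)) * EE p Ω u - AA p Ω u / 2 + C / p := by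
  obtain ⟨C, hC, hb⟩ := FK_bd hγ D hD
  refine ⟨C, hC, fun p Ω u x0 h => ?_⟩
  have hp := h.hp
  obtain ⟨i1, i2⟩ := hb x0 (h.hb h.mem) Ω h.hb h.hO.measurableSet
  have g1 := h.green h.mem
  have ig := h.gp_int (q := p) (by linarith)
  have ig1 := h.gp_int (q := p+1) (by linarith)
  have j1 : IntegrableOn (fun y => Real.log p * gp p u y + p * Real.exp (-(1/2)) * gp (p+1) u y - p/2 * gp p u y) Ω :=
    ((ig.const_mul _).add (ig1.const_mul _)).sub (ig.const_mul _)
  have j0 : IntegrableOn (fun y => Real.log p * gp p u y + p * Real.exp (-(1/2)) * gp (p+1) u y) Ω :=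
    ((ig.const_mul _).add (ig1.const_mul _))
  have key : ∫ y in Ω, γ * LK D x0 y * gp p u y ≤ ∫ y in Ω, (Real.log p * gp p u y + p * Real.exp (-(1/2)) * gp (p+1) u y - p/2 * gp p u y + Real.exp (γ * LK D x0 y) / p) := by
    apply setIntegral_mono_on (h.int_mul (by linarith) ((LK_int D x0 h.hb).const_mul γ)) (j1.add (i1.div_const p)) h.hO.measurableSet
    intro y hy
    exact young_pt hp
  rw [integral_add j1 (i1.div_const p), integral_sub j0 (ig.const_mul _), integral_add (ig.const_mul _) (ig1.const_mul _),
    integral_const_mul, integral_const_mul, integral_const_mul, integral_div] at key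
  have e : ∫ y in Ω, γ * LK D x0 y * gp p u y = γ * ∫ y in Ω, LK D x0 y * gp p u y := by
    rw [← integral_const_mul]; congr 1; funext y; ring
  rw [e] at key
  have hp0 : p ≠ 0 := by linarith
  have e2 : Real.log p / p * AA p Ω u = Real.log p * ∫ y in Ω, gp p u y := by unfold AA; field_simp
  rw [e2]
  unfold EE AA
  have a := mul_le_mul_of_nonneg_left g1 hγ0.le
  have b : (∫ y in Ω, Real.exp (γ * LK D x0 y))/p ≤ C/p := by gcongr
  linarith

lemma Sol.lower (D : ℝ) (hD : 1 ≤ D) : ∃ c > 0, ∀ (p : ℝ) (Ω : Set ℂ) (u : ℂ → ℝ) (x0 : ℂ), Sol D p Ω u x0 → c ≤ u x0 ^ (p-1) := by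
  obtain ⟨C, hC, hb⟩ := FK_bd (γ := 1) (by norm_num) D hD
  refine ⟨2*π/C, by positivity, fun p Ω u x0 h => ?_⟩
  have hp := h.hp
  obtain ⟨i1, i2⟩ := hb x0 (h.hb h.mem) Ω h.hb h.hO.measurableSet
  have g1 := h.green h.mem
  have hpos := h.pos
  have : ∫ y in Ω, LK D x0 y * gp p u y ≤ ∫ y in Ω, Real.exp (1 * LK D x0 y) * u x0 ^ p := by
    apply setIntegral_mono_on (h.int_mul (by linarith) (LK_int D x0 h.hb)) (i1.mul_const _) h.hO.measurableSet
    intro y hy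
    have a := LK_nonneg h.hD (h.hb h.mem) (h.hb hy)
    have b := Real.add_one_le_exp (1 * LK D x0 y)
    exact mul_le_mul (by linarith) (h.gp_le (by linarith) hy) (gp_nonneg _ _ _) (Real.exp_pos _).le
  rw [integral_mul_const] at this
  have hM : u x0 ^ p = u x0 ^ (p-1) * u x0 := by
    rw [← Real.rpow_add_one hpos.ne']; ring_nf
  have h2 : 2 * π * u x0 ≤ C * (u x0 ^ (p-1) * u x0) := by
    rw [← hM]
    have := mul_le_mul_of_nonneg_right i2 (Real.rpow_nonneg hpos.le p)
    linarith
  rw [div_le_iff₀ hC]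
  have h3 : 2 * π * u x0 ≤ (u x0^(p-1) * C) * u x0 := by linarith
  exact le_of_mul_le_mul_right h3 hpos

end LE

namespace LE
open ComplexConjugate

lemma ev_inv (C : ℝ) {θ : ℝ} (hθ : 0 < θ) : ∀ᶠ p : ℝ in atTop, C / p ≤ θ := by
  have : Tendsto (fun p : ℝ => C / p) atTop (𝓝 0) := tendsto_const_nhds.div_atTop tendsto_id
  exact (this.eventually (gt_mem_nhds hθ)).mono fun p hp => hp.le

lemma ev_log {θ : ℝ} (hθ : 0 < θ) : ∀ᶠ p : ℝ in atTop, Real.log p / p ≤ θ := by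
  have : Tendsto (fun p : ℝ => Real.log p / p) atTop (𝓝 0) := Real.isLittleO_log_id_atTop.tendsto_div_nhds_zero
  exact (this.eventually (gt_mem_nhds hθ)).mono fun p hp => hp.le

lemma ev_half {θ : ℝ} (hθ : 0 < θ) : ∀ᶠ p : ℝ in atTop, (1/2:ℝ)^(p-1) < θ := by
  have h1 : Tendsto (fun p : ℝ => (1/2:ℝ)^p) atTop (𝓝 0) := tendsto_rpow_atTop_of_base_lt_one _ (by norm_num) (by norm_num)
  have h2 : Tendsto (fun p : ℝ => p - 1) atTop atTop := tendsto_atTop_add_const_right _ _ tendsto_id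
  exact (h1.comp h2).eventually (gt_mem_nhds hθ)

def sq : ℝ := Real.exp (1/2)
lemma sq_pos : 0 < sq := Real.exp_pos _
lemma sq_one : 1 < sq := by unfold sq; rw [Real.one_lt_exp_iff]; norm_num
lemma sq_inv : Real.exp (-(1/2)) = 1 / sq := by unfold sq; rw [Real.exp_neg]; simp
lemma sq_sq : sq * sq = Real.exp 1 := by unfold sq; rw [← Real.exp_add]; norm_num
lemma sq_lt : sq < 2 := by
  have h1 := sq_sq
  have := Real.exp_one_lt_d9
  nlinarith [sq_pos]

lemma Sol.main (D : ℝ) (hD : 1 ≤ D) {Em θ : ℝ} (hE : 0 < Em) (hθ : 0 < θ) (hθ1 : θ ≤ 1) :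
    ∀ᶠ p : ℝ in atTop, ∀ (Ω : Set ℂ) (u : ℂ → ℝ) (x0 : ℂ), Sol D p Ω u x0 → EE p Ω u ≤ Em →
      4 * π * u x0 ≤ EE p Ω u / sq - AA p Ω u / 2 + θ ∧ 1/2 ≤ u x0 ∧ u x0 ≤ Em + 1 ∧ AA p Ω u ≤ 4 * (Em + 1) := by
  obtain ⟨C1, hC1, h1⟩ := Sol.young (γ := 1) (by norm_num) (by norm_num) D hD
  obtain ⟨c, hc, hl⟩ := Sol.lower D hD
  set K := 4 * (Em + 1) with hK
  set δ := θ / (24 * K) with hδ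
  have hK4 : 4 ≤ K := by linarith
  have hδ0 : 0 < δ := by positivity
  have hδ1 : δ < 1 := by rw [hδ, div_lt_one (by positivity)]; linarith
  obtain ⟨C2, hC2, h2⟩ := Sol.young (γ := 2 - δ) (by linarith) (by linarith) D hD
  filter_upwards [ev_inv C1 one_pos, ev_inv C2 (show 0 < θ/3 by positivity), ev_log (show (0:ℝ) < 1/4 by norm_num),
    ev_log (show 0 < θ/(3*K) by positivity), ev_half hc] with p e1 e2 e3 e4 e5 Ω u x0 h hEm
  have a1 := h1 p Ω u x0 h
  have a2 := h2 p Ω u x0 h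
  have a3 := hl p Ω u x0 h
  have hA := h.AA_nonneg
  have hEn := h.EE_nonneg
  have hM := h.pos
  have hpi := Real.pi_gt_three
  have hpi4 := Real.pi_le_four
  rw [sq_inv, one_div_mul_eq_div] at a1 a2
  have b1 : EE p Ω u / sq ≤ EE p Ω u := div_le_self hEn sq_one.le
  have b2 : Real.log p / p * AA p Ω u ≤ 1/4 * AA p Ω u := mul_le_mul_of_nonneg_right e3 hA
  have b3 : 6 * u x0 ≤ 2 * π * 1 * u x0 := by
    apply mul_le_mul_of_nonneg_right _ hM.le; linarith
  have c1 : AA p Ω u ≤ K := by linarith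
  have c2 : u x0 ≤ Em + 1 := by linarith
  refine ⟨?_, ?_, c2, c1⟩
  · have d1 : Real.log p / p * AA p Ω u ≤ θ/3 := by
      calc _ ≤ θ/(3*K) * AA p Ω u := mul_le_mul_of_nonneg_right e4 hA
        _ ≤ θ/(3*K) * K := by gcongr
        _ = θ/3 := by field_simp
    have d2 : 2 * π * δ * u x0 ≤ θ/3 := by
      calc 2 * π * δ * u x0 ≤ 2 * 4 * δ * K := by gcongr; linarith
        _ = θ/3 := by rw [hδ]; field_simp; norm_num
    linarith
  · by_contra hn
    push Not at hn
    have : u x0^(p-1) ≤ (1/2:ℝ)^(p-1) := Real.rpow_le_rpow hM.le hn.le (by linarith [h.hp])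
    linarith

/-- algebraic core -/
lemma core {M E A θ : ℝ} (hA : 0 ≤ A) (hθ1 : θ ≤ 1) (h1 : 4 * π * M ≤ E / sq - A / 2 + θ) (hM : 1/2 ≤ M)
    (h2 : E ≤ A * M) :
    4 * π * (M - sq)^2 - θ * M ≤ (E - 8 * π * Real.exp 1) * (M / sq - 1/2) ∧ 2 ≤ E * (M / sq - 1/2) := by
  have hpi := Real.pi_gt_three
  have h3 := mul_le_mul_of_nonneg_right h1 (show 0 ≤ M by linarith)
  have e1 : E / sq * M = E * (M / sq) := by ring
  have h4 : 4 * π * M * M + E/2 ≤ E * (M/sq) + θ * M := by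
    rw [← e1]; linarith
  have e2 : 8 * π * Real.exp 1 * (M/sq - 1/2) = 8 * π * sq * M - 4 * π * (sq * sq) := by
    rw [← sq_sq]; have := sq_pos.ne'; field_simp; ring
  constructor
  · have e3 : (E - 8 * π * Real.exp 1) * (M / sq - 1/2) = E * (M/sq) - E/2 - 8 * π * Real.exp 1 * (M/sq - 1/2) := by ring
    rw [e3, e2]
    have e4 : 4 * π * (M - sq)^2 = 4 * π * M * M - 8 * π * sq * M + 4 * π * (sq * sq) := by ring
    rw [e4]; linarith
  · have : (2:ℝ) ≤ 4 * π * M * M - θ * M := by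
      have a : θ * M ≤ 1 * M := mul_le_mul_of_nonneg_right hθ1 (by linarith)
      have b : 12 * (M * M) ≤ 4 * π * (M * M) := by
        apply mul_le_mul_of_nonneg_right _ (by nlinarith); linarith
      nlinarith
    linarith

lemma Sol.lowE (D : ℝ) (hD : 1 ≤ D) {Em η : ℝ} (hE : 0 < Em) (hη : 0 < η) :
    ∀ᶠ p : ℝ in atTop, ∀ (Ω : Set ℂ) (u : ℂ → ℝ) (x0 : ℂ), Sol D p Ω u x0 → EE p Ω u ≤ Em →
      8 * π * Real.exp 1 - η ≤ EE p Ω u := by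
  obtain ⟨θ, t0, t1, t2⟩ : ∃ θ > 0, θ ≤ 1 ∧ θ ≤ η / (Em * (Em+1)) := ⟨min 1 (η / (Em * (Em+1))), by positivity, by simp, by simp⟩
  filter_upwards [Sol.main D hD hE t0 t1] with p hp Ω u x0 h hEm
  obtain ⟨a1, a2, a3, a4⟩ := hp Ω u x0 h hEm
  obtain ⟨b1, b2⟩ := core h.AA_nonneg t1 a1 a2 h.EE_le
  by_contra hn
  push Not at hn
  set X := u x0 / sq - 1/2
  have hX : 0 < X := by
    by_contra hx
    push Not at hx
    have := mul_nonpos_of_nonneg_of_nonpos h.EE_nonneg hx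
    linarith
  have c1 : 2 ≤ Em * X := b2.trans (mul_le_mul_of_nonneg_right hEm hX.le)
  have c2 : (EE p Ω u - 8 * π * Real.exp 1) * X ≤ -η * X := mul_le_mul_of_nonneg_right (by linarith) hX.le
  have c3 : θ * u x0 ≤ η / Em := by
    calc _ ≤ η / (Em * (Em+1)) * (Em + 1) := by gcongr
      _ = _ := by field_simp
  have c4 : 2 * (η / Em) ≤ η * X := by
    rw [← mul_div_assoc, div_le_iff₀ hE]
    have := mul_le_mul_of_nonneg_left c1 hη.le
    linarith
  have c5 : 0 < η / Em := by positivity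
  have c6 : 0 ≤ 4 * π * (u x0 - sq)^2 := by positivity
  linarith

lemma Sol.close (D : ℝ) (hD : 1 ≤ D) {η : ℝ} (hη : 0 < η) : ∃ η' > 0,
    ∀ᶠ p : ℝ in atTop, ∀ (Ω : Set ℂ) (u : ℂ → ℝ) (x0 : ℂ), Sol D p Ω u x0 → EE p Ω u ≤ 8 * π * Real.exp 1 + η' →
      |u x0 - sq| ≤ η ∧ |AA p Ω u - 8 * π * sq| ≤ η ∧ 1/2 ≤ u x0 := by
  set Em := 8 * π * Real.exp 1 + 1 with hEm
  have hpi := Real.pi_gt_three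
  have hpi4 := Real.pi_le_four
  have hE0 : 0 < Em := by positivity
  obtain ⟨θ, t0, t1, t2, t3⟩ : ∃ θ > 0, θ ≤ 1 ∧ θ ≤ η/16 ∧ θ ≤ (η/60)^2/(Em+1) := ⟨min 1 (min (η/16) ((η/60)^2/(Em+1))), by positivity, by simp, by simp, by simp⟩
  refine ⟨θ, t0, ?_⟩
  filter_upwards [Sol.main D hD hE0 t0 t1, Sol.lowE D hD hE0 t0] with p hp hlow Ω u x0 h hEp
  obtain ⟨a1, a2, a3, a4⟩ := hp Ω u x0 h (by linarith)
  have hl := hlow Ω u x0 h (by linarith)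
  obtain ⟨b1, b2⟩ := core h.AA_nonneg t1 a1 a2 h.EE_le
  set M := u x0
  set E := EE p Ω u
  set A := AA p Ω u
  set X := M / sq - 1/2
  have hX : 0 < X := by
    by_contra hx
    push Not at hx
    have := mul_nonpos_of_nonneg_of_nonpos h.EE_nonneg hx
    linarith
  have hXM : X ≤ M := by
    have := div_le_self (show 0 ≤ M by linarith) sq_one.le
    simp only [X]; linarith
  have c2 : (E - 8 * π * Real.exp 1) * X ≤ θ * X := mul_le_mul_of_nonneg_right (by linarith) hX.le
  have c3 : θ * X ≤ θ * M := mul_le_mul_of_nonneg_left hXM t0.le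
  have c4 : θ * M ≤ (η/60)^2 := by
    calc _ ≤ (η/60)^2/(Em+1) * (Em + 1) := by gcongr
      _ = _ := by field_simp
  have c5 : (M - sq)^2 ≤ (η/60)^2 := by
    have : 12 * (M - sq)^2 ≤ 4 * π * (M - sq)^2 := by
      apply mul_le_mul_of_nonneg_right _ (sq_nonneg _); linarith
    have := sq_nonneg (M - sq)
    linarith
  have c6 : |M - sq| ≤ η/60 := abs_le_of_sq_le_sq c5 (by positivity)
  have c7 := abs_le.1 c6
  have s1 := sq_one
  refine ⟨by linarith, ?_, a2⟩
  have eE : (8 * π * Real.exp 1) / sq = 8 * π * sq := by rw [← sq_sq]; have := sq_pos.ne'; field_simp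
  have d1 : E / sq ≤ 8 * π * sq + θ := by
    calc E / sq ≤ (8 * π * Real.exp 1 + θ)/sq := by have := sq_pos; gcongr
      _ = 8 * π * sq + θ/sq := by rw [add_div, eE]
      _ ≤ _ := by have := div_le_self t0.le s1.le; linarith
  have d2 : 8 * π * (M - sq) ≥ -(8 * 4 * (η/60)) := by
    have e := mul_le_mul_of_nonneg_left c7.1 (show 0 ≤ 8 * π by positivity)
    have e2 : 8 * π * (η/60) ≤ 8 * 4 * (η/60) := by gcongr
    linarith
  rw [abs_le]
  constructor
  · -- lower
    have hE2 := h.EE_le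
    by_contra hn
    push Not at hn
    have hA : A ≤ 8 * π * sq - η := by linarith
    have f1 : A * M ≤ A * (sq + η/60) := mul_le_mul_of_nonneg_left (by linarith) h.AA_nonneg
    have f2 : A * (sq + η/60) ≤ (8 * π * sq - η) * (sq + η/60) := mul_le_mul_of_nonneg_right hA (by positivity)
    have f3 : (8 * π * sq - η) * (sq + η/60) = 8 * π * (sq * sq) + 8 * π * sq * (η/60) - η * sq - η * (η/60) := by ring
    rw [sq_sq] at f3
    have f4 : 8 * π * sq * (η/60) ≤ 8 * 4 * sq * (η/60) := by have := sq_pos; gcongr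
    have f5 : η ≤ η * sq := le_mul_of_one_le_right hη.le s1.le
    have f6 : 0 < η * (η/60) := by positivity
    change E ≤ A * M at hE2
    linarith
  · linarith

end LE

namespace LE
open ComplexConjugate

section
variable {D p : ℝ} {Ω : Set ℂ} {u : ℂ → ℝ} {x0 : ℂ}

lemma Sol.kern (h : Sol D p Ω u x0) {ε : ℝ} (he : 0 < ε) (he1 : ε ≤ 1) (hε : ε^2 * (p * u x0^(p-1)) = 1)
    {x : ℂ} (hx : x ∈ Ω) {S : Set ℂ} (hS : S ⊆ Ω) (hm : MeasurableSet S) :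
    ∫ y in S, LK D x y * gp p u y ≤ (Real.log (2*D) - Real.log ε) * (∫ y in S, gp p u y) + 2 * π * u x0 / p := by
  have hp := h.hp
  have ig := (h.gp_int (q := p) (by linarith)).mono_set hS
  have iL := (h.int_mul (q := p) (by linarith) (LK_int D x h.hb)).mono_set hS
  have iB0 : Integrable ((ball x ε).indicator (fun y => ‖y - x‖⁻¹)) := (integrable_indicator_iff measurableSet_ball).2 (integrableOn_inv x ε)
  have iB : IntegrableOn (fun y => u x0^p * ε * (ball x ε).indicator (fun y => ‖y - x‖⁻¹) y) S := (iB0.const_mul _).integrableOn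
  have hMp : 0 ≤ u x0 ^ p := Real.rpow_nonneg h.pos.le p
  have key : ∫ y in S, LK D x y * gp p u y ≤ ∫ y in S, ((Real.log (2*D) - Real.log ε) * gp p u y + u x0^p * ε * (ball x ε).indicator (fun y => ‖y - x‖⁻¹) y) := by
    apply setIntegral_mono_on iL ((ig.const_mul _).add iB) hm
    intro y hy
    have g0 := gp_nonneg p u y
    have g1 := h.gp_le (q := p) (by linarith) (hS hy)
    have : (Real.log ε - Real.log ‖y - x‖) * gp p u y ≤ u x0^p * ε * (ball x ε).indicator (fun y => ‖y - x‖⁻¹) y := by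
      by_cases hyx : y = x
      · subst hyx
        simp [he]
        exact mul_nonpos_of_nonpos_of_nonneg (Real.log_nonpos he.le he1) g0
      have hr : 0 < ‖y - x‖ := norm_pos_iff.2 (sub_ne_zero.2 hyx)
      by_cases hb : y ∈ ball x ε
      · rw [Set.indicator_of_mem hb]
        have a : Real.log ε - Real.log ‖y - x‖ ≤ ε * ‖y - x‖⁻¹ := by
          rw [← Real.log_div he.ne' hr.ne', ← div_eq_mul_inv]
          have := Real.log_le_sub_one_of_pos (x := ε / ‖y - x‖) (by positivity)
          linarith
        calc _ ≤ ε * ‖y - x‖⁻¹ * gp p u y := mul_le_mul_of_nonneg_right a g0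
          _ ≤ ε * ‖y - x‖⁻¹ * u x0^p := mul_le_mul_of_nonneg_left g1 (by positivity)
          _ = _ := by ring
      · rw [Set.indicator_of_notMem hb, mul_zero]
        rw [mem_ball, dist_eq_norm, not_lt] at hb
        have := Real.log_le_log he hb
        exact mul_nonpos_of_nonpos_of_nonneg (by linarith) g0
    simp only [Pi.add_apply]
    unfold LK
    linarith
  rw [integral_add (ig.const_mul _) iB, integral_const_mul, integral_const_mul] at key
  have b : ∫ y in S, (ball x ε).indicator (fun y => ‖y - x‖⁻¹) y ≤ 2 * π * ε := by
    rw [← integral_inv x he.le, ← integral_indicator measurableSet_ball]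
    apply setIntegral_le_integral iB0
    exact ae_of_all _ fun y => Set.indicator_nonneg (fun _ _ => by positivity) _
  have c := mul_le_mul_of_nonneg_left b (mul_nonneg hMp he.le)
  have e : u x0^p * ε * (2 * π * ε) = 2 * π * u x0 / p := by
    have hM : u x0 ^ p = u x0 ^ (p-1) * u x0 := by
      rw [← Real.rpow_add_one h.pos.ne']; ring_nf
    rw [eq_div_iff (by linarith), hM]
    calc _ = 2 * π * u x0 * (ε^2 * (p * u x0^(p-1))) := by ring
      _ = _ := by rw [hε]; ring
  linarith

lemma Sol.far (h : Sol D p Ω u x0) {r : ℝ} (hr : 0 < r) {x : ℂ} {S : Set ℂ} (hS : S ⊆ Ω) (hm : MeasurableSet S)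
    (hd : ∀ y ∈ S, r ≤ ‖y - x‖) :
    ∫ y in S, LK D x y * gp p u y ≤ (Real.log (2*D) - Real.log r) * (∫ y in S, gp p u y) := by
  have hp := h.hp
  have ig := (h.gp_int (q := p) (by linarith)).mono_set hS
  have iL := (h.int_mul (q := p) (by linarith) (LK_int D x h.hb)).mono_set hS
  rw [← integral_const_mul]
  apply setIntegral_mono_on iL (ig.const_mul _) hm
  intro y hy
  have := Real.log_le_log hr (hd y hy)
  apply mul_le_mul_of_nonneg_right _ (gp_nonneg p u y)
  unfold LK; linarith

def BB (p : ℝ) (Ω : Set ℂ) (u : ℂ → ℝ) (x0 : ℂ) (r : ℝ) : ℝ := p * ∫ y in Ω \ ball x0 r, gp p u y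

lemma Sol.split (h : Sol D p Ω u x0) {f : ℂ → ℝ} (hf : IntegrableOn f Ω) (r : ℝ) :
    ∫ y in Ω, f y = (∫ y in Ω ∩ ball x0 r, f y) + ∫ y in Ω \ ball x0 r, f y :=
  (integral_inter_add_diff measurableSet_ball hf).symm

lemma Sol.BB_nonneg (h : Sol D p Ω u x0) (r : ℝ) : 0 ≤ BB p Ω u x0 r :=
  mul_nonneg (by linarith [h.hp]) (integral_nonneg fun y => gp_nonneg _ _ _)

lemma Sol.inner_eq (h : Sol D p Ω u x0) (r : ℝ) : p * ∫ y in Ω ∩ ball x0 r, gp p u y = AA p Ω u - BB p Ω u x0 r := by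
  unfold AA BB
  rw [h.split (h.gp_int (by linarith [h.hp])) r]; ring

lemma Sol.BB_le (h : Sol D p Ω u x0) (r : ℝ) : BB p Ω u x0 r ≤ AA p Ω u := by
  have := h.inner_eq r
  have h2 : 0 ≤ p * ∫ y in Ω ∩ ball x0 r, gp p u y := mul_nonneg (by linarith [h.hp]) (integral_nonneg fun y => gp_nonneg _ _ _)
  linarith

lemma Sol.near_ineq (h : Sol D p Ω u x0) {ε : ℝ} (he : 0 < ε) (he1 : ε ≤ 1) (hε : ε^2 * (p * u x0^(p-1)) = 1)
    {r : ℝ} (hr : 0 < r) :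
    2 * π * u x0 ≤ (Real.log (2*D) - Real.log ε)/p * (AA p Ω u - BB p Ω u x0 r) + (Real.log (2*D) - Real.log r)/p * BB p Ω u x0 r + 2 * π * u x0 / p := by
  have hp := h.hp
  have g := h.green h.mem
  rw [h.split (h.int_mul (by linarith) (LK_int D x0 h.hb)) r] at g
  have a := h.kern he he1 hε h.mem (S := Ω ∩ ball x0 r) Set.inter_subset_left (h.hO.measurableSet.inter measurableSet_ball)
  have b := h.far hr (x := x0) (S := Ω \ ball x0 r) Set.diff_subset (h.hO.measurableSet.diff measurableSet_ball) (by
    intro y hy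
    have := hy.2
    rwa [mem_ball, dist_eq_norm, not_lt] at this)
  rw [← h.inner_eq r]
  unfold BB
  have hp0 : p ≠ 0 := by linarith
  have e1 : (Real.log (2*D) - Real.log ε)/p * (p * ∫ y in Ω ∩ ball x0 r, gp p u y) = (Real.log (2*D) - Real.log ε) * ∫ y in Ω ∩ ball x0 r, gp p u y := by field_simp
  have e2 : (Real.log (2*D) - Real.log r)/p * (p * ∫ y in Ω \ ball x0 r, gp p u y) = (Real.log (2*D) - Real.log r) * ∫ y in Ω \ ball x0 r, gp p u y := by field_simp
  rw [e1, e2]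
  linarith

lemma Sol.far_ineq (h : Sol D p Ω u x0) {ε : ℝ} (he : 0 < ε) (he1 : ε ≤ 1) (hε : ε^2 * (p * u x0^(p-1)) = 1)
    {r : ℝ} (hr : 0 < r) {x : ℂ} (hx : x ∈ Ω) (hxr : 2 * r ≤ ‖x - x0‖) :
    2 * π * u x ≤ (Real.log (2*D) - Real.log r)/p * (AA p Ω u - BB p Ω u x0 r) + ∫ y in Ω \ ball x0 r, LK D x y * gp p u y := by
  have hp := h.hp
  have g := h.green hx
  rw [h.split (h.int_mul (by linarith) (LK_int D x h.hb)) r] at g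
  have b := h.far hr (x := x) (S := Ω ∩ ball x0 r) Set.inter_subset_left (h.hO.measurableSet.inter measurableSet_ball) (by
    intro y hy
    have h1 := hy.2
    rw [mem_ball, dist_eq_norm] at h1
    have := norm_sub_le_norm_sub_add_norm_sub x y x0
    rw [norm_sub_rev x y] at this
    linarith)
  rw [← h.inner_eq r]
  have hp0 : p ≠ 0 := by linarith
  have e1 : (Real.log (2*D) - Real.log r)/p * (p * ∫ y in Ω ∩ ball x0 r, gp p u y) = (Real.log (2*D) - Real.log r) * ∫ y in Ω ∩ ball x0 r, gp p u y := by field_simp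
  rw [e1]
  linarith

end

lemma Sol.eps (D : ℝ) (hD : 1 ≤ D) {κ : ℝ} (hκ : 0 < κ) (hκ1 : κ ≤ 1/8) : ∃ η' > 0,
    ∀ᶠ p : ℝ in atTop, ∀ (Ω : Set ℂ) (u : ℂ → ℝ) (x0 : ℂ) (ε : ℝ), Sol D p Ω u x0 → EE p Ω u ≤ 8 * π * Real.exp 1 + η' →
      0 < ε → ε^2 * (p * u x0^(p-1)) = 1 →
      |u x0 - sq| ≤ κ ∧ |AA p Ω u - 8 * π * sq| ≤ κ ∧ p / 8 ≤ -Real.log ε ∧ (Real.log (2*D) - Real.log ε)/p ≤ 1/4 + κ ∧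
      ε ≤ 1 ∧ 1/2 ≤ u x0 := by
  obtain ⟨η', h0, hc⟩ := Sol.close D hD hκ
  refine ⟨η', h0, ?_⟩
  filter_upwards [hc, ev_inv (Real.log (2*D)) (show 0 < κ/4 by positivity), ev_log (show 0 < κ/4 by positivity),
    Filter.eventually_ge_atTop (Real.exp 1)] with p hp e1 e2 e3 Ω u x0 ε h hE he hε
  obtain ⟨a1, a2, a3⟩ := hp Ω u x0 h hE
  have hp1 := h.hp
  have hM := h.pos
  have hlp : 1 ≤ Real.log p := by
    rw [← Real.log_exp 1]; exact Real.log_le_log (Real.exp_pos _) e3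
  have hle : -Real.log ε = (Real.log p + (p-1) * Real.log (u x0))/2 := by
    have hMp : 0 < u x0 ^ (p-1) := Real.rpow_pos_of_pos hM _
    have := congrArg Real.log hε
    rw [Real.log_mul (by positivity) (by positivity), Real.log_mul (by linarith) hMp.ne', Real.log_rpow hM, Real.log_pow, Real.log_one] at this
    push_cast at this
    linarith
  have s0 := sq_pos
  have hls : Real.log sq = 1/2 := by unfold sq; rw [Real.log_exp]
  rw [abs_le] at a1
  have l1 : Real.log (u x0) ≤ 1/2 + κ := by
    have := Real.log_le_sub_one_of_pos (x := u x0 / sq) (by positivity)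
    rw [Real.log_div hM.ne' s0.ne', hls] at this
    have h3 : u x0 / sq - 1 ≤ κ := by
      have : u x0 / sq - 1 = (u x0 - sq)/sq := by field_simp
      rw [this, div_le_iff₀ s0]
      have := sq_one
      nlinarith
    linarith
  have l2 : 1/4 ≤ Real.log (u x0) := by
    have := Real.log_le_sub_one_of_pos (x := sq / u x0) (by positivity)
    rw [Real.log_div s0.ne' hM.ne', hls] at this
    have h3 : sq / u x0 - 1 ≤ 2 * κ := by
      have : sq / u x0 - 1 = (sq - u x0)/u x0 := by field_simp
      rw [this, div_le_iff₀ hM]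
      nlinarith
    linarith
  have l3 : p / 8 ≤ -Real.log ε := by
    rw [hle]
    have := mul_le_mul_of_nonneg_left l2 (show 0 ≤ p - 1 by linarith)
    linarith
  refine ⟨abs_le.2 a1, a2, l3, ?_, ?_, a3⟩
  · have hp0 : 0 < p := by linarith
    have e : (Real.log (2*D) - Real.log ε)/p = Real.log (2*D)/p + (Real.log p / p)/2 + ((p-1)/p) * (Real.log (u x0)/2) := by
      rw [sub_eq_add_neg, hle]; field_simp; ring
    rw [e]
    have q : (p-1)/p ≤ 1 := by rw [div_le_one hp0]; linarith
    have := mul_le_mul_of_nonneg_right q (show 0 ≤ Real.log (u x0)/2 by linarith)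
    linarith
  · by_contra hn
    push Not at hn
    have := Real.log_pos hn
    linarith

lemma Sol.mass (D : ℝ) (hD : 1 ≤ D) {r κ : ℝ} (hr : 0 < r) (hκ : 0 < κ) (hκ1 : κ ≤ 1/8) : ∃ η' > 0,
    ∀ᶠ p : ℝ in atTop, ∀ (Ω : Set ℂ) (u : ℂ → ℝ) (x0 : ℂ) (ε : ℝ), Sol D p Ω u x0 → EE p Ω u ≤ 8 * π * Real.exp 1 + η' →
      0 < ε → ε^2 * (p * u x0^(p-1)) = 1 → BB p Ω u x0 r ≤ 300 * κ := by
  obtain ⟨η', h0, hc⟩ := Sol.eps D hD hκ hκ1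
  refine ⟨η', h0, ?_⟩
  filter_upwards [hc, ev_inv (|Real.log (2*D) - Real.log r|) hκ, ev_inv 24 hκ] with p hp e1 e2 Ω u x0 ε h hE he hε
  obtain ⟨a1, a2, a3, a4, a5, a6⟩ := hp Ω u x0 ε h hE he hε
  have n := h.near_ineq he a5 hε hr
  have hp1 := h.hp
  have hB := h.BB_nonneg r
  have hBA := h.BB_le r
  have hpi := Real.pi_gt_three
  have hpi4 := Real.pi_le_four
  have s2 := sq_lt
  rw [abs_le] at a1 a2
  set A := AA p Ω u
  set B := BB p Ω u x0 r
  set M := u x0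
  have f1 : (Real.log (2*D) - Real.log ε)/p * (A - B) ≤ (1/4 + κ) * (A - B) := mul_le_mul_of_nonneg_right a4 (by linarith)
  have f2 : (Real.log (2*D) - Real.log r)/p * B ≤ κ * B := by
    apply mul_le_mul_of_nonneg_right _ hB
    refine le_trans ?_ e1
    have := le_abs_self (Real.log (2*D) - Real.log r)
    have hp0 : 0 < p := by linarith
    gcongr
  have f3 : 2 * π * M / p ≤ κ := by
    refine le_trans ?_ e2
    have hp0 : 0 < p := by linarith
    have : 2 * π * M ≤ 24 := by
      calc 2 * π * M ≤ 2 * 4 * 3 := by gcongr; linarith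
        _ = 24 := by norm_num
    gcongr
  have hA : A ≤ 65 := by
    have : 8 * π * sq ≤ 8 * 4 * 2 := by have := sq_pos; gcongr
    linarith
  have f4 : κ * A ≤ κ * 65 := by gcongr
  have f5 : 2 * π * (sq - M) ≤ 2 * 4 * κ := by
    rcases le_total 0 (sq - M) with g | g
    · gcongr; linarith
    · have := mul_nonpos_of_nonneg_of_nonpos (show 0 ≤ 2 * π by positivity) g
      linarith
  linarith

lemma Sol.small1 (D : ℝ) (hD : 1 ≤ D) {r : ℝ} (hr : 0 < r) : ∃ η' > 0,
    ∀ᶠ p : ℝ in atTop, ∀ (Ω : Set ℂ) (u : ℂ → ℝ) (x0 : ℂ) (ε : ℝ), Sol D p Ω u x0 → EE p Ω u ≤ 8 * π * Real.exp 1 + η' →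
      0 < ε → ε^2 * (p * u x0^(p-1)) = 1 → ∀ x ∈ Ω, 2 * r ≤ ‖x - x0‖ → u x ≤ 1/2 := by
  have hκ : (0:ℝ) < 1/1000 := by norm_num
  obtain ⟨η1, h1, hc⟩ := Sol.eps D hD hκ (by norm_num)
  obtain ⟨η2, h2, hm⟩ := Sol.mass D hD hr hκ (by norm_num)
  refine ⟨min η1 η2, by positivity, ?_⟩
  filter_upwards [hc, hm, ev_inv (|Real.log (2*D) - Real.log r|) hκ, ev_inv 24 hκ] with p hp hq e1 e2 Ω u x0 ε h hE he hε x hx hxr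
  obtain ⟨a1, a2, a3, a4, a5, a6⟩ := hp Ω u x0 ε h (by linarith [min_le_left η1 η2]) he hε
  have hB1 := hq Ω u x0 ε h (by linarith [min_le_right η1 η2]) he hε
  have n := h.far_ineq he a5 hε hr hx hxr
  have n2 := h.kern he a5 hε hx (S := Ω \ ball x0 r) Set.diff_subset (h.hO.measurableSet.diff measurableSet_ball)
  have hp1 := h.hp
  have hp0 : 0 < p := by linarith
  have hB := h.BB_nonneg r
  have hBA := h.BB_le r
  have hpi := Real.pi_gt_three
  have hpi4 := Real.pi_le_four
  have s2 := sq_lt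
  rw [abs_le] at a1 a2
  have eB : (Real.log (2*D) - Real.log ε) * (∫ y in Ω \ ball x0 r, gp p u y) = (Real.log (2*D) - Real.log ε)/p * BB p Ω u x0 r := by
    unfold BB; field_simp
  rw [eB] at n2
  set A := AA p Ω u
  set B := BB p Ω u x0 r
  set M := u x0
  have hA : A ≤ 65 := by
    have : 8 * π * sq ≤ 8 * 4 * 2 := by have := sq_pos; gcongr
    linarith
  have f1 : (Real.log (2*D) - Real.log ε)/p * B ≤ (1/4 + 1/1000) * B := mul_le_mul_of_nonneg_right a4 hB
  have f2 : (Real.log (2*D) - Real.log r)/p * (A - B) ≤ 1/1000 * (A - B) := by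
    apply mul_le_mul_of_nonneg_right _ (by linarith)
    refine le_trans ?_ e1
    have := le_abs_self (Real.log (2*D) - Real.log r)
    gcongr
  have f3 : 2 * π * M / p ≤ 1/1000 := by
    refine le_trans ?_ e2
    have : 2 * π * M ≤ 24 := by
      calc 2 * π * M ≤ 2 * 4 * 3 := by gcongr; linarith
        _ = 24 := by norm_num
    gcongr
  by_contra hn
  push Not at hn
  have : 2 * π * (1/2) < 2 * π * u x := by gcongr
  linarith

lemma Sol.small2 (D : ℝ) (hD : 1 ≤ D) {r : ℝ} (hr : 0 < r) : ∃ C0 > 0, ∃ η' > 0,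
    ∀ᶠ p : ℝ in atTop, ∀ (Ω : Set ℂ) (u : ℂ → ℝ) (x0 : ℂ) (ε : ℝ), Sol D p Ω u x0 → EE p Ω u ≤ 8 * π * Real.exp 1 + η' →
      0 < ε → ε^2 * (p * u x0^(p-1)) = 1 → ∀ x ∈ Ω, 2 * r ≤ ‖x - x0‖ → p * u x ≤ C0 := by
  obtain ⟨CD, hCD, hb⟩ := FK_bd (γ := 1) (by norm_num) D hD
  obtain ⟨η1, h1, hc⟩ := Sol.eps D hD (κ := 1/8) (by norm_num) le_rfl
  obtain ⟨η2, h2, hm⟩ := Sol.small1 D hD (half_pos hr)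
  set l := |Real.log (2*D) - Real.log r|
  have hl : 0 ≤ l := abs_nonneg _
  refine ⟨65 * l + CD, by positivity, min η1 η2, by positivity, ?_⟩
  have hpow : ∀ᶠ p : ℝ in atTop, p * (1/2:ℝ)^p ≤ 1 := by
    have h1 : Tendsto (fun p : ℝ => p * Real.exp (-Real.log 2 * p)) atTop (𝓝 0) := by
      have := tendsto_rpow_mul_exp_neg_mul_atTop_nhds_zero 1 (Real.log 2) (Real.log_pos (by norm_num))
      simpa using this
    have := (h1.eventually (gt_mem_nhds one_pos))
    refine this.mono fun p hp => ?_
    rw [Real.rpow_def_of_pos (by norm_num)]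
    have e : Real.log (1/2) = -Real.log 2 := by rw [one_div, Real.log_inv]
    rw [e]; exact hp.le
  filter_upwards [hc, hm, hpow] with p hp hq e1 Ω u x0 ε h hE he hε x hx hxr
  obtain ⟨a1, a2, a3, a4, a5, a6⟩ := hp Ω u x0 ε h (by linarith [min_le_left η1 η2]) he hε
  have hB1 := hq Ω u x0 ε h (by linarith [min_le_right η1 η2]) he hε
  have n := h.far_ineq he a5 hε hr hx hxr
  have hp1 := h.hp
  have hp0 : 0 < p := by linarith
  have hB := h.BB_nonneg r
  have hBA := h.BB_le r
  have hpi := Real.pi_gt_three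
  have hpi4 := Real.pi_le_four
  have s2 := sq_lt
  rw [abs_le] at a1 a2
  have hmS : MeasurableSet (Ω \ ball x0 r) := h.hO.measurableSet.diff measurableSet_ball
  obtain ⟨i1, i2⟩ := hb x (h.hb hx) (Ω \ ball x0 r) (Set.diff_subset.trans h.hb) hmS
  have n2 : ∫ y in Ω \ ball x0 r, LK D x y * gp p u y ≤ ∫ y in Ω \ ball x0 r, Real.exp (1 * LK D x y) * (1/2)^p := by
    apply setIntegral_mono_on ((h.int_mul (by linarith) (LK_int D x h.hb)).mono_set Set.diff_subset) (i1.mul_const _) hmS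
    intro y hy
    have b := Real.add_one_le_exp (1 * LK D x y)
    have hu : u y ≤ 1/2 := by
      apply hB1 y hy.1
      have := hy.2
      rw [mem_ball, dist_eq_norm, not_lt] at this
      linarith
    have : gp p u y ≤ (1/2)^p := Real.rpow_le_rpow (le_max_right _ _) (max_le hu (by norm_num)) hp0.le
    exact mul_le_mul (by linarith) this (gp_nonneg _ _ _) (Real.exp_pos _).le
  rw [integral_mul_const] at n2
  set A := AA p Ω u
  set B := BB p Ω u x0 r
  set M := u x0
  have hA : A ≤ 65 := by
    have : 8 * π * sq ≤ 8 * 4 * 2 := by have := sq_pos; gcongr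
    linarith
  have f2 : (Real.log (2*D) - Real.log r)/p * (A - B) ≤ l/p * 65 := by
    have := le_abs_self (Real.log (2*D) - Real.log r)
    apply mul_le_mul (by gcongr) (by linarith) (by linarith) (by positivity)
  have f3 : (∫ y in Ω \ ball x0 r, Real.exp (1 * LK D x y)) * (1/2)^p ≤ CD * (1/2:ℝ)^p := by gcongr
  have f4 : 2 * π * u x ≤ l/p * 65 + CD * (1/2:ℝ)^p := by linarith
  have f5 := mul_le_mul_of_nonneg_left f4 hp0.le
  have f6 : p * (l/p * 65 + CD * (1/2:ℝ)^p) = l * 65 + CD * (p * (1/2:ℝ)^p) := by field_simp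
  rw [f6] at f5
  have f7 : CD * (p * (1/2:ℝ)^p) ≤ CD * 1 := by gcongr
  rcases le_total (u x) 0 with hn | hn
  · have := mul_nonpos_of_nonneg_of_nonpos hp0.le hn
    have : 0 < 65 * l + CD := by positivity
    linarith
  · have g0 : 0 ≤ p * u x := by positivity
    have : 1 * (p * u x) ≤ 2 * π * (p * u x) := by
      apply mul_le_mul_of_nonneg_right _ g0; linarith
    linarith

end LE

namespace LE
open ComplexConjugate

lemma fderiv_scale {f : ℂ → ℝ} {x0 z : ℂ} {ε a m : ℝ} (hf : DifferentiableAt ℝ f (x0 + ε • z)) (k : ℂ) :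
    fderiv ℝ (fun y => a * (f (x0 + ε • y) - m)) z k = a * ε * fderiv ℝ f (x0 + ε • z) k := by
  have h1 : HasFDerivAt (fun y : ℂ => x0 + ε • y) (ε • ContinuousLinearMap.id ℝ ℂ) z :=
    ((hasFDerivAt_id z).const_smul ε).const_add x0
  have h2 : HasFDerivAt (fun y : ℂ => f (x0 + ε • y)) ((fderiv ℝ f (x0 + ε • z)).comp (ε • ContinuousLinearMap.id ℝ ℂ)) z :=
    HasFDerivAt.comp z (g := f) (f := fun y : ℂ => x0 + ε • y) hf.hasFDerivAt h1
  have h3 : HasFDerivAt (fun y : ℂ => a * (f (x0 + ε • y) - m)) (a • ((fderiv ℝ f (x0 + ε • z)).comp (ε • ContinuousLinearMap.id ℝ ℂ))) z :=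
    (h2.sub_const m).const_mul a
  rw [h3.fderiv]
  simp [mul_assoc]

lemma lapC_scale {u : ℂ → ℝ} {x0 z : ℂ} {ε a m : ℝ} (hu : ContDiffAt ℝ 2 u (x0 + ε • z)) :
    lapC (fun y => a * (u (x0 + ε • y) - m)) z = a * ε^2 * lapC u (x0 + ε • z) := by
  have hc : Tendsto (fun y : ℂ => x0 + ε • y) (𝓝 z) (𝓝 (x0 + ε • z)) := by
    apply Continuous.tendsto; fun_prop
  have hev : ∀ᶠ y in 𝓝 z, DifferentiableAt ℝ u (x0 + ε • y) := by
    apply hc.eventually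
    filter_upwards [hu.eventually (by simp)] with y hy using hy.differentiableAt two_ne_zero
  have hd : ∀ k : ℂ, DifferentiableAt ℝ (fun y => fderiv ℝ u y k) (x0 + ε • z) := by
    intro k
    have : ContDiffAt ℝ 1 (fderiv ℝ u) (x0 + ε • z) := hu.fderiv_right (by norm_num)
    exact (this.differentiableAt one_ne_zero).clm_apply (differentiableAt_const k)
  have key : ∀ k : ℂ, fderiv ℝ (fun y => fderiv ℝ (fun y => a * (u (x0 + ε • y) - m)) y k) z k
      = a * ε^2 * fderiv ℝ (fun y => fderiv ℝ u y k) (x0 + ε • z) k := by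
    intro k
    have e : (fun y => fderiv ℝ (fun y => a * (u (x0 + ε • y) - m)) y k) =ᶠ[𝓝 z]
        (fun y => (a * ε) * ((fun y => fderiv ℝ u y k) (x0 + ε • y) - 0)) := by
      filter_upwards [hev] with y hy
      rw [fderiv_scale hy]; simp
    rw [e.fderiv_eq, fderiv_scale (hd k)]
    ring
  unfold lapC
  rw [key, key]; ring

def vv (p : ℝ) (u : ℂ → ℝ) (x0 : ℂ) (ε : ℝ) (z : ℂ) : ℝ := (p / u x0) * (u (x0 + ε • z) - u x0)
def cv (p : ℝ) (u : ℂ → ℝ) (x0 : ℂ) (ε R : ℝ) (z : ℂ) : ℝ := chi R z • vv p u x0 ε z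

section
variable {D p : ℝ} {Ω : Set ℂ} {u : ℂ → ℝ} {x0 : ℂ} {ε ρ : ℝ}

lemma cv_eq {R : ℝ} (hR : 0 < R) {z : ℂ} (hz : ‖z‖ ≤ R) : cv p u x0 ε R z = vv p u x0 ε z := by
  unfold cv; rw [chi_one hR hz, one_smul]

lemma vv_div (hp : 0 < p) (hM : 0 < u x0) (z : ℂ) : 1 + vv p u x0 ε z / p = u (x0 + ε • z) / u x0 := by
  unfold vv; field_simp; ring

lemma eps_pow (h : Sol D p Ω u x0) (hε : ε^2 * (p * u x0^(p-1)) = 1) : ε^2 * p * u x0 ^ p = u x0 := by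
  have hM : u x0 ^ p = u x0 ^ (p-1) * u x0 := by
    rw [← Real.rpow_add_one h.pos.ne']; ring_nf
  rw [hM]
  linear_combination u x0 * hε

lemma norm_in (he : 0 < ε) {t : ℝ} {z : ℂ} (hz : ‖z‖ < t / ε) : x0 + ε • z ∈ ball x0 t := by
  rw [mem_ball, dist_eq_norm, add_sub_cancel_left, norm_smul, Real.norm_of_nonneg he.le]
  rwa [lt_div_iff₀ he, mul_comm] at hz

lemma vv_lap (h : Sol D p Ω u x0) (he : 0 < ε) (hε : ε^2 * (p * u x0^(p-1)) = 1) {z : ℂ} (hz : x0 + ε • z ∈ Ω)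
    (hu : 0 < u (x0 + ε • z)) : lapC (vv p u x0 ε) z = -(u (x0 + ε • z) / u x0)^p := by
  have hp := h.hp
  have e := lapC_scale (a := p / u x0) (m := u x0) (h.cd.contDiffAt (h.hO.mem_nhds hz))
  change lapC (vv p u x0 ε) z = _ at e
  rw [e, h.eq _ hz, abs_of_pos hu, Real.div_rpow hu.le h.pos.le, ← Real.rpow_add_one hu.ne']
  have a := eps_pow h hε
  have b := h.pos
  have c : 0 < u x0 ^ p := Real.rpow_pos_of_pos b p
  rw [show p - 1 + 1 = p by ring]
  field_simp
  linarith

lemma cv_contDiff (h : Sol D p Ω u x0) (he : 0 < ε) (hρ : 0 < ρ) (hε : ε^2 * (p * u x0^(p-1)) = 1)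
    (hB : ball x0 (7*ρ/4) ⊆ Ω) (hu : ∀ y ∈ ball x0 (7*ρ/4), 0 < u y) : ContDiff ℝ 3 (cv p u x0 ε (ρ/ε)) := by
  have hO : IsOpen (ball (0:ℂ) ((7*ρ/4)/ε)) := isOpen_ball
  have hin : ∀ z ∈ ball (0:ℂ) ((7*ρ/4)/ε), x0 + ε • z ∈ ball x0 (7*ρ/4) := fun z hz => norm_in he (by simpa using hz)
  have hcu : ContDiffOn ℝ 2 (fun z : ℂ => u (x0 + ε • z)) (ball (0:ℂ) ((7*ρ/4)/ε)) := by
    refine ContDiffOn.comp (g := u) (f := fun z : ℂ => x0 + ε • z) h.cd (ContDiff.contDiffOn (by fun_prop)) ?_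
    intro z hz; exact hB (hin z hz)
  have hv2 : ContDiffOn ℝ 2 (vv p u x0 ε) (ball (0:ℂ) ((7*ρ/4)/ε)) := by
    unfold vv
    exact contDiffOn_const.mul (hcu.sub contDiffOn_const)
  have hf : ContDiffOn ℝ 2 (fun z : ℂ => (u (x0 + ε • z) / u x0)^p) (ball (0:ℂ) ((7*ρ/4)/ε)) := by
    apply ContDiffOn.rpow_const_of_ne (hcu.div_const _)
    intro z hz
    exact (div_pos (hu _ (hin z hz)) h.pos).ne'
  have hv3 := reg hO hv2 hf (fun z hz => vv_lap h he hε (hB (hin z hz)) (hu _ (hin z hz)))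
  apply cut_contDiff hO (chi_contDiff (ρ/ε) (n := 3) (WithTop.coe_le_coe.2 (le_top : (3:ℕ∞) ≤ ⊤))) hv3
  refine (chi_tsupport (by positivity)).trans ?_
  apply closedBall_subset_ball
  rw [show 3 * (ρ/ε)/2 = (3*ρ/2)/ε by ring]
  exact div_lt_div_of_pos_right (by linarith) he

lemma cv_mass (h : Sol D p Ω u x0) (he : 0 < ε) (hρ : 0 < ρ) (hε : ε^2 * (p * u x0^(p-1)) = 1)
    (hB : ball x0 (7*ρ/4) ⊆ Ω) (hu : ∀ y ∈ ball x0 (7*ρ/4), 0 < u y) :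
    ∫ z in closedBall 0 (ρ/ε), FF p (cv p u x0 ε (ρ/ε)) z ≤ AA p Ω u / u x0 := by
  have hp := h.hp
  have hM := h.pos
  have hMp : 0 < u x0 ^ p := Real.rpow_pos_of_pos hM p
  have hsub : closedBall x0 ρ ⊆ Ω := (closedBall_subset_ball (by linarith)).trans hB
  have e1 : ∫ z in closedBall 0 (ρ/ε), FF p (cv p u x0 ε (ρ/ε)) z
      = ∫ z : ℂ, (fun y => (closedBall x0 ρ).indicator (fun y => gp p u y / u x0^p) (x0 + y)) (ε • z) := by
    rw [← integral_indicator measurableSet_closedBall]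
    congr 1
    ext z
    have hiff : z ∈ closedBall (0:ℂ) (ρ/ε) ↔ x0 + ε • z ∈ closedBall x0 ρ := by
      rw [mem_closedBall, mem_closedBall, dist_eq_norm, dist_eq_norm, add_sub_cancel_left, norm_smul, Real.norm_of_nonneg he.le, sub_zero, le_div_iff₀ he, mul_comm]
    by_cases hz : z ∈ closedBall (0:ℂ) (ρ/ε)
    · have hz' := hiff.1 hz
      have hup : 0 < u (x0 + ε • z) := hu _ (closedBall_subset_ball (by linarith) hz')
      simp only
      rw [Set.indicator_of_mem hz, Set.indicator_of_mem hz']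
      unfold FF
      rw [cv_eq (by positivity) (by simpa using hz), vv_div (by linarith) hM, Real.div_rpow hup.le hM.le]
      unfold gp
      rw [max_eq_left hup.le]
    · simp only
      rw [Set.indicator_of_notMem hz, Set.indicator_of_notMem (fun a => hz (hiff.2 a))]
  rw [e1, Measure.integral_comp_smul volume (fun y => (closedBall x0 ρ).indicator (fun y => gp p u y / u x0^p) (x0 + y)) ε, integral_add_left_eq_self (μ := volume) ((closedBall x0 ρ).indicator (fun y => gp p u y / u x0^p)) x0,
    integral_indicator measurableSet_closedBall, integral_div, Complex.finrank_real_complex, abs_of_pos (by positivity), smul_eq_mul]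
  have e2 : ∫ y in closedBall x0 ρ, gp p u y ≤ ∫ y in Ω, gp p u y :=
    setIntegral_mono_set (h.gp_int (by linarith)) (ae_of_all _ fun y => gp_nonneg p u y) hsub.eventuallyLE
  unfold AA
  have a := eps_pow h hε
  have e3 : (ε^2)⁻¹ = p * u x0^p / u x0 := by
    rw [eq_div_iff hM.ne']
    field_simp
    linarith
  rw [e3]
  calc _ = p * (∫ y in closedBall x0 ρ, gp p u y) / u x0 := by field_simp
    _ ≤ _ := by gcongr

lemma cv_adm {C0 N C1 : ℝ} (h : Sol D p Ω u x0) (he : 0 < ε) (hρ : 0 < ρ) (hε : ε^2 * (p * u x0^(p-1)) = 1)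
    (hB : ball x0 (7*ρ/4) ⊆ Ω) (hu : ∀ y ∈ ball x0 (7*ρ/4), 0 < u y)
    (hN : 1 ≤ N) (hp : 64 ≤ p) (hpN : N ≤ p) (hM : 1/2 ≤ u x0)
    (hA : AA p Ω u / u x0 ≤ 8 * π + 1/N) (hC1 : 0 < C1)
    (hpow : p^N ≤ ρ/ε) (hlog : Real.log (ρ/ε) ≤ C0 * p)
    (s1 : ∀ x ∈ Ω, 2 * (ρ/6) ≤ ‖x - x0‖ → u x ≤ 1/2)
    (s2 : ∀ x ∈ Ω, 2 * (ρ/6) ≤ ‖x - x0‖ → p * u x ≤ C1)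
    (c1 : 2 * C1 ≤ C0) (c2 : 30 ≤ C0) (c3 : 2 * ρ^2 ≤ C0) :
    Adm C0 N p (ρ/ε) (cv p u x0 ε (ρ/ε)) := by
  have hR : 0 < ρ / ε := by positivity
  have hpR : p ≤ ρ/ε := by
    refine le_trans ?_ hpow
    conv_lhs => rw [← Real.rpow_one p]
    exact Real.rpow_le_rpow_of_exponent_le (by linarith) hN
  have hM0 := h.pos
  have hin : ∀ z : ℂ, ‖z‖ ≤ ρ/ε → x0 + ε • z ∈ ball x0 (7*ρ/4) := by
    intro z hz
    apply norm_in he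
    refine hz.trans_lt (div_lt_div_of_pos_right (by linarith) he)
  have hFF : ∀ z : ℂ, ‖z‖ ≤ ρ/ε → FF p (cv p u x0 ε (ρ/ε)) z = u (x0 + ε • z)^p / u x0^p := by
    intro z hz
    unfold FF
    rw [cv_eq hR hz, vv_div (by linarith) hM0, Real.div_rpow (hu _ (hin z hz)).le hM0.le]
  have hfar : ∀ z : ℂ, ρ/ε/3 ≤ ‖z‖ → 2 * (ρ/6) ≤ ‖x0 + ε • z - x0‖ := by
    intro z hz
    rw [add_sub_cancel_left, norm_smul, Real.norm_of_nonneg he.le]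
    rw [div_div, div_le_iff₀ (by positivity)] at hz
    linarith
  have hmass := (cv_mass h he hρ hε hB hu).trans hA
  have hNi : 1/N ≤ 1 := by rw [div_le_one (by linarith)]; exact hN
  have a := eps_pow h hε
  refine ⟨⟨cv_contDiff h he hρ hε hB hu, by linarith, by linarith, by linarith, ?_, ?_, ?_, ?_, ?_, ?_, ?_⟩, hN, hpN, by linarith, hmass, hpow, hlog⟩
  · intro z hz
    rw [cv_eq hR hz]
    have h1 := hu _ (hin z hz)
    have h2 := h.mx _ (subset_closure (hB (hin z hz)))
    have h3 := vv_div (ε := ε) (u := u) (x0 := x0) (p := p) (by linarith) hM0 z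
    have h4 : 0 < u (x0 + ε • z) / u x0 := by positivity
    have h5 : u (x0 + ε • z) / u x0 ≤ 1 := by rw [div_le_one hM0]; exact h2
    rw [← h3] at h4 h5
    have h6 : vv p u x0 ε z = p * (vv p u x0 ε z / p) := by field_simp
    constructor <;> rw [h6] <;> nlinarith
  · intro z hz
    have e : cv p u x0 ε (ρ/ε) =ᶠ[𝓝 z] vv p u x0 ε := by
      have : ∀ᶠ y : ℂ in 𝓝 z, ‖y‖ < ρ/ε := (continuous_norm.tendsto z).eventually (gt_mem_nhds hz)
      filter_upwards [this] with y hy using cv_eq hR hy.le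
    rw [lapC_congr e, vv_lap h he hε (hB (hin z hz.le)) (hu _ (hin z hz.le)), hFF z hz.le, Real.div_rpow (hu _ (hin z hz.le)).le hM0.le]
  · rw [cv_eq hR (by simpa using hR.le)]
    simp [vv]
  · have e : cv p u x0 ε (ρ/ε) =ᶠ[𝓝 0] vv p u x0 ε := by
      have : ∀ᶠ y : ℂ in 𝓝 0, ‖y‖ < ρ/ε := (continuous_norm.tendsto 0).eventually (gt_mem_nhds (by simpa using hR))
      filter_upwards [this] with y hy using cv_eq hR hy.le
    have hl : IsLocalMax (cv p u x0 ε (ρ/ε)) 0 := by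
      have : ∀ᶠ y : ℂ in 𝓝 0, ‖y‖ < ρ/ε := (continuous_norm.tendsto 0).eventually (gt_mem_nhds (by simpa using hR))
      filter_upwards [this] with y hy
      rw [cv_eq hR hy.le, cv_eq hR (by simpa using hR.le)]
      have h2 := h.mx _ (subset_closure (hB (hin y hy.le)))
      unfold vv
      apply mul_le_mul_of_nonneg_left _ (by positivity)
      simpa using h2
    have hf := hl.fderiv_eq_zero
    have k1 := fderiv_real_eq (v := cv p u x0 ε (ρ/ε)) (z := 0) (((cv_contDiff h he hρ hε hB hu).differentiable (by norm_num)) 0) 1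
    have k2 := fderiv_real_eq (v := cv p u x0 ε (ρ/ε)) (z := 0) (((cv_contDiff h he hρ hε hB hu).differentiable (by norm_num)) 0) Complex.I
    rw [hf] at k1 k2
    simp at k1 k2
    exact Complex.ext k1 k2
  · have := Real.pi_lt_d2
    linarith
  · intro z hz1 hz2
    rw [cv_eq hR hz2]
    have h3 := vv_div (ε := ε) (u := u) (x0 := x0) (p := p) (by linarith) hM0 z
    have h6 : vv p u x0 ε z + p = p * (1 + vv p u x0 ε z / p) := by field_simp; ring
    rw [h6, h3]
    have := s2 _ (hB (hin z hz2)) (hfar z hz1)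
    have h7 : p * (u (x0 + ε • z) / u x0) ≤ C1 / u x0 := by rw [← mul_div_assoc]; gcongr
    have h8 : C1 / u x0 ≤ 2 * C1 := by rw [div_le_iff₀ hM0]; nlinarith
    linarith
  · intro z hz1 hz2
    rw [hFF z hz2]
    have h1 := s1 _ (hB (hin z hz2)) (hfar z hz1)
    have h2 := hu _ (hin z hz2)
    have h3 : u (x0 + ε • z)^p ≤ (1/2)^p := Real.rpow_le_rpow h2.le h1 (by linarith)
    have h4 : p * (1/2:ℝ)^p ≤ 1 := by
      have := one_add_mul_self_le_rpow_one_add (s := 1) (p := p) (by norm_num) (by linarith)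
      rw [Real.div_rpow (by norm_num) (by norm_num), Real.one_rpow, ← mul_div_assoc, div_le_one (by positivity)]
      norm_num at this
      linarith
    have hMp : 0 < u x0 ^ p := Real.rpow_pos_of_pos hM0 p
    have e3 : (ε^2)⁻¹ = p * u x0^p / u x0 := by
      rw [eq_div_iff hM0.ne']
      field_simp
      linarith
    calc (ρ/ε)^2 * (u (x0 + ε • z)^p / u x0^p) = ρ^2 * (ε^2)⁻¹ * (u (x0 + ε • z)^p / u x0^p) := by ring
      _ = ρ^2 * (p * u (x0 + ε • z)^p) / u x0 := by rw [e3]; field_simp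
      _ ≤ ρ^2 * 1 / u x0 := by
          gcongr
          exact (mul_le_mul_of_nonneg_left h3 (by linarith)).trans h4
      _ ≤ 2 * ρ^2 := by rw [div_le_iff₀ hM0]; nlinarith [sq_nonneg ρ]
      _ ≤ C0 := c3
end

lemma adm_ev (D : ℝ) (hD : 1 ≤ D) {ρ : ℝ} (hρ : 0 < ρ) : ∃ C0 > 0, ∀ N : ℝ, 1 ≤ N → ∃ η' > 0,
    ∀ᶠ p : ℝ in atTop, ∀ (Ω : Set ℂ) (u : ℂ → ℝ) (x0 : ℂ) (ε : ℝ), Sol D p Ω u x0 → EE p Ω u ≤ 8 * π * Real.exp 1 + η' →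
      0 < ε → ε^2 * (p * u x0^(p-1)) = 1 → ball x0 (7*ρ/4) ⊆ Ω → (∀ y ∈ ball x0 (7*ρ/4), 0 < u y) →
      Adm C0 N p (ρ/ε) (cv p u x0 ε (ρ/ε)) := by
  obtain ⟨C1, hC1, η2, hη2, hs2⟩ := Sol.small2 D hD (r := ρ/6) (by positivity)
  obtain ⟨η1, hη1, hs1⟩ := Sol.small1 D hD (r := ρ/6) (by positivity)
  refine ⟨2 * C1 + 30 + 2 * ρ^2 + |Real.log ρ|, by positivity, ?_⟩
  intro N hN
  have hNp : 0 < N := by linarith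
  have hκ : 0 < 1/(40*N) := by positivity
  have hκ2 : 1/(40*N) ≤ 1/40 := by
    apply one_div_le_one_div_of_le <;> linarith
  obtain ⟨η3, hη3, hs3⟩ := Sol.eps D hD hκ (by linarith)
  refine ⟨min η1 (min η2 η3), by positivity, ?_⟩
  filter_upwards [hs1, hs2, hs3, eventually_ge_atTop 64, eventually_ge_atTop N, ev_log (θ := 1/(16*N)) (by positivity),
    ev_inv (|Real.log ρ|) (θ := 1/16) (by norm_num)] with p h1 h2 h3 hp64 hpN hpl hpi Ω u x0 ε h hE he hε hB hu
  have hE1 : EE p Ω u ≤ 8 * π * Real.exp 1 + η1 := hE.trans (by gcongr; simp)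
  have hE2 : EE p Ω u ≤ 8 * π * Real.exp 1 + η2 := hE.trans (by gcongr; simp)
  have hE3 : EE p Ω u ≤ 8 * π * Real.exp 1 + η3 := hE.trans (by gcongr; simp)
  obtain ⟨b1, b2, b3, b4, b5, b6⟩ := h3 Ω u x0 ε h hE3 he hε
  have hp0 : 0 < p := by linarith
  have hlogR : Real.log (ρ/ε) = Real.log ρ - Real.log ε := Real.log_div hρ.ne' he.ne'
  rw [div_le_iff₀ hp0] at hpl hpi b4
  refine cv_adm h he hρ hε hB hu hN hp64 hpN b6 ?_ hC1 ?_ ?_ (h1 Ω u x0 ε h hE1 he hε) (h2 Ω u x0 ε h hE2 he hε) ?_ ?_ ?_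
  · rw [div_le_iff₀ h.pos]
    have s1 := sq_one
    rw [abs_le] at b1 b2
    have k : 1/N = 40 * (1/(40*N)) := by field_simp
    set κ := 1/(40*N)
    rw [k]
    have := Real.pi_lt_d2
    have q0 := Real.pi_pos
    have q1 : 8 * π * u x0 ≥ 8 * π * (sq - κ) := by nlinarith
    have q2 : κ * u x0 ≥ κ * (7/8) := by nlinarith
    nlinarith
  · have hpos : 0 < p^N := Real.rpow_pos_of_pos hp0 N
    rw [← Real.log_le_log_iff hpos (by positivity), hlogR, Real.log_rpow hp0]
    have q : N * Real.log p ≤ N * (1/(16*N) * p) := mul_le_mul_of_nonneg_left hpl hNp.le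
    have q2 : N * (1/(16*N) * p) = p/16 := by field_simp
    have := neg_abs_le (Real.log ρ)
    linarith
  · rw [hlogR]
    have l2 : 0 ≤ Real.log (2*D) := Real.log_nonneg (by linarith)
    have l3 := le_abs_self (Real.log ρ)
    have l4 := abs_nonneg (Real.log ρ)
    nlinarith [sq_nonneg ρ, mul_pos hC1 hp0, mul_nonneg (sq_nonneg ρ) hp0.le]
  · nlinarith [abs_nonneg (Real.log ρ), sq_nonneg ρ]
  · nlinarith [abs_nonneg (Real.log ρ), sq_nonneg ρ]
  · nlinarith [abs_nonneg (Real.log ρ), sq_nonneg ρ]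

end LE

namespace LE
open ComplexConjugate

lemma contDiff_Uc {n : WithTop ℕ∞} : ContDiff ℝ n Uc := by
  unfold Uc
  apply contDiff_const.mul
  apply ContDiff.log
  · exact contDiff_const.add ((contDiff_norm_sq ℝ).div_const _)
  · intro z; positivity

lemma iter_bd {φ : ℂ → ℝ} {z a b : ℂ} {κ : ℝ} (hφ : ContDiff ℝ 2 φ) (hg : HasW (gz φ) a b z)
    (h0 : |φ z| ≤ κ) (h1 : ‖gz φ z‖ ≤ κ) (h2 : ‖a‖ + ‖b‖ ≤ κ) {k : ℕ} (hk : k ≤ 2) : ‖iteratedFDeriv ℝ k φ z‖ ≤ 2 * κ := by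
  have hκ : 0 ≤ κ := (abs_nonneg _).trans h0
  have hd : Differentiable ℝ φ := hφ.differentiable two_ne_zero
  interval_cases k
  · rw [norm_iteratedFDeriv_zero, Real.norm_eq_abs]; linarith
  · rw [norm_iteratedFDeriv_one]
    apply ContinuousLinearMap.opNorm_le_bound _ (by linarith)
    intro k
    rw [fderiv_real_eq (hd z), Real.norm_eq_abs, abs_mul, abs_two, mul_assoc]
    have := Complex.abs_re_le_norm (gz φ z * k)
    rw [norm_mul] at this
    have := mul_le_mul_of_nonneg_right h1 (norm_nonneg k)
    linarith
  · rw [← norm_iteratedFDeriv_fderiv, norm_iteratedFDeriv_one]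
    apply ContinuousLinearMap.opNorm_le_bound _ (by linarith)
    intro h
    apply ContinuousLinearMap.opNorm_le_bound _ (by positivity)
    intro k
    have hdd : DifferentiableAt ℝ (fderiv ℝ φ) z :=
      (hφ.fderiv_right (m := 1) (by norm_num)).differentiable one_ne_zero z
    have e1 : fderiv ℝ (fderiv ℝ φ) z h k = fderiv ℝ (fun y => fderiv ℝ φ y k) z h := by
      rw [fderiv_clm_apply hdd (differentiableAt_const k)]
      simp
    have e2 : (fun y => fderiv ℝ φ y k) = fun y => 2 * (gz φ y * k).re := by
      ext y; exact fderiv_real_eq (hd y) k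
    have e3 : HasFDerivAt (fun y => 2 * (gz φ y * k).re)
        ((2:ℝ) • (Complex.reCLM.comp ((wirt a b).smulRight k))) z := by
      have m1 : HasFDerivAt (fun y => gz φ y * k) ((wirt a b).smulRight k) z := by
        have := HasFDerivAt.mul_const' (𝕜 := ℝ) hg k
        convert! this using 1
      exact (Complex.reCLM.hasFDerivAt.comp z m1).const_mul 2
    rw [e1, e2, e3.fderiv]
    simp only [ContinuousLinearMap.smul_apply, ContinuousLinearMap.comp_apply, ContinuousLinearMap.smulRight_apply, Complex.reCLM_apply, smul_eq_mul]
    rw [Real.norm_eq_abs, abs_mul, abs_two, mul_assoc, mul_assoc]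
    have n1 := Complex.abs_re_le_norm (wirt a b h * k)
    rw [norm_mul] at n1
    have n2 : ‖wirt a b h‖ ≤ κ * ‖h‖ :=
      ((wirt a b).le_opNorm h).trans (mul_le_mul_of_nonneg_right ((wirt_norm_le a b).trans h2) (norm_nonneg h))
    have := mul_le_mul_of_nonneg_right n2 (norm_nonneg k)
    linarith

lemma phi_iter {C0 N p R : ℝ} {v : ℂ → ℝ} (h : Adm C0 N p R v) {z : ℂ} (hz : ‖z‖ < R) {κ : ℝ}
    (h0 : |p * (v z - Uc z) - wc z| ≤ κ) (h1 : ‖(p:ℂ) * (gz v z - gU z) - Wc z‖ ≤ κ)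
    (h2 : ‖(p:ℂ)*(SS v z - gU z^2/2) - Sc z‖ + ‖(p:ℂ)*(-(FF p v z:ℂ)/4 - -(Real.exp (Uc z):ℂ)/4) - ((Real.exp (Uc z)*(Uc z^2/2 - wc z):ℝ):ℂ)/4‖ ≤ κ)
    {k : ℕ} (hk : k ≤ 2) : ‖iteratedFDeriv ℝ k (fun z => p * (v z - Uc z) - wc z) z‖ ≤ 2 * κ := by
  have cv2 : ContDiff ℝ 2 v := h.loc.cd.of_le (by norm_num)
  have hφ : ContDiff ℝ 2 (fun z => p * (v z - Uc z) - wc z) :=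
    (contDiff_const.mul (cv2.sub contDiff_Uc)).sub (contDiff_wc.of_le (by norm_num))
  have eg : gz (fun z => p * (v z - Uc z) - wc z) = fun z => (p:ℂ) * (gz v z - gU z) - Wc z := by
    ext y
    have a1 : HasW (fun z => ((v z : ℝ):ℂ)) (gz v y) (conj (gz v y)) y := hasW_gz (cv2.differentiable two_ne_zero y)
    have a2 := (((HasW.const (p:ℂ) y).mul (a1.sub (hasW_Uc y))).sub (hasW_wc y)).dz
    unfold gz
    have e : (fun z => (((p * (v z - Uc z) - wc z : ℝ)):ℂ)) = fun z => (p:ℂ) * ((v z : ℂ) - (Uc z:ℂ)) - (wc z : ℂ) := by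
      ext z; push_cast; rfl
    rw [e, a2]
    change 0 * _ + (p:ℂ) * (gz v y - gU y) - Wc y = _
    unfold gz
    ring
  have hG : HasW (gz v) (SS v z) (-(FF p v z:ℂ)/4) z := by
    have a := dzb_gz (v := v) (z := z) cv2.contDiffAt
    have b := LE.DifferentiableAt.hasW a.2
    rw [a.1, h.loc.eq z hz] at b
    push_cast at b
    exact b
  have hW := ((HasW.const (p:ℂ) z).mul (hG.sub (hasW_gU z))).sub (hasW_Wc z)
  rw [← eg] at hW
  refine iter_bd hφ hW h0 (by rw [eg]; exact h1) ?_ hk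
  simpa using h2

/-- The isometry between `ℂ` and the Euclidean plane. -/
def io : ℂ ≃ₗᵢ[ℝ] E2 := Complex.orthonormalBasisOneI.repr

lemma io_one : io 1 = EuclideanSpace.single 0 1 := by
  have := Complex.orthonormalBasisOneI.repr_self 0
  simpa [io] using this
lemma io_I : io Complex.I = EuclideanSpace.single 1 1 := by
  have := Complex.orthonormalBasisOneI.repr_self 1
  simpa [io] using this

lemma lap_io (u : E2 → ℝ) (z : ℂ) : lap u (io z) = lapC (fun y => u (io y)) z := by
  have e : ∀ (f : E2 → ℝ) (y k : ℂ), fderiv ℝ (fun y => f (io y)) y k = fderiv ℝ f (io y) (io k) := by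
    intro f y k
    have := ContinuousLinearEquiv.comp_right_fderiv (io.toContinuousLinearEquiv) (f := f) (x := y)
    have h2 := congrArg (fun L => L k) this
    exact h2
  unfold lap lapC
  rw [Fin.sum_univ_two, ← io_one, ← io_I]
  simp only [e]
  rw [← e (fun y => fderiv ℝ u y (io 1)), ← e (fun y => fderiv ℝ u y (io Complex.I))]

lemma Ustd_io (z : ℂ) : Ustd (io z) = Uc z := by
  unfold Ustd Uc; rw [io.norm_map]

lemma io_mp : MeasurePreserving io volume volume := io.measurePreserving
lemma io_me : MeasurableEmbedding io := io.toHomeomorph.measurableEmbedding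

end LE

namespace LE
open ComplexConjugate

lemma mkSol {Ω : Set E2} {D p s : ℝ} {u : E2 → ℝ} {x0 : E2} (hD : 1 ≤ D) (hp : 1 < p) (hs : |s| = 1) (hO : IsOpen Ω)
    (hb : Ω ⊆ ball 0 D) (hsol : IsSolution Ω p u) (hx : x0 ∈ Ω) (hm : ∀ y ∈ closure Ω, s * u y ≤ s * u x0)
    (hpos : ∃ y ∈ Ω, 0 < s * u y) : Sol D p (io ⁻¹' Ω) (fun z => s * u (io z)) (io.symm x0) := by
  obtain ⟨h1, h2, h3, h4⟩ := hsol
  have hcl : closure (io ⁻¹' Ω) = io ⁻¹' (closure Ω) := (io.toHomeomorph.preimage_closure Ω).symm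
  have hfr : frontier (io ⁻¹' Ω) = io ⁻¹' (frontier Ω) := (io.toHomeomorph.preimage_frontier Ω).symm
  have hcd : ContDiffOn ℝ 2 (fun z => u (io z)) (io ⁻¹' Ω) :=
    ContDiffOn.comp (g := u) (f := io) h1 io.contDiff.contDiffOn (fun z hz => hz)
  refine ⟨hp, hD, hO.preimage io.continuous, ?_, contDiffOn_const.mul hcd, ?_, ?_, ?_, ?_, ?_, ?_⟩
  · intro z hz
    have := hb hz
    simpa using this
  · rw [hcl]
    exact continuousOn_const.mul (ContinuousOn.comp (g := u) (f := io) h2 io.continuous.continuousOn (fun z hz => hz))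
  · intro z hz
    have hat : ContDiffAt ℝ 2 (fun z => u (io z)) (0 + (1:ℝ) • z) := by
      rw [zero_add, one_smul]
      exact hcd.contDiffAt ((hO.preimage io.continuous).mem_nhds hz)
    have e := lapC_scale (x0 := 0) (ε := 1) (a := s) (m := 0) (z := z) hat
    simp only [zero_add, one_smul, sub_zero] at e
    rw [e, ← lap_io, abs_mul, hs]
    have := h3 _ hz
    rw [one_mul]
    linear_combination (-s) * this
  · intro z hz
    rw [hfr] at hz
    simp [h4 _ hz]
  · simpa using hx
  · intro y hy
    rw [hcl] at hy
    simpa using hm _ hy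
  · obtain ⟨y, hy, h⟩ := hpos
    have := hm y (subset_closure hy)
    simp only [LinearIsometryEquiv.apply_symm_apply]
    linarith

lemma EE_sum {Ω : Set E2} {D p : ℝ} {u : E2 → ℝ} {x0 x1 : ℂ} (hp : 1 < p)
    (h1 : Sol D p (io ⁻¹' Ω) (fun z => 1 * u (io z)) x0) (h2 : Sol D p (io ⁻¹' Ω) (fun z => (-1) * u (io z)) x1) :
    EE p (io ⁻¹' Ω) (fun z => 1 * u (io z)) + EE p (io ⁻¹' Ω) (fun z => (-1) * u (io z)) = p * ∫ x in Ω, |u x|^(p+1) := by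
  unfold EE
  rw [← io_mp.setIntegral_preimage_emb io_me, ← mul_add, ← integral_add (h1.gp_int (by linarith)) (h2.gp_int (by linarith))]
  congr 2
  ext z
  unfold gp
  have hz : (0:ℝ)^(p+1) = 0 := Real.zero_rpow (by linarith)
  rcases le_total 0 (u (io z)) with h | h
  · rw [max_eq_left (by linarith), max_eq_right (by linarith), hz, abs_of_nonneg h]; simp
  · rw [max_eq_right (by linarith), max_eq_left (by linarith), hz, abs_of_nonpos h]; simp

/-- The sign attached to the two concentration points. -/
def sg (i : Fin 2) : ℝ := if i = 0 then 1 else -1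
lemma sg_abs (i : Fin 2) : |sg i| = 1 := by unfold sg; split_ifs <;> simp
lemma sg_ne (i : Fin 2) : sg i ≠ 0 := by unfold sg; split_ifs <;> simp

lemma vv_sg (i : Fin 2) (p : ℝ) (u : E2 → ℝ) (x0 : E2) (ε : ℝ) (z : ℂ) :
    vv p (fun z => sg i * u (io z)) (io.symm x0) ε z = (p / u x0) * (u (x0 + ε • io z) - u x0) := by
  unfold vv
  simp only [map_add, LinearIsometryEquiv.apply_symm_apply, map_smul]
  have := sg_ne i
  field_simp

lemma seq_adm
    (Ω : Set E2) (hΩo : IsOpen Ω) (hΩb : IsBounded Ω)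
    (p : ℕ → ℝ) (hp1 : ∀ n, 1 < p n) (hptop : Tendsto p atTop atTop)
    (u : ℕ → E2 → ℝ)
    (hsol : ∀ n, IsSolution Ω (p n) (u n))
    (hnod : ∀ n, IsNodal Ω (u n))
    (hlow : Tendsto (fun n => p n * ∫ x in Ω, |u n x| ^ (p n + 1)) atTop
      (𝓝 (16 * π * Real.exp 1)))
    (xl : Fin 2 → ℕ → E2)
    (hmax : ∀ n, xl 0 n ∈ Ω ∧ ∀ y ∈ closure Ω, u n y ≤ u n (xl 0 n))
    (hmin : ∀ n, xl 1 n ∈ Ω ∧ ∀ y ∈ closure Ω, u n (xl 1 n) ≤ u n y)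
    (x : Fin 2 → E2) (hx : ∀ i, x i ∈ Ω)
    (hxconv : ∀ i, Tendsto (fun n => xl i n) atTop (𝓝 (x i)))
    (ε : Fin 2 → ℕ → ℝ) (hεpos : ∀ i n, 0 < ε i n)
    (hεdef : ∀ i n, (ε i n) ^ 2 * (p n * |u n (xl i n)| ^ (p n - 1)) = 1)
    (ϱ0 : ℝ) (hϱ0 : 0 < ϱ0) (N0 : ℕ)
    (hsign : ∀ n ≥ N0,
      (∀ y ∈ ball (x 0) (2 * ϱ0), 1 / p n ≤ u n y) ∧
      (∀ y ∈ ball (x 1) (2 * ϱ0), u n y ≤ -(1 / p n))) :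
    ∃ C0 : ℝ, ∀ N : ℝ, 1 ≤ N → ∀ᶠ n in atTop, ∀ i : Fin 2,
      Adm C0 N (p n) (ϱ0 / ε i n) (cv (p n) (fun z => sg i * u n (io z)) (io.symm (xl i n)) (ε i n) (ϱ0 / ε i n)) := by
  obtain ⟨D, hD, hb⟩ : ∃ D : ℝ, 1 ≤ D ∧ Ω ⊆ ball 0 D := by
    obtain ⟨r, hr⟩ := hΩb.subset_ball 0
    exact ⟨max r 1, le_max_right _ _, hr.trans (ball_subset_ball (le_max_left _ _))⟩
  have hS : ∀ (i : Fin 2) (n : ℕ), Sol D (p n) (io ⁻¹' Ω) (fun z => sg i * u n (io z)) (io.symm (xl i n)) := by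
    intro i n
    fin_cases i
    · refine mkSol hD (hp1 n) (sg_abs 0) hΩo hb (hsol n) (hmax n).1 ?_ ?_
      · intro y hy; simpa [sg] using (hmax n).2 y hy
      · obtain ⟨y, hy, h⟩ := (hnod n).1
        exact ⟨y, hy, by simpa [sg] using h⟩
    · refine mkSol hD (hp1 n) (sg_abs 1) hΩo hb (hsol n) (hmin n).1 ?_ ?_
      · intro y hy; simpa [sg] using (hmin n).2 y hy
      · obtain ⟨y, hy, h⟩ := (hnod n).2
        exact ⟨y, hy, by simpa [sg] using h⟩
  have hsp : ∀ (i : Fin 2), ∀ n ≥ N0, ∀ y ∈ ball (x i) (2 * ϱ0), 0 < sg i * u n y := by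
    intro i n hn y hy
    have hpi : 0 < 1 / p n := by have := hp1 n; positivity
    fin_cases i
    · have := (hsign n hn).1 y hy
      simp [sg]; linarith
    · have := (hsign n hn).2 y hy
      simp [sg]; linarith
  have hball : ∀ i, ball (x i) (2 * ϱ0) ⊆ Ω := by
    intro i
    apply (convex_ball (x i) (2*ϱ0)).isPreconnected.subset_of_closure_inter_subset hΩo
    · exact ⟨x i, mem_ball_self (by linarith), hx i⟩
    · rintro y ⟨hy1, hy2⟩
      by_contra hy3
      have hf : y ∈ frontier Ω := by
        rw [hΩo.frontier_eq]; exact ⟨hy1, hy3⟩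
      have a := (hsol N0).2.2.2 y hf
      have b := hsp i N0 le_rfl y hy2
      rw [a] at b; simp at b
  obtain ⟨C0, hC0, hadm⟩ := adm_ev D hD hϱ0
  refine ⟨C0, ?_⟩
  intro N hN
  obtain ⟨η, hη, hev⟩ := hadm N hN
  have hlowE := Sol.lowE D hD (Em := 16 * π * Real.exp 1 + η/2) (η := η/2) (by positivity) (by positivity)
  have hl1 : ∀ᶠ n in atTop, p n * ∫ x in Ω, |u n x| ^ (p n + 1) ≤ 16 * π * Real.exp 1 + η/2 :=
    hlow.eventually (eventually_le_nhds (by linarith))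
  have hcl : ∀ᶠ n in atTop, ∀ i, dist (xl i n) (x i) < ϱ0/4 := by
    rw [eventually_all]
    intro i
    exact (Metric.tendsto_nhds.1 (hxconv i)) _ (by positivity)
  filter_upwards [hptop.eventually hev, hptop.eventually hlowE, hl1, hcl, eventually_ge_atTop N0] with n k1 k2 k3 k4 k5
  have hE : ∀ i, EE (p n) (io ⁻¹' Ω) (fun z => sg i * u n (io z)) ≤ 8 * π * Real.exp 1 + η := by
    have h0 := hS 0 n
    have h1 := hS 1 n
    have a0 : (fun z => sg 0 * u n (io z)) = fun z => 1 * u n (io z) := by simp [sg]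
    have a1 : (fun z => sg 1 * u n (io z)) = fun z => (-1) * u n (io z) := by simp [sg]
    rw [a0] at h0
    rw [a1] at h1
    have es := EE_sum (hp1 n) h0 h1
    rw [← es] at k3
    have n0 := h0.EE_nonneg
    have n1 := h1.EE_nonneg
    have l0 := k2 _ _ _ h0 (by linarith)
    have l1 := k2 _ _ _ h1 (by linarith)
    intro i
    fin_cases i
    · simp only [Fin.zero_eta, Fin.isValue]
      rw [a0]; linarith
    · simp only [Fin.mk_one, Fin.isValue]
      rw [a1]; linarith
  intro i
  have hin : ∀ y ∈ ball (io.symm (xl i n)) (7*ϱ0/4), io y ∈ ball (x i) (2 * ϱ0) := by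
    intro y hy
    rw [mem_ball] at hy ⊢
    have e : dist (io y) (xl i n) = dist y (io.symm (xl i n)) := by
      conv_lhs => rw [← io.apply_symm_apply (xl i n), io.dist_map]
    have := dist_triangle (io y) (xl i n) (x i)
    have := k4 i
    linarith
  apply k1 _ _ _ _ (hS i n) (hE i) (hεpos i n)
  · have hpos := (hS i n).pos
    have := hεdef i n
    have e : |u n (xl i n)| = sg i * u n (io (io.symm (xl i n))) := by
      rw [← abs_of_pos hpos, abs_mul, sg_abs, one_mul, io.apply_symm_apply]
    rw [← e]; exact this
  · intro y hy
    exact hball i (hin y hy)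
  · intro y hy
    exact hsp i n k5 _ (hin y hy)

end LE

end

/-- Proposition 3.8: bounds and convergence of `w_{i,p} = p(v_{i,p} − U)`
to the solution `w₀` of `−Δw₀ − e^U w₀ = −(U²/2)e^U`, with `∫ Δw₀ = 24π`. -/
theorem first_order_expansion_w
    (Ω : Set E2) (hΩo : IsOpen Ω) (hΩb : IsBounded Ω) (hΩne : Ω.Nonempty)
    (p : ℕ → ℝ) (hp1 : ∀ n, 1 < p n) (hptop : Tendsto p atTop atTop)
    (u : ℕ → E2 → ℝ)
    (hsol : ∀ n, IsSolution Ω (p n) (u n))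
    (hnod : ∀ n, IsNodal Ω (u n))
    (hlow : Tendsto (fun n => p n * ∫ x in Ω, |u n x| ^ (p n + 1)) atTop
      (𝓝 (16 * π * Real.exp 1)))
    (xl : Fin 2 → ℕ → E2)
    (hmax : ∀ n, xl 0 n ∈ Ω ∧ ∀ y ∈ closure Ω, u n y ≤ u n (xl 0 n))
    (hmin : ∀ n, xl 1 n ∈ Ω ∧ ∀ y ∈ closure Ω, u n (xl 1 n) ≤ u n y)
    (x : Fin 2 → E2) (hx : ∀ i, x i ∈ Ω) (hxne : x 0 ≠ x 1)
    (hxconv : ∀ i, Tendsto (fun n => xl i n) atTop (𝓝 (x i)))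
    (ε : Fin 2 → ℕ → ℝ) (hεpos : ∀ i n, 0 < ε i n)
    (hεdef : ∀ i n, (ε i n) ^ 2 * (p n * |u n (xl i n)| ^ (p n - 1)) = 1)
    (v : Fin 2 → ℕ → E2 → ℝ)
    (hv : ∀ i n z, v i n z =
      (p n / u n (xl i n)) * (u n (xl i n + ε i n • z) - u n (xl i n)))
    (r0 : ℝ) (hr0 : 0 < r0)
    (hdisj : Disjoint (ball (x 0) (2 * r0)) (ball (x 1) (2 * r0)))
    (ϱ0 : ℝ) (hϱ0 : ϱ0 ∈ Set.Ioo (0:ℝ) (r0 / 2)) (N0 : ℕ)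
    (hsign : ∀ n ≥ N0,
      (∀ y ∈ ball (x 0) (2 * ϱ0), 1 / p n ≤ u n y) ∧
      (∀ y ∈ ball (x 1) (2 * ϱ0), u n y ≤ -(1 / p n)))
    :
    (∀ τ ∈ Set.Ioo (0:ℝ) 1, ∃ C > (0:ℝ), ∃ N : ℕ, ∀ n ≥ N, ∀ i : Fin 2, ∀ z : E2,
        ‖z‖ ≤ ϱ0 / ε i n →
          |p n * (v i n z - Ustd z)| ≤ C * (1 + ‖z‖) ^ τ) ∧
    ∃ w0 : E2 → ℝ,
      (∀ i : Fin 2,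
        TendstoC2LocOn Set.univ (fun n z => p n * (v i n z - Ustd z)) w0) ∧
      (∀ z : E2, -lap w0 z - Real.exp (Ustd z) * w0 z
          = -((Ustd z) ^ 2 / 2) * Real.exp (Ustd z)) ∧
      (∀ τ ∈ Set.Ioo (0:ℝ) 1, ∃ C > (0:ℝ), ∀ z : E2, |w0 z| ≤ C * (1 + ‖z‖) ^ τ) ∧
      (∫ z : E2, lap w0 z) = 24 * π := by
  obtain ⟨C0, hadm⟩ := LE.seq_adm Ω hΩo hΩb p hp1 hptop u hsol hnod hlow xl hmax hmin x hx hxconv ε hεpos hεdef ϱ0 hϱ0.1 N0 hsign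
  have hve : ∀ (i : Fin 2) (n : ℕ) (z : ℂ), ‖z‖ ≤ ϱ0 / ε i n →
      LE.cv (p n) (fun z => LE.sg i * u n (LE.io z)) (LE.io.symm (xl i n)) (ε i n) (ϱ0 / ε i n) z = v i n (LE.io z) := by
    intro i n z hz
    have hR : 0 < ϱ0 / ε i n := div_pos hϱ0.1 (hεpos i n)
    rw [LE.cv_eq hR hz, LE.vv_sg, hv]
  refine ⟨?_, fun z => LE.wc (LE.io.symm z), ?_, ?_, ?_, ?_⟩
  · intro τ hτ
    obtain ⟨N, hN, C, hC, hb⟩ := LE.w_bound C0 τ hτ.1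
    obtain ⟨n0, hn0⟩ := eventually_atTop.1 (hadm N hN)
    refine ⟨C, hC, n0, ?_⟩
    intro n hn i z hz
    have hz' : ‖LE.io.symm z‖ ≤ ϱ0 / ε i n := by rwa [LE.io.symm.norm_map]
    have := hb _ _ _ (hn0 n hn i) (LE.io.symm z) hz'
    rw [hve i n _ hz', ← LE.Ustd_io, LE.io.apply_symm_apply, LE.io.symm.norm_map] at this
    exact this
  · intro i K _ hK k hk
    rw [Metric.tendstoUniformlyOn_iff]
    intro δ hδ
    obtain ⟨Kb, hKb0, hKb⟩ : ∃ Kb : ℝ, 0 < Kb ∧ K ⊆ closedBall 0 Kb := by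
      obtain ⟨r, hr⟩ := hK.isBounded.subset_closedBall 0
      exact ⟨max r 1, by positivity, hr.trans (closedBall_subset_closedBall (le_max_left _ _))⟩
    obtain ⟨N, hN, hb⟩ := LE.w_conv C0 LE.lim_wc (δ/4) (by positivity) Kb hKb0
    filter_upwards [hadm (max N (Kb + 1)) (hN.le.trans (le_max_left _ _))] with n hn z hz
    have ha := hn i
    have ha1 := ha.mono hN (le_max_left _ _)
    have hzK : ‖LE.io.symm z‖ ≤ Kb := by
      rw [LE.io.symm.norm_map]; simpa using hKb hz
    have hzR : ‖LE.io.symm z‖ < ϱ0 / ε i n := by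
      have := ha.hRN
      have := le_max_right N (Kb+1)
      linarith
    obtain ⟨b0, b1, b2⟩ := hb _ _ _ ha1 (LE.io.symm z) hzK
    have it := LE.phi_iter ha1 hzR b0 b1 b2 hk
    set V := LE.cv (p n) (fun z => LE.sg i * u n (LE.io z)) (LE.io.symm (xl i n)) (ε i n) (ϱ0 / ε i n) with hV
    have ev : (fun z => p n * (v i n z - Ustd z)) =ᶠ[𝓝 z] (fun z => p n * (V (LE.io.symm z) - LE.Uc (LE.io.symm z))) := by
      have : ∀ᶠ y in 𝓝 z, ‖LE.io.symm y‖ < ϱ0 / ε i n := by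
        have hc : Continuous (fun y => ‖LE.io.symm y‖) := continuous_norm.comp LE.io.symm.continuous
        exact (hc.tendsto z).eventually (gt_mem_nhds hzR)
      filter_upwards [this] with y hy
      rw [hV, hve i n _ hy.le, ← LE.Ustd_io, LE.io.apply_symm_apply]
    have hk3 : ((k:ℕ) : WithTop ℕ∞) ≤ 3 := by
      have : k ≤ 3 := by omega
      exact_mod_cast this
    have c1 : ContDiff ℝ k (fun z => p n * (V (LE.io.symm z) - LE.Uc (LE.io.symm z))) :=
      contDiff_const.mul (((ha.loc.cd.of_le hk3).comp LE.io.symm.contDiff).sub (LE.contDiff_Uc.comp LE.io.symm.contDiff))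
    have c2 : ContDiff ℝ k (fun z => LE.wc (LE.io.symm z)) := (LE.contDiff_wc.of_le hk3).comp LE.io.symm.contDiff
    rw [dist_comm, dist_eq_norm, (ev.iteratedFDeriv ℝ k).eq_of_nhds, ← iteratedFDeriv_sub_apply c1.contDiffAt c2.contDiffAt]
    have := LinearIsometryEquiv.norm_iteratedFDeriv_comp_right LE.io.symm (fun z => p n * (V z - LE.Uc z) - LE.wc z) z k
    have e : ((fun z => p n * (V (LE.io.symm z) - LE.Uc (LE.io.symm z))) - fun z => LE.wc (LE.io.symm z))
        = (fun z => p n * (V z - LE.Uc z) - LE.wc z) ∘ LE.io.symm := rfl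
    rw [e, this]
    linarith
  · intro z
    obtain ⟨y, rfl⟩ := LE.io.surjective z
    rw [LE.lap_io]
    simp only [LinearIsometryEquiv.symm_apply_apply]
    have := LE.lapC_wc y
    rw [LE.Ustd_io]
    change -LE.lapC LE.wc y - _ = _
    rw [this]; ring
  · intro τ hτ
    obtain ⟨C, hC, h⟩ := LE.wc_bound hτ.1
    refine ⟨C, hC, fun z => ?_⟩
    have := h (LE.io.symm z)
    rwa [LE.io.symm.norm_map] at this
  · rw [← LE.integral_lapwc, ← LE.io_mp.integral_comp LE.io_me]
    congr 1
    ext y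
    rw [LE.lap_io]
    simp only [LinearIsometryEquiv.symm_apply_apply]

end
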